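/- Let $X$ be a topological space. All $*$-homomorphisms are between C*-algebras over $\mathbb C$, ideals are closed and two-sided. An action of $X$ on a C*-algebra $A$ is an order-preserving map $U\mapsto A(U)$ from the open subsets of $X$ to the ideals of $A$; a $*$-homomorphism $\psi:A\to B$ is $X$-equivariant if $\psi(A(U))\subseteq B(U)$ for all open $U$. Separable C*-algebras with an action of $X$ and $X$-equivariant $*$-homomorphisms form a category $\mathfrak C_X$. Homotopies are always through $X$-equivariant $*$-homomorphisms. $M_n(A)$ and $\mathcal K\otimes A$ (with $\mathcal K$ the compact operators on $\ell^2(\mathbb N)$) carry the actions $M_n(A(U))$ and $\mathcal K\otimes A(U)$. Let $QA=A\star A$ be the free product with the inclusions $\iota,\bar\iota:A\to QA$, let $QA(U)$ be the ideal generated by $\iota(A(U))\cup\bar\iota(A(U))$, let $qA=\ker(QA\to A)$ be the kernel of the map identifying the two copies of $A$, with $qA(U)=qA\cap QA(U)=\ker(qA\to q(A/A(U)))$, and let $\pi_A:qA\to A$ be the restriction of $\mathrm{id}\star 0$. Let $KK(X;A,B)$ be the set of homotopy classes of $X$-equivariant $*$-homomorphisms $qA\to\mathcal K\otimes B$. The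 sum of two classes is $[\alpha]+[\beta]=[\alpha\oplus\beta]$, using $M_2(\mathcal K\otimes B)\cong\mathcal K\otimes B$. The product of $[\alpha]\in KK(X;A,B)$ and $[\beta]\in KK(X;B,C)$ is the class of $$qA\xrightarrow{\varphi_A}M_2(q(qA))\xrightarrow{q(\alpha)}M_2(q(\mathcal K\otimes B))\xrightarrow{\mu}M_2(\mathcal K\otimes qB)\xrightarrow{\mathrm{id}\otimes\beta}M_2(\mathcal K\otimes\mathcal K\otimes C)\cong\mathcal K\otimes C ,$$ where $\mu$ is the restriction of $(\mathrm{id}\otimes\iota)\star(\mathrm{id}\otimes\bar\iota)$ and $\varphi_A$ is defined as follows. Let $\eta,\bar\eta:QA\to Q(QA)$ be the two inclusions, $R\subseteq M_2(Q(QA))$ the C*-subalgebra generated by the matrices with entries in $\begin{pmatrix}R_1&R_1R_2\\R_2R_1&R_2\end{pmatrix}$, $R_1=\eta(qA)$, $R_2=\bar\eta(qA)$, and $J=R\cap M_2(q(qA))$, so that $R/J\cong M_2(qA)$. Let $S$ be a self-adjoint multiplier of $R$ that lifts the multiplier $\begin{pmatrix}0&1\\1&0\end{pmatrix}$ of $R/J$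 and commutes modulo $J$ with $\eta\iota(x)\oplus\bar\eta\iota(x)$ for all $x\in A$, and put $F=e^{\pi i S/2}$. Then $\varphi_A:qA\to J$ is the restriction to $qA$ of $h_1\star(\mathrm{Ad}F\circ h_2)$, where $h_1=\eta\iota\oplus\bar\eta\bar\iota$ and $h_2=\eta\bar\iota\oplus\bar\eta\iota$. A functor $F$ from $\mathfrak C_X$ to an additive category is stable if it maps the corner embeddings $A\to\mathcal K\otimes A$ to isomorphisms; homotopy invariant if homotopic morphisms have the same image; and split exact if for every exact sequence $0\to I\xrightarrow{j}E\xrightarrow{p}A\to0$ in $\mathfrak C_X$ with $I(U)=j^{-1}(E(U))$ for all $U$ and with an $X$-equivariant $*$-homomorphism $s:A\to E$ such that $ps=\mathrm{id}_A$, the map $(F(j),F(s)):F(I)\oplus F(A)\to F(E)$ is an isomorphism. **Theorem.** With the above sum and product, which are well defined, the objects of $\mathfrak C_X$ and the groups $KK(X;A,B)$ form an additive category $KK(X)$, in which the identity of $A$ is the class of $qA\xrightarrow{\pi_A}A\to\mathcal K\otimes A$. Sending a morphism $f:A\to B$ to the class of $qA\xrightarrow{\pi_A}A\xrightarrow{f}B\to\mathcal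 K\otimes B$ defines a functor $kk:\mathfrak C_X\to KK(X)$, the identity on objects, which is stable, homotopy invariant and split exact. It is universal with these properties: for every stable, homotopy invariant and split exact functor $F$ from $\mathfrak C_X$ to an additive category $\mathcal D$ there is exactly one functor $\hat F:KK(X)\to\mathcal D$ with $\hat F\circ kk=F$, and $\hat F$ is additive. In particular every class in $KK(X;A,B)$ induces a uniquely determined morphism $F(A)\to F(B)$, compatibly with composition. -/

import Mathlib

universe u v w v₁

open CategoryTheory

noncomputable section

set_option linter.unusedVariables false

namespace XKK

open scoped ENNReal MultiplierAlgebra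
open TopologicalSpace

/-! ### Universal C⋆-algebras -/

theorem hom_continuous {A : Type u} {B : Type v} [NonUnitalCStarAlgebra A]
    [NonUnitalCStarAlgebra B] (f : A →⋆ₙₐ[ℂ] B) : Continuous f :=
  AddMonoidHomClass.continuous_of_bound f 1 fun x => by
    simpa using NonUnitalStarAlgHom.norm_apply_le f x

theorem isSeparable_mul_closure {E : Type u} [NonUnitalCStarAlgebra E] {s : Set E}
    (hs : IsSeparable s) : IsSeparable (Subsemigroup.closure s : Set E) := by
  let P : ℕ → Set E := fun n => Nat.rec s (fun _ t => Set.image2 (· * ·) t s) n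
  have hpow : ∀ n : ℕ, IsSeparable (P n) := by
    intro n
    induction n with
    | zero => exact hs
    | succ n ih =>
      have := (ih.prod hs).image (f := fun p : E × E => p.1 * p.2) (by fun_prop)
      rwa [Set.image_prod] at this
  have hP : ∀ m n x y, x ∈ P m → y ∈ P n → x * y ∈ P (m + n + 1) := by
    intro m n
    induction n with
    | zero => exact fun x y hx hy => ⟨x, hx, y, hy, rfl⟩
    | succ n ih =>
      rintro x _ hx ⟨y, hy, z, hz, rfl⟩
      exact ⟨x * y, ih x y hx hy, z, hz, mul_assoc x y z⟩
  refine (IsSeparable.iUnion hpow).mono fun x hx => ?_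
  induction hx using Subsemigroup.closure_induction with
  | mem x hx => exact Set.mem_iUnion.2 ⟨0, hx⟩
  | mul x y _ _ ihx ihy =>
    obtain ⟨m, hm⟩ := Set.mem_iUnion.1 ihx
    obtain ⟨n, hn⟩ := Set.mem_iUnion.1 ihy
    exact Set.mem_iUnion.2 ⟨m + n + 1, hP m n x y hm hn⟩

theorem isSeparable_adjoin {E : Type u} [NonUnitalCStarAlgebra E] {s : Set E}
    (hs : IsSeparable s) :
    IsSeparable ((NonUnitalStarAlgebra.adjoin ℂ s).topologicalClosure : Set E) := by
  change IsSeparable (closure (NonUnitalStarAlgebra.adjoin ℂ s : Set E))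
  refine IsSeparable.closure ?_
  have h1 : IsSeparable (s ∪ star s) := by
    refine hs.union ?_
    rw [← Set.image_star]
    exact hs.image continuous_star
  have := (isSeparable_mul_closure h1).span (R := ℂ)
  rw [← NonUnitalStarAlgebra.adjoin_eq_span] at this
  exact this

/-- Transport of a C⋆-algebra structure along a bijection. -/
abbrev transferCStar {T : Type v} {E : Type u} [NonUnitalCStarAlgebra E] (e : T ≃ E) :
    NonUnitalCStarAlgebra T := by
  letI := e.nonUnitalRing
  letI : Module ℂ T := e.module ℂ
  letI : Star T := e.star
  have hs : ∀ x : T, e (star x) = star (e x) := fun x => e.apply_symm_apply _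
  have hm : ∀ x y : T, e (x * y) = e x * e y := fun x y => e.apply_symm_apply _
  have ha : ∀ x y : T, e (x + y) = e x + e y := fun x y => e.apply_symm_apply _
  have hc : ∀ (c : ℂ) (x : T), e (c • x) = c • e x := fun c x => e.apply_symm_apply _
  letI : StarRing T :=
    { star_involutive := fun x => e.injective (by simp [hs])
      star_mul := fun x y => e.injective (by simp [hs, hm])
      star_add := fun x y => e.injective (by simp [hs, ha]) }
  let L : T ≃ₗ[ℂ] E := e.linearEquiv ℂ
  let φ : T →ₙ+* E := (e.ringEquiv : T ≃+* E)
  letI : NonUnitalNormedRing T := NonUnitalNormedRing.induced T E φ e.injective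
  letI : NormedSpace ℂ T := NormedSpace.induced ℂ T E L.toLinearMap
  have hn : ∀ x : T, ‖x‖ = ‖e x‖ := fun _ => rfl
  have iso : Isometry e := AddMonoidHomClass.isometry_of_norm (φ : T →+ E) (fun _ => rfl)
  exact
    { complete := ((completeSpace_congr (e := e) iso.isUniformEmbedding).2 inferInstance).complete
      norm_mul_self_le := fun x => by
        rw [hn, hn, hm, hs]
        exact CStarRing.norm_mul_self_le (e x)
      smul_assoc := fun c x y => e.injective (by
        simp only [smul_eq_mul, hc, hm, smul_mul_assoc])
      smul_comm := fun c x y => e.injective (by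
        simp only [smul_eq_mul, hc, hm, mul_smul_comm])
      star_smul := fun c x => e.injective (by simp [hc, hs]) }

/-- The subset `S` of `ℝ^ℕ` as a bare type, without its metric and order. -/
def SmallType (S : Set (ℕ → ℝ)) : Type := S

section

variable {ι : Type} (G : ι → Type u) [∀ i, NonUnitalCStarAlgebra (G i)]
  (rel : (Σ i, G i) → (Σ i, G i) → Prop)

/-- A family of homomorphisms from the `G i` to a C⋆-algebra on a subset of `ℝ^ℕ` that identifies
`x` with `y` whenever `rel x y`. Every separable C⋆-algebra is isomorphic to one on a subset of
`ℝ^ℕ`. -/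
structure SmallCocone where
  S : Set (ℕ → ℝ)
  str : NonUnitalCStarAlgebra (SmallType S)
  f : ∀ i, G i →⋆ₙₐ[ℂ] SmallType S
  compat : ∀ x y, rel x y → f x.1 x.2 = f y.1 y.2

instance (c : SmallCocone G rel) : NonUnitalCStarAlgebra (SmallType c.S) := c.str

/-- The `ℓ^∞`-product of the targets of all such families. -/
abbrev AmalgAmbient : Type u := lp (fun c : SmallCocone G rel => SmallType c.S) ∞

/-- The homomorphism `x ↦ (f i x)` to the product. -/
def AmalgAmbient.incl (i : ι) : G i →⋆ₙₐ[ℂ] AmalgAmbient G rel where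
  toFun x := ⟨fun c => c.f i x, memℓp_infty ⟨‖x‖, by
    rintro _ ⟨c, rfl⟩
    exact NonUnitalStarAlgHom.norm_apply_le (c.f i) x⟩⟩
  map_smul' c x := by ext d; exact map_smul (d.f i) c x
  map_zero' := by ext d; exact map_zero (d.f i)
  map_add' x y := by ext d; exact map_add (d.f i) x y
  map_mul' x y := by ext d; exact map_mul (d.f i) x y
  map_star' x := by ext d; exact map_star (d.f i) x

/-- The C⋆-subalgebra of the product generated by the images of the `G i`. -/
def amalgSub : NonUnitalStarSubalgebra ℂ (AmalgAmbient G rel) :=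
  (NonUnitalStarAlgebra.adjoin ℂ
    (⋃ i, Set.range (AmalgAmbient.incl G rel i))).topologicalClosure

instance : IsClosed (amalgSub G rel : Set (AmalgAmbient G rel)) :=
  NonUnitalStarSubalgebra.isClosed_topologicalClosure _

/-- The universal C⋆-algebra generated by copies of the C⋆-algebras `G i` subject to the relations
`x = y` for `rel x y`. For countably many separable `G i` its universal property for arbitrary
C⋆-algebras is `Amalg.exists_lift` and `Amalg.hom_ext`. -/
def Amalg : Type u := amalgSub G rel

instance : NonUnitalCStarAlgebra (Amalg G rel) :=
  inferInstanceAs (NonUnitalCStarAlgebra (amalgSub G rel))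

instance [Countable ι] [∀ i, SeparableSpace (G i)] : SeparableSpace (Amalg G rel) := by
  have : IsSeparable (amalgSub G rel : Set (AmalgAmbient G rel)) :=
    isSeparable_adjoin (IsSeparable.iUnion fun i =>
      isSeparable_range (hom_continuous (AmalgAmbient.incl G rel i)))
  exact this.separableSpace

namespace Amalg
variable {G}

/-- The canonical homomorphism `G i → Amalg G rel`. -/
def incl (i : ι) : G i →⋆ₙₐ[ℂ] Amalg G rel :=
  NonUnitalStarAlgHom.codRestrict (AmalgAmbient.incl G rel i) (amalgSub G rel) fun x =>
    NonUnitalStarSubalgebra.le_topologicalClosure _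
      (NonUnitalStarAlgebra.subset_adjoin ℂ _ (Set.mem_iUnion.2 ⟨i, x, rfl⟩))

theorem incl_eq {x y : Σ i, G i} (h : rel x y) : incl rel x.1 x.2 = incl rel y.1 y.2 := by
  apply Subtype.ext
  apply Subtype.ext
  funext c
  exact c.compat x y h

theorem exists_lift [Countable ι] [∀ i, SeparableSpace (G i)] {E : Type w}
    [NonUnitalCStarAlgebra E] (f : ∀ i, G i →⋆ₙₐ[ℂ] E)
    (hf : ∀ x y, rel x y → f x.1 x.2 = f y.1 y.2) :
    ∃ F : Amalg G rel →⋆ₙₐ[ℂ] E, ∀ i x, F (incl rel i x) = f i x := by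
  let E₀ : NonUnitalStarSubalgebra ℂ E :=
    (NonUnitalStarAlgebra.adjoin ℂ (⋃ i, Set.range (f i))).topologicalClosure
  have : IsClosed (E₀ : Set E) := NonUnitalStarSubalgebra.isClosed_topologicalClosure _
  have hsep : IsSeparable (E₀ : Set E) :=
    isSeparable_adjoin (IsSeparable.iUnion fun i => isSeparable_range (hom_continuous (f i)))
  have : SeparableSpace E₀ := hsep.separableSpace
  let d : E₀ → (ℕ → ℝ) := fun x n => dist x (denseSeq E₀ n)
  have hd : Function.Injective d := by
    intro x y hxy
    refine eq_of_forall_dist_le fun ε hε => ?_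
    obtain ⟨n, hn⟩ := (denseRange_denseSeq E₀).exists_dist_lt x (half_pos hε)
    have h2 : dist x (denseSeq E₀ n) = dist y (denseSeq E₀ n) := congrFun hxy n
    calc dist x y ≤ dist x (denseSeq E₀ n) + dist y (denseSeq E₀ n) := dist_triangle_right _ _ _
      _ ≤ ε := by rw [← h2]; linarith
  let e : SmallType (Set.range d) ≃ E₀ := (Equiv.ofInjective d hd).symm
  let str : NonUnitalCStarAlgebra (SmallType (Set.range d)) := transferCStar e
  have hs : ∀ x : SmallType (Set.range d), e (star x) = star (e x) :=
    fun x => e.apply_symm_apply _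
  have hm : ∀ x y : SmallType (Set.range d), e (x * y) = e x * e y :=
    fun x y => e.apply_symm_apply _
  have ha : ∀ x y : SmallType (Set.range d), e (x + y) = e x + e y :=
    fun x y => e.apply_symm_apply _
  have hc : ∀ (c : ℂ) (x : SmallType (Set.range d)), e (c • x) = c • e x :=
    fun c x => e.apply_symm_apply _
  let g : ∀ i, G i →⋆ₙₐ[ℂ] E₀ := fun i => NonUnitalStarAlgHom.codRestrict (f i) E₀ fun x =>
    NonUnitalStarSubalgebra.le_topologicalClosure _
      (NonUnitalStarAlgebra.subset_adjoin ℂ _ (Set.mem_iUnion.2 ⟨i, x, rfl⟩))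
  let φ : E₀ →⋆ₙₐ[ℂ] SmallType (Set.range d) :=
    { toFun := e.symm
      map_smul' := fun c x => e.injective (by
        rw [hc]; simp)
      map_zero' := rfl
      map_add' := fun x y => e.injective (by rw [ha]; simp)
      map_mul' := fun x y => e.injective (by rw [hm]; simp)
      map_star' := fun x => e.injective (by rw [hs]; simp) }
  let ψ : SmallType (Set.range d) →⋆ₙₐ[ℂ] E₀ :=
    { toFun := e
      map_smul' := hc
      map_zero' := e.apply_symm_apply _
      map_add' := ha
      map_mul' := hm
      map_star' := hs }
  let c : SmallCocone G rel :=
    { S := Set.range d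
      str := str
      f := fun i => φ.comp (g i)
      compat := fun x y h => congrArg φ (Subtype.ext (hf x y h)) }
  let ev : Amalg G rel →⋆ₙₐ[ℂ] SmallType (Set.range d) :=
    { toFun := fun z => (z.1 : ∀ c : SmallCocone G rel, SmallType c.S) c
      map_smul' := fun _ _ => rfl
      map_zero' := rfl
      map_add' := fun _ _ => rfl
      map_mul' := fun _ _ => rfl
      map_star' := fun _ => rfl }
  refine ⟨(NonUnitalStarSubalgebraClass.subtype E₀).comp (ψ.comp ev), fun i x => ?_⟩
  change ((e (e.symm (g i x)) : E₀) : E) = f i x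
  rw [e.apply_symm_apply]; rfl

theorem hom_ext {E : Type w} [NonUnitalCStarAlgebra E] {F F' : Amalg G rel →⋆ₙₐ[ℂ] E}
    (h : ∀ i x, F (incl rel i x) = F' (incl rel i x)) : F = F' := by
  have key : ∀ (x : AmalgAmbient G rel)
      (hx : x ∈ NonUnitalStarAlgebra.adjoin ℂ (⋃ i, Set.range (AmalgAmbient.incl G rel i))),
      F ⟨x, NonUnitalStarSubalgebra.le_topologicalClosure _ hx⟩ =
        F' ⟨x, NonUnitalStarSubalgebra.le_topologicalClosure _ hx⟩ := by
    intro x hx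
    induction hx using NonUnitalStarAlgebra.adjoin_induction with
    | mem x hx =>
      obtain ⟨i, y, rfl⟩ := Set.mem_iUnion.1 hx
      exact h i y
    | add x y _ _ ihx ihy => exact (map_add F _ _).trans ((congrArg₂ _ ihx ihy).trans
        (map_add F' _ _).symm)
    | zero => exact (map_zero F).trans (map_zero F').symm
    | mul x y _ _ ihx ihy => exact (map_mul F _ _).trans ((congrArg₂ _ ihx ihy).trans
        (map_mul F' _ _).symm)
    | smul c x _ ihx => exact (map_smul F c _).trans ((congrArg _ ihx).trans
        (map_smul F' c _).symm)
    | star x _ ihx => exact (map_star F _).trans ((congrArg _ ihx).trans (map_star F' _).symm)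
  refine DFunLike.ext _ _ fun z => ?_
  obtain ⟨x, hx, hlim⟩ := mem_closure_iff_seq_limit.1 (show z.1 ∈ closure _ from z.2)
  let y : ℕ → Amalg G rel :=
    fun n => ⟨x n, NonUnitalStarSubalgebra.le_topologicalClosure _ (hx n)⟩
  have hy : Filter.Tendsto y Filter.atTop (nhds z) := tendsto_subtype_rng.2 hlim
  have h1 := ((hom_continuous F).tendsto z).comp hy
  have h2 := ((hom_continuous F').tendsto z).comp hy
  refine tendsto_nhds_unique h1 (h2.congr fun n => (key (x n) (hx n)).symm)

/-- The homomorphism out of the amalgam given by a compatible family. -/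
def lift [Countable ι] [∀ i, SeparableSpace (G i)] {E : Type w}
    [NonUnitalCStarAlgebra E] (f : ∀ i, G i →⋆ₙₐ[ℂ] E)
    (hf : ∀ x y, rel x y → f x.1 x.2 = f y.1 y.2) : Amalg G rel →⋆ₙₐ[ℂ] E :=
  (exists_lift rel f hf).choose

@[simp] theorem lift_incl [Countable ι] [∀ i, SeparableSpace (G i)] {E : Type w}
    [NonUnitalCStarAlgebra E] (f : ∀ i, G i →⋆ₙₐ[ℂ] E)
    (hf : ∀ x y, rel x y → f x.1 x.2 = f y.1 y.2) (i : ι) (x : G i) :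
    lift rel f hf (incl rel i x) = f i x :=
  (exists_lift rel f hf).choose_spec i x

end Amalg

end

/-! ### The algebras `QA` and `qA` -/

section Q

variable {A : Type u} [NonUnitalCStarAlgebra A]

variable (A) in
/-- The free product `QA = A ⋆ A`. -/
abbrev Q : Type u := Amalg (fun _ : Bool => A) (fun _ _ => False)

/-- The first inclusion `A → QA`. -/
def ι : A →⋆ₙₐ[ℂ] Q A := Amalg.incl (G := fun _ : Bool => A) _ false

/-- The second inclusion `A → QA`. -/
def ιbar : A →⋆ₙₐ[ℂ] Q A := Amalg.incl (G := fun _ : Bool => A) _ true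

theorem Q.hom_ext {E : Type w} [NonUnitalCStarAlgebra E] {F F' : Q A →⋆ₙₐ[ℂ] E}
    (h₁ : ∀ x, F (ι x) = F' (ι x)) (h₂ : ∀ x, F (ιbar x) = F' (ιbar x)) : F = F' :=
  Amalg.hom_ext (G := fun _ : Bool => A) _ fun b => by cases b; exacts [h₁, h₂]

variable [SeparableSpace A]

/-- The homomorphism `f ⋆ g : QA → E`. -/
def Q.lift {E : Type w} [NonUnitalCStarAlgebra E] (f g : A →⋆ₙₐ[ℂ] E) : Q A →⋆ₙₐ[ℂ] E :=
  Amalg.lift _ (fun b : Bool => bif b then g else f) (fun _ _ h => h.elim)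

@[simp] theorem Q.lift_ι {E : Type w} [NonUnitalCStarAlgebra E] (f g : A →⋆ₙₐ[ℂ] E) (x : A) :
    Q.lift f g (ι x) = f x :=
  Amalg.lift_incl (G := fun _ : Bool => A) _ _ _ false x

@[simp] theorem Q.lift_ιbar {E : Type w} [NonUnitalCStarAlgebra E] (f g : A →⋆ₙₐ[ℂ] E)
    (x : A) : Q.lift f g (ιbar x) = g x :=
  Amalg.lift_incl (G := fun _ : Bool => A) _ _ _ true x

variable (A) in
/-- The map `QA → A` that identifies the two copies of `A`. -/
def Q.fold : Q A →⋆ₙₐ[ℂ] A :=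
  Q.lift (NonUnitalStarAlgHom.id ℂ A) (NonUnitalStarAlgHom.id ℂ A)

/-- The functor `Q` on homomorphisms. -/
def Q.map {B : Type v} [NonUnitalCStarAlgebra B] (f : A →⋆ₙₐ[ℂ] B) : Q A →⋆ₙₐ[ℂ] Q B :=
  Q.lift (ι.comp f) (ιbar.comp f)

theorem Q.fold_map {B : Type v} [NonUnitalCStarAlgebra B] [SeparableSpace B]
    (f : A →⋆ₙₐ[ℂ] B) (z : Q A) : Q.fold B (Q.map f z) = f (Q.fold A z) := by
  have : (Q.fold B).comp (Q.map f) = f.comp (Q.fold A) :=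
    Q.hom_ext (fun x => by simp [Q.fold, Q.map]) (fun x => by simp [Q.fold, Q.map])
  exact DFunLike.congr_fun this z

variable (A) in
/-- `qA = ker (QA → A)` as a subalgebra of `QA`. -/
def qSub : NonUnitalStarSubalgebra ℂ (Q A) where
  carrier := {z | Q.fold A z = 0}
  add_mem' {x y} hx hy := by simp_all
  zero_mem' := map_zero _
  mul_mem' {x y} hx hy := by simp_all
  smul_mem' c x hx := by simp_all
  star_mem' {x} hx := by simp_all [map_star]

instance : IsClosed (qSub A : Set (Q A)) :=
  isClosed_eq (hom_continuous (Q.fold A)) continuous_const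

variable (A) in
/-- The algebra `qA`. -/
abbrev q : Type u := qSub A

/-- The inclusion `qA → QA`. -/
def qIncl : q A →⋆ₙₐ[ℂ] Q A := NonUnitalStarSubalgebraClass.subtype (qSub A)

instance : SeparableSpace (q A) :=
  (IsSeparable.of_separableSpace (qSub A : Set (Q A))).separableSpace

/-- The evaluation map `π_A : qA → A`, the restriction of `id ⋆ 0`. -/
def qEval : q A →⋆ₙₐ[ℂ] A := (Q.lift (NonUnitalStarAlgHom.id ℂ A) 0).comp qIncl

/-- The functor `q` on homomorphisms: the restriction of `Q.map f`. -/
def q.map {B : Type v} [NonUnitalCStarAlgebra B] [SeparableSpace B] (f : A →⋆ₙₐ[ℂ] B) :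
    q A →⋆ₙₐ[ℂ] q B :=
  NonUnitalStarAlgHom.codRestrict ((Q.map f).comp qIncl) (qSub B) fun z => by
    change Q.fold B (Q.map f z.1) = 0
    rw [Q.fold_map, show Q.fold A z.1 = 0 from z.2, map_zero]

end Q

/-! ### Matrices and stabilization -/

/-- The `n × n`-matrices over `A`. -/
abbrev Mat (n : ℕ) (A : Type u) : Type u := CStarMatrix (Fin n) (Fin n) A

section Mat

variable {A : Type u} [NonUnitalCStarAlgebra A] {B : Type v} [NonUnitalCStarAlgebra B]

instance (n : ℕ) : NonUnitalCStarAlgebra (Mat n A) :=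
  letI := CStarAlgebra.spectralOrder A
  haveI := CStarAlgebra.spectralOrderedRing A
  CStarMatrix.instNonUnitalCStarAlgebra

instance (n : ℕ) [SeparableSpace A] : SeparableSpace (Mat n A) :=
  inferInstanceAs (SeparableSpace (Fin n → Fin n → A))

/-- A homomorphism applied to all entries. -/
def Mat.map (n : ℕ) (f : A →⋆ₙₐ[ℂ] B) : Mat n A →⋆ₙₐ[ℂ] Mat n B := CStarMatrix.mapₙₐ f

/-- The diagonal matrix with entries `a`, `b`. -/
def Mat.diag₂ (a b : A) : Mat 2 A := CStarMatrix.ofMatrix !![a, 0; 0, b]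

/-- The homomorphism `f ⊕ g : A → M₂(B)`. -/
def Mat.oplus (f g : A →⋆ₙₐ[ℂ] B) : A →⋆ₙₐ[ℂ] Mat 2 B where
  toFun x := Mat.diag₂ (f x) (g x)
  map_smul' c x := by
    ext i j; fin_cases i <;> fin_cases j <;> simp [Mat.diag₂]
  map_zero' := by
    ext i j; fin_cases i <;> fin_cases j <;> simp [Mat.diag₂]
  map_add' x y := by
    ext i j; fin_cases i <;> fin_cases j <;> simp [Mat.diag₂]
  map_mul' x y := by
    ext i j; fin_cases i <;> fin_cases j <;> simp [Mat.diag₂, CStarMatrix.mul_apply]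
  map_star' x := by
    ext i j
    fin_cases i <;> fin_cases j <;> simp [Mat.diag₂, CStarMatrix.star_apply, map_star]

/-- The identification of `A` with the `1 × 1`-matrices. -/
def Mat.one : A →⋆ₙₐ[ℂ] Mat 1 A where
  toFun x := CStarMatrix.ofMatrix fun _ _ => x
  map_smul' c x := rfl
  map_zero' := rfl
  map_add' x y := rfl
  map_mul' x y := by
    ext i j; simp only [CStarMatrix.mul_apply, Fin.sum_univ_one]; rfl
  map_star' x := rfl

/-- The upper left corner embedding `Mₙ(A) → Mₙ₊₁(A)`, `M ↦ M ⊕ 0`. -/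
def Mat.pad {A : Type u} [Zero A] {n : ℕ} (M : Mat n A) : Mat (n + 1) A :=
  CStarMatrix.ofMatrix fun i k =>
    if h : (i : ℕ) < n ∧ (k : ℕ) < n then M ⟨i, h.1⟩ ⟨k, h.2⟩ else 0

/-- `M` is identified with `M ⊕ 0`. -/
def stabRel (A : Type u) [Zero A] (x y : Σ n : ℕ, Mat n A) : Prop :=
  y = ⟨x.1 + 1, x.2.pad⟩

variable (A) in
/-- The stabilization `K ⊗ A`: the inductive limit of the C⋆-algebras `Mₙ(A)` under the upper
left corner embeddings. -/
abbrev Stab : Type u := Amalg (fun n : ℕ => Mat n A) (stabRel A)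

/-- The inclusion `Mₙ(A) → K ⊗ A`. -/
def Stab.incl (n : ℕ) : Mat n A →⋆ₙₐ[ℂ] Stab A :=
  Amalg.incl (G := fun n : ℕ => Mat n A) (stabRel A) n

/-- The corner embedding `A → K ⊗ A`. -/
def Stab.corner : A →⋆ₙₐ[ℂ] Stab A := (Stab.incl 1).comp Mat.one

/-- The homomorphism `id ⊗ f : K ⊗ A → K ⊗ B`. -/
def Stab.map [SeparableSpace A] (f : A →⋆ₙₐ[ℂ] B) : Stab A →⋆ₙₐ[ℂ] Stab B :=
  Amalg.lift (stabRel A) (fun n => (Stab.incl n).comp (Mat.map n f)) (by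
    rintro ⟨n, M⟩ _ rfl
    have h : Mat.map (n + 1) f M.pad = (Mat.map n f M).pad := by
      ext i k
      change f (if h : _ then _ else _) = if h : _ then _ else _
      split_ifs with h
      · rfl
      · exact map_zero f
    change Stab.incl n (Mat.map n f M) = Stab.incl (n + 1) (Mat.map (n + 1) f M.pad)
    rw [h]
    exact Amalg.incl_eq (G := fun n : ℕ => Mat n B) (stabRel B)
      (x := ⟨n, Mat.map n f M⟩) (y := ⟨n + 1, (Mat.map n f M).pad⟩) rfl)

theorem Stab.map_incl [SeparableSpace A] (f : A →⋆ₙₐ[ℂ] B) (n : ℕ) (M : Mat n A) :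
    Stab.map f (Stab.incl n M) = Stab.incl n (Mat.map n f M) :=
  Amalg.lift_incl (G := fun n : ℕ => Mat n A) (stabRel A) _ _ n M

end Mat

/-! ### Actions of a topological space -/

section Ideals

variable {A : Type u} [NonUnitalCStarAlgebra A] {B : Type v} [NonUnitalCStarAlgebra B]

/-- The closed two-sided ideal generated by a set. -/
def closedIdealSpan (s : Set A) : TwoSidedIdeal A :=
  sInf {I | IsClosed (I : Set A) ∧ s ⊆ (I : Set A)}

theorem mem_closedIdealSpan {s : Set A} {x : A} : x ∈ closedIdealSpan s ↔
    ∀ I : TwoSidedIdeal A, IsClosed (I : Set A) → s ⊆ (I : Set A) → x ∈ I := by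
  simp only [closedIdealSpan, TwoSidedIdeal.mem_sInf, Set.mem_ofPred_eq, and_imp]

theorem isClosed_closedIdealSpan (s : Set A) : IsClosed (closedIdealSpan s : Set A) := by
  have : (closedIdealSpan s : Set A) =
      ⋂ I : {I : TwoSidedIdeal A // IsClosed (I : Set A) ∧ s ⊆ (I : Set A)}, (I.1 : Set A) := by
    ext x
    simp [mem_closedIdealSpan]
  rw [this]
  exact isClosed_iInter fun I => I.2.1

theorem subset_closedIdealSpan (s : Set A) : s ⊆ (closedIdealSpan s : Set A) :=
  fun _ hx => mem_closedIdealSpan.2 fun _ _ hI => hI hx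

theorem closedIdealSpan_mono {s t : Set A} (h : s ⊆ t) : closedIdealSpan s ≤ closedIdealSpan t :=
  fun _ hx => mem_closedIdealSpan.2 fun I hc hI => mem_closedIdealSpan.1 hx I hc (h.trans hI)

theorem isClosed_comap (f : A →⋆ₙₐ[ℂ] B) {I : TwoSidedIdeal B} (h : IsClosed (I : Set B)) :
    IsClosed (I.comap f : Set A) := by
  have : (I.comap f : Set A) = f ⁻¹' (I : Set B) := by
    ext x; exact TwoSidedIdeal.mem_comap f
  rw [this]
  exact h.preimage (hom_continuous f)

theorem map_mem_of_mem_closedIdealSpan (f : A →⋆ₙₐ[ℂ] B) {s : Set A} {I : TwoSidedIdeal B}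
    (hI : IsClosed (I : Set B)) (h : ∀ x ∈ s, f x ∈ I) {x : A} (hx : x ∈ closedIdealSpan s) :
    f x ∈ I :=
  (TwoSidedIdeal.mem_comap f).1
    (mem_closedIdealSpan.1 hx (I.comap f) (isClosed_comap f hI)
      fun y hy => (TwoSidedIdeal.mem_comap f).2 (h y hy))

/-- The ideal `Mₙ(I)` of `Mₙ(A)`. -/
def matIdeal (n : ℕ) (I : TwoSidedIdeal A) : TwoSidedIdeal (Mat n A) :=
  TwoSidedIdeal.mk' {M | ∀ i j, M i j ∈ I}
    (fun _ _ => zero_mem I) (fun hx hy i j => add_mem (hx i j) (hy i j))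
    (fun hx i j => neg_mem (hx i j))
    (fun {x y} hy i j => by
      rw [CStarMatrix.mul_apply]
      exact sum_mem fun k _ => I.mul_mem_left _ _ (hy k j))
    (fun {x y} hx i j => by
      rw [CStarMatrix.mul_apply]
      exact sum_mem fun k _ => I.mul_mem_right _ _ (hx i k))

theorem mem_matIdeal {n : ℕ} {I : TwoSidedIdeal A} {M : Mat n A} :
    M ∈ matIdeal n I ↔ ∀ i j, M i j ∈ I := TwoSidedIdeal.mem_mk' _ _ _ _ _ _ _

theorem isClosed_matIdeal (n : ℕ) {I : TwoSidedIdeal A} (h : IsClosed (I : Set A)) :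
    IsClosed (matIdeal n I : Set (Mat n A)) := by
  have : (matIdeal n I : Set (Mat n A)) =
      ⋂ i, ⋂ j, (fun M : Mat n A => M i j) ⁻¹' (I : Set A) := by
    ext M; simp [mem_matIdeal]
  rw [this]
  refine isClosed_iInter fun i => isClosed_iInter fun j => h.preimage ?_
  exact (continuous_apply j).comp (continuous_apply (A := fun _ => Fin n → A) i)

end Ideals

/-- An action of the topological space `X` on the C⋆-algebra `A`: an order preserving map from
the open subsets of `X` to the closed two-sided ideals of `A`. -/
structure XAction (X : Type v) [TopologicalSpace X] (A : Type u) [NonUnitalCStarAlgebra A] where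
  ideal : Opens X → TwoSidedIdeal A
  isClosed_ideal : ∀ U, IsClosed (ideal U : Set A)
  mono : Monotone ideal

/-- A separable C⋆-algebra with an action of `X`. -/
structure XCAlg (X : Type v) [TopologicalSpace X] where
  carrier : Type u
  [cstar : NonUnitalCStarAlgebra carrier]
  [sep : SeparableSpace carrier]
  act : XAction X carrier

attribute [instance] XCAlg.cstar XCAlg.sep

variable {X : Type v} [TopologicalSpace X]

instance : CoeSort (XCAlg.{u} X) (Type u) := ⟨XCAlg.carrier⟩

/-- An `X`-equivariant ⋆-homomorphism. -/
@[ext] structure XHom (A B : XCAlg.{u} X) where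
  hom : A →⋆ₙₐ[ℂ] B
  equivariant : ∀ U, ∀ x ∈ A.act.ideal U, hom x ∈ B.act.ideal U

/-- The category of separable C⋆-algebras with an action of `X`. -/
instance : Category (XCAlg.{u} X) where
  Hom := XHom
  id A := ⟨NonUnitalStarAlgHom.id ℂ A, fun _ _ h => h⟩
  comp f g := ⟨g.hom.comp f.hom, fun U x h => g.equivariant U _ (f.equivariant U x h)⟩

/-- Homotopy through `X`-equivariant homomorphisms. -/
def Homotopic {A B : XCAlg.{u} X} (f g : A ⟶ B) : Prop :=
  ∃ H : unitInterval → (A ⟶ B),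
    (∀ x : A, Continuous fun t => (H t).hom x) ∧ H 0 = f ∧ H 1 = g

namespace XCAlg

/-- `QA` with the action for which `QA(U)` is the closed ideal generated by the two copies of
`A(U)`, that is, the kernel of `QA → Q(A/A(U))`. -/
def QObj (A : XCAlg.{u} X) : XCAlg.{u} X where
  carrier := Q A
  act :=
    { ideal := fun U => closedIdealSpan (ι '' {x : A | x ∈ A.act.ideal U} ∪
        ιbar '' {x : A | x ∈ A.act.ideal U})
      isClosed_ideal := fun _ => isClosed_closedIdealSpan _
      mono := fun U V h => closedIdealSpan_mono (Set.union_subset_union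
        (Set.image_mono fun _ hx => A.act.mono h hx)
        (Set.image_mono fun _ hx => A.act.mono h hx)) }

/-- `qA` with the action `qA(U) = qA ∩ QA(U) = ker (qA → q(A/A(U)))`. -/
def qObj (A : XCAlg.{u} X) : XCAlg.{u} X where
  carrier := q A
  act :=
    { ideal := fun U => (A.QObj.act.ideal U).comap qIncl
      isClosed_ideal := fun U => isClosed_comap qIncl (A.QObj.act.isClosed_ideal U)
      mono := fun U V h x hx => (TwoSidedIdeal.mem_comap _).2
        (A.QObj.act.mono h ((TwoSidedIdeal.mem_comap _).1 hx)) }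

/-- `Mₙ(A)` with the action `Mₙ(A)(U) = Mₙ(A(U))`. -/
def matObj (n : ℕ) (A : XCAlg.{u} X) : XCAlg.{u} X where
  carrier := Mat n A
  act :=
    { ideal := fun U => matIdeal n (A.act.ideal U)
      isClosed_ideal := fun U => isClosed_matIdeal n (A.act.isClosed_ideal U)
      mono := fun U V h M hM => mem_matIdeal.2 fun i j => A.act.mono h (mem_matIdeal.1 hM i j) }

/-- `K ⊗ A` with the action `(K ⊗ A)(U) = K ⊗ A(U)`, the closed ideal generated by the matrix
algebras over `A(U)`. -/
def stabObj (A : XCAlg.{u} X) : XCAlg.{u} X where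
  carrier := Stab A
  act :=
    { ideal := fun U => closedIdealSpan
        (⋃ n : ℕ, Stab.incl n '' {M : Mat n A | ∀ i j, M i j ∈ A.act.ideal U})
      isClosed_ideal := fun _ => isClosed_closedIdealSpan _
      mono := fun U V h => closedIdealSpan_mono (Set.iUnion_mono fun n =>
        Set.image_mono fun _ hM i j => A.act.mono h (hM i j)) }

variable {A B : XCAlg.{u} X}

theorem mem_qObj_ideal {U : Opens X} {x : q A} :
    x ∈ A.qObj.act.ideal U ↔ qIncl x ∈ A.QObj.act.ideal U :=
  TwoSidedIdeal.mem_comap (qIncl (A := A))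

/-- The functor `Q_X` on morphisms. -/
def QMap (f : A ⟶ B) : A.QObj ⟶ B.QObj where
  hom := Q.map f.hom
  equivariant U x hx := by
    refine map_mem_of_mem_closedIdealSpan (Q.map f.hom) (B.QObj.act.isClosed_ideal U) ?_ hx
    rintro _ (⟨y, hy, rfl⟩ | ⟨y, hy, rfl⟩)
    · refine subset_closedIdealSpan _ (Or.inl ⟨f.hom y, f.equivariant U y hy, ?_⟩)
      simp [Q.map]
    · refine subset_closedIdealSpan _ (Or.inr ⟨f.hom y, f.equivariant U y hy, ?_⟩)
      simp [Q.map]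

/-- The functor `q_X` on morphisms. -/
def qMap (f : A ⟶ B) : A.qObj ⟶ B.qObj where
  hom := q.map f.hom
  equivariant U x hx := mem_qObj_ideal.2 ((QMap f).equivariant U _ (mem_qObj_ideal.1 hx))

/-- The evaluation map `π_A : q_X A → A`. -/
def π (A : XCAlg.{u} X) : A.qObj ⟶ A where
  hom := qEval
  equivariant U x hx := by
    refine map_mem_of_mem_closedIdealSpan (Q.lift (NonUnitalStarAlgHom.id ℂ A) 0)
      (A.act.isClosed_ideal U) ?_ (mem_qObj_ideal.1 hx)
    rintro _ (⟨y, hy, rfl⟩ | ⟨y, hy, rfl⟩)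
    · simpa using hy
    · simp

/-- The functor `Mₙ` on morphisms. -/
def matMap (n : ℕ) (f : A ⟶ B) : matObj n A ⟶ matObj n B where
  hom := Mat.map n f.hom
  equivariant U M hM := mem_matIdeal.2 fun i j => f.equivariant U _ (mem_matIdeal.1 hM i j)

/-- The functor `K ⊗ ·` on morphisms. -/
def stabMap (f : A ⟶ B) : A.stabObj ⟶ B.stabObj where
  hom := Stab.map f.hom
  equivariant U x hx := by
    refine map_mem_of_mem_closedIdealSpan (Stab.map f.hom) (B.stabObj.act.isClosed_ideal U) ?_ hx
    intro y hy
    obtain ⟨n, M, hM, rfl⟩ := Set.mem_iUnion.1 hy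
    refine subset_closedIdealSpan _ (Set.mem_iUnion.2
      ⟨n, Mat.map n f.hom M, fun i j => f.equivariant U _ (hM i j), ?_⟩)
    exact (Stab.map_incl f.hom n M).symm

/-- The corner embedding `A → K ⊗ A`. -/
def corner (A : XCAlg.{u} X) : A ⟶ A.stabObj where
  hom := Stab.corner (A := A)
  equivariant U x hx := subset_closedIdealSpan _ (Set.mem_iUnion.2
    ⟨1, Mat.one (A := A) x, fun _ _ => hx, rfl⟩)

/-- The direct sum `f ⊕ g : A → M₂(B)` of two morphisms. -/
def oplus (f g : A ⟶ B) : A ⟶ matObj 2 B where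
  hom := Mat.oplus f.hom g.hom
  equivariant U x hx := mem_matIdeal.2 fun i j => by
    have hf := f.equivariant U x hx
    have hg := g.equivariant U x hx
    have h0 := zero_mem (B.act.ideal U)
    fin_cases i <;> fin_cases j
    exacts [hf, h0, h0, hg]

/-- The zero morphism. -/
def zeroHom (A B : XCAlg.{u} X) : A ⟶ B where
  hom := 0
  equivariant U _ _ := zero_mem (B.act.ideal U)

/-- The upper left corner embedding `A → M₂(A)`, `a ↦ a ⊕ 0`. -/
def corner₂ (A : XCAlg.{u} X) : A ⟶ matObj 2 A := oplus (𝟙 A) (zeroHom A A)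

end XCAlg

open XCAlg

/-! ### The groups `KK(X; A, B)` -/

/-- `KK(X; A, B)`: the set of homotopy classes of `X`-equivariant homomorphisms
`q_X A → K ⊗ B`. -/
def KK (A B : XCAlg.{u} X) : Type u := Quot (Homotopic (A := A.qObj) (B := B.stabObj))

/-- The class of a homomorphism `q_X A → K ⊗ B`. -/
def KK.mk {A B : XCAlg.{u} X} (α : A.qObj ⟶ B.stabObj) : KK A B := Quot.mk _ α

/-- The class in `KK(X; A, B)` of an `X`-equivariant homomorphism `f : A → B`: the class of the
composition `q_X A → A → B → K ⊗ B`. -/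
def KK.ofHom {A B : XCAlg.{u} X} (f : A ⟶ B) : KK A B := KK.mk (π A ≫ f ≫ corner B)

/-- `c = a + b` in `KK(X; A, B)`: for representatives `α`, `β`, `γ`, the homomorphism `γ` is
homotopic to `α ⊕ β` under the identification of `M₂(K ⊗ B)` with `K ⊗ B`. Up to homotopy this
identification is inverse to the corner embedding `K ⊗ B → M₂(K ⊗ B)`. -/
def IsSum {A B : XCAlg.{u} X} (a b c : KK A B) : Prop :=
  ∃ α β γ : A.qObj ⟶ B.stabObj, KK.mk α = a ∧ KK.mk β = b ∧ KK.mk γ = c ∧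
    Homotopic (γ ≫ corner₂ B.stabObj) (oplus α β)

/-! ### The universal map `φ_A : qA → M₂(q²A)` -/

section Phi

variable (A : Type u) [NonUnitalCStarAlgebra A] [SeparableSpace A]

/-- The first embedding `η : QA → Q(QA)`. -/
abbrev η : Q A →⋆ₙₐ[ℂ] Q (Q A) := ι

/-- The second embedding `η̄ : QA → Q(QA)`. -/
abbrev ηbar : Q A →⋆ₙₐ[ℂ] Q (Q A) := ιbar

/-- The matrix with the entry `a` at `(i, j)` and zeros elsewhere. -/
def Mat.unit {E : Type u} [NonUnitalCStarAlgebra E] (i j : Fin 2) (a : E) : Mat 2 E :=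
  CStarMatrix.ofMatrix (Matrix.single i j a)

/-- The C⋆-subalgebra `R` of `M₂(Q(QA))` generated by the matrices with entries in
`R₁`, `R₁R₂`, `R₂R₁`, `R₂`, where `R₁ = η(qA)` and `R₂ = η̄(qA)`. -/
def RSub : NonUnitalStarSubalgebra ℂ (Mat 2 (Q (Q A))) :=
  (NonUnitalStarAlgebra.adjoin ℂ
    {M | ∃ z w : q A,
      M = Mat.unit 0 0 (η A z) ∨ M = Mat.unit 0 1 (η A z * ηbar A w) ∨
      M = Mat.unit 1 0 (ηbar A z * η A w) ∨ M = Mat.unit 1 1 (ηbar A z)}).topologicalClosure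

instance : IsClosed (RSub A : Set (Mat 2 (Q (Q A)))) :=
  NonUnitalStarSubalgebra.isClosed_topologicalClosure _

/-- The map `M₂(Q(QA)) → M₂(QA)` identifying the two copies of `QA`. Its restriction to `R` is
the quotient map `R → R/J = M₂(qA)`, where `J = R ∩ M₂(q²A)`. -/
def foldR : Mat 2 (Q (Q A)) →⋆ₙₐ[ℂ] Mat 2 (Q A) := Mat.map 2 (Q.fold (Q A))

variable {A}

/-- The multiplier `m` of `R` is the multiplication by the matrix `w`. -/
def IsMulBy (m : 𝓜(ℂ, RSub A)) (w : Mat 2 (Q (Q A))) : Prop :=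
  ∀ r : RSub A, ((m.fst r : RSub A) : Mat 2 (Q (Q A))) = w * r ∧
    ((m.snd r : RSub A) : Mat 2 (Q (Q A))) = r * w

/-- `S` is a self-adjoint multiplier of `R` that lifts the multiplier `(0 1; 1 0)` of
`R/J = M₂(qA)` and commutes modulo `J` with `D = {η(ι x) ⊕ η̄(ι x) : x ∈ A}`. -/
structure IsRotation (S : 𝓜(ℂ, RSub A)) : Prop where
  selfAdjoint : IsSelfAdjoint S
  lifts : ∀ (r : RSub A) (i j : Fin 2),
    foldR A (S.fst r : RSub A) i j = foldR A r (Fin.rev i) j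
  commutes : ∀ x : A, ∃ d : 𝓜(ℂ, RSub A),
    IsMulBy d (Mat.diag₂ (η A (ι x)) (ηbar A (ι x))) ∧
      ∃ r : RSub A, foldR A r = 0 ∧ S * d - d * S = DoubleCentralizer.coe ℂ r

/-- `F = exp (πi/2 · S)`. -/
def rotExp (S : 𝓜(ℂ, RSub A)) : 𝓜(ℂ, RSub A) :=
  NormedSpace.exp ((Real.pi / 2 * Complex.I : ℂ) • S)

/-- `φ = q(h₁, σ h₂) : qA → J ⊆ M₂(q²A)`, where `h₁ = η ι ⊕ η̄ ῑ`, `h₂ = η ῑ ⊕ η̄ ι` and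
`σ = Ad F` for a multiplier `S` as above. The map `H` is `h₁ ⋆ σ h₂ : QA → M(R)`. -/
def IsPhi (φ : q A →⋆ₙₐ[ℂ] Mat 2 (q (q A))) : Prop :=
  ∃ S : 𝓜(ℂ, RSub A), IsRotation S ∧ ∃ H : Q A →⋆ₙₐ[ℂ] 𝓜(ℂ, RSub A),
    (∀ x : A, IsMulBy (H (ι x)) (Mat.diag₂ (η A (ι x)) (ηbar A (ιbar x)))) ∧
    (∀ x : A, ∃ m : 𝓜(ℂ, RSub A),
      IsMulBy m (Mat.diag₂ (η A (ιbar x)) (ηbar A (ι x))) ∧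
        H (ιbar x) = rotExp S * m * star (rotExp S)) ∧
    ∀ z : q A, ∃ r : RSub A,
      (r : Mat 2 (Q (Q A))) = Mat.map 2 ((Q.map qIncl).comp qIncl) (φ z) ∧
        H (qIncl z) = DoubleCentralizer.coe ℂ r

end Phi

/-! ### The composition product -/

/-- `μ : q(K ⊗ B) → K ⊗ qB` is the restriction of `(id ⊗ ι) ⋆ (id ⊗ ῑ) : Q(K ⊗ B) → K ⊗ QB`. -/
def IsMu {B : Type u} [NonUnitalCStarAlgebra B] [SeparableSpace B]
    (μ : q (Stab B) →⋆ₙₐ[ℂ] Stab (q B)) : Prop :=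
  ∀ z : q (Stab B), Stab.map qIncl (μ z) = Q.lift (Stab.map ι) (Stab.map ιbar) (qIncl z)

/-- `c` is the product of `a ∈ KK(X; A, B)` and `b ∈ KK(X; B, C)`: for representatives `α`, `β`,
`γ`, the homomorphism `γ` is homotopic to the composition
`qA → M₂(q²A) → M₂(q(K ⊗ B)) → M₂(K ⊗ qB) → M₂(K ⊗ K ⊗ C)` of `φ_A`, `q(α)`, `μ` and
`id ⊗ β` under the identification of `M₂(K ⊗ K ⊗ C)` with `K ⊗ C`. Up to homotopy this
identification is inverse to the corner embedding. -/
def IsProduct {A B C : XCAlg.{u} X} (a : KK A B) (b : KK B C) (c : KK A C) : Prop :=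
  ∃ (α : A.qObj ⟶ B.stabObj) (β : B.qObj ⟶ C.stabObj) (γ : A.qObj ⟶ C.stabObj)
    (φ : A.qObj ⟶ matObj 2 A.qObj.qObj) (μ : B.stabObj.qObj ⟶ B.qObj.stabObj),
    KK.mk α = a ∧ KK.mk β = b ∧ KK.mk γ = c ∧ IsPhi (A := A) φ.hom ∧ IsMu (B := B) μ.hom ∧
    Homotopic (γ ≫ corner C.stabObj ≫ corner₂ C.stabObj.stabObj)
      (φ ≫ matMap 2 (qMap α ≫ μ ≫ stabMap β))

/-! ### The category `KK(X)` -/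

variable (X) in
/-- The category `KK(X)`: the sum and the product turn the sets `KK(X; A, B)` into the morphism
groups of a preadditive category, and `f ↦ KK.ofHom f` is a functor to it. -/
structure KKCat where
  addGroup : ∀ A B : XCAlg.{u} X, AddCommGroup (KK A B)
  add_eq_iff : ∀ {A B : XCAlg.{u} X} (a b c : KK A B), a + b = c ↔ IsSum a b c
  comp : ∀ {A B C : XCAlg.{u} X}, KK A B → KK B C → KK A C
  comp_eq_iff : ∀ {A B C : XCAlg.{u} X} (a : KK A B) (b : KK B C) (c : KK A C),
    comp a b = c ↔ IsProduct a b c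
  id_comp : ∀ {A B : XCAlg.{u} X} (a : KK A B), comp (KK.ofHom (𝟙 A)) a = a
  comp_id : ∀ {A B : XCAlg.{u} X} (a : KK A B), comp a (KK.ofHom (𝟙 B)) = a
  assoc : ∀ {A B C D : XCAlg.{u} X} (a : KK A B) (b : KK B C) (c : KK C D),
    comp (comp a b) c = comp a (comp b c)
  add_comp : ∀ {A B C : XCAlg.{u} X} (a a' : KK A B) (b : KK B C),
    comp (a + a') b = comp a b + comp a' b
  comp_add : ∀ {A B C : XCAlg.{u} X} (a : KK A B) (b b' : KK B C),
    comp a (b + b') = comp a b + comp a b'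
  ofHom_comp : ∀ {A B C : XCAlg.{u} X} (f : A ⟶ B) (g : B ⟶ C),
    KK.ofHom (f ≫ g) = comp (KK.ofHom f) (KK.ofHom g)

namespace KKCat

/-- The objects of `KK(X)` are those of the category of separable C⋆-algebras with an action
of `X`. -/
@[nolint unusedArguments]
def Obj (_ : KKCat.{u} X) : Type _ := XCAlg.{u} X

variable (𝒦 : KKCat.{u} X)

instance : Category.{u} 𝒦.Obj where
  Hom A B := KK (X := X) A B
  id A := KK.ofHom (𝟙 (show XCAlg.{u} X from A))
  comp a b := 𝒦.comp a b
  id_comp := 𝒦.id_comp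
  comp_id := 𝒦.comp_id
  assoc := 𝒦.assoc

instance : Preadditive 𝒦.Obj where
  homGroup A B := 𝒦.addGroup A B
  add_comp _ _ _ := 𝒦.add_comp
  comp_add _ _ _ := 𝒦.comp_add

/-- The functor to `KK(X)`: the identity on objects, `f ↦ KK.ofHom f` on morphisms. -/
def functor : XCAlg.{u} X ⥤ 𝒦.Obj where
  obj A := A
  map f := KK.ofHom f
  map_id _ := rfl
  map_comp f g := 𝒦.ofHom_comp f g

end KKCat

/-! ### Stable, homotopy invariant and split exact functors -/

/-- An `X`-equivariant exact sequence `0 → I → E → A → 0` with an `X`-equivariant splitting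
homomorphism `s`. Exactness includes `I(U) = I ∩ E(U)`; the equality `p(E(U)) = A(U)` is a
consequence of the existence of `s`. -/
structure IsSplitExtension {I E A : XCAlg.{u} X} (j : I ⟶ E) (p : E ⟶ A) (s : A ⟶ E) :
    Prop where
  injective : Function.Injective j.hom
  range_eq_ker : ∀ x : E, x ∈ Set.range j.hom ↔ p.hom x = 0
  splits : s ≫ p = 𝟙 A
  ideal_eq : ∀ (U : Opens X) (x : I), x ∈ I.act.ideal U ↔ j.hom x ∈ E.act.ideal U

attribute [local instance] Limits.hasBinaryBiproducts_of_finite_biproducts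

/-- A functor on separable C⋆-algebras with an action of `X`, with values in an additive category,
that is stable, homotopy invariant and split exact. -/
structure IsStableHtpySplitExact {𝒞 : Type w} [Category.{v₁} 𝒞] [Preadditive 𝒞]
    [Limits.HasFiniteBiproducts 𝒞] (F : XCAlg.{u} X ⥤ 𝒞) : Prop where
  stable : ∀ A : XCAlg.{u} X, IsIso (F.map (corner A))
  homotopy_invariant : ∀ {A B : XCAlg.{u} X} (f g : A ⟶ B), Homotopic f g → F.map f = F.map g
  split_exact : ∀ {I E A : XCAlg.{u} X} (j : I ⟶ E) (p : E ⟶ A) (s : A ⟶ E),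
    IsSplitExtension j p s → IsIso (Limits.biprod.desc (F.map j) (F.map s))

end XKK
end


open CategoryTheory
noncomputable section
namespace XKK
open scoped ENNReal MultiplierAlgebra
open TopologicalSpace

/-! ### Generalities on homomorphisms -/

theorem isClosed_range_hom {A : Type u} {B : Type v} [NonUnitalCStarAlgebra A]
    [NonUnitalCStarAlgebra B] (f : A →⋆ₙₐ[ℂ] B) (hf : Function.Injective f) :
    IsClosed (Set.range f) :=
  (NonUnitalStarAlgHom.isometry f hf).isClosedEmbedding.isClosed_range

theorem norm_hom_le {A : Type u} {B : Type v} [NonUnitalCStarAlgebra A]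
    [NonUnitalCStarAlgebra B] (f : A →⋆ₙₐ[ℂ] B) (x : A) : ‖f x‖ ≤ ‖x‖ :=
  NonUnitalStarAlgHom.norm_apply_le f x

theorem isClosed_continuous_family {T : Type w} [TopologicalSpace T] {A : Type u} {B : Type v}
    [NonUnitalCStarAlgebra A] [NonUnitalCStarAlgebra B] (F : T → A →⋆ₙₐ[ℂ] B) :
    IsClosed {x : A | Continuous fun t => F t x} := by
  refine isClosed_of_closure_subset fun x hx => ?_
  refine continuous_of_uniform_approx_of_continuous fun u hu => ?_
  obtain ⟨ε, hε, hεu⟩ := Metric.mem_uniformity_dist.1 hu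
  obtain ⟨y, hy, hxy⟩ := Metric.mem_closure_iff.1 hx ε hε
  refine ⟨fun t => F t y, hy, fun t => hεu ?_⟩
  rw [dist_eq_norm, ← map_sub]
  exact (norm_hom_le _ _).trans_lt (by rwa [← dist_eq_norm])

theorem continuous_of_injective_hom {T : Type w} [TopologicalSpace T] {A : Type u} {B : Type v}
    [NonUnitalCStarAlgebra A] [NonUnitalCStarAlgebra B] (j : A →⋆ₙₐ[ℂ] B)
    (hj : Function.Injective j) {f : T → A} (h : Continuous fun t => j (f t)) : Continuous f :=
  (NonUnitalStarAlgHom.isometry j hj).isEmbedding.continuous_iff.2 h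

theorem exists_approx_unit (A : Type u) [NonUnitalCStarAlgebra A] (s : Finset A) {ε : ℝ}
    (hε : 0 < ε) : ∃ e : A, star e = e ∧ ‖e‖ ≤ 1 ∧
      ∀ a ∈ s, ‖e * a - a‖ < ε ∧ ‖a * e - a‖ < ε := by
  let := CStarAlgebra.spectralOrder A
  have := CStarAlgebra.spectralOrderedRing A
  have hl := CStarAlgebra.increasingApproximateUnit A
  have h1 : ∀ a ∈ s, ∀ᶠ e in CStarAlgebra.approximateUnit A,
      ‖e * a - a‖ < ε ∧ ‖a * e - a‖ < ε := fun a _ => by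
    have h2 := (hl.tendsto_mul_right a).eventually (Metric.ball_mem_nhds _ hε)
    have h3 := (hl.tendsto_mul_left a).eventually (Metric.ball_mem_nhds _ hε)
    filter_upwards [h2, h3] with e he he'
    rw [dist_eq_norm] at he he'
    exact ⟨he, he'⟩
  obtain ⟨e, ⟨he1, he2⟩, he3⟩ := ((hl.eventually_star_eq.and hl.eventually_norm).and
    ((Filter.eventually_all_finset s).2 h1)).exists
  exact ⟨e, he1, he2, he3⟩

theorem Amalg.induction {ι : Type} {G : ι → Type u} [∀ i, NonUnitalCStarAlgebra (G i)]
    {rel : (Σ i, G i) → (Σ i, G i) → Prop} {p : Amalg G rel → Prop}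
    (hc : IsClosed {z | p z}) (h0 : p 0) (hi : ∀ i x, p (incl rel i x))
    (ha : ∀ x y, p x → p y → p (x + y)) (hm : ∀ x y, p x → p y → p (x * y))
    (hs : ∀ (c : ℂ) x, p x → p (c • x)) (z : Amalg G rel) : p z := by
  have key : ∀ (x : AmalgAmbient G rel)
      (hx : x ∈ NonUnitalStarAlgebra.adjoin ℂ (⋃ i, Set.range (AmalgAmbient.incl G rel i))),
      p ⟨x, NonUnitalStarSubalgebra.le_topologicalClosure _ hx⟩ := by
    set s := ⋃ i, Set.range (AmalgAmbient.incl G rel i)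
    have hst : s ∪ star s = s := by
      refine Set.union_eq_self_of_subset_right fun x hx => ?_
      obtain ⟨i, y, hy⟩ := Set.mem_iUnion.1 hx
      exact Set.mem_iUnion.2 ⟨i, star y, by rw [map_star, hy, star_star]⟩
    intro x hx
    let sub : ∀ x, x ∈ NonUnitalStarAlgebra.adjoin ℂ s → Amalg G rel := fun x hx =>
      ⟨x, NonUnitalStarSubalgebra.le_topologicalClosure _ hx⟩
    have hx' : x ∈ Submodule.span ℂ (Subsemigroup.closure (s ∪ star s) : Set _) := by
      rw [← NonUnitalStarAlgebra.adjoin_eq_span]; exact hx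
    have main : ∃ h : x ∈ NonUnitalStarAlgebra.adjoin ℂ s, p (sub x h) := by
      induction hx' using Submodule.span_induction with
      | mem y hy =>
        rw [hst] at hy
        clear hx
        induction hy using Subsemigroup.closure_induction with
        | mem y hy =>
          refine ⟨NonUnitalStarAlgebra.subset_adjoin ℂ _ hy, ?_⟩
          obtain ⟨i, y, rfl⟩ := Set.mem_iUnion.1 hy
          exact hi i y
        | mul y z _ _ ihy ihz =>
          obtain ⟨h1, h2⟩ := ihy
          obtain ⟨h3, h4⟩ := ihz
          exact ⟨mul_mem h1 h3, hm _ _ h2 h4⟩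
      | zero => exact ⟨zero_mem _, h0⟩
      | add y z hy hz ihy ihz =>
        obtain ⟨h1, h2⟩ := ihy (by
          have := hy; rw [← NonUnitalStarAlgebra.adjoin_eq_span] at this; exact this)
        obtain ⟨h3, h4⟩ := ihz (by
          have := hz; rw [← NonUnitalStarAlgebra.adjoin_eq_span] at this; exact this)
        exact ⟨add_mem h1 h3, ha _ _ h2 h4⟩
      | smul c y hy ihy =>
        obtain ⟨h1, h2⟩ := ihy (by
          have := hy; rw [← NonUnitalStarAlgebra.adjoin_eq_span] at this; exact this)
        exact ⟨SMulMemClass.smul_mem c h1, hs _ _ h2⟩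
    exact main.2
  obtain ⟨x, hx, hlim⟩ := mem_closure_iff_seq_limit.1 (show z.1 ∈ closure _ from z.2)
  let y : ℕ → Amalg G rel :=
    fun n => ⟨x n, NonUnitalStarSubalgebra.le_topologicalClosure _ (hx n)⟩
  have hy : Filter.Tendsto y Filter.atTop (nhds z) := tendsto_subtype_rng.2 hlim
  exact hc.mem_of_tendsto hy (Filter.Eventually.of_forall fun n => key (x n) (hx n))

theorem Q.induction {A : Type u} [NonUnitalCStarAlgebra A] {p : Q A → Prop}
    (hc : IsClosed {z | p z}) (h₁ : ∀ x, p (ι x)) (h₂ : ∀ x, p (ιbar x))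
    (ha : ∀ x y, p x → p y → p (x + y)) (hm : ∀ x y, p x → p y → p (x * y))
    (hs : ∀ (c : ℂ) x, p x → p (c • x)) (z : Q A) : p z :=
  Amalg.induction hc (by simpa using h₁ 0) (fun b x => by cases b; exacts [h₁ x, h₂ x]) ha hm hs z

theorem Q.continuous_family {T : Type w} [TopologicalSpace T] {A : Type u} {B : Type v}
    [NonUnitalCStarAlgebra A] [NonUnitalCStarAlgebra B] {F : T → Q A →⋆ₙₐ[ℂ] B}
    (h₁ : ∀ x, Continuous fun t => F t (ι x)) (h₂ : ∀ x, Continuous fun t => F t (ιbar x))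
    (z : Q A) : Continuous fun t => F t z := by
  refine Q.induction (p := fun z => Continuous fun t => F t z) (isClosed_continuous_family F)
    h₁ h₂ (fun x y hx hy => ?_) (fun x y hx hy => ?_) (fun c x hx => ?_) z
  · simp only [map_add]; exact hx.add hy
  · simp only [map_mul]; exact hx.mul hy
  · simp only [map_smul]; exact hx.const_smul c


end XKK
end

open CategoryTheory
noncomputable section
namespace XKK
open scoped ENNReal MultiplierAlgebra
open TopologicalSpace

/-! ### Closed ideals and representations -/

section ClosedIdeal

variable {E : Type u} [NonUnitalCStarAlgebra E] {K : TwoSidedIdeal E}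

theorem smul_mem_closedIdeal (hK : IsClosed (K : Set E)) (c : ℂ) {k : E} (hk : k ∈ K) :
    c • k ∈ K := by
  refine hK.closure_subset (Metric.mem_closure_iff.2 fun ε hε => ?_)
  obtain ⟨e, -, -, he⟩ := exists_approx_unit E {c • k} hε
  refine ⟨(c • e) * k, K.mul_mem_left _ _ hk, ?_⟩
  have := (he (c • k) (by simp)).1
  rw [dist_comm, dist_eq_norm]
  simpa [smul_mul_assoc, mul_smul_comm] using this

/-- The largest self-adjoint part of a closed ideal, which is the ideal itself. -/
def idealCore (hK : IsClosed (K : Set E)) : NonUnitalStarSubalgebra ℂ E where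
  carrier := {x | x ∈ K ∧ star x ∈ K}
  add_mem' hx hy := ⟨add_mem hx.1 hy.1, by rw [star_add]; exact add_mem hx.2 hy.2⟩
  zero_mem' := ⟨zero_mem K, by rw [star_zero]; exact zero_mem K⟩
  mul_mem' hx hy := ⟨K.mul_mem_left _ _ hy.1, by rw [star_mul]; exact K.mul_mem_left _ _ hx.2⟩
  smul_mem' c x hx := ⟨smul_mem_closedIdeal hK c hx.1, by
    rw [star_smul]; exact smul_mem_closedIdeal hK _ hx.2⟩
  star_mem' hx := ⟨hx.2, by rw [star_star]; exact hx.1⟩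

theorem isClosed_idealCore (hK : IsClosed (K : Set E)) : IsClosed (idealCore hK : Set E) :=
  hK.inter (hK.preimage continuous_star)

theorem star_mem_closedIdeal (hK : IsClosed (K : Set E)) {x : E} (hx : x ∈ K) : star x ∈ K := by
  have := isClosed_idealCore hK
  let y : idealCore hK := ⟨x * star x, K.mul_mem_right _ _ hx, by
    rw [star_mul, star_star]; exact K.mul_mem_right _ _ hx⟩
  refine hK.closure_subset (Metric.mem_closure_iff.2 fun ε hε => ?_)
  obtain ⟨e, he1, he2, he⟩ := exists_approx_unit (idealCore hK) {y}
    (show (0 : ℝ) < ε ^ 2 / 2 by positivity)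
  refine ⟨star x * e, K.mul_mem_left _ _ e.2.1, ?_⟩
  have he3 : star (e : E) = e := congrArg Subtype.val he1
  have h1 : ‖(e : E) * (x * star x) - x * star x‖ < ε ^ 2 / 2 := (he y (by simp)).1
  have h2 : ‖(e : E)‖ ≤ 1 := he2
  rw [dist_eq_norm]
  have h3 : ‖star x - star x * e‖ * ‖star x - star x * e‖ ≤ 2 * ‖(e : E) * (x * star x) - x * star x‖ := by
    rw [← CStarRing.norm_star_mul_self]
    have : star (star x - star x * (e : E)) * (star x - star x * e) =
        (e * (x * star x) - x * star x) * e - (e * (x * star x) - x * star x) := by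
      simp only [star_sub, star_mul, star_star, he3]
      noncomm_ring
    rw [this]
    refine (norm_sub_le _ _).trans ?_
    have := (norm_mul_le ((e : E) * (x * star x) - x * star x) e).trans
      (mul_le_of_le_one_right (norm_nonneg _) h2)
    linarith
  exact lt_of_pow_lt_pow_left₀ 2 hε.le (by nlinarith)

theorem exists_approx_unit_mem (hK : IsClosed (K : Set E)) {k : E} (hk : k ∈ K) {ε : ℝ}
    (hε : 0 < ε) : ∃ e ∈ K, star e = e ∧ ‖e‖ ≤ 1 ∧ ‖e * k - k‖ < ε ∧ ‖k * e - k‖ < ε := by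
  have := isClosed_idealCore hK
  obtain ⟨e, he1, he2, he⟩ := exists_approx_unit (idealCore hK)
    {⟨k, hk, star_mem_closedIdeal hK hk⟩} hε
  have h := he _ (Finset.mem_singleton_self _)
  exact ⟨e, e.2.1, congrArg Subtype.val he1, he2, h.1, h.2⟩

section
variable [PartialOrder E] [StarOrderedRing E]

theorem neg_star_mul_self_notMem_closure (hK : IsClosed (K : Set E)) {w : E} (hw : w ∉ K) :
    -(star w * w) ∉ closure {x : E | ∃ p k s : E, 0 ≤ p ∧ k ∈ K ∧ IsSelfAdjoint s ∧
      x = p + k + Complex.I • s} := by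
  intro hcl
  refine hw (hK.closure_subset (Metric.mem_closure_iff.2 fun ε hε => ?_))
  obtain ⟨x, ⟨p, k, s, hp, hk, hs, rfl⟩, hx⟩ := Metric.mem_closure_iff.1 hcl (ε ^ 2 / 16)
    (by positivity)
  set y := star w * w + (p + k + Complex.I • s) with hy
  have hyn : ‖y‖ < ε ^ 2 / 16 := by
    rw [dist_eq_norm, ← norm_neg] at hx
    rwa [show -(-(star w * w) - (p + k + Complex.I • s)) = y by rw [hy]; abel] at hx
  set m := k + star k with hm
  have hmK : m ∈ K := add_mem hk (star_mem_closedIdeal hK hk)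
  have hsum : y + star y = star w * w + star w * w + (p + p) + m := by
    simp only [hy, hm, star_add, star_mul, star_star, star_smul, hs.star_eq,
      (IsSelfAdjoint.of_nonneg hp).star_eq]
    simp only [Complex.star_def, Complex.conj_I, neg_smul]
    abel
  obtain ⟨e, heK, hes, hen, -, hme⟩ := exists_approx_unit_mem hK hmK
    (show (0 : ℝ) < ε ^ 2 / 16 by positivity)
  refine ⟨w * e, K.mul_mem_left _ _ heK, ?_⟩
  let T : E → E := fun x => (x - x * e) - e * (x - x * e)
  have hT : ∀ x, ‖T x‖ ≤ 2 * ‖x - x * e‖ := fun x => by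
    refine (norm_sub_le _ _).trans ?_
    have := (norm_mul_le e (x - x * e)).trans (mul_le_of_le_one_left (norm_nonneg _) hen)
    linarith
  have hT' : ∀ x, ‖T x‖ ≤ 4 * ‖x‖ := fun x => by
    refine (hT x).trans ?_
    have := norm_sub_le x (x * e)
    have := (norm_mul_le x e).trans (mul_le_of_le_one_right (norm_nonneg _) hen)
    linarith
  have hTs : ∀ x, T (star x * x) = star (x - x * e) * (x - x * e) := fun x => by
    simp only [T, star_sub, star_mul, hes]
    noncomm_ring
  have hTadd : ∀ x y, T (x + y) = T x + T y := fun x y => by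
    simp only [T, add_mul, mul_sub, mul_add]; abel
  obtain ⟨r, hr⟩ := CStarAlgebra.nonneg_iff_eq_star_mul_self.1 hp
  have hTp : 0 ≤ T p := by rw [hr, hTs]; exact star_mul_self_nonneg _
  have hTw : 0 ≤ T (star w * w) := by rw [hTs]; exact star_mul_self_nonneg _
  have hle : T (star w * w) ≤ T (y + star y) - T m := by
    rw [hsum]
    simp only [hTadd, add_sub_cancel_right]
    calc T (star w * w) ≤ T (star w * w) + (T (star w * w) + (T p + T p)) :=
          le_add_of_nonneg_right (add_nonneg hTw (add_nonneg hTp hTp))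
      _ = _ := by abel
  have h1 := CStarAlgebra.norm_le_norm_of_nonneg_of_le hTw hle
  rw [hTs, CStarRing.norm_star_mul_self] at h1
  have h2 : ‖T (y + star y) - T m‖ < ε ^ 2 := by
    refine (norm_sub_le _ _).trans_lt ?_
    have h3 := hT' (y + star y)
    have h4 := norm_add_le y (star y)
    rw [norm_star] at h4
    have h5 : ‖T m‖ ≤ 2 * ‖m * e - m‖ := by rw [norm_sub_rev (m * e)]; exact hT m
    nlinarith
  rw [dist_eq_norm]
  exact lt_of_pow_lt_pow_left₀ 2 hε.le (by nlinarith)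

theorem exists_positive_functional (hK : IsClosed (K : Set E)) {w : E} (hw : w ∉ K) :
    ∃ f : E →L[ℂ] ℂ, (∀ p, 0 ≤ p → ∃ r : ℝ, 0 ≤ r ∧ f p = r) ∧ (∀ k ∈ K, f k = 0) ∧
      f (star w * w) ≠ 0 := by
  set C := {x : E | ∃ p k s : E, 0 ≤ p ∧ k ∈ K ∧ IsSelfAdjoint s ∧
      x = p + k + Complex.I • s} with hC
  have hCsmul : ∀ x ∈ C, ∀ c : ℝ, 0 ≤ c → c • x ∈ C := by
    rintro _ ⟨p, k, s, hp, hk, hs, rfl⟩ c hc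
    refine ⟨c • p, c • k, c • s, smul_nonneg hc hp, ?_, ?_, ?_⟩
    · have := smul_mem_closedIdeal hK (c : ℂ) hk
      simpa using this
    · exact (IsSelfAdjoint.all c).smul hs
    · rw [smul_add, smul_add, smul_comm c]
  have hCadd : ∀ x ∈ C, ∀ y ∈ C, x + y ∈ C := by
    rintro _ ⟨p, k, s, hp, hk, hs, rfl⟩ _ ⟨p', k', s', hp', hk', hs', rfl⟩
    exact ⟨p + p', k + k', s + s', add_nonneg hp hp', add_mem hk hk', hs.add hs', by
      rw [smul_add]; abel⟩
  have hconv : Convex ℝ (closure C) := by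
    refine Convex.closure fun x hx y hy a b ha hb _ => ?_
    exact hCadd _ (hCsmul x hx a ha) _ (hCsmul y hy b hb)
  obtain ⟨g, u, hu, hg⟩ := geometric_hahn_banach_point_closed hconv isClosed_closure
    (neg_star_mul_self_notMem_closure hK hw)
  have h0C : (0 : E) ∈ C := ⟨0, 0, 0, le_rfl, zero_mem K, .zero E, by simp⟩
  have hu0 : u < 0 := by simpa using hg 0 (subset_closure h0C)
  have hgC : ∀ x ∈ C, 0 ≤ g x := by
    intro x hx
    by_contra! hlt
    have h1 := hg _ (subset_closure (hCsmul x hx (u / g x) (div_nonneg_of_nonpos hu0.le hlt.le)))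
    rw [map_smul, smul_eq_mul, div_mul_cancel₀ _ hlt.ne] at h1
    exact lt_irrefl _ h1
  have hgp : ∀ p, 0 ≤ p → 0 ≤ g p := fun p hp =>
    hgC p ⟨p, 0, 0, hp, zero_mem K, .zero E, by simp⟩
  have hgk : ∀ k ∈ K, g k = 0 := fun k hk => by
    have h1 := hgC k ⟨0, k, 0, le_rfl, hk, .zero E, by simp⟩
    have h2 := hgC (-k) ⟨0, -k, 0, le_rfl, neg_mem hk, .zero E, by simp⟩
    rw [map_neg] at h2
    linarith
  have hgs : ∀ s, IsSelfAdjoint s → g (Complex.I • s) = 0 := fun s hs => by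
    have h1 := hgC (Complex.I • s) ⟨0, 0, s, le_rfl, zero_mem K, hs, by simp⟩
    have h2 := hgC (-(Complex.I • s)) ⟨0, 0, -s, le_rfl, zero_mem K, hs.neg, by simp⟩
    rw [map_neg] at h2
    linarith
  have hF : ∀ x, g.extendRCLike (𝕜 := ℂ) x = (g x : ℂ) - Complex.I * (g (Complex.I • x) : ℂ) :=
    fun x => by simpa using g.extendRCLike_apply (𝕜 := ℂ) x
  refine ⟨g.extendRCLike (𝕜 := ℂ), fun p hp => ⟨g p, hgp p hp, ?_⟩, fun k hk => ?_, ?_⟩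
  · rw [hF, hgs p (.of_nonneg hp)]; simp
  · rw [hF, hgk k hk, hgk _ (smul_mem_closedIdeal hK _ hk)]; simp
  · rw [hF, hgs _ (.star_mul_self w)]
    rw [map_neg] at hu
    have : g (star w * w) ≠ 0 := by linarith
    simpa using this

end

open scoped ComplexOrder in
theorem exists_rep_of_notMem (hK : IsClosed (K : Set E)) {w : E} (hw : w ∉ K) :
    ∃ (H : Type u) (_ : NormedAddCommGroup H) (_ : InnerProductSpace ℂ H) (_ : CompleteSpace H)
      (ρ : E →⋆ₙₐ[ℂ] (H →L[ℂ] H)), (∀ k ∈ K, ρ k = 0) ∧ ρ w ≠ 0 := by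
  let := CStarAlgebra.spectralOrder E
  have := CStarAlgebra.spectralOrderedRing E
  obtain ⟨f, hfp, hfK, hfw⟩ := exists_positive_functional hK hw
  let F : E →ₚ[ℂ] ℂ := PositiveLinearMap.mk₀ (f : E →ₗ[ℂ] ℂ) fun p hp => by
    obtain ⟨r, hr, h⟩ := hfp p hp
    change 0 ≤ f p
    rw [h]
    exact_mod_cast hr
  have hFf : ∀ x, F x = f x := fun _ => rfl
  refine ⟨F.GNS, inferInstance, inferInstance, inferInstance, F.gnsNonUnitalStarAlgHom, ?_, ?_⟩
  · intro k hk
    ext x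
    induction x using UniformSpace.Completion.induction_on with
    | hp => apply isClosed_eq <;> fun_prop
    | ih x =>
      rw [PositiveLinearMap.gnsNonUnitalStarAlgHom_apply_coe]
      have h1 : ‖F.leftMulMapPreGNS k x‖ = 0 := by
        have := F.preGNS_norm_sq (F.leftMulMapPreGNS k x)
        have h2 : F (star (F.ofPreGNS (F.leftMulMapPreGNS k x)) *
            F.ofPreGNS (F.leftMulMapPreGNS k x)) = 0 := by
          refine hfK _ (K.mul_mem_left _ _ ?_)
          exact K.mul_mem_right _ _ hk
        rw [h2] at this
        exact_mod_cast pow_eq_zero_iff (two_ne_zero) |>.1 (by exact_mod_cast this)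
      have h2 : ‖((F.leftMulMapPreGNS k x : F.PreGNS) : F.GNS)‖ = 0 := by
        rw [UniformSpace.Completion.norm_coe]; exact h1
      exact norm_eq_zero.1 h2
  · intro h0
    apply hfw
    have hz : ∀ b : E, f (star (w * b) * (w * b)) = 0 := fun b => by
      have h1 := DFunLike.congr_fun h0 ((F.toPreGNS b : F.PreGNS) : F.GNS)
      rw [PositiveLinearMap.gnsNonUnitalStarAlgHom_apply_coe] at h1
      have h2 : ‖F.leftMulMapPreGNS w (F.toPreGNS b)‖ = 0 := by
        rw [← UniformSpace.Completion.norm_coe, h1]; simp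
      have := F.preGNS_norm_sq (F.leftMulMapPreGNS w (F.toPreGNS b))
      rw [h2] at this
      have h3 : F (star (w * b) * (w * b)) = 0 := by simpa using this.symm
      exact h3
    have hl := CStarAlgebra.increasingApproximateUnit E
    have ht := hl.tendsto_mul_left w
    have ht2 := ((f.continuous.tendsto _).comp
      ((continuous_star.tendsto w).comp ht |>.mul ht))
    have := hl.neBot
    refine tendsto_nhds_unique ht2 ?_
    refine tendsto_const_nhds.congr fun b => ?_
    exact (hz b).symm

end ClosedIdeal


end XKK
end

open CategoryTheory
noncomputable section
namespace XKK
open scoped ENNReal MultiplierAlgebra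
open TopologicalSpace

section Extension

open Filter Topology

variable {I A : Type u} [NonUnitalCStarAlgebra I] [NonUnitalCStarAlgebra A]
  {H : Type w} [NormedAddCommGroup H] [InnerProductSpace ℂ H] [CompleteSpace H]

/-- The essential subspace of a representation. -/
def essSpace (f : I →⋆ₙₐ[ℂ] (H →L[ℂ] H)) : Submodule ℂ H :=
  (Submodule.span ℂ {x | ∃ i h, x = f i h}).topologicalClosure

theorem apply_mem_essSpace (f : I →⋆ₙₐ[ℂ] (H →L[ℂ] H)) (i : I) (h : H) : f i h ∈ essSpace f :=
  Submodule.le_topologicalClosure _ (Submodule.subset_span ⟨i, h, rfl⟩)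

theorem apply_eq_zero_of_mem_essSpace_orthogonal (f : I →⋆ₙₐ[ℂ] (H →L[ℂ] H)) (i : I) {h : H}
    (hh : h ∈ (essSpace f)ᗮ) : f i h = 0 := by
  rw [← inner_self_eq_zero (𝕜 := ℂ)]
  have h1 := (Submodule.mem_orthogonal _ _).1 hh _ (apply_mem_essSpace f (star i) (f i h))
  rw [map_star, ContinuousLinearMap.star_eq_adjoint, ContinuousLinearMap.adjoint_inner_left] at h1
  exact h1

theorem eq_of_eqOn_essSpace (f : I →⋆ₙₐ[ℂ] (H →L[ℂ] H)) {S T : H →L[ℂ] H}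
    (h₁ : ∀ i h, S (f i h) = T (f i h)) (h₂ : ∀ h ∈ (essSpace f)ᗮ, S h = T h) : S = T := by
  have : CompleteSpace (essSpace f) :=
    (Submodule.isClosed_topologicalClosure _).completeSpace_coe
  have h3 : ∀ h ∈ essSpace f, S h = T h := by
    refine ContinuousLinearMap.eqOn_closure_span ?_
    rintro _ ⟨i, h, rfl⟩
    exact h₁ i h
  ext x
  obtain ⟨y, hy, z, hz, rfl⟩ := (essSpace f).exists_add_mem_mem_orthogonal x
  rw [map_add, map_add, h3 y hy, h₂ z hz]

theorem lam_mul (j : I →⋆ₙₐ[ℂ] A) (hj : Function.Injective j) (lam : A → I → I)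
    (hlam : ∀ a i, j (lam a i) = a * j i) (a : A) (e i : I) : lam a e * i = lam a (e * i) :=
  hj (by rw [map_mul, hlam, hlam, map_mul, mul_assoc])

theorem norm_lam_le (j : I →⋆ₙₐ[ℂ] A) (hj : Function.Injective j) (lam : A → I → I)
    (hlam : ∀ a i, j (lam a i) = a * j i) (a : A) (i : I) : ‖lam a i‖ ≤ ‖a‖ * ‖i‖ := by
  rw [← NonUnitalStarAlgHom.norm_map j hj, hlam, ← NonUnitalStarAlgHom.norm_map j hj i]
  exact norm_mul_le _ _

theorem continuous_lam (j : I →⋆ₙₐ[ℂ] A) (hj : Function.Injective j) (lam : A → I → I)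
    (hlam : ∀ a i, j (lam a i) = a * j i) (a : A) : Continuous (lam a) := by
  refine continuous_of_injective_hom j hj ?_
  simp only [hlam]
  exact continuous_const.mul (hom_continuous j)

theorem exists_limit_extension [PartialOrder I] [StarOrderedRing I]
    (j : I →⋆ₙₐ[ℂ] A) (hj : Function.Injective j) (lam : A → I → I)
    (hlam : ∀ a i, j (lam a i) = a * j i) (f : I →⋆ₙₐ[ℂ] (H →L[ℂ] H)) (a : A) (h : H) :
    ∃ y, Tendsto (fun e => f (lam a e) h) (CStarAlgebra.approximateUnit I) (𝓝 y) := by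
  have hl := CStarAlgebra.increasingApproximateUnit I
  have : CompleteSpace (essSpace f) :=
    (Submodule.isClosed_topologicalClosure _).completeSpace_coe
  let S : Submodule ℂ H :=
    { carrier := {h | ∃ y, Tendsto (fun e => f (lam a e) h) (CStarAlgebra.approximateUnit I) (𝓝 y)}
      add_mem' := fun ⟨y, hy⟩ ⟨z, hz⟩ => ⟨y + z, by simpa using hy.add hz⟩
      zero_mem' := ⟨0, by simp⟩
      smul_mem' := fun c _ ⟨y, hy⟩ => ⟨c • y, by simpa using hy.const_smul c⟩ }
  have hS : IsClosed (S : Set H) := by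
    refine isClosed_of_closure_subset fun x hx => ?_
    refine cauchy_map_iff_exists_tendsto.1 (Metric.cauchy_iff.2 ⟨hl.neBot.map _, fun ε hε => ?_⟩)
    have hd : 0 < ε / (4 * (‖a‖ + 1)) := by positivity
    obtain ⟨z, ⟨y, hy⟩, hxz⟩ := Metric.mem_closure_iff.1 hx _ hd
    have h1 := hy.eventually (Metric.ball_mem_nhds y (show 0 < ε / 4 by positivity))
    refine ⟨(fun e => f (lam a e) x) '' {e | dist (f (lam a e) z) y < ε / 4 ∧ ‖e‖ ≤ 1},
      image_mem_map (h1.and hl.eventually_norm), ?_⟩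
    have h2 : ∀ e, ‖e‖ ≤ 1 → dist (f (lam a e) x) (f (lam a e) z) ≤ ε / 4 := fun e he => by
      rw [dist_eq_norm, ← map_sub]
      have h3 := (f (lam a e)).le_opNorm (x - z)
      have h4 := (norm_hom_le f (lam a e)).trans (norm_lam_le j hj lam hlam a e)
      rw [dist_eq_norm] at hxz
      have h5 : ‖a‖ * ‖e‖ ≤ ‖a‖ + 1 := by nlinarith [norm_nonneg a, norm_nonneg e]
      calc _ ≤ (‖a‖ + 1) * (ε / (4 * (‖a‖ + 1))) :=
            h3.trans (mul_le_mul (h4.trans h5) hxz.le (norm_nonneg _) (by positivity))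
        _ = ε / 4 := by field_simp
    rintro _ ⟨e, ⟨he, he'⟩, rfl⟩ _ ⟨d, ⟨hd, hd'⟩, rfl⟩
    have h3 := h2 e he'
    have h4 := h2 d hd'
    have h5 := dist_triangle (f (lam a e) x) (f (lam a e) z) (f (lam a d) x)
    have h6 := dist_triangle (f (lam a e) z) y (f (lam a d) x)
    have h7 := dist_triangle y (f (lam a d) z) (f (lam a d) x)
    rw [dist_comm] at h4 hd
    simp only at *
    linarith
  have hSe : essSpace f ≤ S := by
    refine Submodule.topologicalClosure_minimal _ (Submodule.span_le.2 ?_) hS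
    rintro _ ⟨i, k, rfl⟩
    refine ⟨f (lam a i) k, ?_⟩
    have h1 : ∀ e, f (lam a e) (f i k) = f (lam a (e * i)) k := fun e => by
      rw [← lam_mul j hj lam hlam, map_mul]; rfl
    simp only [h1]
    have h2 : Continuous fun i => f (lam a i) k :=
      ((hom_continuous f).comp (continuous_lam j hj lam hlam a)).clm_apply continuous_const
    exact (h2.tendsto i).comp (hl.tendsto_mul_right i)
  obtain ⟨y, hy, z, hz, rfl⟩ := (essSpace f).exists_add_mem_mem_orthogonal h
  refine S.add_mem (hSe hy) ⟨0, ?_⟩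
  simp only [apply_eq_zero_of_mem_essSpace_orthogonal f _ hz]
  exact tendsto_const_nhds

theorem exists_operator_extension (j : I →⋆ₙₐ[ℂ] A) (hj : Function.Injective j) (lam : A → I → I)
    (hlam : ∀ a i, j (lam a i) = a * j i)
    (f : I →⋆ₙₐ[ℂ] (H →L[ℂ] H)) (a : A) : ∃ T : H →L[ℂ] H,
    (∀ i h, T (f i h) = f (lam a i) h) ∧ (∀ h ∈ (essSpace f)ᗮ, T h = 0) ∧
    (∀ h, T h ∈ essSpace f) ∧ ∀ i, f i * T = f (star (lam (star a) (star i))) := by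
  let := CStarAlgebra.spectralOrder I
  have := CStarAlgebra.spectralOrderedRing I
  have hl := CStarAlgebra.increasingApproximateUnit I
  have := hl.neBot
  choose T hT using exists_limit_extension j hj lam hlam f a
  have hbound : ∀ h, ‖T h‖ ≤ ‖a‖ * ‖h‖ := fun h => by
    refine le_of_tendsto (hT h).norm ?_
    filter_upwards [hl.eventually_norm] with e he
    refine ((f (lam a e)).le_opNorm h).trans (mul_le_mul_of_nonneg_right ?_ (norm_nonneg _))
    exact (norm_hom_le f _).trans ((norm_lam_le j hj lam hlam a e).trans
      (mul_le_of_le_one_right (norm_nonneg _) he))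
  let L : H →L[ℂ] H := LinearMap.mkContinuous
    { toFun := T
      map_add' := fun x y => tendsto_nhds_unique (hT _) (by simpa using (hT x).add (hT y))
      map_smul' := fun c x => tendsto_nhds_unique (hT _) (by simpa using (hT x).const_smul c) }
    ‖a‖ hbound
  refine ⟨L, fun i h => ?_, fun h hh => ?_, fun h => ?_, fun i => ?_⟩
  · have h1 : ∀ e, f (lam a e) (f i h) = f (lam a (e * i)) h := fun e => by
      rw [← lam_mul j hj lam hlam, map_mul]; rfl
    have h2 : Continuous fun i => f (lam a i) h :=
      ((hom_continuous f).comp (continuous_lam j hj lam hlam a)).clm_apply continuous_const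
    have h3 := (h2.tendsto i).comp (hl.tendsto_mul_right i)
    exact tendsto_nhds_unique (hT _) (h3.congr fun e => (h1 e).symm)
  · refine tendsto_nhds_unique (hT _) (tendsto_const_nhds.congr fun e => ?_)
    exact (apply_eq_zero_of_mem_essSpace_orthogonal f _ hh).symm
  · exact (Submodule.isClosed_topologicalClosure _).mem_of_tendsto (hT h)
      (Eventually.of_forall fun e => apply_mem_essSpace f _ _)
  · ext h
    have h1 : ∀ e, i * lam a e = star (lam (star a) (star i)) * e := fun e => hj (by
      simp only [map_mul, map_star, hlam, star_mul, star_star, mul_assoc])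
    set x := star (lam (star a) (star i))
    have h2 : Tendsto (fun e => f (x * e) h) (CStarAlgebra.approximateUnit I) (𝓝 (f x h)) := by
      have h2 : Continuous fun i => f i h := (hom_continuous f).clm_apply continuous_const
      exact (h2.tendsto x).comp (hl.tendsto_mul_left x)
    refine tendsto_nhds_unique (((f i).continuous.tendsto _).comp (hT h)) (h2.congr fun e => ?_)
    rw [← h1, map_mul]; rfl

theorem exists_extension (j : I →⋆ₙₐ[ℂ] A) (hj : Function.Injective j)
    (f : I →⋆ₙₐ[ℂ] (H →L[ℂ] H)) (hid : ∀ a i, ∃ i', j i' = a * j i) :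
    ∃ f' : A →⋆ₙₐ[ℂ] (H →L[ℂ] H), (∀ i, f' (j i) = f i) ∧
      ∀ a, (∀ i i', j i' = a * j i → f i' = 0) → f' a = 0 := by
  choose lam hlam using hid
  choose T hT₁ hT₂ hT₃ hT₄ using exists_operator_extension j hj lam hlam f
  refine ⟨{ toFun := T, map_smul' := ?_, map_zero' := ?_, map_add' := ?_, map_mul' := ?_,
            map_star' := ?_ }, ?_, ?_⟩
  · intro c a
    refine eq_of_eqOn_essSpace f (fun i h => ?_) fun h hh => ?_
    · have : lam (c • a) i = c • lam a i := hj (by simp [hlam, smul_mul_assoc])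
      simp [hT₁, this]
    · simp [hT₂ _ h hh]
  · refine eq_of_eqOn_essSpace f (fun i h => ?_) fun h hh => by simp [hT₂ _ h hh]
    have : lam 0 i = 0 := hj (by simp [hlam])
    simp [hT₁, this]
  · intro a b
    refine eq_of_eqOn_essSpace f (fun i h => ?_) fun h hh => by simp [hT₂ _ h hh]
    have : lam (a + b) i = lam a i + lam b i := hj (by simp [hlam, add_mul])
    simp [hT₁, this]
  · intro a b
    refine eq_of_eqOn_essSpace f (fun i h => ?_) fun h hh => by simp [hT₂ _ h hh]
    have : lam (a * b) i = lam a (lam b i) := hj (by simp [hlam, mul_assoc])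
    simp [hT₁, this]
  · intro a
    refine eq_of_eqOn_essSpace f (fun i h => ?_) fun h hh => ?_
    · have h1 : star (T a) * f i = f (lam (star a) i) := by
        rw [← star_star (f i), ← star_mul, ← map_star, hT₄, ← map_star, star_star, star_star]
      rw [hT₁, ← h1]; rfl
    · rw [hT₂ _ h hh]
      refine (ext_inner_right ℂ fun k => ?_).symm
      rw [ContinuousLinearMap.star_eq_adjoint, ContinuousLinearMap.adjoint_inner_left,
        inner_zero_left]
      exact (Submodule.mem_orthogonal' _ _).1 hh _ (hT₃ a k)
  · intro i
    refine eq_of_eqOn_essSpace f (fun i' h => ?_) fun h hh => ?_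
    · have : lam (j i) i' = i * i' := hj (by simp [hlam])
      change T (j i) (f i' h) = _
      simp [hT₁, this]
    · change T (j i) h = _
      rw [hT₂ _ h hh, apply_eq_zero_of_mem_essSpace_orthogonal f _ hh]
  · intro a ha
    refine eq_of_eqOn_essSpace f (fun i h => ?_) fun h hh => ?_
    · change T a (f i h) = _
      rw [hT₁, ha i _ (hlam a i)]; simp
    · change T a h = _
      rw [hT₂ _ h hh]; simp

end Extension

theorem isClosed_bot_ideal {A : Type u} [NonUnitalCStarAlgebra A] :
    IsClosed ((⊥ : TwoSidedIdeal A) : Set A) := by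
  have : ((⊥ : TwoSidedIdeal A) : Set A) = {0} := by
    ext x; simp
  rw [this]; exact isClosed_singleton

/-- Let `I` be an ideal of `A` and `N` a closed ideal of `A`. An element of `QI` that is mapped into
the ideal of `QA` generated by the two copies of `N` belongs to the ideal of `QI` generated by the
two copies of `I ∩ N`. -/
theorem mem_closedIdealSpan_of_Qmap_mem {I A : Type u} [NonUnitalCStarAlgebra I]
    [NonUnitalCStarAlgebra A] [SeparableSpace I] [SeparableSpace A] (j : I →⋆ₙₐ[ℂ] A)
    (hj : Function.Injective j) (hid : ∀ a i, ∃ i', j i' = a * j i) (N : TwoSidedIdeal A)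
    {z : Q I} (hz : Q.map j z ∈ closedIdealSpan (ι '' {x : A | x ∈ N} ∪ ιbar '' {x : A | x ∈ N})) :
    z ∈ closedIdealSpan (ι '' {x : I | j x ∈ N} ∪ ιbar '' {x : I | j x ∈ N}) := by
  by_contra hcon
  obtain ⟨H, _, _, _, ρ, hρ, hne⟩ := exists_rep_of_notMem (isClosed_closedIdealSpan _) hcon
  obtain ⟨f, hf, hf'⟩ := exists_extension j hj (ρ.comp ι) hid
  obtain ⟨g, hg, hg'⟩ := exists_extension j hj (ρ.comp ιbar) hid
  apply hne
  have h1 : (Q.lift f g).comp (Q.map j) = ρ := Q.hom_ext (fun x => by simp [Q.map, hf])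
    (fun x => by simp [Q.map, hg])
  rw [← h1]
  refine (TwoSidedIdeal.mem_bot _).1 (map_mem_of_mem_closedIdealSpan (Q.lift f g) isClosed_bot_ideal ?_ hz)
  rintro _ (⟨n, hn, rfl⟩ | ⟨n, hn, rfl⟩)
  · rw [Q.lift_ι, TwoSidedIdeal.mem_bot]
    refine hf' n fun i i' hi' => hρ _ (subset_closedIdealSpan _ (Or.inl ⟨i', ?_, rfl⟩))
    rw [Set.mem_ofPred_eq, hi']
    exact N.mul_mem_right _ _ hn
  · rw [Q.lift_ιbar, TwoSidedIdeal.mem_bot]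
    refine hg' n fun i i' hi' => hρ _ (subset_closedIdealSpan _ (Or.inr ⟨i', ?_, rfl⟩))
    rw [Set.mem_ofPred_eq, hi']
    exact N.mul_mem_right _ _ hn

theorem Qmap_injective {I A : Type u} [NonUnitalCStarAlgebra I]
    [NonUnitalCStarAlgebra A] [SeparableSpace I] [SeparableSpace A] (j : I →⋆ₙₐ[ℂ] A)
    (hj : Function.Injective j) (hid : ∀ a i, ∃ i', j i' = a * j i) :
    Function.Injective (Q.map j) := by
  refine (injective_iff_map_eq_zero _).2 fun z hz => ?_
  have h1 := mem_closedIdealSpan_of_Qmap_mem j hj hid ⊥ (z := z) (by rw [hz]; exact zero_mem _)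
  refine (TwoSidedIdeal.mem_bot _).1 (mem_closedIdealSpan.1 h1 ⊥ isClosed_bot_ideal ?_)
  rintro _ (⟨n, hn, rfl⟩ | ⟨n, hn, rfl⟩)
  all_goals
    have : n = 0 := hj (by rw [map_zero]; exact (TwoSidedIdeal.mem_bot _).1 hn)
    rw [this, map_zero]
    exact zero_mem _


end XKK
end

open CategoryTheory
noncomputable section
namespace XKK
open scoped ENNReal MultiplierAlgebra
open TopologicalSpace

/-! ### Systems of matrix units over an algebra -/

/-- A system of matrix units over `A` in `E`, indexed by `S`: linear maps `a ↦ a ⊗ e_{st}` with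
the relations of the elementary matrices. -/
structure MatSys (S : Type) (A : Type u) (E : Type v) [NonUnitalCStarAlgebra A]
    [NonUnitalCStarAlgebra E] where
  p : S → S → A →ₗ[ℂ] E
  mul_same : ∀ s t v a b, p s t a * p t v b = p s v (a * b)
  mul_ne : ∀ s t u v a b, t ≠ u → p s t a * p u v b = 0
  star_p : ∀ s t a, star (p s t a) = p t s (star a)

namespace MatSys

variable {S T : Type} {A : Type u} {E : Type v} [NonUnitalCStarAlgebra A]
  [NonUnitalCStarAlgebra E]

theorem ext_p {P P' : MatSys S A E} (h : ∀ s t a, P.p s t a = P'.p s t a) : P = P' := by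
  have : P.p = P'.p := funext fun s => funext fun t => LinearMap.ext (h s t)
  cases P; cases P'; cases this; rfl

theorem mul_eq [DecidableEq S] (P : MatSys S A E) (s t u v : S) (a b : A) :
    P.p s t a * P.p u v b = (if t = u then (1 : ℂ) else 0) • P.p s v (a * b) := by
  split_ifs with h
  · subst h; rw [P.mul_same, one_smul]
  · rw [P.mul_ne _ _ _ _ _ _ h, zero_smul]

/-- Restriction to a smaller index set. -/
def reindex (P : MatSys S A E) (f : T → S) (hf : Function.Injective f) : MatSys T A E where
  p s t := P.p (f s) (f t)
  mul_same _ _ _ := P.mul_same _ _ _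
  mul_ne _ _ _ _ _ _ h := P.mul_ne _ _ _ _ _ _ (hf.ne h)
  star_p _ _ := P.star_p _ _

/-- The homomorphism `a ↦ a ⊗ e_{ss}`. -/
def diag (P : MatSys S A E) (s : S) : A →⋆ₙₐ[ℂ] E where
  toFun := P.p s s
  map_smul' c x := map_smul _ c x
  map_zero' := map_zero _
  map_add' x y := map_add _ x y
  map_mul' x y := (P.mul_same s s s x y).symm
  map_star' x := (P.star_p s s x).symm

/-- Conjugation by the isometry that maps the basis vector `i` to `∑ k, x i k • f i k`. -/
def conj [DecidableEq S] [DecidableEq T] (P : MatSys S A E) {R : Type} [Fintype R]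
    (f : T → R → S) (x : T → R → ℂ)
    (hx : ∀ i j, ∑ l, ∑ m, star (x i l) * x j m * (if f i l = f j m then (1 : ℂ) else 0) =
      if i = j then 1 else 0) : MatSys T A E := by
  have key : ∀ i j j' i' (a b : A),
      (∑ k, ∑ l, (x i k * star (x j l)) • P.p (f i k) (f j l) a) *
        (∑ k, ∑ l, (x j' k * star (x i' l)) • P.p (f j' k) (f i' l) b) =
      (if j = j' then (1 : ℂ) else 0) •
        ∑ k, ∑ l, (x i k * star (x i' l)) • P.p (f i k) (f i' l) (a * b) := by
    intro i j j' i' a b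
    rw [← hx j j', Finset.sum_mul_sum, Finset.smul_sum]
    refine Finset.sum_congr rfl fun k _ => ?_
    have h1 : ∀ l' : R, (∑ l, (x i k * star (x j l)) • P.p (f i k) (f j l) a) *
        (∑ n, (x j' l' * star (x i' n)) • P.p (f j' l') (f i' n) b) =
        ∑ n, (∑ l, star (x j l) * x j' l' * (if f j l = f j' l' then (1 : ℂ) else 0)) •
          (x i k * star (x i' n)) • P.p (f i k) (f i' n) (a * b) := fun l' => by
      rw [Finset.sum_mul_sum, Finset.sum_comm]
      refine Finset.sum_congr rfl fun n _ => ?_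
      rw [Finset.sum_smul]
      refine Finset.sum_congr rfl fun l _ => ?_
      rw [smul_mul_smul_comm, mul_eq, smul_smul, smul_smul]
      congr 1
      ring
    rw [Finset.sum_congr rfl fun l' _ => h1 l', Finset.sum_comm, Finset.smul_sum]
    refine Finset.sum_congr rfl fun n _ => ?_
    rw [← Finset.sum_smul, Finset.sum_comm]
  exact
  { p := fun i j => ∑ k, ∑ l, (x i k * star (x j l)) • P.p (f i k) (f j l)
    mul_same := fun i j i' a b => by
      simpa only [LinearMap.sum_apply, LinearMap.smul_apply, if_true, one_smul]
        using key i j j i' a b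
    mul_ne := fun i j j' i' a b h => by
      have := key i j j' i' a b
      rw [if_neg h, zero_smul] at this
      simpa only [LinearMap.sum_apply, LinearMap.smul_apply] using this
    star_p := fun i j a => by
      simp only [LinearMap.sum_apply, LinearMap.smul_apply, star_sum, star_smul, star_mul,
        star_star, P.star_p]
      rw [Finset.sum_comm] }

theorem conj_p [DecidableEq S] [DecidableEq T] (P : MatSys S A E) {R : Type} [Fintype R]
    (f : T → R → S) (x : T → R → ℂ)
    (hx : ∀ i j, ∑ l, ∑ m, star (x i l) * x j m * (if f i l = f j m then (1 : ℂ) else 0) =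
      if i = j then 1 else 0) (i j : T) (a : A) :
    (P.conj f x hx).p i j a = ∑ k, ∑ l, (x i k * star (x j l)) • P.p (f i k) (f j l) a := by
  simp [conj]

/-- The homomorphism from matrices defined by a finite system. -/
def toMat {n : ℕ} (P : MatSys (Fin n) A E) : Mat n A →⋆ₙₐ[ℂ] E where
  toFun M := ∑ i, ∑ j, P.p i j (M i j)
  map_smul' c M := by
    simp only [CStarMatrix.smul_apply, map_smul, Finset.smul_sum]; rfl
  map_zero' := by simp
  map_add' M N := by
    simp only [CStarMatrix.add_apply, map_add, Finset.sum_add_distrib]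
  map_mul' M N := by
    simp only [CStarMatrix.mul_apply, map_sum, Finset.sum_mul_sum]
    refine Finset.sum_congr rfl fun i _ => ?_
    rw [Finset.sum_comm]
    refine Finset.sum_congr rfl fun k _ => Eq.symm ?_
    refine (Finset.sum_eq_single k (fun j _ hj => ?_) (by simp)).trans ?_
    · exact Finset.sum_eq_zero fun l _ => P.mul_ne _ _ _ _ _ _ hj
    · exact Finset.sum_congr rfl fun l _ => P.mul_same _ _ _ _ _
  map_star' M := by
    simp only [star_sum, P.star_p]
    rw [Finset.sum_comm]; rfl

theorem toMat_apply {n : ℕ} (P : MatSys (Fin n) A E) (M : Mat n A) :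
    P.toMat M = ∑ i, ∑ j, P.p i j (M i j) := rfl

end MatSys

section
variable {A : Type u} {B : Type v} [NonUnitalCStarAlgebra A] [NonUnitalCStarAlgebra B]

/-- The elementary matrices. -/
def Mat.sys (n : ℕ) (A : Type u) [NonUnitalCStarAlgebra A] : MatSys (Fin n) A (Mat n A) where
  p i j :=
    { toFun := fun a => CStarMatrix.ofMatrix (Matrix.single i j a)
      map_add' := fun a b => congrArg CStarMatrix.ofMatrix (Matrix.single_add i j a b)
      map_smul' := fun c a => congrArg CStarMatrix.ofMatrix (Matrix.smul_single c i j a).symm }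
  mul_same i j k a b :=
    congrArg CStarMatrix.ofMatrix (Matrix.single_mul_single_same (c := a) i j k b)
  mul_ne i j j' k a b h :=
    congrArg CStarMatrix.ofMatrix (Matrix.single_mul_single_of_ne (c := a) i j j' h b)
  star_p i j a := congrArg CStarMatrix.ofMatrix (Matrix.conjTranspose_single i j a)

theorem Mat.sys_apply {n : ℕ} (i j k l : Fin n) (a : A) :
    (Mat.sys n A).p i j a k l = if i = k ∧ j = l then a else 0 := by
  change Matrix.single i j a k l = _
  rw [Matrix.single_apply]

theorem Mat.eq_sum {n : ℕ} (M : Mat n A) : M = ∑ i, ∑ j, (Mat.sys n A).p i j (M i j) := by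
  conv_lhs => rw [show M = CStarMatrix.ofMatrix (M : Matrix (Fin n) (Fin n) A) from rfl,
    Matrix.matrix_eq_sum_single (M : Matrix (Fin n) (Fin n) A)]
  exact map_sum (CStarMatrix.ofMatrixₗ (R := ℂ)) _ _ |>.trans
    (Finset.sum_congr rfl fun i _ => map_sum (CStarMatrix.ofMatrixₗ (R := ℂ)) _ _)

@[simp] theorem MatSys.toMat_sys {E : Type w} [NonUnitalCStarAlgebra E] {n : ℕ}
    (P : MatSys (Fin n) A E) (i j : Fin n) (a : A) :
    P.toMat ((Mat.sys n A).p i j a) = P.p i j a := by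
  rw [MatSys.toMat_apply, Finset.sum_eq_single i, Finset.sum_eq_single j]
  · simp [Mat.sys_apply]
  · intro k _ hk; simp [Mat.sys_apply, hk.symm]
  · simp
  · intro k _ hk; simp [Mat.sys_apply, hk.symm]
  · simp

theorem Mat.hom_ext {E : Type w} [NonUnitalCStarAlgebra E] {n : ℕ} {F F' : Mat n A →⋆ₙₐ[ℂ] E}
    (h : ∀ i j a, F ((Mat.sys n A).p i j a) = F' ((Mat.sys n A).p i j a)) : F = F' := by
  ext M
  rw [Mat.eq_sum M]
  simp only [map_sum, h]

theorem Mat.map_sys {n : ℕ} (f : A →⋆ₙₐ[ℂ] B) (i j : Fin n) (a : A) :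
    Mat.map n f ((Mat.sys n A).p i j a) = (Mat.sys n B).p i j (f a) := by
  ext k l
  change f ((Mat.sys n A).p i j a k l) = _
  rw [Mat.sys_apply, Mat.sys_apply]
  split_ifs <;> simp

theorem Mat.continuous_entry {n : ℕ} (i j : Fin n) : Continuous fun M : Mat n A => M i j :=
  (continuous_apply j).comp (continuous_apply (A := fun _ => Fin n → A) i)

theorem Mat.continuous_iff {T : Type w} [TopologicalSpace T] {n : ℕ} {f : T → Mat n A} :
    Continuous f ↔ ∀ i j, Continuous fun t => f t i j := by
  refine ⟨fun h i j => (Mat.continuous_entry i j).comp h, fun h => ?_⟩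
  exact continuous_pi (A := fun _ => Fin n → A) fun i => continuous_pi fun j => h i j

theorem Stab.incl_pad {n : ℕ} (M : Mat n A) : Stab.incl (n + 1) M.pad = Stab.incl n M :=
  (Amalg.incl_eq (G := fun n : ℕ => Mat n A) (stabRel A) (x := ⟨n, M⟩) (y := ⟨n + 1, M.pad⟩)
    rfl).symm

theorem Mat.pad_sys {n : ℕ} (i j : Fin n) (a : A) :
    ((Mat.sys n A).p i j a).pad = (Mat.sys (n + 1) A).p i.castSucc j.castSucc a := by
  ext k l
  rw [Mat.sys_apply]
  change (if h : (k : ℕ) < n ∧ (l : ℕ) < n then (Mat.sys n A).p i j a ⟨k, h.1⟩ ⟨l, h.2⟩ else 0) = _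
  simp only [Mat.sys_apply, Fin.ext_iff, Fin.val_castSucc]
  by_cases h : (i : ℕ) = k ∧ (j : ℕ) = l
  · have : (k : ℕ) < n ∧ (l : ℕ) < n := ⟨h.1 ▸ i.2, h.2 ▸ j.2⟩
    simp [h, this]
  · simp [h]

theorem Stab.incl_sys_le {n m : ℕ} (h : n ≤ m) (i j : Fin n) (a : A) :
    Stab.incl m ((Mat.sys m A).p (i.castLE h) (j.castLE h) a) =
      Stab.incl n ((Mat.sys n A).p i j a) := by
  induction m, h using Nat.le_induction with
  | base => rfl
  | succ m h ih => rw [← ih, ← Stab.incl_pad (n := m), Mat.pad_sys]; rfl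

/-- The elementary matrices in `K ⊗ A`. -/
def Stab.sys (A : Type u) [NonUnitalCStarAlgebra A] : MatSys ℕ A (Stab A) := by
  have key : ∀ (m s t : ℕ) (hs : s < m) (ht : t < m) (a : A),
      Stab.incl (max s t + 1) ((Mat.sys (max s t + 1) A).p ⟨s, by omega⟩ ⟨t, by omega⟩ a) =
      Stab.incl m ((Mat.sys m A).p ⟨s, hs⟩ ⟨t, ht⟩ a) := fun m s t hs ht a =>
    (Stab.incl_sys_le (show max s t + 1 ≤ m by omega) ⟨s, by omega⟩ ⟨t, by omega⟩ a).symm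
  exact
  { p := fun s t => ((Stab.incl (max s t + 1) : Mat (max s t + 1) A →⋆ₙₐ[ℂ] Stab A) :
        Mat (max s t + 1) A →ₗ[ℂ] Stab A) ∘ₗ
        (Mat.sys (max s t + 1) A).p ⟨s, by omega⟩ ⟨t, by omega⟩
    mul_same := fun s t v a b => by
      change Stab.incl _ _ * Stab.incl _ _ = Stab.incl _ _
      rw [key (s + t + v + 1) s t (by omega) (by omega),
        key (s + t + v + 1) t v (by omega) (by omega),
        key (s + t + v + 1) s v (by omega) (by omega), ← map_mul, MatSys.mul_same]
    mul_ne := fun s t t' v a b h => by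
      change Stab.incl _ _ * Stab.incl _ _ = 0
      rw [key (s + t + t' + v + 1) s t (by omega) (by omega),
        key (s + t + t' + v + 1) t' v (by omega) (by omega), ← map_mul, MatSys.mul_ne, map_zero]
      simpa using h
    star_p := fun s t a => by
      change star (Stab.incl _ _) = Stab.incl _ _
      rw [key (s + t + 1) s t (by omega) (by omega), key (s + t + 1) t s (by omega) (by omega),
        ← map_star, MatSys.star_p] }

theorem Stab.incl_sys {n : ℕ} (i j : Fin n) (a : A) :
    Stab.incl n ((Mat.sys n A).p i j a) = (Stab.sys A).p i j a := by
  have h : max (i : ℕ) j + 1 ≤ n := by omega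
  exact Stab.incl_sys_le h ⟨i, by omega⟩ ⟨j, by omega⟩ a

theorem Stab.incl_eq_sum {n : ℕ} (M : Mat n A) :
    Stab.incl n M = ∑ i : Fin n, ∑ j : Fin n, (Stab.sys A).p i j (M i j) := by
  conv_lhs => rw [Mat.eq_sum M]
  simp only [map_sum, Stab.incl_sys]

theorem Stab.corner_apply (a : A) : Stab.corner a = (Stab.sys A).p 0 0 a := by
  change Stab.incl 1 (Mat.one a) = _
  rw [Stab.incl_eq_sum]
  simp only [Fin.sum_univ_one]; rfl

theorem Stab.induction {p : Stab A → Prop} (hc : IsClosed {z | p z})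
    (hp : ∀ s t a, p ((Stab.sys A).p s t a)) (ha : ∀ x y, p x → p y → p (x + y))
    (z : Stab A) : p z := by
  set V : Submodule ℂ (Stab A) := Submodule.span ℂ {x | ∃ s t a, x = (Stab.sys A).p s t a} with hV
  have hVp : ∀ x ∈ V, p x := by
    intro x hx
    have : ∀ c : ℂ, p (c • x) := by
      induction hx using Submodule.span_induction with
      | mem x hx => obtain ⟨s, t, a, rfl⟩ := hx; intro c; rw [← map_smul]; exact hp _ _ _
      | zero => intro c; simpa using hp 0 0 0
      | add x y _ _ hx hy => intro c; rw [smul_add]; exact ha _ _ (hx c) (hy c)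
      | smul d x _ hx => intro c; rw [smul_smul]; exact hx _
    simpa using this 1
  have hVm : ∀ x ∈ V, ∀ y ∈ V, x * y ∈ V := by
    intro x hx y hy
    induction hx using Submodule.span_induction with
    | mem x hx =>
      obtain ⟨s, t, a, rfl⟩ := hx
      induction hy using Submodule.span_induction with
      | mem y hy =>
        obtain ⟨u, v, b, rfl⟩ := hy
        rw [MatSys.mul_eq, ← map_smul]
        exact Submodule.subset_span ⟨_, _, _, rfl⟩
      | zero => simp
      | add y z _ _ hy hz => rw [mul_add]; exact add_mem hy hz
      | smul c y _ hy => rw [mul_smul_comm]; exact V.smul_mem c hy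
    | zero => simp
    | add x z _ _ hx hz => rw [add_mul]; exact add_mem hx hz
    | smul c x _ hx => rw [smul_mul_assoc]; exact V.smul_mem c hx
  have hz : z ∈ closure (V : Set (Stab A)) := by
    refine Amalg.induction (p := fun z => z ∈ closure (V : Set (Stab A))) isClosed_closure
      (subset_closure V.zero_mem) (fun n M => subset_closure ?_) (fun x y hx hy => ?_)
      (fun x y hx hy => ?_) (fun c x hx => ?_) z
    · change Stab.incl n M ∈ V
      rw [Stab.incl_eq_sum]
      exact sum_mem fun i _ => sum_mem fun j _ => Submodule.subset_span ⟨_, _, _, rfl⟩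
    · exact map_mem_closure₂ continuous_add hx hy fun a ha b hb => V.add_mem ha hb
    · exact map_mem_closure₂ continuous_mul hx hy fun a ha b hb => hVm a ha b hb
    · exact map_mem_closure (continuous_const_smul c) hx fun a ha => V.smul_mem c ha
  exact hc.closure_subset_iff.2 hVp hz

theorem Stab.hom_ext {E : Type w} [NonUnitalCStarAlgebra E] {F F' : Stab A →⋆ₙₐ[ℂ] E}
    (h : ∀ s t a, F ((Stab.sys A).p s t a) = F' ((Stab.sys A).p s t a)) : F = F' := by
  ext z
  refine Stab.induction (p := fun z => F z = F' z)
    (isClosed_eq (hom_continuous F) (hom_continuous F')) h (fun x y hx hy => ?_) z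
  rw [map_add, map_add, hx, hy]

theorem Stab.map_sys [SeparableSpace A] (f : A →⋆ₙₐ[ℂ] B) (s t : ℕ) (a : A) :
    Stab.map f ((Stab.sys A).p s t a) = (Stab.sys B).p s t (f a) := by
  have h1 : (Stab.sys A).p s t a = Stab.incl (s + t + 1)
      ((Mat.sys (s + t + 1) A).p ⟨s, by omega⟩ ⟨t, by omega⟩ a) := by rw [Stab.incl_sys]
  have h2 : (Stab.sys B).p s t (f a) = Stab.incl (s + t + 1)
      ((Mat.sys (s + t + 1) B).p ⟨s, by omega⟩ ⟨t, by omega⟩ (f a)) := by rw [Stab.incl_sys]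
  rw [h1, h2, Stab.map_incl, Mat.map_sys]

/-- The homomorphism from `K ⊗ A` defined by a system indexed by `ℕ`. -/
def MatSys.toStab [SeparableSpace A] (P : MatSys ℕ A B) : Stab A →⋆ₙₐ[ℂ] B :=
  Amalg.lift (stabRel A) (fun n => (P.reindex (fun i : Fin n => (i : ℕ))
    Fin.val_injective).toMat) (by
    rintro ⟨n, M⟩ _ rfl
    change ∑ i : Fin n, ∑ j : Fin n, P.p i j (M i j) =
      ∑ i : Fin (n + 1), ∑ j : Fin (n + 1), P.p i j (M.pad i j)
    have hpad : ∀ i j : Fin (n + 1), M.pad i j =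
      if h : (i : ℕ) < n ∧ (j : ℕ) < n then M ⟨i, h.1⟩ ⟨j, h.2⟩ else 0 := fun _ _ => rfl
    simp [Fin.sum_univ_castSucc, hpad])

@[simp] theorem MatSys.toStab_sys [SeparableSpace A] (P : MatSys ℕ A B) (s t : ℕ) (a : A) :
    P.toStab ((Stab.sys A).p s t a) = P.p s t a := by
  have h1 : (Stab.sys A).p s t a = Stab.incl (s + t + 1)
      ((Mat.sys (s + t + 1) A).p ⟨s, by omega⟩ ⟨t, by omega⟩ a) := by rw [Stab.incl_sys]
  rw [h1]
  refine (Amalg.lift_incl (G := fun n : ℕ => Mat n A) (stabRel A) _ _ _ _).trans ?_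
  rw [MatSys.toMat_sys]; rfl

theorem Stab.continuous_family {T : Type w} [TopologicalSpace T] {F : T → Stab A →⋆ₙₐ[ℂ] B}
    (h : ∀ s t a, Continuous fun τ => F τ ((Stab.sys A).p s t a)) (z : Stab A) :
    Continuous fun τ => F τ z := by
  refine Stab.induction (p := fun z => Continuous fun t => F t z) (isClosed_continuous_family F)
    h (fun x y hx hy => ?_) z
  simp only [map_add]; exact hx.add hy

end


end XKK
end

open CategoryTheory
noncomputable section
namespace XKK
open scoped ENNReal MultiplierAlgebra
open TopologicalSpace

/-! ### The structure of the stabilization -/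

section
open Filter Topology
variable {A : Type u} [NonUnitalCStarAlgebra A] {B : Type v} [NonUnitalCStarAlgebra B]

section
variable {H : Type w} [NormedAddCommGroup H] [InnerProductSpace ℂ H] [CompleteSpace H]

/-- The evaluation at a coordinate of `ℓ²(ℕ, H)`. -/
abbrev ellEval (H : Type w) [NormedAddCommGroup H] [InnerProductSpace ℂ H] [CompleteSpace H]
    (s : ℕ) : lp (fun _ : ℕ => H) 2 →L[ℂ] H := lp.evalCLM ℂ (fun _ : ℕ => H) 2 s

theorem ellEval_comp_adjoint (s t : ℕ) : ellEval H s ∘L ContinuousLinearMap.adjoint (ellEval H t) =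
    if s = t then ContinuousLinearMap.id ℂ H else 0 := by
  have h : ∀ v, ContinuousLinearMap.adjoint (ellEval H t) v = lp.single 2 t v := fun v => by
    refine ext_inner_right ℂ fun y => ?_
    rw [ContinuousLinearMap.adjoint_inner_left, lp.inner_single_left]
    rfl
  ext v
  change (ContinuousLinearMap.adjoint (ellEval H t) v : lp (fun _ : ℕ => H) 2) s = _
  rw [h]
  split_ifs with hst
  · subst hst; simp
  · rw [lp.single_apply_ne _ _ _ hst]; rfl

/-- The system of operators on `ℓ²(ℕ, H)` defined by a representation on `H`. -/
def ellSys (ρ : A →⋆ₙₐ[ℂ] (H →L[ℂ] H)) :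
    MatSys ℕ A (lp (fun _ : ℕ => H) 2 →L[ℂ] lp (fun _ : ℕ => H) 2) where
  p s t :=
    { toFun := fun a => ContinuousLinearMap.adjoint (ellEval H s) ∘L ρ a ∘L ellEval H t
      map_add' := fun a b => by
        rw [map_add, ContinuousLinearMap.add_comp, ContinuousLinearMap.comp_add]
      map_smul' := fun c a => by
        rw [map_smul, ContinuousLinearMap.smul_comp, ContinuousLinearMap.comp_smul]; rfl }
  mul_same s t v a b := by
    change (ContinuousLinearMap.adjoint (ellEval H s) ∘L ρ a ∘L ellEval H t) ∘L
      (ContinuousLinearMap.adjoint (ellEval H t) ∘L ρ b ∘L ellEval H v) =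
      ContinuousLinearMap.adjoint (ellEval H s) ∘L ρ (a * b) ∘L ellEval H v
    have h := ellEval_comp_adjoint (H := H) t t
    rw [if_pos rfl] at h
    calc _ = ContinuousLinearMap.adjoint (ellEval H s) ∘L ρ a ∘L
          (ellEval H t ∘L ContinuousLinearMap.adjoint (ellEval H t)) ∘L ρ b ∘L ellEval H v := rfl
      _ = _ := by rw [h, map_mul]; rfl
  mul_ne s t u v a b htu := by
    change (ContinuousLinearMap.adjoint (ellEval H s) ∘L ρ a ∘L ellEval H t) ∘L
      (ContinuousLinearMap.adjoint (ellEval H u) ∘L ρ b ∘L ellEval H v) = 0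
    have h := ellEval_comp_adjoint (H := H) t u
    rw [if_neg htu] at h
    calc _ = ContinuousLinearMap.adjoint (ellEval H s) ∘L ρ a ∘L
          (ellEval H t ∘L ContinuousLinearMap.adjoint (ellEval H u)) ∘L ρ b ∘L ellEval H v := rfl
      _ = _ := by rw [h]; simp
  star_p s t a := by
    change ContinuousLinearMap.adjoint
      (ContinuousLinearMap.adjoint (ellEval H s) ∘L ρ a ∘L ellEval H t) =
      ContinuousLinearMap.adjoint (ellEval H t) ∘L ρ (star a) ∘L ellEval H s
    rw [ContinuousLinearMap.adjoint_comp, ContinuousLinearMap.adjoint_comp,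
      ContinuousLinearMap.adjoint_adjoint, map_star]
    rfl

theorem ellSys_compress (ρ : A →⋆ₙₐ[ℂ] (H →L[ℂ] H)) (s t : ℕ) (a : A) :
    ellEval H s ∘L (ellSys ρ).p s t a ∘L ContinuousLinearMap.adjoint (ellEval H t) = ρ a := by
  have h1 := ellEval_comp_adjoint (H := H) s s
  have h2 := ellEval_comp_adjoint (H := H) t t
  rw [if_pos rfl] at h1 h2
  calc _ = (ellEval H s ∘L ContinuousLinearMap.adjoint (ellEval H s)) ∘L ρ a ∘L
        (ellEval H t ∘L ContinuousLinearMap.adjoint (ellEval H t)) := rfl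
    _ = _ := by rw [h1, h2]; rfl

end

/-- The closed ideal `K ⊗ N` of `K ⊗ A` defined by a closed ideal `N` of `A`. -/
def stabIdeal (N : TwoSidedIdeal A) : TwoSidedIdeal (Stab A) :=
  closedIdealSpan (⋃ n : ℕ, Stab.incl n '' {M : Mat n A | ∀ i j, M i j ∈ N})

theorem sys_mem_stabIdeal {N : TwoSidedIdeal A} (s t : ℕ) {a : A} (ha : a ∈ N) :
    (Stab.sys A).p s t a ∈ stabIdeal N := by
  refine subset_closedIdealSpan _ (Set.mem_iUnion.2 ⟨s + t + 1,
    (Mat.sys (s + t + 1) A).p ⟨s, by omega⟩ ⟨t, by omega⟩ a, fun i j => ?_, Stab.incl_sys _ _ _⟩)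
  rw [Mat.sys_apply]
  split_ifs
  exacts [ha, zero_mem N]

theorem map_eq_zero_of_mem_stabIdeal (F : Stab A →⋆ₙₐ[ℂ] B) {N : TwoSidedIdeal A}
    (h : ∀ s t, ∀ a ∈ N, F ((Stab.sys A).p s t a) = 0) {x : Stab A} (hx : x ∈ stabIdeal N) :
    F x = 0 := by
  refine (TwoSidedIdeal.mem_bot _).1 (map_mem_of_mem_closedIdealSpan F isClosed_bot_ideal ?_ hx)
  intro y hy
  obtain ⟨n, M, hM, rfl⟩ := Set.mem_iUnion.1 hy
  rw [TwoSidedIdeal.mem_bot, Stab.incl_eq_sum, map_sum]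
  refine Finset.sum_eq_zero fun i _ => ?_
  rw [map_sum]
  exact Finset.sum_eq_zero fun j _ => h _ _ _ (hM i j)

/-- The homomorphism `a ↦ a ⊗ 1`, where `1` is the unit of the `n × n`-matrices. -/
def MatSys.scalar {n : ℕ} (P : MatSys (Fin n) A B) : A →⋆ₙₐ[ℂ] B where
  toFun a := ∑ i, P.p i i a
  map_smul' c x := by simp [Finset.smul_sum]
  map_zero' := by simp
  map_add' x y := by simp [Finset.sum_add_distrib]
  map_mul' x y := by
    rw [Finset.sum_mul_sum]
    refine Finset.sum_congr rfl fun i _ => Eq.symm ?_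
    exact (Finset.sum_eq_single i (fun j _ hj => P.mul_ne _ _ _ _ _ _ hj.symm) (by simp)).trans
      (P.mul_same _ _ _ _ _)
  map_star' x := by simp [star_sum, P.star_p]

/-- The element `a ⊗ 1ₙ` of `K ⊗ A`. -/
def Stab.scalar (n : ℕ) (a : A) : Stab A :=
  ((Stab.sys A).reindex (fun i : Fin n => (i : ℕ)) Fin.val_injective).scalar a

theorem Stab.scalar_eq (n : ℕ) (a : A) :
    Stab.scalar n a = ∑ i : Fin n, (Stab.sys A).p i i a := rfl

theorem Stab.norm_scalar_le (n : ℕ) (a : A) : ‖Stab.scalar n a‖ ≤ ‖a‖ := norm_hom_le _ a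

theorem Stab.scalar_mul_sys {n : ℕ} {s : ℕ} (t : ℕ) (h : s < n) (a b : A) :
    Stab.scalar n a * (Stab.sys A).p s t b = (Stab.sys A).p s t (a * b) := by
  rw [Stab.scalar_eq, Finset.sum_mul, Finset.sum_eq_single ⟨s, h⟩]
  · exact MatSys.mul_same _ _ _ _ _ _
  · exact fun i _ hi => MatSys.mul_ne _ _ _ _ _ _ _ fun h' => hi (Fin.ext h')
  · simp

theorem Stab.sys_mul_scalar {n : ℕ} (s : ℕ) {t : ℕ} (h : t < n) (a b : A) :
    (Stab.sys A).p s t b * Stab.scalar n a = (Stab.sys A).p s t (b * a) := by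
  rw [Stab.scalar_eq, Finset.mul_sum, Finset.sum_eq_single ⟨t, h⟩]
  · exact MatSys.mul_same _ _ _ _ _ _
  · exact fun i _ hi => MatSys.mul_ne _ _ _ _ _ _ _ fun h' => hi (Fin.ext h'.symm)
  · simp

variable [SeparableSpace A]

theorem mem_of_sys_mem_stabIdeal {N : TwoSidedIdeal A} (hN : IsClosed (N : Set A)) {s t : ℕ}
    {a : A} (h : (Stab.sys A).p s t a ∈ stabIdeal N) : a ∈ N := by
  by_contra ha
  obtain ⟨H, _, _, _, ρ, hρ, hne⟩ := exists_rep_of_notMem hN ha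
  apply hne
  have h1 : (ellSys ρ).toStab ((Stab.sys A).p s t a) = 0 := by
    refine map_eq_zero_of_mem_stabIdeal _ (fun s t a ha => ?_) h
    rw [MatSys.toStab_sys]
    change ContinuousLinearMap.adjoint (ellEval H s) ∘L ρ a ∘L ellEval H t = 0
    rw [hρ a ha]; simp
  rw [MatSys.toStab_sys] at h1
  rw [← ellSys_compress ρ s t a, h1]; simp

theorem Stab.sys_injective (s t : ℕ) : Function.Injective ((Stab.sys A).p s t) := by
  refine (injective_iff_map_eq_zero _).2 fun a ha => ?_
  refine (TwoSidedIdeal.mem_bot _).1 (mem_of_sys_mem_stabIdeal isClosed_bot_ideal (s := s) (t := t) ?_)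
  rw [ha]; exact zero_mem _

theorem Stab.norm_sys (s t : ℕ) (a : A) : ‖(Stab.sys A).p s t a‖ = ‖a‖ := by
  have h : ∀ b, ‖(Stab.sys A).p t t b‖ = ‖b‖ := fun b =>
    NonUnitalStarAlgHom.norm_map ((Stab.sys A).diag t) (Stab.sys_injective t t) b
  have h1 : ‖(Stab.sys A).p s t a‖ * ‖(Stab.sys A).p s t a‖ = ‖a‖ * ‖a‖ := by
    rw [← CStarRing.norm_star_mul_self, MatSys.star_p, MatSys.mul_same, h,
      CStarRing.norm_star_mul_self]
  exact (mul_self_inj (norm_nonneg _) (norm_nonneg _)).1 h1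

theorem Stab.isClosed_range_sys (s t : ℕ) : IsClosed (Set.range ((Stab.sys A).p s t)) :=
  (AddMonoidHomClass.isometry_of_norm _ (Stab.norm_sys s t)).isClosedEmbedding.isClosed_range

theorem Stab.exists_compress (s t : ℕ) (a b : A) (x : Stab A) :
    ∃ y, (Stab.sys A).p s s a * x * (Stab.sys A).p t t b = (Stab.sys A).p s t y := by
  suffices h : (Stab.sys A).p s s a * x * (Stab.sys A).p t t b ∈
      Set.range ((Stab.sys A).p s t) from ⟨h.choose, h.choose_spec.symm⟩
  refine Stab.induction (p := fun x => (Stab.sys A).p s s a * x * (Stab.sys A).p t t b ∈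
      Set.range ((Stab.sys A).p s t)) ?_ (fun u v c => ?_) (fun x y hx hy => ?_) x
  · exact (Stab.isClosed_range_sys s t).preimage (by fun_prop)
  · rw [MatSys.mul_eq, smul_mul_assoc, MatSys.mul_eq, ← map_smul, ← map_smul]
    split_ifs with h1 h2
    · exact ⟨_, rfl⟩
    · exact ⟨0, by simp⟩
    · exact ⟨0, by simp⟩
    · exact ⟨0, by simp⟩
  · obtain ⟨c, hc⟩ := hx
    obtain ⟨d, hd⟩ := hy
    exact ⟨c + d, by rw [map_add, hc, hd, mul_add, add_mul]⟩

theorem Stab.exists_scalar_approx (x : Stab A) {ε : ℝ} (hε : 0 < ε) :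
    ∃ n a, ‖Stab.scalar n a * x * Stab.scalar n a - x‖ < ε := by
  let := CStarAlgebra.spectralOrder A
  have := CStarAlgebra.spectralOrderedRing A
  have hl := CStarAlgebra.increasingApproximateUnit A
  have := hl.neBot
  set l : Filter (ℕ × A) := atTop ×ˢ CStarAlgebra.approximateUnit A with hldef
  have hl1 : ∀ᶠ p in l, ‖p.2‖ ≤ 1 := tendsto_snd.eventually hl.eventually_norm
  let F : ℕ × A → Stab A → Stab A := fun p x => Stab.scalar p.1 p.2 * x * Stab.scalar p.1 p.2
  have hF : ∀ p x, ‖p.2‖ ≤ 1 → ‖F p x‖ ≤ ‖x‖ := fun p x hp => by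
    have h1 := (Stab.norm_scalar_le p.1 p.2).trans hp
    calc _ ≤ ‖Stab.scalar p.1 p.2 * x‖ * ‖Stab.scalar p.1 p.2‖ := norm_mul_le _ _
      _ ≤ ‖Stab.scalar p.1 p.2 * x‖ := mul_le_of_le_one_right (norm_nonneg _) h1
      _ ≤ ‖Stab.scalar p.1 p.2‖ * ‖x‖ := norm_mul_le _ _
      _ ≤ ‖x‖ := mul_le_of_le_one_left (norm_nonneg _) h1
  suffices h : Tendsto (fun p => F p x) l (𝓝 x) by
    obtain ⟨p, hp⟩ := (h.eventually (Metric.ball_mem_nhds x hε)).exists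
    exact ⟨p.1, p.2, by rwa [dist_eq_norm] at hp⟩
  refine Stab.induction (p := fun x => Tendsto (fun p => F p x) l (𝓝 x)) ?_ (fun s t b => ?_)
    (fun x y hx hy => ?_) x
  · refine isClosed_of_closure_subset fun x hx => Metric.tendsto_nhds.2 fun ε hε => ?_
    obtain ⟨y, hy, hxy⟩ := Metric.mem_closure_iff.1 hx (ε / 3) (by positivity)
    have h1 := Metric.tendsto_nhds.1 hy (ε / 3) (by positivity)
    filter_upwards [h1, hl1] with p hp hp1
    have h2 : dist (F p x) (F p y) ≤ dist x y := by
      rw [dist_eq_norm, dist_eq_norm]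
      have : F p x - F p y = F p (x - y) := by simp only [F, mul_sub, sub_mul]
      rw [this]; exact hF _ _ hp1
    have h3 := dist_triangle (F p x) (F p y) x
    have h4 := dist_triangle (F p y) y x
    rw [dist_comm y x] at h4
    linarith
  · have h1 : ∀ᶠ p in l, (Stab.sys A).p s t (p.2 * b * p.2) = F p ((Stab.sys A).p s t b) := by
      have : ∀ᶠ p : ℕ × A in l, max s t < p.1 := tendsto_fst.eventually (eventually_gt_atTop _)
      filter_upwards [this] with p hp
      simp only [F]
      rw [Stab.scalar_mul_sys _ (lt_of_le_of_lt (le_max_left _ _) hp),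
        Stab.sys_mul_scalar _ (lt_of_le_of_lt (le_max_right _ _) hp)]
    refine Tendsto.congr' h1 ?_
    have hc : Continuous ((Stab.sys A).p s t) :=
      (AddMonoidHomClass.isometry_of_norm _ (Stab.norm_sys s t)).continuous
    refine (hc.tendsto b).comp ?_
    have h2 : Tendsto (fun p : ℕ × A => p.2 * b) l (𝓝 b) := (hl.tendsto_mul_right b).comp tendsto_snd
    have h3 : Tendsto (fun p : ℕ × A => b * p.2) l (𝓝 b) := (hl.tendsto_mul_left b).comp tendsto_snd
    refine Metric.tendsto_nhds.2 fun ε hε => ?_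
    filter_upwards [Metric.tendsto_nhds.1 h2 (ε / 2) (by positivity),
      Metric.tendsto_nhds.1 h3 (ε / 2) (by positivity), hl1] with p hp hp' hp1
    rw [dist_eq_norm] at hp hp' ⊢
    have h4 : p.2 * b * p.2 - b = (p.2 * b - b) * p.2 + (b * p.2 - b) := by
      rw [sub_mul]; abel
    rw [h4]
    refine (norm_add_le _ _).trans_lt ?_
    have := (norm_mul_le (p.2 * b - b) p.2).trans (mul_le_of_le_one_right (norm_nonneg _) hp1)
    linarith
  · have : ∀ p, F p (x + y) = F p x + F p y := fun p => by simp only [F, mul_add, add_mul]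
    simp only [this]
    exact hx.add hy

theorem Stab.mem_of_compress_mem {Z : AddSubmonoid (Stab A)} (hZ : IsClosed (Z : Set (Stab A)))
    {x : Stab A} (h : ∀ s t a b y, (Stab.sys A).p s s a * x * (Stab.sys A).p t t b =
      (Stab.sys A).p s t y → (Stab.sys A).p s t y ∈ Z) : x ∈ Z := by
  refine hZ.closure_subset (Metric.mem_closure_iff.2 fun ε hε => ?_)
  obtain ⟨n, a, ha⟩ := Stab.exists_scalar_approx x hε
  refine ⟨_, ?_, by rw [dist_comm, dist_eq_norm]; exact ha⟩
  rw [Stab.scalar_eq, Finset.sum_mul, Finset.sum_mul]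
  refine sum_mem fun i _ => ?_
  rw [Finset.mul_sum]
  refine sum_mem fun j _ => ?_
  obtain ⟨y, hy⟩ := Stab.exists_compress i j a a x
  rw [hy]
  exact h _ _ _ _ y hy

theorem Stab.map_injective [SeparableSpace B] (f : A →⋆ₙₐ[ℂ] B) (hf : Function.Injective f) :
    Function.Injective (Stab.map f) := by
  refine (injective_iff_map_eq_zero _).2 fun x hx => ?_
  have : x ∈ (⊥ : AddSubmonoid (Stab A)) := by
    refine Stab.mem_of_compress_mem (by simp) fun s t a b y hy => ?_
    have h1 := congrArg (Stab.map f) hy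
    rw [map_mul, map_mul, hx, mul_zero, zero_mul, Stab.map_sys] at h1
    have h2 : f y = 0 := Stab.sys_injective s t (by rw [← h1, map_zero])
    rw [hf (h2.trans (map_zero f).symm), map_zero]
    exact zero_mem _
  simpa using this

theorem Stab.mem_range_map {I : Type u} [NonUnitalCStarAlgebra I] [SeparableSpace I]
    [SeparableSpace B] (j : I →⋆ₙₐ[ℂ] A) (p : A →⋆ₙₐ[ℂ] B) (hj : Function.Injective j)
    (hjp : ∀ x, x ∈ Set.range j ↔ p x = 0) (x : Stab A) :
    x ∈ Set.range (Stab.map j) ↔ Stab.map p x = 0 := by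
  constructor
  · rintro ⟨y, rfl⟩
    have : (Stab.map p).comp (Stab.map j) = 0 := Stab.hom_ext fun s t a => by
      simp [Stab.map_sys, (hjp (j a)).1 ⟨a, rfl⟩]
    exact DFunLike.congr_fun this y
  · intro hx
    let Z : AddSubmonoid (Stab A) :=
      { carrier := Set.range (Stab.map j)
        add_mem' := by rintro _ _ ⟨a, rfl⟩ ⟨b, rfl⟩; exact ⟨a + b, map_add _ _ _⟩
        zero_mem' := ⟨0, map_zero _⟩ }
    have hZ : IsClosed (Z : Set (Stab A)) :=
      isClosed_range_hom (Stab.map j) (Stab.map_injective j hj)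
    refine Stab.mem_of_compress_mem hZ fun s t a b y hy => ?_
    have h1 := congrArg (Stab.map p) hy
    rw [map_mul, map_mul, hx, mul_zero, zero_mul, Stab.map_sys] at h1
    have h2 : p y = 0 := Stab.sys_injective s t (by rw [← h1, map_zero])
    obtain ⟨z, rfl⟩ := (hjp y).2 h2
    exact ⟨(Stab.sys I).p s t z, Stab.map_sys _ _ _ _⟩

theorem Stab.mem_stabIdeal_of_map_mem [SeparableSpace B] (j : A →⋆ₙₐ[ℂ] B)
    {N : TwoSidedIdeal B} (hN : IsClosed (N : Set B)) {M : TwoSidedIdeal A}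
    (hNM : ∀ x, j x ∈ N → x ∈ M) {x : Stab A} (hx : Stab.map j x ∈ stabIdeal N) :
    x ∈ stabIdeal M := by
  let Z : AddSubmonoid (Stab A) :=
    { carrier := (stabIdeal M : Set (Stab A))
      add_mem' := fun ha hb => add_mem (S := TwoSidedIdeal (Stab A)) ha hb
      zero_mem' := zero_mem (stabIdeal M) }
  have : x ∈ Z := by
    refine Stab.mem_of_compress_mem ?_ fun s t a b y hy => ?_
    · exact isClosed_closedIdealSpan _
    · refine sys_mem_stabIdeal s t (hNM y (mem_of_sys_mem_stabIdeal hN (s := s) (t := t) ?_))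
      rw [← Stab.map_sys, ← hy, map_mul, map_mul]
      exact (stabIdeal N).mul_mem_right _ _ ((stabIdeal N).mul_mem_left _ _ hx)
  exact this

end


end XKK
end

open CategoryTheory
noncomputable section
namespace XKK
open scoped ENNReal MultiplierAlgebra
open TopologicalSpace

open XCAlg
variable {X : Type v} [TopologicalSpace X]

/-! ### Equivariant systems of matrix units -/

/-- A system of matrix units over `A` in `E` that respects the actions of `X`. -/
structure XSys (S : Type) (A E : XCAlg.{u} X) extends MatSys S A E where
  equivariant : ∀ (U : Opens X) s t, ∀ a ∈ A.act.ideal U, p s t a ∈ E.act.ideal U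

section HomotopicBasics
variable {A B C : XCAlg.{u} X}

theorem XHom.ext_apply {f g : A ⟶ B} (h : ∀ x, f.hom x = g.hom x) : f = g :=
  XHom.ext (DFunLike.ext _ _ h)

@[simp] theorem comp_hom_apply (f : A ⟶ B) (g : B ⟶ C) (x : A) :
    (f ≫ g).hom x = g.hom (f.hom x) := rfl

@[simp] theorem id_hom_apply (x : A) : (𝟙 A : A ⟶ A).hom x = x := rfl

theorem Homotopic.refl (f : A ⟶ B) : Homotopic f f :=
  ⟨fun _ => f, fun _ => continuous_const, rfl, rfl⟩

theorem Homotopic.of_eq {f g : A ⟶ B} (h : f = g) : Homotopic f g := h ▸ Homotopic.refl f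

theorem Homotopic.symm {f g : A ⟶ B} : Homotopic f g → Homotopic g f
  | ⟨H, hc, h0, h1⟩ => ⟨fun t => H (unitInterval.symm t),
      fun x => (hc x).comp unitInterval.continuous_symm, by simpa using h1, by simpa using h0⟩

theorem Homotopic.trans {f g k : A ⟶ B} : Homotopic f g → Homotopic g k → Homotopic f k := by
  rintro ⟨H, hc, h0, h1⟩ ⟨H', hc', h0', h1'⟩
  refine ⟨fun t => if (t : ℝ) ≤ 1 / 2 then H (Set.projIcc 0 1 zero_le_one (2 * (t : ℝ)))
    else H' (Set.projIcc 0 1 zero_le_one (2 * (t : ℝ) - 1)), fun x => ?_, ?_, ?_⟩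
  · have hpt : ∀ t : unitInterval, ((if (t : ℝ) ≤ 1 / 2
        then H (Set.projIcc 0 1 zero_le_one (2 * (t : ℝ)))
        else H' (Set.projIcc 0 1 zero_le_one (2 * (t : ℝ) - 1))).hom x) =
        if (t : ℝ) ≤ 1 / 2 then (H (Set.projIcc 0 1 zero_le_one (2 * (t : ℝ)))).hom x
        else (H' (Set.projIcc 0 1 zero_le_one (2 * (t : ℝ) - 1))).hom x := fun t => by
      split_ifs <;> rfl
    simp only [hpt]
    refine Continuous.if_le ?_ ?_ continuous_subtype_val continuous_const fun t ht => ?_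
    · exact (hc x).comp (continuous_projIcc.comp (by fun_prop))
    · exact (hc' x).comp (continuous_projIcc.comp (by fun_prop))
    · rw [ht]
      have e1 : Set.projIcc (0 : ℝ) 1 zero_le_one (2 * (1 / 2)) = 1 := by
        rw [show (2 * (1 / 2) : ℝ) = 1 by norm_num]; exact Set.projIcc_right _
      have e0 : Set.projIcc (0 : ℝ) 1 zero_le_one (2 * (1 / 2) - 1) = 0 := by
        rw [show (2 * (1 / 2) - 1 : ℝ) = 0 by norm_num]; exact Set.projIcc_left _
      rw [e1, e0, h1, h0']
  · have e0 : Set.projIcc (0 : ℝ) 1 zero_le_one (2 * 0) = 0 := by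
      rw [mul_zero]; exact Set.projIcc_left _
    simp only [Set.Icc.coe_zero]
    rw [if_pos (by norm_num), e0, h0]
  · have e1 : Set.projIcc (0 : ℝ) 1 zero_le_one (2 * 1 - 1) = 1 := by
      rw [show (2 * 1 - 1 : ℝ) = 1 by norm_num]; exact Set.projIcc_right _
    simp only [Set.Icc.coe_one]
    rw [if_neg (by norm_num), e1, h1']

theorem Homotopic.comp_right {f g : A ⟶ B} (h : Homotopic f g) (k : B ⟶ C) :
    Homotopic (f ≫ k) (g ≫ k) := by
  obtain ⟨H, hc, rfl, rfl⟩ := h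
  exact ⟨fun t => H t ≫ k, fun x => (hom_continuous k.hom).comp (hc x), rfl, rfl⟩

theorem Homotopic.comp_left {f g : B ⟶ C} (k : A ⟶ B) (h : Homotopic f g) :
    Homotopic (k ≫ f) (k ≫ g) := by
  obtain ⟨H, hc, rfl, rfl⟩ := h
  exact ⟨fun t => k ≫ H t, fun x => hc (k.hom x), rfl, rfl⟩

theorem Homotopic.matMap {f g : A ⟶ B} (n : ℕ) (h : Homotopic f g) :
    Homotopic (matMap n f) (matMap n g) := by
  obtain ⟨H, hc, rfl, rfl⟩ := h
  exact ⟨fun t => XCAlg.matMap n (H t),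
    fun M => Mat.continuous_iff.2 fun i j => hc ((M : Mat n A) i j), rfl, rfl⟩

theorem Homotopic.stabMap {f g : A ⟶ B} (h : Homotopic f g) :
    Homotopic (stabMap f) (stabMap g) := by
  obtain ⟨H, hc, rfl, rfl⟩ := h
  refine ⟨fun t => XCAlg.stabMap (H t), fun x => Stab.continuous_family
    (F := fun t => Stab.map (H t).hom) (fun s t a => ?_) x, rfl, rfl⟩
  simp only [Stab.map_sys]
  exact (AddMonoidHomClass.isometry_of_norm ((Stab.sys B).p s t)
    (Stab.norm_sys s t)).continuous.comp (hc a)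

theorem Homotopic.oplus {f g f' g' : A ⟶ B} (h : Homotopic f f') (h' : Homotopic g g') :
    Homotopic (oplus f g) (oplus f' g') := by
  obtain ⟨H, hc, rfl, rfl⟩ := h
  obtain ⟨H', hc', rfl, rfl⟩ := h'
  refine ⟨fun t => XCAlg.oplus (H t) (H' t), fun x => Mat.continuous_iff.2 fun i j => ?_, rfl, rfl⟩
  fin_cases i <;> fin_cases j
  exacts [hc x, continuous_const, continuous_const, hc' x]

theorem qIncl_injective {A : Type u} [NonUnitalCStarAlgebra A] [SeparableSpace A] :
    Function.Injective (qIncl (A := A)) := Subtype.val_injective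

theorem Homotopic.qMap {f g : A ⟶ B} (h : Homotopic f g) :
    Homotopic (qMap f) (qMap g) := by
  obtain ⟨H, hc, h0, h1⟩ := h
  refine ⟨fun t => XCAlg.qMap (H t), fun x => ?_, congrArg _ h0, congrArg _ h1⟩
  refine continuous_of_injective_hom (qIncl (A := B)) qIncl_injective ?_
  refine Q.continuous_family (F := fun t => Q.map (H t).hom) (fun a => ?_) (fun a => ?_) (qIncl x)
  · simp only [Q.map, Q.lift_ι]
    exact (hom_continuous ι).comp (hc a)
  · simp only [Q.map, Q.lift_ιbar]
    exact (hom_continuous ιbar).comp (hc a)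

end HomotopicBasics

namespace XSys
variable {S T : Type} {A B E : XCAlg.{u} X}

theorem ext_p {P P' : XSys S A E} (h : ∀ s t a, P.p s t a = P'.p s t a) : P = P' := by
  have : P.toMatSys = P'.toMatSys := MatSys.ext_p h
  cases P; cases P'; cases this; rfl

/-- Restriction to a smaller index set. -/
def reindex (P : XSys S A E) (f : T → S) (hf : Function.Injective f) : XSys T A E where
  toMatSys := P.toMatSys.reindex f hf
  equivariant U _ _ a ha := P.equivariant U _ _ a ha

@[simp] theorem reindex_p (P : XSys S A E) (f : T → S) (hf : Function.Injective f) (s t : T) (a : A) :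
    (P.reindex f hf).p s t a = P.p (f s) (f t) a := rfl

/-- The morphism from matrices defined by a finite system. -/
def toMatHom {n : ℕ} (P : XSys (Fin n) A E) : matObj n A ⟶ E where
  hom := P.toMatSys.toMat
  equivariant U M hM := by
    change ∑ i, ∑ j, P.p i j ((M : Mat n A) i j) ∈ _
    exact sum_mem fun i _ => sum_mem fun j _ => P.equivariant U i j _ (mem_matIdeal.1 hM i j)

/-- The morphism from `K ⊗ A` defined by a system indexed by `ℕ`. -/
def toStabHom (P : XSys ℕ A E) : A.stabObj ⟶ E where
  hom := P.toMatSys.toStab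
  equivariant U x hx := by
    refine map_mem_of_mem_closedIdealSpan P.toMatSys.toStab (E.act.isClosed_ideal U) ?_ hx
    intro y hy
    obtain ⟨n, M, hM, rfl⟩ := Set.mem_iUnion.1 hy
    rw [Stab.incl_eq_sum, map_sum]
    refine sum_mem fun i _ => ?_
    rw [map_sum]
    refine sum_mem fun j _ => ?_
    rw [MatSys.toStab_sys]
    exact P.equivariant U _ _ _ (hM i j)

/-- The elementary matrices in `Mₙ(A)`. -/
def mat (n : ℕ) (A : XCAlg.{u} X) : XSys (Fin n) A (matObj n A) where
  toMatSys := Mat.sys n A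
  equivariant U i j a ha := mem_matIdeal.2 fun k l => by
    refine (congrArg (· ∈ A.act.ideal U) (Mat.sys_apply i j k l a)).mpr ?_
    split_ifs
    exacts [ha, zero_mem (A.act.ideal U)]

/-- The elementary matrices in `K ⊗ A`. -/
def stab (A : XCAlg.{u} X) : XSys ℕ A A.stabObj where
  toMatSys := Stab.sys A
  equivariant _ s t _ ha := sys_mem_stabIdeal s t ha

@[simp] theorem toMatHom_mat {n : ℕ} (P : XSys (Fin n) A E) (i j : Fin n) (a : A) :
    P.toMatHom.hom ((mat n A).p i j a) = P.p i j a := MatSys.toMat_sys P.toMatSys i j a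

@[simp] theorem toStabHom_stab (P : XSys ℕ A E) (i j : ℕ) (a : A) :
    P.toStabHom.hom ((stab A).p i j a) = P.p i j a := MatSys.toStab_sys P.toMatSys i j a

@[simp] theorem matMap_mat {n : ℕ} (f : A ⟶ B) (i j : Fin n) (a : A) :
    (matMap n f).hom ((mat n A).p i j a) = (mat n B).p i j (f.hom a) := Mat.map_sys f.hom i j a

@[simp] theorem stabMap_stab (f : A ⟶ B) (i j : ℕ) (a : A) :
    (stabMap f).hom ((stab A).p i j a) = (stab B).p i j (f.hom a) := Stab.map_sys f.hom i j a

@[simp] theorem corner_eq (a : A) : (corner A).hom a = (stab A).p 0 0 a := Stab.corner_apply a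

theorem oplus_eq (f g : A ⟶ B) (a : A) :
    (oplus f g).hom a = (mat 2 B).p 0 0 (f.hom a) + (mat 2 B).p 1 1 (g.hom a) := by
  change (Mat.oplus f.hom g.hom a : Mat 2 B) =
    (Mat.sys 2 B).p 0 0 (f.hom a) + (Mat.sys 2 B).p 1 1 (g.hom a)
  ext i j
  rw [CStarMatrix.add_apply, Mat.sys_apply, Mat.sys_apply]
  fin_cases i <;> fin_cases j <;> simp [Mat.oplus, Mat.diag₂]

@[simp] theorem corner₂_eq (a : A) : (corner₂ A).hom a = (mat 2 A).p 0 0 a := by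
  have := oplus_eq (𝟙 A) (zeroHom A A) a
  rw [corner₂, this]
  change _ + (mat 2 A).p 1 1 0 = _
  rw [map_zero, add_zero]; rfl

theorem mat_hom_ext {n : ℕ} {f g : matObj n A ⟶ E}
    (h : ∀ i j a, f.hom ((mat n A).p i j a) = g.hom ((mat n A).p i j a)) : f = g :=
  XHom.ext (Mat.hom_ext h)

theorem stab_hom_ext {f g : A.stabObj ⟶ E}
    (h : ∀ i j a, f.hom ((stab A).p i j a) = g.hom ((stab A).p i j a)) : f = g :=
  XHom.ext (Stab.hom_ext h)

/-- The system of the elements `(a ⊗ e_{st}) ⊗ e_{ij}`. -/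
def comp (P : XSys T B E) (P' : XSys S A B) : XSys (T × S) A E where
  p x y := P.p x.1 y.1 ∘ₗ P'.p x.2 y.2
  mul_same x y z a b := by
    change P.p _ _ (P'.p _ _ a) * P.p _ _ (P'.p _ _ b) = P.p _ _ (P'.p _ _ (a * b))
    rw [P.mul_same, P'.mul_same]
  mul_ne x y y' z a b h := by
    change P.p _ _ (P'.p _ _ a) * P.p _ _ (P'.p _ _ b) = 0
    by_cases h1 : y.1 = y'.1
    · rw [h1, P.mul_same, P'.mul_ne _ _ _ _ _ _ fun h2 => h (Prod.ext h1 h2), map_zero]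
    · rw [P.mul_ne _ _ _ _ _ _ h1]
  star_p x y a := by
    change star (P.p _ _ (P'.p _ _ a)) = P.p _ _ (P'.p _ _ (star a))
    rw [P.star_p, P'.star_p]
  equivariant U x y a ha := P.equivariant U _ _ _ (P'.equivariant U _ _ _ ha)

@[simp] theorem comp_p (P : XSys T B E) (P' : XSys S A B) (x y : T × S) (a : A) :
    (P.comp P').p x y a = P.p x.1 y.1 (P'.p x.2 y.2 a) := rfl

/-- A homotopy of systems. -/
def Htpy (P P' : XSys S A E) : Prop :=
  ∃ F : unitInterval → XSys S A E, (∀ s t a, Continuous fun τ => (F τ).p s t a) ∧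
    F 0 = P ∧ F 1 = P'

theorem Htpy.toMatHom {n : ℕ} {P P' : XSys (Fin n) A E} (h : Htpy P P') :
    Homotopic P.toMatHom P'.toMatHom := by
  obtain ⟨F, hF, rfl, rfl⟩ := h
  refine ⟨fun t => (F t).toMatHom, fun M => ?_, rfl, rfl⟩
  change Continuous fun t => ∑ i, ∑ j, (F t).p i j ((M : Mat n A) i j)
  exact continuous_finsetSum _ fun i _ => continuous_finsetSum _ fun j _ => hF i j _

theorem Htpy.toStabHom {P P' : XSys ℕ A E} (h : Htpy P P') :
    Homotopic P.toStabHom P'.toStabHom := by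
  obtain ⟨F, hF, rfl, rfl⟩ := h
  refine ⟨fun t => (F t).toStabHom, fun x => ?_, rfl, rfl⟩
  refine Stab.continuous_family (F := fun t => (F t).toMatSys.toStab) (fun s t a => ?_) x
  simp only [MatSys.toStab_sys]
  exact hF s t a

/-- Conjugation of a system by the isometry `i ↦ x₀ i • f₀ i + x₁ i • f₁ i`. -/
def rot [DecidableEq S] [DecidableEq T] (P : XSys S A E) (f₀ f₁ : T → S) (x₀ x₁ : T → ℂ)
    (hx : ∀ i j, star (x₀ i) * x₀ j * (if f₀ i = f₀ j then (1 : ℂ) else 0) +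
      star (x₀ i) * x₁ j * (if f₀ i = f₁ j then (1 : ℂ) else 0) +
      (star (x₁ i) * x₀ j * (if f₁ i = f₀ j then (1 : ℂ) else 0) +
      star (x₁ i) * x₁ j * (if f₁ i = f₁ j then (1 : ℂ) else 0)) = if i = j then 1 else 0) :
    XSys T A E where
  toMatSys := P.toMatSys.conj (fun i => ![f₀ i, f₁ i]) (fun i => ![x₀ i, x₁ i]) fun i j => by
    rw [Fin.sum_univ_two, Fin.sum_univ_two, Fin.sum_univ_two]
    exact hx i j
  equivariant U s t a ha := by
    rw [MatSys.conj_p]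
    exact sum_mem fun k _ => sum_mem fun l _ =>
      smul_mem_closedIdeal (E.act.isClosed_ideal U) _ (P.equivariant U _ _ a ha)

theorem rot_p [DecidableEq S] [DecidableEq T] (P : XSys S A E) (f₀ f₁ : T → S) (x₀ x₁ : T → ℂ)
    (hx) (i j : T) (a : A) : (P.rot f₀ f₁ x₀ x₁ hx).p i j a =
      (x₀ i * star (x₀ j)) • P.p (f₀ i) (f₀ j) a + (x₀ i * star (x₁ j)) • P.p (f₀ i) (f₁ j) a +
      ((x₁ i * star (x₀ j)) • P.p (f₁ i) (f₀ j) a + (x₁ i * star (x₁ j)) • P.p (f₁ i) (f₁ j) a) := by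
  refine (MatSys.conj_p P.toMatSys (fun i => ![f₀ i, f₁ i]) (fun i => ![x₀ i, x₁ i])
    (fun i j => ?_) i j a).trans ?_
  · rw [Fin.sum_univ_two, Fin.sum_univ_two, Fin.sum_univ_two]
    exact hx i j
  · simp [Fin.sum_univ_two]

theorem htpy_of_rot [DecidableEq S] [DecidableEq T] (P : XSys S A E) (f₀ f₁ : T → S)
    (x₀ x₁ : unitInterval → T → ℂ)
    (hx : ∀ τ i j, star (x₀ τ i) * x₀ τ j * (if f₀ i = f₀ j then (1 : ℂ) else 0) +
      star (x₀ τ i) * x₁ τ j * (if f₀ i = f₁ j then (1 : ℂ) else 0) +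
      (star (x₁ τ i) * x₀ τ j * (if f₁ i = f₀ j then (1 : ℂ) else 0) +
      star (x₁ τ i) * x₁ τ j * (if f₁ i = f₁ j then (1 : ℂ) else 0)) = if i = j then 1 else 0)
    (h₀ : ∀ i, Continuous fun τ => x₀ τ i) (h₁ : ∀ i, Continuous fun τ => x₁ τ i) :
    Htpy (P.rot f₀ f₁ (x₀ 0) (x₁ 0) (hx 0)) (P.rot f₀ f₁ (x₀ 1) (x₁ 1) (hx 1)) := by
  refine ⟨fun τ => P.rot f₀ f₁ (x₀ τ) (x₁ τ) (hx τ), fun s t a => ?_, rfl, rfl⟩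
  simp only [rot_p]
  have := h₀ s; have := h₀ t; have := h₁ s; have := h₁ t
  fun_prop

theorem htpy_corner {R : Type} [DecidableEq R] [DecidableEq S] [DecidableEq T]
    (P : XSys (S × T) A E) (u : R → S) (v : R → T) (hu : Function.Injective u)
    (hv : Function.Injective v) (o : R) :
    Htpy (P.reindex (fun i => (u i, v o)) fun i j h => hu (Prod.ext_iff.1 h).1)
      (P.reindex (fun i => (u o, v i)) fun i j h => hv (Prod.ext_iff.1 h).2) := by
  have h := htpy_of_rot P (fun i => (u i, v o)) (fun i => (u o, v i))
    (fun τ i => if i = o then 1 else (Real.cos (Real.pi / 2 * (τ : ℝ)) : ℂ))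
    (fun τ i => if i = o then 0 else (Real.sin (Real.pi / 2 * (τ : ℝ)) : ℂ)) (fun τ i j => by
      have hcs : (Real.cos (Real.pi / 2 * (τ : ℝ)) : ℂ) * Real.cos (Real.pi / 2 * (τ : ℝ)) +
          Real.sin (Real.pi / 2 * (τ : ℝ)) * Real.sin (Real.pi / 2 * (τ : ℝ)) = 1 := by
        rw [← Complex.ofReal_mul, ← Complex.ofReal_mul, ← Complex.ofReal_add]
        norm_cast
        have := Real.cos_sq_add_sin_sq (Real.pi / 2 * (τ : ℝ))
        nlinarith
      generalize (Real.cos (Real.pi / 2 * (τ : ℝ))) = c at hcs ⊢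
      generalize (Real.sin (Real.pi / 2 * (τ : ℝ))) = s at hcs ⊢
      simp only [Prod.mk.injEq, hu.eq_iff, hv.eq_iff, and_true, true_and]
      by_cases h1 : i = o <;> by_cases h2 : j = o <;> by_cases h3 : i = j <;>
        simp_all [Complex.conj_ofReal, eq_comm])
    (fun i => by split_ifs <;> fun_prop) (fun i => by split_ifs <;> fun_prop)
  convert h using 1
  · refine ext_p fun s t a => ?_
    rw [rot_p]; simp; try rfl
  · refine ext_p fun s t a => ?_
    rw [rot_p]
    by_cases h1 : s = o <;> by_cases h2 : t = o <;> simp [h1, h2] <;> rfl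

theorem htpy_involution [DecidableEq S] (P : XSys S A E) (σ : S → S) (hσ : ∀ i, σ (σ i) = i) :
    Htpy P (P.reindex σ (Function.LeftInverse.injective hσ)) := by
  have hσi := Function.LeftInverse.injective hσ
  have h := htpy_of_rot P (fun i => i) σ
    (fun τ _ => (Real.cos (Real.pi / 2 * (τ : ℝ)) : ℂ))
    (fun τ _ => Complex.I * (Real.sin (Real.pi / 2 * (τ : ℝ)) : ℂ)) (fun τ i j => by
      have hcs : (Real.cos (Real.pi / 2 * (τ : ℝ)) : ℂ) * Real.cos (Real.pi / 2 * (τ : ℝ)) +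
          Real.sin (Real.pi / 2 * (τ : ℝ)) * Real.sin (Real.pi / 2 * (τ : ℝ)) = 1 := by
        rw [← Complex.ofReal_mul, ← Complex.ofReal_mul, ← Complex.ofReal_add]
        norm_cast
        have := Real.cos_sq_add_sin_sq (Real.pi / 2 * (τ : ℝ))
        nlinarith
      generalize (Real.cos (Real.pi / 2 * (τ : ℝ))) = c at hcs ⊢
      generalize (Real.sin (Real.pi / 2 * (τ : ℝ))) = s at hcs ⊢
      have h1 : (σ i = j) = (i = σ j) := propext ⟨fun h => by rw [← h, hσ], fun h => by rw [h, hσ]⟩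
      simp only [h1, hσi.eq_iff, star_mul', RCLike.star_def, Complex.conj_ofReal, Complex.conj_I]
      split_ifs
      · linear_combination hcs - (s : ℂ) ^ 2 * Complex.I_sq
      · linear_combination hcs - (s : ℂ) ^ 2 * Complex.I_sq
      · ring
      · ring)
    (fun i => by fun_prop) (fun i => by fun_prop)
  convert h using 1
  · refine ext_p fun s t a => ?_
    rw [rot_p]; simp; try rfl
  · refine ext_p fun s t a => ?_
    rw [rot_p]; simp; try rfl

/-- The angle at the time `t` of the `k`-th rotation of a sequence of successive rotations. -/
def angle (t : ℝ) (k : ℕ) : ℝ := Real.pi / 2 * max 0 (min 1 ((t - k / (k + 1)) * ((k + 1) * (k + 2))))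

theorem angle_zero (k : ℕ) : angle 0 k = 0 := by
  have : (0 - (k : ℝ) / (k + 1)) * ((k + 1) * (k + 2)) ≤ 0 :=
    mul_nonpos_of_nonpos_of_nonneg (by simp; positivity) (by positivity)
  rw [angle, max_eq_left ((min_le_right _ _).trans this), mul_zero]

theorem angle_one (k : ℕ) : angle 1 k = Real.pi / 2 := by
  have : (1 - (k : ℝ) / (k + 1)) * ((k + 1) * (k + 2)) = k + 2 := by
    have : (k : ℝ) + 1 ≠ 0 := by positivity
    field_simp; ring
  have hk : (0 : ℝ) ≤ k := Nat.cast_nonneg k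
  rw [angle, this, min_eq_left (by linarith), max_eq_right zero_le_one, mul_one]

theorem continuous_angle (k : ℕ) : Continuous fun t => angle t k := by
  unfold angle; fun_prop

theorem angle_lt (t : ℝ) {i j : ℕ} (h : i < j) : angle t i = Real.pi / 2 ∨ angle t j = 0 := by
  have hi : (0 : ℝ) < i + 1 := by positivity
  have hj : (0 : ℝ) < j + 1 := by positivity
  rcases le_total t (j / (j + 1)) with ht | ht
  · right
    have : (t - (j : ℝ) / (j + 1)) * ((j + 1) * (j + 2)) ≤ 0 :=
      mul_nonpos_of_nonpos_of_nonneg (by linarith) (by positivity)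
    rw [angle, max_eq_left ((min_le_right _ _).trans this), mul_zero]
  · left
    have h1 : ((i : ℝ) + 1) / (i + 2) ≤ t := by
      refine le_trans ?_ ht
      rw [div_le_div_iff₀ (by positivity) hj]
      have : (i : ℝ) + 1 ≤ j := by exact_mod_cast h
      nlinarith
    have h2 : (1 : ℝ) ≤ (t - (i : ℝ) / (i + 1)) * ((i + 1) * (i + 2)) := by
      have : ((i : ℝ) + 1) / (i + 2) - i / (i + 1) = 1 / ((i + 1) * (i + 2)) := by
        field_simp; ring
      have h3 : 1 / (((i : ℝ) + 1) * (i + 2)) ≤ t - i / (i + 1) := by linarith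
      rwa [div_le_iff₀ (by positivity)] at h3
    rw [angle, min_eq_left h2, max_eq_right zero_le_one, mul_one]

theorem htpy_shift (P : XSys ℕ A E) (s : ℕ → ℕ) (hs : Function.Injective s) (h : ∀ k, k < s k) :
    Htpy (P.reindex s hs) P := by
  have h := htpy_of_rot P s (fun k => k)
    (fun τ k => (Real.cos (angle (τ : ℝ) k) : ℂ))
    (fun τ k => (Real.sin (angle (τ : ℝ) k) : ℂ)) (fun τ i j => by
      have hcs : ∀ k, (Real.cos (angle (τ : ℝ) k) : ℂ) * Real.cos (angle (τ : ℝ) k) +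
          Real.sin (angle (τ : ℝ) k) * Real.sin (angle (τ : ℝ) k) = 1 := fun k => by
        rw [← Complex.ofReal_mul, ← Complex.ofReal_mul, ← Complex.ofReal_add]
        norm_cast
        have := Real.cos_sq_add_sin_sq (angle (τ : ℝ) k)
        nlinarith
      have hz : ∀ i, Real.cos (angle (τ : ℝ) i) = 0 ∨ Real.sin (angle (τ : ℝ) (s i)) = 0 := by
        intro i
        rcases angle_lt (τ : ℝ) (h i) with h | h <;> rw [h] <;> simp
      have c1 : (Real.cos (angle (τ : ℝ) i) : ℂ) * Real.sin (angle (τ : ℝ) j) *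
          (if s i = j then (1 : ℂ) else 0) = 0 := by
        split_ifs with hij
        · subst hij; rcases hz i with h | h <;> simp [h]
        · simp
      have c2 : (Real.sin (angle (τ : ℝ) i) : ℂ) * Real.cos (angle (τ : ℝ) j) *
          (if i = s j then (1 : ℂ) else 0) = 0 := by
        split_ifs with hij
        · subst hij; rcases hz j with h | h <;> simp [h]
        · simp
      simp only [RCLike.star_def, Complex.conj_ofReal, c1, c2, hs.eq_iff, zero_add, add_zero]
      split_ifs with hij
      · subst hij; rw [mul_one, mul_one]; exact hcs i
      · simp)
    (fun i => Complex.continuous_ofReal.comp (Real.continuous_cos.comp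
      ((continuous_angle i).comp continuous_subtype_val)))
    (fun i => Complex.continuous_ofReal.comp (Real.continuous_sin.comp
      ((continuous_angle i).comp continuous_subtype_val)))
  convert h using 1
  · refine ext_p fun s t a => ?_
    rw [rot_p]; simp [angle_zero]
  · refine ext_p fun s t a => ?_
    rw [rot_p]; simp [angle_one]

end XSys

end XKK
end

open CategoryTheory
noncomputable section
namespace XKK
open scoped ENNReal MultiplierAlgebra
open TopologicalSpace

open XCAlg
variable {X : Type v} [TopologicalSpace X]

namespace XSys
variable {S T : Type} {A B E : XCAlg.{u} X}

/-- Half of the `2 × 2`-matrices with entries in the rows `g 0`, `g 1` of a system. -/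
def pairSys (P : XSys (T × S) A E) (g : Fin 2 → T) : XSys S A (matObj 2 E) where
  p s t :=
    { toFun := fun a => (CStarMatrix.ofMatrix fun k l => (2⁻¹ : ℂ) • P.p (g k, s) (g l, t) a :
        Mat 2 E)
      map_add' := fun a b => by
        refine CStarMatrix.ext fun k l => ?_
        exact (congrArg _ (map_add (P.p _ _) a b)).trans (smul_add _ _ _)
      map_smul' := fun c a => by
        refine CStarMatrix.ext fun k l => ?_
        exact (congrArg _ (map_smul (P.p _ _) c a)).trans (smul_comm _ _ _) }
  mul_same s t v a b := by
    refine CStarMatrix.ext fun k l => ?_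
    refine (CStarMatrix.mul_apply ..).trans ?_
    change ∑ m, ((2⁻¹ : ℂ) • P.p (g k, s) (g m, t) a) * ((2⁻¹ : ℂ) • P.p (g m, t) (g l, v) b) =
      (2⁻¹ : ℂ) • P.p (g k, s) (g l, v) (a * b)
    simp only [smul_mul_smul_comm, P.mul_same, Fin.sum_univ_two, ← add_smul]
    norm_num
  mul_ne s t t' v a b h := by
    refine CStarMatrix.ext fun k l => ?_
    refine (CStarMatrix.mul_apply ..).trans ?_
    change ∑ m, ((2⁻¹ : ℂ) • P.p (g k, s) (g m, t) a) * ((2⁻¹ : ℂ) • P.p (g m, t') (g l, v) b) = 0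
    have : ∀ m, P.p (g k, s) (g m, t) a * P.p (g m, t') (g l, v) b = 0 := fun m =>
      P.mul_ne _ _ _ _ _ _ fun h' => h (Prod.ext_iff.1 h').2
    simp only [smul_mul_smul_comm, this, smul_zero, Finset.sum_const_zero]
  star_p s t a := by
    refine CStarMatrix.ext fun k l => ?_
    change star ((2⁻¹ : ℂ) • P.p (g l, s) (g k, t) a) = (2⁻¹ : ℂ) • P.p (g k, t) (g l, s) (star a)
    rw [star_smul, P.star_p]; simp
  equivariant U s t a ha := mem_matIdeal.2 fun k l =>
    smul_mem_closedIdeal (E.act.isClosed_ideal U) _ (P.equivariant U _ _ a ha)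

/-- The linear maps on `K ⊗ A` given by a system with two indices. -/
def curryStabLin (P : XSys (T × ℕ) A E) (i j : T) : A.stabObj →ₗ[ℂ] E where
  toFun x := (2 : ℂ) • ((P.pairSys ![i, j]).toStabHom.hom x : Mat 2 E) 0 1
  map_add' x y := by
    rw [map_add, ← smul_add]; rfl
  map_smul' c x := by
    rw [map_smul, RingHom.id_apply, smul_comm c]; rfl

@[simp] theorem curryStabLin_stab (P : XSys (T × ℕ) A E) (i j : T) (k l : ℕ) (a : A) :
    P.curryStabLin i j ((stab A).p k l a) = P.p (i, k) (j, l) a := by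
  change (2 : ℂ) • ((P.pairSys ![i, j]).toStabHom.hom ((stab A).p k l a) : Mat 2 E) 0 1 = _
  rw [toStabHom_stab]
  change (2 : ℂ) • (2⁻¹ : ℂ) • P.p (i, k) (j, l) a = _
  simp

theorem continuous_curryStabLin (P : XSys (T × ℕ) A E) (i j : T) :
    Continuous (P.curryStabLin i j) :=
  ((Mat.continuous_entry (A := E) 0 1).comp
    (hom_continuous (P.pairSys ![i, j]).toStabHom.hom)).const_smul (2 : ℂ)

theorem stab_induction {p : A.stabObj → Prop} (hc : IsClosed {z | p z})
    (hp : ∀ s t a, p ((stab A).p s t a)) (ha : ∀ x y, p x → p y → p (x + y))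
    (z : A.stabObj) : p z := Stab.induction hc hp ha z

/-- A system over `A` with two indices as a system over `K ⊗ A`. -/
def curryStab (P : XSys (T × ℕ) A E) : XSys T A.stabObj E where
  p := P.curryStabLin
  mul_same i j k x y := by
    have h1 := P.continuous_curryStabLin i j
    have h2 := P.continuous_curryStabLin j k
    have h3 := P.continuous_curryStabLin i k
    refine stab_induction (p := fun x => P.curryStabLin i j x * P.curryStabLin j k y =
      P.curryStabLin i k (x * y)) (isClosed_eq (by fun_prop) (by fun_prop)) (fun s t a => ?_)
      (fun x x' hx hx' => by rw [map_add, add_mul, add_mul, map_add, hx, hx']) x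
    refine stab_induction (p := fun y => P.curryStabLin i j ((stab A).p s t a) *
      P.curryStabLin j k y = P.curryStabLin i k ((stab A).p s t a * y))
      (isClosed_eq (by fun_prop) (by fun_prop)) (fun s' t' b => ?_)
      (fun x x' hx hx' => by rw [map_add, mul_add, mul_add, map_add, hx, hx']) y
    rw [curryStabLin_stab, curryStabLin_stab]
    by_cases h : t = s'
    · subst h
      rw [P.mul_same, (stab A).mul_same, curryStabLin_stab]
    · rw [P.mul_ne _ _ _ _ _ _ fun h' => h (Prod.ext_iff.1 h').2, (stab A).mul_ne _ _ _ _ _ _ h,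
        map_zero]
  mul_ne i j j' k x y hij := by
    have h1 := P.continuous_curryStabLin i j
    have h2 := P.continuous_curryStabLin j' k
    refine stab_induction (p := fun x => P.curryStabLin i j x * P.curryStabLin j' k y = 0)
      (isClosed_eq (by fun_prop) (by fun_prop)) (fun s t a => ?_)
      (fun x x' hx hx' => by rw [map_add, add_mul, hx, hx', add_zero]) x
    refine stab_induction (p := fun y => P.curryStabLin i j ((stab A).p s t a) *
      P.curryStabLin j' k y = 0) (isClosed_eq (by fun_prop) (by fun_prop)) (fun s' t' b => ?_)
      (fun x x' hx hx' => by rw [map_add, mul_add, hx, hx', add_zero]) y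
    rw [curryStabLin_stab, curryStabLin_stab,
      P.mul_ne _ _ _ _ _ _ fun h' => hij (Prod.ext_iff.1 h').1]
  star_p i j x := by
    have h1 := P.continuous_curryStabLin i j
    have h2 := P.continuous_curryStabLin j i
    refine stab_induction (p := fun x => star (P.curryStabLin i j x) =
      P.curryStabLin j i (star x)) (isClosed_eq (by fun_prop) (by fun_prop)) (fun s t a => ?_)
      (fun x x' hx hx' => by rw [map_add, star_add, star_add, map_add, hx, hx']) x
    rw [curryStabLin_stab, P.star_p, (stab A).star_p, curryStabLin_stab]
  equivariant U i j x hx := smul_mem_closedIdeal (E.act.isClosed_ideal U) _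
    (mem_matIdeal.1 ((P.pairSys ![i, j]).toStabHom.equivariant U x hx) 0 1)

@[simp] theorem curryStab_stab (P : XSys (T × ℕ) A E) (i j : T) (k l : ℕ) (a : A) :
    P.curryStab.p i j ((stab A).p k l a) = P.p (i, k) (j, l) a := P.curryStabLin_stab i j k l a

/-- A system over `A` with two indices as a system over matrices. -/
def curryMat {n : ℕ} (P : XSys (T × Fin n) A E) : XSys T (matObj n A) E where
  p i j :=
    { toFun := fun M => ∑ k, ∑ l, P.p (i, k) (j, l) ((M : Mat n A) k l)
      map_add' := fun M N => by
        simp only [← Finset.sum_add_distrib, ← map_add]; rfl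
      map_smul' := fun c M => by
        simp only [RingHom.id_apply, Finset.smul_sum, ← map_smul]; rfl }
  mul_same i j k M N := by
    change (∑ k', ∑ l, P.p (i, k') (j, l) ((M : Mat n A) k' l)) *
      (∑ k', ∑ l, P.p (j, k') (k, l) ((N : Mat n A) k' l)) =
      ∑ k', ∑ l, P.p (i, k') (k, l) (((M : Mat n A) * (N : Mat n A)) k' l)
    have h1 : ∀ k' l, ((M : Mat n A) * (N : Mat n A)) k' l =
        ∑ m, (M : Mat n A) k' m * (N : Mat n A) m l := fun _ _ => CStarMatrix.mul_apply
    simp only [h1, map_sum]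
    generalize (M : Mat n A) = x
    generalize (N : Mat n A) = y
    rw [Finset.sum_mul]
    refine Finset.sum_congr rfl fun k' _ => ?_
    rw [Finset.sum_mul]
    refine Eq.trans ?_ Finset.sum_comm
    refine Finset.sum_congr rfl fun l _ => ?_
    rw [Finset.mul_sum, Finset.sum_eq_single l]
    · rw [Finset.mul_sum]
      exact Finset.sum_congr rfl fun l' _ => P.mul_same _ _ _ _ _
    · intro m _ hm
      rw [Finset.mul_sum]
      exact Finset.sum_eq_zero fun l' _ => P.mul_ne _ _ _ _ _ _ fun h' =>
        hm (Prod.ext_iff.1 h').2.symm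
    · simp
  mul_ne i j j' k M N h := by
    change (∑ k', ∑ l, P.p (i, k') (j, l) ((M : Mat n A) k' l)) *
      (∑ k', ∑ l, P.p (j', k') (k, l) ((N : Mat n A) k' l)) = 0
    simp only [Finset.sum_mul_sum]
    refine Finset.sum_eq_zero fun _ _ => Finset.sum_eq_zero fun _ _ => Finset.sum_eq_zero fun _ _ =>
      Finset.sum_eq_zero fun _ _ => P.mul_ne _ _ _ _ _ _ fun h' => h (Prod.ext_iff.1 h').1
  star_p i j M := by
    change star (∑ k', ∑ l, P.p (i, k') (j, l) ((M : Mat n A) k' l)) =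
      ∑ k', ∑ l, P.p (j, k') (i, l) (star ((M : Mat n A) l k'))
    simp only [star_sum, P.star_p]
    rw [Finset.sum_comm]
  equivariant U i j M hM := by
    change ∑ k, ∑ l, P.p (i, k) (j, l) ((M : Mat n A) k l) ∈ _
    exact sum_mem fun k _ => sum_mem fun l _ => P.equivariant U _ _ _ (mem_matIdeal.1 hM k l)

theorem curryMat_p {n : ℕ} (P : XSys (T × Fin n) A E) (i j : T) (M : Mat n A) :
    P.curryMat.p i j M = ∑ k, ∑ l, P.p (i, k) (j, l) (M k l) := rfl

@[simp] theorem curryMat_mat {n : ℕ} (P : XSys (T × Fin n) A E) (i j : T) (k l : Fin n) (a : A) :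
    P.curryMat.p i j ((mat n A).p k l a) = P.p (i, k) (j, l) a := by
  change ∑ k', ∑ l', P.p (i, k') (j, l') ((Mat.sys n A).p k l a k' l') = _
  simp only [Mat.sys_apply]
  rw [Finset.sum_eq_single k, Finset.sum_eq_single l]
  · simp
  · intro l' _ hl; simp [hl.symm]
  · simp
  · intro k' _ hk; simp [hk.symm]
  · simp

theorem Htpy.curryMat {n : ℕ} {P P' : XSys (T × Fin n) A E} (h : Htpy P P') :
    Htpy P.curryMat P'.curryMat := by
  obtain ⟨F, hF, rfl, rfl⟩ := h
  refine ⟨fun t => (F t).curryMat, fun i j M => ?_, rfl, rfl⟩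
  change Continuous fun t => ∑ k, ∑ l, (F t).p (i, k) (j, l) ((M : Mat n A) k l)
  exact continuous_finsetSum _ fun k _ => continuous_finsetSum _ fun l _ => hF _ _ _

/-- Matrices over a system. -/
def matSys (n : ℕ) (P : XSys S A E) : XSys S (matObj n A) (matObj n E) where
  p s t :=
    { toFun := fun M => (CStarMatrix.ofMatrix fun k l => P.p s t ((M : Mat n A) k l) : Mat n E)
      map_add' := fun M N => by
        refine CStarMatrix.ext fun k l => ?_
        exact map_add (P.p s t) _ _
      map_smul' := fun c M => by
        refine CStarMatrix.ext fun k l => ?_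
        exact map_smul (P.p s t) _ _ }
  mul_same s t v M N := by
    refine CStarMatrix.ext fun k l => ?_
    refine (CStarMatrix.mul_apply ..).trans ?_
    change ∑ m, P.p s t ((M : Mat n A) k m) * P.p t v ((N : Mat n A) m l) =
      P.p s v (((M : Mat n A) * (N : Mat n A)) k l)
    have h1 : ((M : Mat n A) * (N : Mat n A)) k l =
        ∑ m, (M : Mat n A) k m * (N : Mat n A) m l := CStarMatrix.mul_apply
    simp only [h1, P.mul_same, map_sum]
  mul_ne s t t' v M N h := by
    refine CStarMatrix.ext fun k l => ?_
    refine (CStarMatrix.mul_apply ..).trans ?_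
    exact Finset.sum_eq_zero fun _ _ => P.mul_ne _ _ _ _ _ _ h
  star_p s t M := by
    refine CStarMatrix.ext fun k l => ?_
    exact P.star_p s t _
  equivariant U s t M hM := mem_matIdeal.2 fun k l => P.equivariant U _ _ _ (mem_matIdeal.1 hM k l)

@[simp] theorem matSys_mat {n : ℕ} (P : XSys S A E) (s t : S) (i j : Fin n) (a : A) :
    (P.matSys n).p s t ((mat n A).p i j a) = (mat n E).p i j (P.p s t a) := by
  refine CStarMatrix.ext fun k l => ?_
  change P.p s t ((Mat.sys n A).p i j a k l) = (Mat.sys n E).p i j (P.p s t a) k l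
  rw [Mat.sys_apply, Mat.sys_apply]
  split_ifs <;> simp

end XSys

/-! ### Corner embeddings up to homotopy -/

section Corners
variable (A : XCAlg.{u} X) {B C : XCAlg.{u} X}
open XSys

theorem homotopic_stabMap_corner : Homotopic (stabMap (corner A)) (corner A.stabObj) := by
  have h := (htpy_corner ((stab A.stabObj).comp (stab A)) (fun i : ℕ => i) (fun i : ℕ => i)
    (fun _ _ h => h) (fun _ _ h => h) 0).toStabHom
  convert h using 1
  · exact stab_hom_ext fun i j a => by simp; rfl
  · exact stab_hom_ext fun i j a => by simp; rfl

theorem homotopic_matMap_corner₂ : Homotopic (matMap 2 (corner₂ A)) (corner₂ (matObj 2 A)) := by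
  have h := (htpy_corner ((mat 2 (matObj 2 A)).comp (mat 2 A)) (fun i : Fin 2 => i)
    (fun i : Fin 2 => i) (fun _ _ h => h) (fun _ _ h => h) 0).toMatHom
  convert h using 1
  · exact mat_hom_ext fun i j a => by simp; rfl
  · exact mat_hom_ext fun i j a => by simp; rfl

/-- The inclusion `M₂(A) → K ⊗ A`. -/
def incl₂ : matObj 2 A ⟶ A.stabObj :=
  ((stab A).reindex (fun i : Fin 2 => (i : ℕ)) Fin.val_injective).toMatHom

theorem corner₂_incl₂ : corner₂ A ≫ incl₂ A = corner A :=
  XHom.ext_apply fun a => by simp [incl₂]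

theorem homotopic_incl₂_stabMap :
    Homotopic (incl₂ A ≫ stabMap (corner₂ A)) (corner (matObj 2 A)) := by
  have h := (htpy_corner ((stab (matObj 2 A)).comp (mat 2 A)) (fun i : Fin 2 => (i : ℕ))
    (fun i : Fin 2 => i) Fin.val_injective (fun _ _ h => h) 0).toMatHom
  convert h using 1
  · exact mat_hom_ext fun i j a => by simp [incl₂]; rfl
  · exact mat_hom_ext fun i j a => by simp

/-- The identification of `K ⊗ K ⊗ A` with a corner of `K ⊗ A`. -/
def stabStab : A.stabObj.stabObj ⟶ A.stabObj :=
  (((stab A).reindex (fun x : ℕ × ℕ => Nat.pair x.2 x.1 + 1) fun x y h => by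
    have := Nat.pair_eq_pair.1 (Nat.succ_injective h)
    exact Prod.ext this.2 this.1).curryStab).toStabHom

theorem corner_stabStab : Homotopic (corner A.stabObj ≫ stabStab A) (𝟙 A.stabObj) := by
  have h := ((stab A).htpy_shift (fun k => Nat.pair k 0 + 1)
    (fun k l h => (Nat.pair_eq_pair.1 (Nat.succ_injective h)).1)
    (fun k => Nat.lt_succ_of_le (Nat.left_le_pair k 0))).toStabHom
  convert h using 1
  · exact stab_hom_ext fun i j a => by simp [stabStab]; rfl
  · exact stab_hom_ext fun i j a => by simp

/-- The identification of `M₂(K ⊗ A)` with a corner of `K ⊗ A`. -/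
def matStab : matObj 2 A.stabObj ⟶ A.stabObj :=
  (((stab A).reindex (fun x : Fin 2 × ℕ => 2 * x.2 + 1 + x.1) fun x y h => by
    have h1 := x.1.2
    have h2 := y.1.2
    exact Prod.ext (Fin.ext (by dsimp at h; omega)) (by dsimp at h; omega)).curryStab).toMatHom

theorem corner₂_matStab : Homotopic (corner₂ A.stabObj ≫ matStab A) (𝟙 A.stabObj) := by
  have h := ((stab A).htpy_shift (fun k => 2 * k + 1) (fun k l h => by dsimp at h; omega)
    (fun k => by omega)).toStabHom
  convert h using 1
  · exact stab_hom_ext fun i j a => by simp [matStab]; rfl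
  · exact stab_hom_ext fun i j a => by simp

/-- The morphism `K ⊗ M₂(A) → M₂(K ⊗ A)`. -/
def stabMat : (matObj 2 A).stabObj ⟶ matObj 2 A.stabObj := ((stab A).matSys 2).toStabHom

theorem stabMap_oplus (f g : B ⟶ C) :
    stabMap (oplus f g) ≫ stabMat C = oplus (stabMap f) (stabMap g) :=
  stab_hom_ext fun i j a => by
    simp [stabMat, oplus_eq]

/-- The exchange of the two diagonal entries. -/
def matSwap : matObj 2 A ⟶ matObj 2 A := ((mat 2 A).reindex Fin.rev Fin.rev_injective).toMatHom

theorem oplus_matSwap (f g : B ⟶ C) : oplus f g ≫ matSwap C = oplus g f :=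
  XHom.ext_apply fun a => by simp [oplus_eq, matSwap, add_comm]

theorem homotopic_matSwap : Homotopic (𝟙 _) (matSwap A) := by
  have h := ((mat 2 A).htpy_involution Fin.rev Fin.rev_rev).toMatHom
  refine Homotopic.trans (.of_eq ?_) h
  exact mat_hom_ext fun i j a => by simp

/-- The exchange of the two matrix algebras in `M₂(M₂(A))`. -/
def matFlip : matObj 2 (matObj 2 A) ⟶ matObj 2 (matObj 2 A) :=
  ((((mat 2 (matObj 2 A)).comp (mat 2 A)).reindex Prod.swap Prod.swap_injective).curryMat).toMatHom

theorem oplus_matFlip (a b c d : B ⟶ C) : oplus (oplus a b) (oplus c d) ≫ matFlip C =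
    oplus (oplus a c) (oplus b d) :=
  XHom.ext_apply fun x => by simp [oplus_eq, matFlip]; abel

theorem homotopic_matFlip : Homotopic (𝟙 _) (matFlip A) := by
  have h := (((mat 2 (matObj 2 A)).comp (mat 2 A)).htpy_involution Prod.swap
    Prod.swap_swap).curryMat.toMatHom
  refine Homotopic.trans (.of_eq ?_) h
  refine mat_hom_ext fun i j M => ?_
  rw [toMatHom_mat]
  refine Eq.trans ?_ (curryMat_p _ i j M).symm
  simp only [comp_p, ← map_sum]
  exact congrArg ((mat 2 (matObj 2 A)).p i j) (Mat.eq_sum (M : Mat 2 A))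

theorem comp_oplus (k : A ⟶ B) (f g : B ⟶ C) : k ≫ oplus f g = oplus (k ≫ f) (k ≫ g) := rfl

theorem oplus_matMap (f g : A ⟶ B) (k : B ⟶ C) :
    oplus f g ≫ matMap 2 k = oplus (f ≫ k) (g ≫ k) :=
  XHom.ext_apply fun x => by simp [oplus_eq]

theorem corner₂_matMap (f : B ⟶ C) : corner₂ B ≫ matMap 2 f = f ≫ corner₂ C :=
  XHom.ext_apply fun x => by simp

theorem corner_stabMap (f : B ⟶ C) : corner B ≫ stabMap f = f ≫ corner C :=
  XHom.ext_apply fun x => by simp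

theorem matMap_comp (n : ℕ) (f : A ⟶ B) (g : B ⟶ C) :
    matMap n (f ≫ g) = matMap n f ≫ matMap n g := rfl

theorem matMap_id (n : ℕ) : matMap n (𝟙 A) = 𝟙 _ := rfl

theorem stabMap_comp (f : A ⟶ B) (g : B ⟶ C) : stabMap (f ≫ g) = stabMap f ≫ stabMap g :=
  stab_hom_ext fun i j a => by simp

theorem stabMap_id : stabMap (𝟙 A) = 𝟙 _ :=
  stab_hom_ext fun i j a => by simp

end Corners

end XKK
end

open CategoryTheory
noncomputable section
namespace XKK
open scoped ENNReal MultiplierAlgebra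
open TopologicalSpace

open XCAlg
variable {X : Type v} [TopologicalSpace X]

/-! ### Kernels and homomorphisms from `qA` -/

section KerSeq
variable {I E D I' E' D' A B C Z : XCAlg.{u} X}

/-- `j` is the kernel of `p`, with the action of `X` restricted from `E`. -/
structure KerSeq (j : I ⟶ E) (p : E ⟶ D) : Prop where
  injective : Function.Injective j.hom
  range_eq_ker : ∀ x : E, x ∈ Set.range j.hom ↔ p.hom x = 0
  ideal_eq : ∀ (U : Opens X) (x : I), x ∈ I.act.ideal U ↔ j.hom x ∈ E.act.ideal U

theorem IsSplitExtension.kerSeq {j : I ⟶ E} {p : E ⟶ D} {s : D ⟶ E}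
    (h : IsSplitExtension j p s) : KerSeq j p := ⟨h.injective, h.range_eq_ker, h.ideal_eq⟩

namespace KerSeq
variable {j : I ⟶ E} {p : E ⟶ D} {j' : I' ⟶ E'} {p' : E' ⟶ D'}

theorem cancel (h : KerSeq j p) {f g : Z ⟶ I} (hfg : f ≫ j = g ≫ j) : f = g :=
  XHom.ext_apply fun x => h.injective (DFunLike.congr_fun (congrArg XHom.hom hfg) x)

theorem comp_eq_zero (h : KerSeq j p) : j ≫ p = zeroHom I D :=
  XHom.ext_apply fun x => (h.range_eq_ker _).1 ⟨x, rfl⟩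

/-- The factorization through the kernel. -/
def lift (h : KerSeq j p) (k : Z ⟶ E) (hk : ∀ z, p.hom (k.hom z) = 0) : Z ⟶ I := by
  let f : Z → I := fun z => ((h.range_eq_ker _).2 (hk z)).choose
  have hf : ∀ z, j.hom (f z) = k.hom z := fun z => ((h.range_eq_ker _).2 (hk z)).choose_spec
  exact
  { hom :=
    { toFun := f
      map_smul' := fun c x => h.injective (by
        rw [hf, map_smul, ← hf, ← map_smul]; rfl)
      map_zero' := h.injective (by rw [hf, map_zero, map_zero])
      map_add' := fun x y => h.injective (by rw [hf, map_add, ← hf, ← hf, ← map_add])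
      map_mul' := fun x y => h.injective (by rw [hf, map_mul, ← hf, ← hf, ← map_mul])
      map_star' := fun x => h.injective (by rw [hf, map_star, ← hf, ← map_star]) }
    equivariant := fun U z hz => (h.ideal_eq U _).2 (by
      change j.hom (f z) ∈ _
      rw [hf]
      exact k.equivariant U z hz) }

theorem lift_apply (h : KerSeq j p) (k : Z ⟶ E) (hk) (z : Z) :
    j.hom ((h.lift k hk).hom z) = k.hom z := ((h.range_eq_ker _).2 (hk z)).choose_spec

theorem lift_comp (h : KerSeq j p) (k : Z ⟶ E) (hk) : h.lift k hk ≫ j = k :=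
  XHom.ext_apply fun z => h.lift_apply k hk z

theorem homotopic_of_family (h : KerSeq j p) {f g : Z ⟶ I} (H : unitInterval → (Z ⟶ E))
    (hH : ∀ t z, p.hom ((H t).hom z) = 0) (hc : ∀ z, Continuous fun t => (H t).hom z)
    (h0 : H 0 = f ≫ j) (h1 : H 1 = g ≫ j) : Homotopic f g :=
  ⟨fun t => h.lift (H t) (hH t), fun z => continuous_of_injective_hom j.hom h.injective (by
    simp only [lift_apply]; exact hc z), h.cancel (by rw [lift_comp, h0]),
    h.cancel (by rw [lift_comp, h1])⟩

theorem mat (h : KerSeq j p) (n : ℕ) : KerSeq (matMap n j) (matMap n p) where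
  injective M N hMN := CStarMatrix.ext fun k l => h.injective
    (congrFun (congrFun hMN k) l : j.hom ((M : Mat n I) k l) = j.hom ((N : Mat n I) k l))
  range_eq_ker M := by
    constructor
    · rintro ⟨N, rfl⟩
      exact CStarMatrix.ext fun k l => (h.range_eq_ker _).1 ⟨(N : Mat n I) k l, rfl⟩
    · intro hM
      have h1 : ∀ k l, p.hom ((M : Mat n E) k l) = 0 := fun k l => congrFun (congrFun hM k) l
      choose N hN using fun k l => (h.range_eq_ker _).2 (h1 k l)
      exact ⟨(CStarMatrix.ofMatrix N : Mat n I), CStarMatrix.ext fun k l => hN k l⟩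
  ideal_eq U M := mem_matIdeal.trans (Iff.trans (forall_congr' fun k => forall_congr' fun l =>
    h.ideal_eq U _) mem_matIdeal.symm)

theorem stab (h : KerSeq j p) : KerSeq (stabMap j) (stabMap p) where
  injective := Stab.map_injective j.hom h.injective
  range_eq_ker x := Stab.mem_range_map j.hom p.hom h.injective h.range_eq_ker x
  ideal_eq U x := ⟨fun hx => (stabMap j).equivariant U x hx, fun hx =>
    Stab.mem_stabIdeal_of_map_mem j.hom (E.act.isClosed_ideal U)
      (fun y hy => (h.ideal_eq U y).2 hy) hx⟩

end KerSeq

/-- The first inclusion `A → QA`. -/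
def Qι (A : XCAlg.{u} X) : A ⟶ A.QObj where
  hom := ι
  equivariant _ x hx := subset_closedIdealSpan _ (Or.inl ⟨x, hx, rfl⟩)

/-- The second inclusion `A → QA`. -/
def Qιbar (A : XCAlg.{u} X) : A ⟶ A.QObj where
  hom := ιbar
  equivariant _ x hx := subset_closedIdealSpan _ (Or.inr ⟨x, hx, rfl⟩)

/-- The morphism `f ⋆ g : QA → E`. -/
def QLift (f g : A ⟶ E) : A.QObj ⟶ E where
  hom := Q.lift f.hom g.hom
  equivariant U x hx := by
    refine map_mem_of_mem_closedIdealSpan (Q.lift f.hom g.hom) (E.act.isClosed_ideal U) ?_ hx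
    rintro _ (⟨y, hy, rfl⟩ | ⟨y, hy, rfl⟩)
    · rw [Q.lift_ι]; exact f.equivariant U y hy
    · rw [Q.lift_ιbar]; exact g.equivariant U y hy

/-- The inclusion `qA → QA`. -/
def qι (A : XCAlg.{u} X) : A.qObj ⟶ A.QObj where
  hom := qIncl
  equivariant _ _ hx := mem_qObj_ideal.1 hx

/-- The map `QA → A` that identifies the two copies of `A`. -/
def Qfold (A : XCAlg.{u} X) : A.QObj ⟶ A := QLift (𝟙 A) (𝟙 A)

theorem Q_hom_ext {f g : A.QObj ⟶ E} (h₁ : Qι A ≫ f = Qι A ≫ g) (h₂ : Qιbar A ≫ f = Qιbar A ≫ g) :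
    f = g := XHom.ext (Q.hom_ext (fun x => DFunLike.congr_fun (congrArg XHom.hom h₁) x)
      (fun x => DFunLike.congr_fun (congrArg XHom.hom h₂) x))

@[simp] theorem Qι_QLift (f g : A ⟶ E) : Qι A ≫ QLift f g = f :=
  XHom.ext_apply fun x => Q.lift_ι f.hom g.hom x

@[simp] theorem Qιbar_QLift (f g : A ⟶ E) : Qιbar A ≫ QLift f g = g :=
  XHom.ext_apply fun x => Q.lift_ιbar f.hom g.hom x

theorem QLift_comp (f g : A ⟶ E) (k : E ⟶ D) : QLift f g ≫ k = QLift (f ≫ k) (g ≫ k) :=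
  Q_hom_ext (by rw [← Category.assoc, Qι_QLift, Qι_QLift])
    (by rw [← Category.assoc, Qιbar_QLift, Qιbar_QLift])

theorem QMap_eq (f : A ⟶ B) : QMap f = QLift (f ≫ Qι B) (f ≫ Qιbar B) := rfl

theorem QMap_comp_QLift (k : A ⟶ B) (f g : B ⟶ E) :
    QMap k ≫ QLift f g = QLift (k ≫ f) (k ≫ g) := by
  rw [QMap_eq, QLift_comp, Category.assoc, Category.assoc, Qι_QLift, Qιbar_QLift]

theorem qι_comp_QMap (f : A ⟶ B) : qι A ≫ QMap f = qMap f ≫ qι B := rfl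

theorem kerSeq_q (A : XCAlg.{u} X) : KerSeq (qι A) (Qfold A) where
  injective := qIncl_injective
  range_eq_ker x := ⟨by rintro ⟨z, rfl⟩; exact z.2, fun h => ⟨⟨x, h⟩, rfl⟩⟩
  ideal_eq _ _ := mem_qObj_ideal

theorem qι_Qfold_apply (z : A.qObj) : (Qfold A).hom ((qι A).hom z) = 0 := z.2

theorem qι_QLift_self (f : A ⟶ E) : qι A ≫ QLift f f = zeroHom _ _ := by
  have : QLift f f = Qfold A ≫ f := by rw [Qfold, QLift_comp, Category.id_comp]
  rw [this]
  exact XHom.ext_apply fun z => (congrArg f.hom (qι_Qfold_apply z)).trans (map_zero f.hom)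

theorem comp_zeroHom (f : A ⟶ B) : f ≫ zeroHom B C = zeroHom A C := rfl

theorem zeroHom_comp (f : B ⟶ C) : zeroHom A B ≫ f = zeroHom A C :=
  XHom.ext_apply fun _ => map_zero f.hom

namespace KerSeq
variable {j : I ⟶ E} {p : E ⟶ D} {j' : I' ⟶ E'} {p' : E' ⟶ D'}

/-- The morphism `q(f, g) : qA → I` given by two morphisms to `E` that agree modulo `I`. -/
def qPair (h : KerSeq j p) (f g : A ⟶ E) (hfg : f ≫ p = g ≫ p) : A.qObj ⟶ I :=
  h.lift (qι A ≫ QLift f g) fun z => by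
    have : qι A ≫ QLift f g ≫ p = zeroHom _ _ := by rw [QLift_comp, hfg, qι_QLift_self]
    exact DFunLike.congr_fun (congrArg XHom.hom this) z

theorem qPair_j (h : KerSeq j p) (f g : A ⟶ E) (hfg) :
    h.qPair f g hfg ≫ j = qι A ≫ QLift f g := h.lift_comp _ _

theorem qMap_qPair (h : KerSeq j p) (k : B ⟶ A) (f g : A ⟶ E) (hfg) :
    qMap k ≫ h.qPair f g hfg = h.qPair (k ≫ f) (k ≫ g) (by simp only [Category.assoc, hfg]) :=
  h.cancel (by rw [Category.assoc, qPair_j, qPair_j, ← Category.assoc, ← qι_comp_QMap,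
    Category.assoc, QMap_comp_QLift])

theorem qPair_comp (h : KerSeq j p) (h' : KerSeq j' p') {m : I ⟶ I'} {M : E ⟶ E'}
    (hm : m ≫ j' = j ≫ M) (f g : A ⟶ E) (hfg) (hfg') :
    h.qPair f g hfg ≫ m = h'.qPair (f ≫ M) (g ≫ M) hfg' :=
  h'.cancel (by rw [Category.assoc, hm, ← Category.assoc, qPair_j, qPair_j, Category.assoc,
    QLift_comp])

theorem qPair_self (h : KerSeq j p) (f : A ⟶ E) : h.qPair f f rfl = zeroHom _ _ :=
  h.cancel (by rw [qPair_j, qι_QLift_self, zeroHom_comp])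

theorem eq_qPair (h : KerSeq j p) {k : A.qObj ⟶ I} (f g : A ⟶ E) (hfg)
    (hk : k ≫ j = qι A ≫ QLift f g) : k = h.qPair f g hfg := h.cancel (by rw [hk, qPair_j])

theorem homotopic_qPair (h : KerSeq j p) {f g f' g' : A ⟶ E} (hfg) (hfg')
    (F G : unitInterval → (A ⟶ E)) (hF : ∀ x, Continuous fun t => (F t).hom x)
    (hG : ∀ x, Continuous fun t => (G t).hom x) (hFG : ∀ t, F t ≫ p = G t ≫ p)
    (hF0 : F 0 = f) (hG0 : G 0 = g) (hF1 : F 1 = f') (hG1 : G 1 = g') :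
    Homotopic (h.qPair f g hfg) (h.qPair f' g' hfg') := by
  subst hF0 hG0 hF1 hG1
  refine h.homotopic_of_family (fun t => qι A ≫ QLift (F t) (G t)) (fun t z => ?_) (fun z => ?_)
    (h.qPair_j _ _ _).symm (h.qPair_j _ _ _).symm
  · have : qι A ≫ QLift (F t) (G t) ≫ p = zeroHom _ _ := by rw [QLift_comp, hFG, qι_QLift_self]
    exact DFunLike.congr_fun (congrArg XHom.hom this) z
  · refine Q.continuous_family (F := fun t => Q.lift (F t).hom (G t).hom) (fun x => ?_)
      (fun x => ?_) (qIncl z)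
    · simp only [Q.lift_ι]; exact hF x
    · simp only [Q.lift_ιbar]; exact hG x

end KerSeq

theorem qMap_π (f : A ⟶ B) : qMap f ≫ π B = π A ≫ f := by
  have h1 : qMap f ≫ π B = qι A ≫ QMap f ≫ QLift (𝟙 B) (zeroHom B B) := rfl
  have h2 : π A ≫ f = qι A ≫ QLift (𝟙 A) (zeroHom A A) ≫ f := rfl
  rw [h1, h2, QMap_comp_QLift, QLift_comp, zeroHom_comp, Category.comp_id, Category.id_comp]
  rfl

theorem qMap_comp (f : A ⟶ B) (g : B ⟶ C) : qMap (f ≫ g) = qMap f ≫ qMap g := by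
  refine (kerSeq_q C).cancel ?_
  rw [← qι_comp_QMap, Category.assoc, ← qι_comp_QMap, ← Category.assoc, ← qι_comp_QMap,
    Category.assoc, QMap_eq g, QMap_comp_QLift, QMap_eq]
  simp only [Category.assoc]

theorem qMap_id (A : XCAlg.{u} X) : qMap (𝟙 A) = 𝟙 _ := by
  refine (kerSeq_q A).cancel ?_
  rw [← qι_comp_QMap]
  have : QMap (𝟙 A) = 𝟙 _ := Q_hom_ext (by rw [QMap_eq, Qι_QLift]; rfl)
    (by rw [QMap_eq, Qιbar_QLift]; rfl)
  rw [this]; rfl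

theorem QLift_Qι_Qιbar (A : XCAlg.{u} X) : QLift (Qι A) (Qιbar A) = 𝟙 _ :=
  Q_hom_ext (Qι_QLift _ _) (Qιbar_QLift _ _)

/-- The map `μ : q(K ⊗ B) → K ⊗ qB`. -/
def mu (B : XCAlg.{u} X) : B.stabObj.qObj ⟶ B.qObj.stabObj :=
  (kerSeq_q B).stab.qPair (stabMap (Qι B)) (stabMap (Qιbar B))
    (by rw [← stabMap_comp, ← stabMap_comp, Qfold, Qι_QLift, Qιbar_QLift])

theorem mu_stabMap (B : XCAlg.{u} X) : mu B ≫ stabMap (qι B) =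
    qι B.stabObj ≫ QLift (stabMap (Qι B)) (stabMap (Qιbar B)) := KerSeq.qPair_j _ _ _ _

theorem isMu_iff {μ : B.stabObj.qObj ⟶ B.qObj.stabObj} : IsMu (B := B) μ.hom ↔ μ = mu B := by
  constructor
  · intro h
    exact KerSeq.eq_qPair _ _ _ _ (XHom.ext_apply fun z => h z)
  · rintro rfl z
    exact DFunLike.congr_fun (congrArg XHom.hom (mu_stabMap B)) (show B.stabObj.qObj from z)

theorem qMap_corner_mu (B : XCAlg.{u} X) : qMap (corner B) ≫ mu B = corner B.qObj := by
  rw [mu, KerSeq.qMap_qPair]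
  refine (KerSeq.eq_qPair _ _ _ _ ?_).symm
  simp only [corner_stabMap]
  rw [← QLift_comp, QLift_Qι_Qιbar, Category.id_comp]

theorem qMap_stabMap_mu (f : B ⟶ C) : qMap (stabMap f) ≫ mu C = mu B ≫ stabMap (qMap f) := by
  rw [mu, mu, KerSeq.qMap_qPair, KerSeq.qPair_comp _ (kerSeq_q C).stab (M := stabMap (QMap f))
    (by rw [← stabMap_comp, ← stabMap_comp, qι_comp_QMap])
    (hfg' := by
      simp only [← stabMap_comp, Category.assoc, QMap_comp_QLift, Qfold, Qι_QLift, Qιbar_QLift])]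
  congr 1
  all_goals rw [← stabMap_comp, ← stabMap_comp, QMap_eq]
  · rw [Qι_QLift]
  · rw [Qιbar_QLift]

/-- The map `q(M₂(B)) → M₂(qB)`. -/
def mu₂ (B : XCAlg.{u} X) : (matObj 2 B).qObj ⟶ matObj 2 B.qObj :=
  ((kerSeq_q B).mat 2).qPair (matMap 2 (Qι B)) (matMap 2 (Qιbar B))
    (by rw [← matMap_comp, ← matMap_comp, Qfold, Qι_QLift, Qιbar_QLift])

theorem QLift_oplus (f g f' g' : A ⟶ B) :
    QLift (oplus f g) (oplus f' g') = oplus (QLift f f') (QLift g g') :=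
  Q_hom_ext (by rw [Qι_QLift, comp_oplus, Qι_QLift, Qι_QLift])
    (by rw [Qιbar_QLift, comp_oplus, Qιbar_QLift, Qιbar_QLift])

theorem qMap_oplus_mu₂ (f g : A ⟶ B) : qMap (oplus f g) ≫ mu₂ B = oplus (qMap f) (qMap g) := by
  rw [mu₂, KerSeq.qMap_qPair]
  refine (KerSeq.eq_qPair _ _ _ _ ?_).symm
  rw [oplus_matMap, oplus_matMap, oplus_matMap, QLift_oplus, comp_oplus]
  rfl

theorem qMap_zeroHom : qMap (zeroHom A B) = zeroHom A.qObj B.qObj := by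
  refine (kerSeq_q B).cancel ?_
  rw [← qι_comp_QMap, QMap_eq, zeroHom_comp, zeroHom_comp, qι_QLift_self, zeroHom_comp]

theorem qMap_corner₂_mu₂ (B : XCAlg.{u} X) : qMap (corner₂ B) ≫ mu₂ B = corner₂ B.qObj := by
  rw [corner₂, qMap_oplus_mu₂, qMap_id, qMap_zeroHom]; rfl

/-- The exchange of the two copies of `A` in `qA`. -/
def qSwap (A : XCAlg.{u} X) : A.qObj ⟶ A.qObj := (kerSeq_q A).qPair (Qιbar A) (Qι A)
  (by rw [Qfold, Qι_QLift, Qιbar_QLift])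

/-- The conjugation of `M₂(A)` by the matrix `cos (πt/2) + i sin (πt/2) (0 1; 1 0)`. -/
def matRot (t : unitInterval) (A : XCAlg.{u} X) : matObj 2 A ⟶ matObj 2 A :=
  ((XSys.mat 2 A).rot (fun i => i) Fin.rev (fun _ => (Real.cos (Real.pi / 2 * (t : ℝ)) : ℂ))
    (fun _ => Complex.I * (Real.sin (Real.pi / 2 * (t : ℝ)) : ℂ)) (fun i j => by
      have hcs : (Real.cos (Real.pi / 2 * (t : ℝ)) : ℂ) * Real.cos (Real.pi / 2 * (t : ℝ)) +
          Real.sin (Real.pi / 2 * (t : ℝ)) * Real.sin (Real.pi / 2 * (t : ℝ)) = 1 := by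
        rw [← Complex.ofReal_mul, ← Complex.ofReal_mul, ← Complex.ofReal_add]
        norm_cast
        have := Real.cos_sq_add_sin_sq (Real.pi / 2 * (t : ℝ))
        nlinarith
      generalize (Real.cos (Real.pi / 2 * (t : ℝ))) = c at hcs ⊢
      generalize (Real.sin (Real.pi / 2 * (t : ℝ))) = s at hcs ⊢
      have h1 : (Fin.rev i = j) = (i = Fin.rev j) :=
        propext ⟨fun h => by rw [← h, Fin.rev_rev], fun h => by rw [h, Fin.rev_rev]⟩
      simp only [h1, Fin.rev_inj, star_mul', RCLike.star_def, Complex.conj_ofReal,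
        Complex.conj_I]
      split_ifs
      · linear_combination hcs - (s : ℂ) ^ 2 * Complex.I_sq
      · linear_combination hcs - (s : ℂ) ^ 2 * Complex.I_sq
      · ring
      · ring)).toMatHom

theorem matRot_mat (t : unitInterval) (i j : Fin 2) (a : A) :
    (matRot t A).hom ((XSys.mat 2 A).p i j a) =
      (Real.cos (Real.pi / 2 * (t : ℝ)) * Real.cos (Real.pi / 2 * (t : ℝ)) : ℂ) •
        (XSys.mat 2 A).p i j a +
      (-(Complex.I * Real.cos (Real.pi / 2 * (t : ℝ)) * Real.sin (Real.pi / 2 * (t : ℝ))) : ℂ) •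
        (XSys.mat 2 A).p i j.rev a +
      ((Complex.I * Real.cos (Real.pi / 2 * (t : ℝ)) * Real.sin (Real.pi / 2 * (t : ℝ)) : ℂ) •
        (XSys.mat 2 A).p i.rev j a +
      (Real.sin (Real.pi / 2 * (t : ℝ)) * Real.sin (Real.pi / 2 * (t : ℝ)) : ℂ) •
        (XSys.mat 2 A).p i.rev j.rev a) := by
  rw [matRot, XSys.toMatHom_mat, XSys.rot_p]
  simp only [star_mul', RCLike.star_def, Complex.conj_ofReal, Complex.conj_I]
  congr 2
  · congr 1; ring
  · congr 1; ring
  · congr 1; linear_combination (-(Real.sin (Real.pi / 2 * (t : ℝ))) ^ 2 : ℂ) * Complex.I_sq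

theorem matRot_zero (A : XCAlg.{u} X) : matRot 0 A = 𝟙 _ :=
  XSys.mat_hom_ext fun i j a => by rw [matRot_mat]; simp

theorem matRot_one (A : XCAlg.{u} X) : matRot 1 A = matSwap A :=
  XSys.mat_hom_ext fun i j a => by rw [matRot_mat]; simp [matSwap]

theorem continuous_matRot (A : XCAlg.{u} X) (M : matObj 2 A) :
    Continuous fun t => (matRot t A).hom M := by
  have : M = ∑ i, ∑ j, (XSys.mat 2 A).p i j ((M : Mat 2 A) i j) := Mat.eq_sum (M : Mat 2 A)
  rw [this]
  simp only [map_sum, matRot_mat]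
  fun_prop

theorem matMap_matRot (t : unitInterval) (f : A ⟶ B) :
    matMap 2 f ≫ matRot t B = matRot t A ≫ matMap 2 f :=
  XSys.mat_hom_ext fun i j a => by
    simp only [comp_hom_apply, XSys.matMap_mat, matRot_mat, map_add, map_smul]

theorem oplus_id_matRot (t : unitInterval) (A : XCAlg.{u} X) :
    oplus (𝟙 A) (𝟙 A) ≫ matRot t A = oplus (𝟙 A) (𝟙 A) :=
  XHom.ext_apply fun a => by
    have hcs : (Real.cos (Real.pi / 2 * (t : ℝ)) : ℂ) * Real.cos (Real.pi / 2 * (t : ℝ)) +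
        Real.sin (Real.pi / 2 * (t : ℝ)) * Real.sin (Real.pi / 2 * (t : ℝ)) = 1 := by
      rw [← Complex.ofReal_mul, ← Complex.ofReal_mul, ← Complex.ofReal_add]
      norm_cast
      have := Real.cos_sq_add_sin_sq (Real.pi / 2 * (t : ℝ))
      nlinarith
    have r0 : (0 : Fin 2).rev = 1 := rfl
    have r1 : (1 : Fin 2).rev = 0 := rfl
    simp only [comp_hom_apply, XSys.oplus_eq, id_hom_apply, map_add, matRot_mat, r0, r1]
    generalize (Real.cos (Real.pi / 2 * (t : ℝ)) : ℂ) = c at hcs ⊢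
    generalize (Real.sin (Real.pi / 2 * (t : ℝ)) : ℂ) = s at hcs ⊢
    match_scalars <;> first | linear_combination hcs | ring

theorem oplus_self_matRot (t : unitInterval) (f : A ⟶ B) :
    oplus f f ≫ matRot t B = oplus f f := by
  have : oplus f f = f ≫ oplus (𝟙 B) (𝟙 B) := by rw [comp_oplus, Category.comp_id]
  rw [this, Category.assoc, oplus_id_matRot]

theorem homotopic_oplus_qSwap (A : XCAlg.{u} X) :
    Homotopic (oplus (𝟙 A.qObj) (qSwap A)) (zeroHom _ _) := by
  have hfold : ∀ f g : A ⟶ A.QObj, f ≫ Qfold A = 𝟙 A → g ≫ Qfold A = 𝟙 A → ∀ t,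
      (oplus f g ≫ matRot t A.QObj) ≫ matMap 2 (Qfold A) = oplus (𝟙 A) (𝟙 A) := by
    intro f g hf hg t
    rw [Category.assoc, ← matMap_matRot, ← Category.assoc, oplus_matMap, hf, hg,
      oplus_self_matRot]
  have h1 : Qι A ≫ Qfold A = 𝟙 A := Qι_QLift _ _
  have h2 : Qιbar A ≫ Qfold A = 𝟙 A := Qιbar_QLift _ _
  have h := KerSeq.homotopic_qPair ((kerSeq_q A).mat 2) (f := oplus (Qι A) (Qιbar A))
    (g := oplus (Qιbar A) (Qι A)) (f' := oplus (Qι A) (Qιbar A)) (g' := oplus (Qι A) (Qιbar A))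
    (by rw [oplus_matMap, oplus_matMap, h1, h2]) rfl
    (fun _ => oplus (Qι A) (Qιbar A)) (fun t => oplus (Qιbar A) (Qι A) ≫ matRot t _)
    (fun _ => continuous_const) (fun x => continuous_matRot A.QObj ((oplus (Qιbar A) (Qι A)).hom x))
    (fun t => by rw [hfold _ _ h2 h1, oplus_matMap, h1, h2]) rfl
    (by rw [matRot_zero, Category.comp_id]) rfl (by rw [matRot_one, oplus_matSwap])
  rw [KerSeq.qPair_self] at h
  refine Homotopic.trans (.of_eq ?_) h
  refine KerSeq.eq_qPair _ _ _ _ ?_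
  rw [oplus_matMap, QLift_oplus, comp_oplus, qSwap, KerSeq.qPair_j, QLift_Qι_Qιbar]
  rfl

end KerSeq

end XKK
end

open CategoryTheory
noncomputable section
namespace XKK
open scoped ENNReal MultiplierAlgebra
open TopologicalSpace

open XCAlg
variable {X : Type v} [TopologicalSpace X]

/-! ### The homotopy category -/

variable (X) in
/-- The homotopy category of separable C⋆-algebras with an action of `X`. -/
structure HoCat where
  as : XCAlg.{u} X

section Ho
variable {A B C D : XCAlg.{u} X}

theorem homotopic_equivalence (A B : XCAlg.{u} X) : Equivalence (Homotopic (A := A) (B := B)) :=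
  ⟨Homotopic.refl, Homotopic.symm, Homotopic.trans⟩

instance : Category.{u} (HoCat.{u} X) where
  Hom A B := Quot (Homotopic (A := A.as) (B := B.as))
  id A := Quot.mk _ (𝟙 A.as)
  comp f g := Quot.map₂ (fun f g => f ≫ g) (fun f _ _ h => h.comp_left f)
    (fun _ _ g h => h.comp_right g) f g
  id_comp f := by rcases f with ⟨f⟩; rfl
  comp_id f := by rcases f with ⟨f⟩; rfl
  assoc f g h := by rcases f with ⟨f⟩; rcases g with ⟨g⟩; rcases h with ⟨h⟩; rfl

/-- The functor to the homotopy category. -/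
def ho : XCAlg.{u} X ⥤ HoCat.{u} X where
  obj A := ⟨A⟩
  map f := Quot.mk _ f

theorem ho_surj (x : ho.obj A ⟶ ho.obj B) : ∃ f : A ⟶ B, ho.map f = x := Quot.exists_rep x

theorem ho_eq_iff {f g : A ⟶ B} : ho.map f = ho.map g ↔ Homotopic f g :=
  ⟨fun h => (homotopic_equivalence A B).eqvGen_iff.1 (Quot.eqvGen_exact h), fun h => Quot.sound h⟩

/-- The functor `K ⊗ ·` on homotopy classes. -/
def hoStab (x : ho.obj A ⟶ ho.obj B) : ho.obj A.stabObj ⟶ ho.obj B.stabObj :=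
  Quot.map stabMap (fun _ _ h => h.stabMap) x

@[simp] theorem hoStab_map (f : A ⟶ B) : hoStab (ho.map f) = ho.map (stabMap f) := rfl

theorem hoStab_comp (x : ho.obj A ⟶ ho.obj B) (y : ho.obj B ⟶ ho.obj C) :
    hoStab (x ≫ y) = hoStab x ≫ hoStab y := by
  obtain ⟨f, rfl⟩ := ho_surj x
  obtain ⟨g, rfl⟩ := ho_surj y
  simp only [← Functor.map_comp, hoStab_map, stabMap_comp]

/-- The direct sum of homotopy classes. -/
def hoOplus (x y : ho.obj A ⟶ ho.obj B) : ho.obj A ⟶ ho.obj (matObj 2 B) :=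
  Quot.map₂ oplus (fun f _ _ h => (Homotopic.refl f).oplus h)
    (fun _ _ g h => h.oplus (Homotopic.refl g)) x y

@[simp] theorem hoOplus_map (f g : A ⟶ B) :
    hoOplus (ho.map f) (ho.map g) = ho.map (oplus f g) := rfl

/-- The functor `q` on homotopy classes. -/
def hoq (x : ho.obj A ⟶ ho.obj B) : ho.obj A.qObj ⟶ ho.obj B.qObj :=
  Quot.map qMap (fun _ _ h => h.qMap) x

@[simp] theorem hoq_map (f : A ⟶ B) : hoq (ho.map f) = ho.map (qMap f) := rfl

theorem hoq_comp (x : ho.obj A ⟶ ho.obj B) (y : ho.obj B ⟶ ho.obj C) :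
    hoq (x ≫ y) = hoq x ≫ hoq y := by
  obtain ⟨f, rfl⟩ := ho_surj x
  obtain ⟨g, rfl⟩ := ho_surj y
  simp only [← Functor.map_comp, hoq_map, qMap_comp]

theorem ho_stabMap_corner (A : XCAlg.{u} X) :
    ho.map (stabMap (corner A)) = ho.map (corner A.stabObj) :=
  ho_eq_iff.2 (homotopic_stabMap_corner A)

theorem ho_corner_hoStab (x : ho.obj A ⟶ ho.obj B) :
    ho.map (corner A) ≫ hoStab x = x ≫ ho.map (corner B) := by
  obtain ⟨f, rfl⟩ := ho_surj x
  rw [hoStab_map, ← Functor.map_comp, corner_stabMap, Functor.map_comp]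

theorem ho_corner_hoStab_assoc (x : ho.obj A ⟶ ho.obj B) {Z : HoCat.{u} X}
    (h : ho.obj B.stabObj ⟶ Z) : ho.map (corner A) ≫ hoStab x ≫ h = x ≫ ho.map (corner B) ≫ h := by
  rw [← Category.assoc, ho_corner_hoStab, Category.assoc]

theorem ho_corner_stabStab (A : XCAlg.{u} X) :
    ho.map (corner A.stabObj) ≫ ho.map (stabStab A) = 𝟙 _ := by
  rw [← Functor.map_comp, ho_eq_iff.2 (corner_stabStab A), CategoryTheory.Functor.map_id]

theorem ho_corner_stabStab_assoc (A : XCAlg.{u} X) {Z : HoCat.{u} X} (h : ho.obj A.stabObj ⟶ Z) :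
    ho.map (corner A.stabObj) ≫ ho.map (stabStab A) ≫ h = h := by
  rw [← Category.assoc, ho_corner_stabStab, Category.id_comp]

theorem ho_stabStab_corner (A : XCAlg.{u} X) :
    ho.map (stabStab A) ≫ ho.map (corner A.stabObj) = 𝟙 _ := by
  rw [← ho_corner_hoStab, ← ho_stabMap_corner, hoStab_map, ← Functor.map_comp, ← stabMap_comp,
    ← hoStab_map, ho_eq_iff.2 (corner_stabStab A), hoStab_map, stabMap_id, CategoryTheory.Functor.map_id]

theorem ho_corner₂_matStab (A : XCAlg.{u} X) :
    ho.map (corner₂ A.stabObj) ≫ ho.map (matStab A) = 𝟙 _ := by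
  rw [← Functor.map_comp, ho_eq_iff.2 (corner₂_matStab A), CategoryTheory.Functor.map_id]

theorem ho_matStab_corner₂ (A : XCAlg.{u} X) :
    ho.map (matStab A) ≫ ho.map (corner₂ A.stabObj) = 𝟙 _ := by
  rw [← Functor.map_comp, ← corner₂_matMap, Functor.map_comp,
    ← ho_eq_iff.2 (homotopic_matMap_corner₂ _), ← Functor.map_comp, ← matMap_comp,
    ho_eq_iff.2 ((corner₂_matStab A).matMap 2), matMap_id, CategoryTheory.Functor.map_id]

instance (A : XCAlg.{u} X) : IsIso (ho.map (corner A.stabObj)) :=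
  ⟨_, ho_corner_stabStab A, ho_stabStab_corner A⟩

instance (A : XCAlg.{u} X) : IsIso (ho.map (corner₂ A.stabObj)) :=
  ⟨_, ho_corner₂_matStab A, ho_matStab_corner₂ A⟩

theorem ho_stabStab_hoStab (x : ho.obj A ⟶ ho.obj B) :
    ho.map (stabStab A) ≫ hoStab x = hoStab (hoStab x) ≫ ho.map (stabStab B) := by
  rw [← cancel_epi (ho.map (corner A.stabObj)), ho_corner_stabStab_assoc,
    ho_corner_hoStab_assoc, ho_corner_stabStab, Category.comp_id]

theorem ho_stabStab_hoStab_assoc (x : ho.obj A ⟶ ho.obj B) {Z : HoCat.{u} X}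
    (h : ho.obj B.stabObj ⟶ Z) : ho.map (stabStab A) ≫ hoStab x ≫ h =
      hoStab (hoStab x) ≫ ho.map (stabStab B) ≫ h := by
  rw [← Category.assoc, ho_stabStab_hoStab, Category.assoc]

theorem ho_stabMap_stabStab (A : XCAlg.{u} X) :
    ho.map (stabMap (stabStab A)) = ho.map (stabStab A.stabObj) := by
  rw [← cancel_epi (ho.map (corner A.stabObj.stabObj)), ho_corner_stabStab, ← hoStab_map,
    ho_corner_hoStab, ho_stabStab_corner]

theorem comp_hoOplus (x : ho.obj A ⟶ ho.obj B) (y z : ho.obj B ⟶ ho.obj C) :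
    x ≫ hoOplus y z = hoOplus (x ≫ y) (x ≫ z) := by
  obtain ⟨f, rfl⟩ := ho_surj x
  obtain ⟨g, rfl⟩ := ho_surj y
  obtain ⟨h, rfl⟩ := ho_surj z
  rfl

theorem hoOplus_matMap (x y : ho.obj A ⟶ ho.obj B) (f : B ⟶ C) :
    hoOplus x y ≫ ho.map (matMap 2 f) = hoOplus (x ≫ ho.map f) (y ≫ ho.map f) := by
  obtain ⟨g, rfl⟩ := ho_surj x
  obtain ⟨h, rfl⟩ := ho_surj y
  rw [hoOplus_map, ← Functor.map_comp, oplus_matMap]; rfl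

theorem hoOplus_zero (x : ho.obj A ⟶ ho.obj B) :
    hoOplus x (ho.map (zeroHom A B)) = x ≫ ho.map (corner₂ B) := by
  obtain ⟨g, rfl⟩ := ho_surj x
  rw [hoOplus_map, ← Functor.map_comp]; rfl

theorem hoOplus_comm (x y : ho.obj A ⟶ ho.obj B) : hoOplus x y = hoOplus y x := by
  obtain ⟨g, rfl⟩ := ho_surj x
  obtain ⟨h, rfl⟩ := ho_surj y
  rw [hoOplus_map, hoOplus_map, ← oplus_matSwap, Functor.map_comp,
    ← ho_eq_iff.2 (homotopic_matSwap B), CategoryTheory.Functor.map_id, Category.comp_id]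

theorem hoOplus_interchange (x y z w : ho.obj A ⟶ ho.obj B) :
    hoOplus (hoOplus x y) (hoOplus z w) = hoOplus (hoOplus x z) (hoOplus y w) := by
  obtain ⟨x, rfl⟩ := ho_surj x
  obtain ⟨y, rfl⟩ := ho_surj y
  obtain ⟨z, rfl⟩ := ho_surj z
  obtain ⟨w, rfl⟩ := ho_surj w
  simp only [hoOplus_map]
  rw [← oplus_matFlip, Functor.map_comp, ← ho_eq_iff.2 (homotopic_matFlip B), CategoryTheory.Functor.map_id,
    Category.comp_id]

theorem ho_corner₂_matMap (f : A ⟶ B) :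
    ho.map (corner₂ A) ≫ ho.map (matMap 2 f) = ho.map f ≫ ho.map (corner₂ B) := by
  rw [← Functor.map_comp, corner₂_matMap, Functor.map_comp]

/-- The sum of homotopy classes with values in a stable algebra. -/
instance instAddHo : Add (ho.obj A ⟶ ho.obj B.stabObj) :=
  ⟨fun x y => hoOplus x y ≫ ho.map (matStab B)⟩

instance instZeroHo : Zero (ho.obj A ⟶ ho.obj B.stabObj) := ⟨ho.map (zeroHom _ _)⟩

theorem ho_zero : (0 : ho.obj A ⟶ ho.obj B.stabObj) = ho.map (zeroHom _ _) := rfl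

theorem ho_add_eq (x y : ho.obj A ⟶ ho.obj B.stabObj) :
    x + y = hoOplus x y ≫ ho.map (matStab B) := rfl

theorem ho_add_corner₂ (x y : ho.obj A ⟶ ho.obj B.stabObj) :
    (x + y) ≫ ho.map (corner₂ B.stabObj) = hoOplus x y := by
  rw [ho_add_eq, Category.assoc, ho_matStab_corner₂, Category.comp_id]

theorem ho_add_eq_iff (x y z : ho.obj A ⟶ ho.obj B.stabObj) :
    x + y = z ↔ z ≫ ho.map (corner₂ B.stabObj) = hoOplus x y := by
  rw [← ho_add_corner₂, cancel_mono, eq_comm]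

theorem ho_add_comm (x y : ho.obj A ⟶ ho.obj B.stabObj) : x + y = y + x := by
  rw [ho_add_eq, hoOplus_comm, ho_add_eq]

theorem ho_add_zero (x : ho.obj A ⟶ ho.obj B.stabObj) : x + 0 = x := by
  rw [ho_add_eq_iff, ho_zero, hoOplus_zero]

theorem hoOplus_add (x y z w : ho.obj A ⟶ ho.obj B.stabObj) :
    hoOplus (x + y) (z + w) ≫ ho.map (matMap 2 (corner₂ B.stabObj)) =
      hoOplus (hoOplus x y) (hoOplus z w) := by
  rw [hoOplus_matMap, ho_add_corner₂, ho_add_corner₂]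

theorem ho_add_add_add_comm (x y z w : ho.obj A ⟶ ho.obj B.stabObj) :
    (x + y) + (z + w) = (x + z) + (y + w) := by
  have h : hoOplus (x + y) (z + w) = hoOplus (x + z) (y + w) := by
    have h₁ : Homotopic (matStab B ≫ corner₂ B.stabObj) (𝟙 _) := by
      rw [← ho_eq_iff, Functor.map_comp, ho_matStab_corner₂, CategoryTheory.Functor.map_id]
    have : IsIso (ho.map (matMap 2 (corner₂ B.stabObj))) := by
      refine ⟨ho.map (matMap 2 (matStab B)), ?_, ?_⟩
      · rw [← Functor.map_comp, ← matMap_comp, ho_eq_iff.2 ((corner₂_matStab B).matMap 2),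
          matMap_id, CategoryTheory.Functor.map_id]
      · rw [← Functor.map_comp, ← matMap_comp, ho_eq_iff.2 (h₁.matMap 2), matMap_id,
          CategoryTheory.Functor.map_id]
    rw [← cancel_mono (ho.map (matMap 2 (corner₂ B.stabObj))), hoOplus_add, hoOplus_add,
      hoOplus_interchange]
  rw [ho_add_eq (x + y), h, ← ho_add_eq]

instance instAddCommMonoidHo : AddCommMonoid (ho.obj A ⟶ ho.obj B.stabObj) where
  add_assoc x y z := by
    calc x + y + z = (x + y) + (0 + z) := by rw [ho_add_comm 0 z, ho_add_zero]
      _ = (x + 0) + (y + z) := ho_add_add_add_comm _ _ _ _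
      _ = _ := by rw [ho_add_zero]
  zero_add x := by rw [ho_add_comm, ho_add_zero]
  add_zero := ho_add_zero
  add_comm := ho_add_comm
  nsmul := nsmulRec

theorem ho_comp_add (k : ho.obj A ⟶ ho.obj B) (x y : ho.obj B ⟶ ho.obj C.stabObj) :
    k ≫ (x + y) = k ≫ x + k ≫ y := by
  rw [ho_add_eq, ← Category.assoc, comp_hoOplus, ho_add_eq]

theorem ho_add_comp (x y : ho.obj A ⟶ ho.obj B.stabObj) (k : ho.obj B.stabObj ⟶ ho.obj C.stabObj) :
    (x + y) ≫ k = x ≫ k + y ≫ k := by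
  obtain ⟨f, rfl⟩ := ho_surj k
  refine Eq.symm ((ho_add_eq_iff _ _ _).2 ?_)
  rw [Category.assoc, ← ho_corner₂_matMap, ← Category.assoc, ho_add_corner₂, hoOplus_matMap]

theorem hoStab_add (x y : ho.obj A ⟶ ho.obj B.stabObj) :
    hoStab (x + y) = hoStab x + hoStab y := by
  refine Eq.symm ((ho_add_eq_iff _ _ _).2 ?_)
  have h := congrArg (fun z => hoStab z ≫ ho.map (stabMat B.stabObj)) (ho_add_corner₂ x y)
  simp only [hoStab_comp, Category.assoc] at h
  have h2 : hoStab (ho.map (corner₂ B.stabObj)) ≫ ho.map (stabMat B.stabObj) =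
      ho.map (corner₂ B.stabObj.stabObj) := by
    rw [hoStab_map, ← Functor.map_comp, corner₂, stabMap_oplus, stabMap_id]
    congr 2
    exact XSys.stab_hom_ext fun i j a => by
      rw [XSys.stabMap_stab]; exact map_zero _
  rw [h2] at h
  rw [h]
  obtain ⟨f, rfl⟩ := ho_surj x
  obtain ⟨g, rfl⟩ := ho_surj y
  rw [hoOplus_map, hoStab_map, ← Functor.map_comp, stabMap_oplus]; rfl

theorem ho_comp_zero (k : ho.obj A ⟶ ho.obj B) : k ≫ (0 : ho.obj B ⟶ ho.obj C.stabObj) = 0 := by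
  obtain ⟨f, rfl⟩ := ho_surj k
  rfl

theorem ho_zero_comp (k : ho.obj B.stabObj ⟶ ho.obj C.stabObj) :
    (0 : ho.obj A ⟶ ho.obj B.stabObj) ≫ k = 0 := by
  obtain ⟨f, rfl⟩ := ho_surj k
  rw [ho_zero, ← Functor.map_comp, zeroHom_comp]; rfl

theorem hoq_add (x y : ho.obj A ⟶ ho.obj B.stabObj) :
    hoq (x + y) ≫ ho.map (mu B) = hoq x ≫ ho.map (mu B) + hoq y ≫ ho.map (mu B) := by
  refine Eq.symm ((ho_add_eq_iff _ _ _).2 ?_)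
  have h := congrArg (fun z => hoq z ≫ ho.map (mu₂ B.stabObj)) (ho_add_corner₂ x y)
  simp only [hoq_comp, Category.assoc] at h
  have h2 : hoq (ho.map (corner₂ B.stabObj)) ≫ ho.map (mu₂ B.stabObj) =
      ho.map (corner₂ B.stabObj.qObj) := by
    rw [hoq_map, ← Functor.map_comp, qMap_corner₂_mu₂]
  rw [h2] at h
  rw [Category.assoc, ← ho_corner₂_matMap, ← Category.assoc, h]
  obtain ⟨f, rfl⟩ := ho_surj x
  obtain ⟨g, rfl⟩ := ho_surj y
  rw [hoOplus_map, hoq_map, ← Functor.map_comp, qMap_oplus_mu₂, ← hoOplus_map, hoOplus_matMap]; rfl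

theorem hoq_neg (x : ho.obj A.qObj ⟶ ho.obj B.stabObj) : x + ho.map (qSwap A) ≫ x = 0 := by
  rw [ho_add_eq_iff]
  obtain ⟨f, rfl⟩ := ho_surj x
  have h : hoOplus (ho.map f) (ho.map (qSwap A) ≫ ho.map f) =
      ho.map (oplus (𝟙 A.qObj) (qSwap A)) ≫ ho.map (matMap 2 f) := by
    rw [← hoOplus_map, hoOplus_matMap, CategoryTheory.Functor.map_id, Category.id_comp]
  rw [h, ho_eq_iff.2 (homotopic_oplus_qSwap A), ← Functor.map_comp, zeroHom_comp, ho_zero,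
    ← Functor.map_comp, zeroHom_comp]

instance instNegHo : Neg (ho.obj A.qObj ⟶ ho.obj B.stabObj) := ⟨fun x => ho.map (qSwap A) ≫ x⟩

instance instAddCommGroupHo : AddCommGroup (ho.obj A.qObj ⟶ ho.obj B.stabObj) :=
  { instAddCommMonoidHo (A := A.qObj) (B := B) with
    zsmul := zsmulRec
    neg_add_cancel := fun x => by
      rw [ho_add_comm]; exact hoq_neg x }

end Ho

end XKK
end

open CategoryTheory
noncomputable section
namespace XKK
open scoped ENNReal MultiplierAlgebra
open TopologicalSpace

open XCAlg
variable {X : Type v} [TopologicalSpace X]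

/-! ### The stable homotopy category -/

theorem isIso_map_corner₂ {𝒞 : Type w} [Category.{v₁} 𝒞] (F : XCAlg.{u} X ⥤ 𝒞)
    (hs : ∀ A : XCAlg.{u} X, IsIso (F.map (corner A)))
    (hh : ∀ {A B : XCAlg.{u} X} (f g : A ⟶ B), Homotopic f g → F.map f = F.map g)
    (A : XCAlg.{u} X) : IsIso (F.map (corner₂ A)) := by
  have h1 : F.map (corner₂ A) ≫ F.map (incl₂ A) = F.map (corner A) := by
    rw [← Functor.map_comp, corner₂_incl₂]
  have h2 : F.map (incl₂ A) ≫ F.map (stabMap (corner₂ A)) = F.map (corner (matObj 2 A)) := by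
    rw [← Functor.map_comp, hh _ _ (homotopic_incl₂_stabMap A)]
  have := hs A
  have := hs (matObj 2 A)
  have hmono : Mono (F.map (incl₂ A)) := by
    have : Mono (F.map (incl₂ A) ≫ F.map (stabMap (corner₂ A))) := by rw [h2]; infer_instance
    exact mono_of_mono _ (F.map (stabMap (corner₂ A)))
  have hsplit : IsSplitEpi (F.map (incl₂ A)) := IsSplitEpi.mk'
    ⟨inv (F.map (corner A)) ≫ F.map (corner₂ A), by rw [Category.assoc, h1, IsIso.inv_hom_id]⟩
  have := isIso_of_mono_of_isSplitEpi (F.map (incl₂ A))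
  have h3 : F.map (corner₂ A) = F.map (corner A) ≫ inv (F.map (incl₂ A)) := by
    rw [IsIso.eq_comp_inv, h1]
  rw [h3]
  infer_instance

variable (X) in
/-- The stable homotopy category of separable C⋆-algebras with an action of `X`: the morphisms
from `A` to `B` are the homotopy classes of morphisms `A → K ⊗ B`. -/
structure LCat where
  as : XCAlg.{u} X

section El
variable {A B C D : XCAlg.{u} X}

instance : Category.{u} (LCat.{u} X) where
  Hom A B := ho.obj A.as ⟶ ho.obj B.as.stabObj
  id A := ho.map (corner A.as)
  comp {A B C} f g := CategoryStruct.comp (obj := HoCat.{u} X) (Z := ho.obj C.as.stabObj) f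
    (hoStab g ≫ ho.map (stabStab C.as))
  id_comp {A B} f := by
    change ho.map (corner A.as) ≫ hoStab f ≫ ho.map (stabStab B.as) = f
    rw [ho_corner_hoStab_assoc, ho_corner_stabStab, Category.comp_id]
  comp_id {A B} f := by
    change f ≫ hoStab (ho.map (corner B.as)) ≫ ho.map (stabStab B.as) = f
    rw [hoStab_map, ho_stabMap_corner, ho_corner_stabStab, Category.comp_id]
  assoc {A B C D} f g h := by
    change (f ≫ hoStab g ≫ ho.map (stabStab C.as)) ≫ hoStab h ≫ ho.map (stabStab D.as) =
      f ≫ hoStab (g ≫ hoStab h ≫ ho.map (stabStab D.as)) ≫ ho.map (stabStab D.as)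
    simp only [hoStab_comp, Category.assoc, hoStab_map, ho_stabMap_stabStab]
    rw [ho_stabStab_hoStab_assoc]

/-- The functor to the stable homotopy category. -/
def el : XCAlg.{u} X ⥤ LCat.{u} X where
  obj A := ⟨A⟩
  map f := ho.map (f ≫ corner _)
  map_id A := by rw [Category.id_comp]; rfl
  map_comp {A B C} f g := by
    change _ = ho.map (f ≫ corner B) ≫ hoStab (ho.map (g ≫ corner C)) ≫ ho.map (stabStab C)
    rw [Functor.map_comp _ f (corner B), Category.assoc, Category.assoc, ho_corner_hoStab_assoc,
      ho_corner_stabStab, Category.comp_id, ← Functor.map_comp]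

/-- The morphism of the stable homotopy category given by a morphism to `K ⊗ B`. -/
def elMk (α : A ⟶ B.stabObj) : el.obj A ⟶ el.obj B :=
  show ho.obj A ⟶ ho.obj B.stabObj from ho.map α

/-- A morphism of the stable homotopy category as a homotopy class. -/
def toHo (x : el.obj A ⟶ el.obj B) : ho.obj A ⟶ ho.obj B.stabObj := x

theorem el_ext {x y : el.obj A ⟶ el.obj B} (h : toHo x = toHo y) : x = y := h

theorem toHo_comp (x : el.obj A ⟶ el.obj B) (y : el.obj B ⟶ el.obj C) :
    toHo (x ≫ y) = toHo x ≫ hoStab (toHo y) ≫ ho.map (stabStab C) := rfl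

theorem toHo_map (f : A ⟶ B) : toHo (el.map f) = ho.map f ≫ ho.map (corner B) :=
  ho.map_comp f (corner B)

theorem toHo_elMk (f : A ⟶ B.stabObj) : toHo (elMk f) = ho.map f := rfl

theorem elMk_surj (x : el.obj A ⟶ el.obj B) : ∃ f, elMk f = x := ho_surj (toHo x)

theorem toHo_map_comp (f : A ⟶ B) (y : el.obj B ⟶ el.obj C) :
    toHo (el.map f ≫ y) = ho.map f ≫ toHo y := by
  rw [toHo_comp, toHo_map, Category.assoc, ho_corner_hoStab_assoc, ho_corner_stabStab,
    Category.comp_id]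

theorem elMk_corner (f : A ⟶ B.stabObj) : elMk f ≫ el.map (corner B) = el.map f := by
  refine el_ext ?_
  rw [toHo_comp, toHo_elMk, toHo_map, hoStab_comp, hoStab_map, hoStab_map, toHo_map,
    ho_stabMap_corner, ho_stabMap_corner, Category.assoc, ho_corner_stabStab, Category.comp_id]

theorem elMk_corner_assoc (f : A ⟶ B.stabObj) {Z : LCat.{u} X} (h : el.obj B.stabObj ⟶ Z) :
    elMk f ≫ el.map (corner B) ≫ h = el.map f ≫ h := by
  rw [← Category.assoc, elMk_corner]

theorem el_homotopic (f g : A ⟶ B) (h : Homotopic f g) : el.map f = el.map g :=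
  ho_eq_iff.2 (h.comp_right _)

instance (A : XCAlg.{u} X) : IsIso (el.map (corner A)) :=
  ⟨elMk (𝟙 _), by
    refine el_ext ?_
    rw [toHo_map_comp, toHo_elMk, CategoryTheory.Functor.map_id, Category.comp_id]; rfl, by
    rw [elMk_corner, CategoryTheory.Functor.map_id]⟩

instance (A : XCAlg.{u} X) : IsIso (el.map (corner₂ A)) :=
  isIso_map_corner₂ el inferInstance el_homotopic A

instance instAddCommMonoidEl : AddCommMonoid (el.obj A ⟶ el.obj B) :=
  instAddCommMonoidHo (A := A) (B := B)

instance instAddCommGroupEl : AddCommGroup (el.obj A.qObj ⟶ el.obj B) :=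
  instAddCommGroupHo (A := A) (B := B)

theorem el_comp_add (x : el.obj A ⟶ el.obj B) (y z : el.obj B ⟶ el.obj C) :
    x ≫ (y + z) = x ≫ y + x ≫ z := by
  change toHo x ≫ hoStab (toHo y + toHo z) ≫ ho.map (stabStab C) = toHo x ≫ hoStab (toHo y) ≫
    ho.map (stabStab C) + toHo x ≫ hoStab (toHo z) ≫ ho.map (stabStab C)
  rw [hoStab_add, ho_add_comp, ho_comp_add]

theorem el_add_comp (x y : el.obj A ⟶ el.obj B) (z : el.obj B ⟶ el.obj C) :
    (x + y) ≫ z = x ≫ z + y ≫ z :=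
  ho_add_comp (toHo x) (toHo y) (hoStab (toHo z) ≫ ho.map (stabStab C))

theorem el_zeroHom : el.map (zeroHom A B) = 0 := by
  change ho.map (zeroHom A B ≫ corner B) = ho.map (zeroHom A B.stabObj)
  rw [zeroHom_comp]

theorem stabMap_zeroHom : stabMap (zeroHom A B) = zeroHom A.stabObj B.stabObj :=
  XSys.stab_hom_ext fun i j a => by
    rw [XSys.stabMap_stab]; exact map_zero _

theorem el_comp_zero (z : el.obj A ⟶ el.obj B) : z ≫ (0 : el.obj B ⟶ el.obj C) = 0 := by
  change toHo z ≫ hoStab (ho.map (zeroHom B C.stabObj)) ≫ ho.map (stabStab C) = 0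
  rw [hoStab_map, stabMap_zeroHom, ← ho_zero, ho_zero_comp, ho_comp_zero]

theorem el_oplus (f g : A ⟶ B) : el.map (oplus f g) = (el.map f + el.map g) ≫ el.map (corner₂ B) := by
  have h1 : el.map f + el.map g = elMk (oplus (f ≫ corner B) (g ≫ corner B) ≫ matStab B) := rfl
  have h2 : el.map (corner₂ B) ≫ el.map (matMap 2 (corner B)) =
      el.map (corner B) ≫ el.map (corner₂ B.stabObj) := by
    rw [← Functor.map_comp, corner₂_matMap, Functor.map_comp]
  have h3 : IsIso (el.map (matMap 2 (corner B))) := by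
    have : el.map (matMap 2 (corner B)) =
        inv (el.map (corner₂ B)) ≫ el.map (corner B) ≫ el.map (corner₂ B.stabObj) := by
      rw [IsIso.eq_inv_comp, h2]
    rw [this]; infer_instance
  have h4 : el.map (matStab B) ≫ el.map (corner₂ B.stabObj) = 𝟙 _ := by
    rw [← Functor.map_comp, ← CategoryTheory.Functor.map_id]
    refine el_homotopic _ _ (ho_eq_iff.1 ?_)
    rw [Functor.map_comp, ho_matStab_corner₂, CategoryTheory.Functor.map_id]
  rw [← cancel_mono (el.map (matMap 2 (corner B))), Category.assoc, h2, h1, elMk_corner_assoc,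
    Functor.map_comp, Category.assoc, h4, Category.comp_id, ← Functor.map_comp, oplus_matMap]

/-- The functor `q` on the stable homotopy category. -/
def elq (x : el.obj A ⟶ el.obj B) : el.obj A.qObj ⟶ el.obj B.qObj :=
  show ho.obj A.qObj ⟶ ho.obj B.qObj.stabObj from hoq (toHo x) ≫ ho.map (mu B)

theorem elq_elMk (f : A ⟶ B.stabObj) : elq (elMk f) = elMk (qMap f ≫ mu B) :=
  (ho.map_comp _ _).symm

@[simp] theorem elq_map (f : A ⟶ B) : elq (el.map f) = el.map (qMap f) := by
  change elq (elMk (f ≫ corner B)) = _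
  rw [elq_elMk, qMap_comp, Category.assoc, qMap_corner_mu]; rfl

theorem elq_comp (x : el.obj A ⟶ el.obj B) (y : el.obj B ⟶ el.obj C) :
    elq (x ≫ y) = elq x ≫ elq y := by
  refine el_ext ?_
  change hoq (toHo x ≫ hoStab (toHo y) ≫ ho.map (stabStab C)) ≫ ho.map (mu C) =
    (hoq (toHo x) ≫ ho.map (mu B)) ≫ hoStab (hoq (toHo y) ≫ ho.map (mu C)) ≫
      ho.map (stabStab C.qObj)
  have h1 : hoq (hoStab (toHo y)) ≫ ho.map (mu C.stabObj) =
      ho.map (mu B) ≫ hoStab (hoq (toHo y)) := by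
    obtain ⟨f, hf⟩ := ho_surj (toHo y)
    rw [← hf, hoStab_map, hoq_map, hoq_map, hoStab_map, ← Functor.map_comp, qMap_stabMap_mu,
      Functor.map_comp]
  have h2 : hoq (ho.map (stabStab C)) ≫ ho.map (mu C) =
      ho.map (mu C.stabObj) ≫ hoStab (ho.map (mu C)) ≫ ho.map (stabStab C.qObj) := by
    have h3 : hoq (ho.map (corner C.stabObj)) ≫ hoq (ho.map (stabStab C)) = 𝟙 _ := by
      rw [← hoq_comp, ho_corner_stabStab, ← CategoryTheory.Functor.map_id, hoq_map, qMap_id,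
        CategoryTheory.Functor.map_id]
    have h4 : hoq (ho.map (stabStab C)) ≫ hoq (ho.map (corner C.stabObj)) = 𝟙 _ := by
      rw [← hoq_comp, ho_stabStab_corner, ← CategoryTheory.Functor.map_id, hoq_map, qMap_id,
        CategoryTheory.Functor.map_id]
    have : IsIso (hoq (ho.map (corner C.stabObj))) := ⟨_, h3, h4⟩
    rw [← cancel_epi (hoq (ho.map (corner C.stabObj))), ← Category.assoc, h3, Category.id_comp,
      ← Category.assoc, hoq_map, ← Functor.map_comp, qMap_corner_mu, ho_corner_hoStab_assoc,
      ho_corner_stabStab, Category.comp_id]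
  simp only [hoq_comp, hoStab_comp, Category.assoc]
  rw [h2, ← Category.assoc (hoq (hoStab (toHo y))), h1, Category.assoc]

theorem elq_add (x y : el.obj A ⟶ el.obj B) : elq (x + y) = elq x + elq y :=
  hoq_add (toHo x) (toHo y)

theorem elq_π (x : el.obj A ⟶ el.obj B) : elq x ≫ el.map (π B) = el.map (π A) ≫ x := by
  have h1 : mu B ≫ stabMap (π B) = π B.stabObj := by
    have h2 : stabMap (π B) = stabMap (qι B) ≫ stabMap (QLift (𝟙 B) (zeroHom B B)) := by
      rw [← stabMap_comp]; rfl
    rw [h2, ← Category.assoc, mu_stabMap, Category.assoc, QLift_comp, ← stabMap_comp,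
      ← stabMap_comp, Qι_QLift, Qιbar_QLift, stabMap_id, stabMap_zeroHom]
    rfl
  refine el_ext ?_
  rw [toHo_map_comp, toHo_comp, toHo_map, hoStab_comp, hoStab_map, hoStab_map, ho_stabMap_corner,
    Category.assoc, ho_corner_stabStab, Category.comp_id]
  change (hoq (toHo x) ≫ ho.map (mu B)) ≫ _ = _
  rw [Category.assoc, ← Functor.map_comp, h1]
  obtain ⟨f, hf⟩ := ho_surj (toHo x)
  rw [← hf, hoq_map, ← Functor.map_comp, qMap_π, Functor.map_comp]

/-! ### The algebra `QA` and split extensions in the stable homotopy category -/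

theorem homotopic_QLift {f g f' g' : A ⟶ B} (F G : unitInterval → (A ⟶ B))
    (hF : ∀ x, Continuous fun t => (F t).hom x) (hG : ∀ x, Continuous fun t => (G t).hom x)
    (hF0 : F 0 = f) (hG0 : G 0 = g) (hF1 : F 1 = f') (hG1 : G 1 = g') :
    Homotopic (QLift f g) (QLift f' g') := by
  subst hF0 hG0 hF1 hG1
  refine ⟨fun t => QLift (F t) (G t), fun z => ?_, rfl, rfl⟩
  refine Q.continuous_family (F := fun t => Q.lift (F t).hom (G t).hom) (fun x => ?_)
    (fun x => ?_) z
  · simp only [Q.lift_ι]; exact hF x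
  · simp only [Q.lift_ιbar]; exact hG x

theorem homotopic_QLift_oplus_swap (f g h : A ⟶ B) (k : A ⟶ matObj 2 B) :
    Homotopic (QLift k (oplus g h)) (QLift k (oplus h g)) :=
  homotopic_QLift (fun _ => k) (fun t => oplus g h ≫ matRot t B) (fun _ => continuous_const)
    (fun x => continuous_matRot B ((oplus g h).hom x)) rfl
    (by rw [matRot_zero, Category.comp_id]) rfl (by rw [matRot_one, oplus_matSwap])

theorem homotopic_corner₂_Q (A : XCAlg.{u} X) : Homotopic (corner₂ A.QObj)
    (oplus (QLift (𝟙 A) (zeroHom A A) ≫ Qι A) (QLift (zeroHom A A) (𝟙 A) ≫ Qιbar A)) := by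
  have h := homotopic_QLift_oplus_swap (Qιbar A) (Qιbar A) (zeroHom A A.QObj)
    (oplus (Qι A) (zeroHom A A.QObj))
  have e1 : QLift (oplus (Qι A) (zeroHom A A.QObj)) (oplus (Qιbar A) (zeroHom A A.QObj)) =
      corner₂ A.QObj := by
    rw [QLift_oplus, QLift_Qι_Qιbar]
    refine congrArg _ (Q_hom_ext ?_ ?_)
    · rw [Qι_QLift]; rfl
    · rw [Qιbar_QLift]; rfl
  have e2 : QLift (oplus (Qι A) (zeroHom A A.QObj)) (oplus (zeroHom A A.QObj) (Qιbar A)) =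
      oplus (QLift (𝟙 A) (zeroHom A A) ≫ Qι A) (QLift (zeroHom A A) (𝟙 A) ≫ Qιbar A) := by
    rw [QLift_oplus, QLift_comp, QLift_comp, zeroHom_comp, zeroHom_comp, Category.id_comp,
      Category.id_comp]
  rwa [e1, e2] at h

theorem el_Q_decomp (A : XCAlg.{u} X) :
    el.map (QLift (𝟙 A) (zeroHom A A) ≫ Qι A) + el.map (QLift (zeroHom A A) (𝟙 A) ≫ Qιbar A) =
      𝟙 (el.obj A.QObj) := by
  rw [← cancel_mono (el.map (corner₂ A.QObj)), ← el_oplus, Category.id_comp]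
  exact el_homotopic _ _ (homotopic_corner₂_Q A).symm

theorem el_qι_QLift_add (f g : A ⟶ B) :
    el.map (qι A ≫ QLift f g) + el.map (π A ≫ g) = el.map (π A ≫ f) := by
  have hπ : ∀ k : A ⟶ B, π A ≫ k = qι A ≫ QLift k (zeroHom A B) := fun k => by
    have : π A = qι A ≫ QLift (𝟙 A) (zeroHom A A) := rfl
    rw [this, Category.assoc, QLift_comp, Category.id_comp, zeroHom_comp]
  have h := (homotopic_QLift_oplus_swap g g (zeroHom A B) (oplus f g)).comp_left (qι A)
  rw [QLift_oplus, QLift_oplus, comp_oplus, comp_oplus, qι_QLift_self, ← hπ, ← hπ] at h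
  rw [← cancel_mono (el.map (corner₂ B)), ← el_oplus, el_homotopic _ _ h, el_oplus, el_zeroHom,
    add_zero]

end El

end XKK
end

open CategoryTheory
noncomputable section
namespace XKK
open scoped ENNReal MultiplierAlgebra
open TopologicalSpace

/-! ### Multipliers -/

section Mult
variable {R : Type u} [NonUnitalCStarAlgebra R]

theorem eq_of_forall_mul_left_eq {x y : R} (h : ∀ z : R, z * x = z * y) : x = y := by
  rw [← sub_eq_zero, ← CStarRing.star_mul_self_eq_zero_iff, mul_sub, h, sub_self]

theorem Mult.fst_mul (T : 𝓜(ℂ, R)) (r s : R) : T.fst (r * s) = T.fst r * s :=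
  eq_of_forall_mul_left_eq fun z => by
    rw [← T.central, ← mul_assoc, ← mul_assoc, T.central]

theorem Mult.ext_fst {T T' : 𝓜(ℂ, R)} (h : ∀ r, T.fst r = T'.fst r) : T = T' := by
  refine DoubleCentralizer.ext _ _ _ _ (Prod.ext (ContinuousLinearMap.ext h)
    (ContinuousLinearMap.ext fun x => ?_))
  rw [← sub_eq_zero, ← CStarRing.mul_star_self_eq_zero_iff, sub_mul]
  rw [show T.toProd.2 = T.snd from rfl, show T'.toProd.2 = T'.snd from rfl, T.central, T'.central, h,
    sub_self]

theorem Mult.mul_coe (T : 𝓜(ℂ, R)) (r : R) :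
    T * DoubleCentralizer.coe ℂ r = DoubleCentralizer.coe ℂ (T.fst r) :=
  Mult.ext_fst fun s => Mult.fst_mul T r s

theorem Mult.coe_mul (T : 𝓜(ℂ, R)) (r : R) :
    DoubleCentralizer.coe ℂ r * T = DoubleCentralizer.coe ℂ (T.snd r) :=
  Mult.ext_fst fun s => (T.central r s).symm

theorem Mult.coe_injective : Function.Injective (DoubleCentralizer.coeHom (𝕜 := ℂ) (A := R)) := by
  refine (injective_iff_map_eq_zero _).2 fun r hr => ?_
  have h : r * star r = 0 := congrArg (fun T : 𝓜(ℂ, R) => T.fst (star r)) hr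
  exact CStarRing.mul_star_self_eq_zero_iff r |>.1 h

/-- The closed ideal `R` of `M(R)`. -/
def Mult.coeIdeal (R : Type u) [NonUnitalCStarAlgebra R] : TwoSidedIdeal 𝓜(ℂ, R) :=
  TwoSidedIdeal.mk' (Set.range (DoubleCentralizer.coeHom (𝕜 := ℂ) (A := R)))
    ⟨0, map_zero _⟩ (by rintro _ _ ⟨x, rfl⟩ ⟨y, rfl⟩; exact ⟨x + y, map_add _ _ _⟩)
    (by rintro _ ⟨x, rfl⟩; exact ⟨-x, map_neg _ _⟩)
    (by rintro T _ ⟨x, rfl⟩; exact ⟨T.fst x, (Mult.mul_coe T x).symm⟩)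
    (by rintro _ T ⟨x, rfl⟩; exact ⟨T.snd x, (Mult.coe_mul T x).symm⟩)

theorem Mult.mem_coeIdeal {T : 𝓜(ℂ, R)} :
    T ∈ Mult.coeIdeal R ↔ ∃ r, DoubleCentralizer.coe ℂ r = T := TwoSidedIdeal.mem_mk' _ _ _ _ _ _ _

theorem Mult.isClosed_coeIdeal : IsClosed (Mult.coeIdeal R : Set 𝓜(ℂ, R)) := by
  have : (Mult.coeIdeal R : Set 𝓜(ℂ, R)) =
      Set.range (DoubleCentralizer.coeHom (𝕜 := ℂ) (A := R)) := by
    ext T; exact Mult.mem_coeIdeal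
  rw [this]
  exact isClosed_range_hom _ Mult.coe_injective

/-- Conjugation by a unitary. -/
def conjHom {M : Type u} [CStarAlgebra M] (F : M) (hF : star F * F = 1) : M →⋆ₙₐ[ℂ] M where
  toFun T := F * T * star F
  map_smul' c T := by simp
  map_zero' := by simp
  map_add' T T' := by rw [mul_add, add_mul]
  map_mul' T T' := by
    calc F * (T * T') * star F = F * T * 1 * T' * star F := by simp only [mul_assoc, one_mul]
      _ = _ := by rw [← hF]; simp only [mul_assoc]
  map_star' T := by simp [mul_assoc]

theorem exp_mem_of_isClosed {M : Type u} [CStarAlgebra M] {V : Subalgebra ℂ M}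
    (hV : IsClosed (V : Set M)) {x : M} (hx : x ∈ V) : NormedSpace.exp x ∈ V := by
  have h := (NormedSpace.exp_series_hasSum_exp' (𝕂 := ℂ) x)
  exact hV.mem_of_tendsto h (Filter.Eventually.of_forall fun s =>
    V.sum_mem fun n _ => V.smul_mem (V.pow_mem hx n) _)

theorem star_exp_mul_exp {M : Type u} [CStarAlgebra M] {x : M} (hx : star x = -x) :
    star (NormedSpace.exp x) * NormedSpace.exp x = 1 := by
  let : NormedAlgebra ℚ M := NormedAlgebra.restrictScalars ℚ ℂ M
  have : NormedSpace.exp x ∈ unitary M :=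
    NormedSpace.exp_mem_unitary_of_mem_skewAdjoint (skewAdjoint.mem_iff.2 hx)
  exact (Unitary.mem_iff.1 this).1

theorem exp_mul_star_exp {M : Type u} [CStarAlgebra M] {x : M} (hx : star x = -x) :
    NormedSpace.exp x * star (NormedSpace.exp x) = 1 := by
  let : NormedAlgebra ℚ M := NormedAlgebra.restrictScalars ℚ ℂ M
  have : NormedSpace.exp x ∈ unitary M :=
    NormedSpace.exp_mem_unitary_of_mem_skewAdjoint (skewAdjoint.mem_iff.2 hx)
  exact (Unitary.mem_iff.1 this).2

section RotPath
variable {M : Type u} [CStarAlgebra M] (S : M)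

/-- The path `exp (πi/2 · tS)`. -/
def rotPath (t : ℝ) : M := NormedSpace.exp ((Real.pi / 2 * t * Complex.I : ℂ) • S)

theorem rotPath_zero : rotPath S 0 = 1 := by
  rw [rotPath]; simp [NormedSpace.exp_zero]

theorem continuous_rotPath : Continuous (rotPath S) := by
  let : NormedAlgebra ℚ M := NormedAlgebra.restrictScalars ℚ ℂ _
  have h := NormedSpace.exp_continuous (𝔸 := M)
  refine h.comp ?_
  fun_prop

variable {S}

theorem star_rotPath_mul (hS : IsSelfAdjoint S) (t : ℝ) : star (rotPath S t) * rotPath S t = 1 := by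
  refine star_exp_mul_exp ?_
  rw [star_smul, hS.star_eq, ← neg_smul]
  congr 1
  simp

theorem rotPath_mul_star (hS : IsSelfAdjoint S) (t : ℝ) : rotPath S t * star (rotPath S t) = 1 := by
  refine exp_mul_star_exp ?_
  rw [star_smul, hS.star_eq, ← neg_smul]
  congr 1
  simp

variable {J : TwoSidedIdeal M}

theorem rotPath_commutator_mem (hJ : IsClosed (J : Set M)) (t : ℝ) {d : M} (hd : S * d - d * S ∈ J) :
    rotPath S t * d - d * rotPath S t ∈ J := by
  let V : Subalgebra ℂ M :=
    { carrier := {T | T * d - d * T ∈ J}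
      mul_mem' := fun {a b} (ha : a * d - d * a ∈ J) (hb : b * d - d * b ∈ J) => by
        have : a * b * d - d * (a * b) = a * (b * d - d * b) + (a * d - d * a) * b := by noncomm_ring
        change a * b * d - d * (a * b) ∈ J
        rw [this]
        exact add_mem (J.mul_mem_left _ _ hb) (J.mul_mem_right _ _ ha)
      add_mem' := fun {a b} (ha : a * d - d * a ∈ J) (hb : b * d - d * b ∈ J) => by
        have : (a + b) * d - d * (a + b) = (a * d - d * a) + (b * d - d * b) := by noncomm_ring
        change (a + b) * d - d * (a + b) ∈ J
        rw [this]
        exact add_mem ha hb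
      algebraMap_mem' := fun c => by
        change algebraMap ℂ _ c * d - d * algebraMap ℂ _ c ∈ J
        rw [Algebra.commutes, sub_self]
        exact zero_mem J }
  have hV : IsClosed (V : Set M) := hJ.preimage (by fun_prop : Continuous fun T : M => T * d - d * T)
  exact exp_mem_of_isClosed hV (V.smul_mem hd _)

theorem rotPath_conj_sub_mem (hJ : IsClosed (J : Set M)) (hS : IsSelfAdjoint S) (t : ℝ) {d a b : M}
    (hd : S * d - d * S ∈ J) (ha : d - a ∈ J) (hb : d - b ∈ J) :
    rotPath S t * b * star (rotPath S t) - a ∈ J := by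
  have h := rotPath_commutator_mem hJ t hd
  have hF := rotPath_mul_star hS t
  generalize rotPath S t = F at h hF ⊢
  have e : F * b * star F - a = (d - a) + (F * d - d * F) * star F - F * (d - b) * star F := by
    have : d * F * star F = d := by rw [mul_assoc, hF, mul_one]
    rw [sub_mul, this]; noncomm_ring
  rw [e]
  exact sub_mem (add_mem ha (J.mul_mem_right _ _ h)) (J.mul_mem_right _ _ (J.mul_mem_left _ _ hb))

end RotPath

/-- If `Φ (S T) = σ (Φ T)` for an involution `σ` then
`Φ (exp (cS)) = cosh c • Φ 1 + sinh c • σ (Φ 1)`. -/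
theorem map_exp_of_involution {M : Type u} [CStarAlgebra M] {V : Type v} [NormedAddCommGroup V]
    [NormedSpace ℂ V] (Φ : M →L[ℂ] V) (σ : V → V) (S : M) (hS : ∀ T, Φ (S * T) = σ (Φ T))
    (hσ : ∀ v, σ (σ v) = v) (c : ℂ) :
    Φ (NormedSpace.exp (c • S)) = Complex.cosh c • Φ 1 + Complex.sinh c • σ (Φ 1) := by
  have hpow : ∀ n : ℕ, Φ (S ^ n) = ((1 + (-1) ^ n) / 2 : ℂ) • Φ 1 +
      ((1 - (-1) ^ n) / 2 : ℂ) • σ (Φ 1) := by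
    intro n
    induction n using Nat.twoStepInduction with
    | zero => simp
    | one => simpa using hS 1
    | more n ih _ =>
      rw [pow_succ', pow_succ', hS, hS, hσ, ih, pow_add]; simp
  have h := (NormedSpace.exp_series_hasSum_exp' (𝕂 := ℂ) (c • S)).mapL Φ
  have h1 := NormedSpace.exp_series_hasSum_exp' (𝕂 := ℂ) (c : ℂ)
  have h2 := NormedSpace.exp_series_hasSum_exp' (𝕂 := ℂ) (-c : ℂ)
  have h3 := (((h1.add h2).div_const 2).smul_const (Φ 1)).add
    (((h1.sub h2).div_const 2).smul_const (σ (Φ 1)))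
  refine h.unique ?_
  rw [← Complex.exp_eq_exp_ℂ] at h3
  rw [Complex.cosh, Complex.sinh]
  convert h3 using 2 with n
  rw [smul_pow, map_smul, map_smul, hpow, smul_add, smul_add, smul_smul, smul_smul, smul_smul,
    smul_smul, neg_pow]
  simp only [smul_eq_mul]
  congr 2 <;> ring

end Mult

section Idealizer
variable {E : Type u} [NonUnitalCStarAlgebra E] (R : NonUnitalStarSubalgebra ℂ E)

/-- The elements of `E` that multiply `R` into itself. -/
def idealizer : NonUnitalStarSubalgebra ℂ E where
  carrier := {w | ∀ r ∈ R, w * r ∈ R ∧ r * w ∈ R}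
  add_mem' {a b} ha hb r hr := by
    rw [add_mul, mul_add]
    exact ⟨add_mem (ha r hr).1 (hb r hr).1, add_mem (ha r hr).2 (hb r hr).2⟩
  zero_mem' r _ := by rw [zero_mul, mul_zero]; exact ⟨zero_mem R, zero_mem R⟩
  mul_mem' {a b} ha hb r hr := by
    rw [mul_assoc a b r, ← mul_assoc r a b]
    exact ⟨(ha _ (hb r hr).1).1, (hb _ (ha r hr).2).2⟩
  smul_mem' c a ha r hr := by
    rw [smul_mul_assoc, mul_smul_comm]
    exact ⟨SMulMemClass.smul_mem c (ha r hr).1, SMulMemClass.smul_mem c (ha r hr).2⟩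
  star_mem' {a} ha r hr := by
    have h := ha (star r) (star_mem hr)
    exact ⟨by simpa using star_mem h.2, by simpa using star_mem h.1⟩

theorem mem_idealizer_of_adjoin (s W : Set E) (hW : ∀ w ∈ W, star w ∈ W)
    (h : ∀ w ∈ W, ∀ x ∈ s, w * x ∈ (NonUnitalStarAlgebra.adjoin ℂ s).topologicalClosure ∧
      x * w ∈ (NonUnitalStarAlgebra.adjoin ℂ s).topologicalClosure) {w : E} (hw : w ∈ W) :
    w ∈ idealizer (NonUnitalStarAlgebra.adjoin ℂ s).topologicalClosure := by
  set T := (NonUnitalStarAlgebra.adjoin ℂ s).topologicalClosure with hT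
  have hcl : IsClosed (T : Set E) := NonUnitalStarSubalgebra.isClosed_topologicalClosure _
  have hle : NonUnitalStarAlgebra.adjoin ℂ s ≤ T := NonUnitalStarSubalgebra.le_topologicalClosure _
  have key : ∀ x ∈ NonUnitalStarAlgebra.adjoin ℂ s, ∀ w ∈ W, w * x ∈ T ∧ x * w ∈ T := by
    intro x hx
    induction hx using NonUnitalStarAlgebra.adjoin_induction with
    | mem x hx => exact fun w hw => h w hw x hx
    | add x y _ _ ihx ihy =>
      intro w hw
      rw [mul_add, add_mul]
      exact ⟨add_mem (ihx w hw).1 (ihy w hw).1, add_mem (ihx w hw).2 (ihy w hw).2⟩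
    | zero => intro w hw; rw [mul_zero, zero_mul]; exact ⟨zero_mem T, zero_mem T⟩
    | mul x y hx hy ihx ihy =>
      intro w hw
      rw [← mul_assoc, mul_assoc x y w]
      exact ⟨mul_mem (ihx w hw).1 (hle hy), mul_mem (hle hx) (ihy w hw).2⟩
    | smul c x _ ihx =>
      intro w hw
      rw [mul_smul_comm, smul_mul_assoc]
      exact ⟨SMulMemClass.smul_mem c (ihx w hw).1, SMulMemClass.smul_mem c (ihx w hw).2⟩
    | star x _ ihx =>
      intro w hw
      have h := ihx _ (hW w hw)
      exact ⟨by simpa using star_mem h.2, by simpa using star_mem h.1⟩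
  intro r hr
  have h1 : Continuous fun r : E => w * r := by fun_prop
  have h2 : Continuous fun r : E => r * w := by fun_prop
  exact ⟨hcl.closure_subset (map_mem_closure (f := fun r => w * r) (t := (T : Set E)) h1 hr
      fun x hx => (key x hx w hw).1),
    hcl.closure_subset (map_mem_closure (f := fun r => r * w) (t := (T : Set E)) h2 hr
      fun x hx => (key x hx w hw).2)⟩

variable [hR : IsClosed (R : Set E)]

/-- The multiplier of `R` given by an element of the idealizer. -/
def toMult : idealizer R →⋆ₙₐ[ℂ] 𝓜(ℂ, R) where
  toFun w :=
    { fst := LinearMap.mkContinuous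
        { toFun := fun r => ⟨w * r, (w.2 r r.2).1⟩
          map_add' := fun r s => Subtype.ext (mul_add _ _ _)
          map_smul' := fun c r => Subtype.ext (mul_smul_comm _ _ _) } ‖(w : E)‖
          fun r => norm_mul_le (w : E) (r : E)
      snd := LinearMap.mkContinuous
        { toFun := fun r => ⟨r * w, (w.2 r r.2).2⟩
          map_add' := fun r s => Subtype.ext (add_mul _ _ _)
          map_smul' := fun c r => Subtype.ext (smul_mul_assoc _ _ _) } ‖(w : E)‖
          fun r => (norm_mul_le (r : E) (w : E)).trans_eq (mul_comm _ _)
      central := fun x y => Subtype.ext (mul_assoc _ _ _) }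
  map_smul' c w := Mult.ext_fst fun r => Subtype.ext (smul_mul_assoc _ _ _)
  map_zero' := Mult.ext_fst fun r => Subtype.ext (zero_mul _)
  map_add' w w' := Mult.ext_fst fun r => Subtype.ext (add_mul _ _ _)
  map_mul' w w' := Mult.ext_fst fun r => Subtype.ext (mul_assoc _ _ _)
  map_star' w := Mult.ext_fst fun r => Subtype.ext (by
    rw [DoubleCentralizer.star_fst]
    change star (w : E) * r = star (star (r : E) * w)
    rw [star_mul, star_star])

end Idealizer

end XKK
end

open CategoryTheory
noncomputable section
namespace XKK
open scoped ENNReal MultiplierAlgebra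
open TopologicalSpace

/-! ### The algebra `R` and its multipliers -/

section RAlg
variable {A : Type u} [NonUnitalCStarAlgebra A]

theorem Mat.unit_eq {E : Type u} [NonUnitalCStarAlgebra E] (i j : Fin 2) (a : E) :
    Mat.unit i j a = (Mat.sys 2 E).p i j a := rfl

theorem Mat.diag₂_eq {E : Type u} [NonUnitalCStarAlgebra E] (a b : E) :
    Mat.diag₂ a b = (Mat.sys 2 E).p 0 0 a + (Mat.sys 2 E).p 1 1 b := by
  ext i j
  rw [CStarMatrix.add_apply, Mat.sys_apply, Mat.sys_apply]
  fin_cases i <;> fin_cases j <;> simp [Mat.diag₂]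

variable [SeparableSpace A]

theorem sys00_mem_R (z : q A) : (Mat.sys 2 (Q (Q A))).p 0 0 (η A z) ∈ RSub A :=
  NonUnitalStarSubalgebra.le_topologicalClosure _
    (NonUnitalStarAlgebra.subset_adjoin ℂ _ ⟨z, z, Or.inl rfl⟩)

theorem sys01_mem_R (z w : q A) : (Mat.sys 2 (Q (Q A))).p 0 1 (η A z * ηbar A w) ∈ RSub A :=
  NonUnitalStarSubalgebra.le_topologicalClosure _
    (NonUnitalStarAlgebra.subset_adjoin ℂ _ ⟨z, w, Or.inr (Or.inl rfl)⟩)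

theorem sys10_mem_R (z w : q A) : (Mat.sys 2 (Q (Q A))).p 1 0 (ηbar A z * η A w) ∈ RSub A :=
  NonUnitalStarSubalgebra.le_topologicalClosure _
    (NonUnitalStarAlgebra.subset_adjoin ℂ _ ⟨z, w, Or.inr (Or.inr (Or.inl rfl))⟩)

theorem sys11_mem_R (z : q A) : (Mat.sys 2 (Q (Q A))).p 1 1 (ηbar A z) ∈ RSub A :=
  NonUnitalStarSubalgebra.le_topologicalClosure _
    (NonUnitalStarAlgebra.subset_adjoin ℂ _ ⟨z, z, Or.inr (Or.inr (Or.inr rfl))⟩)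

theorem R_induction {p : Mat 2 (Q (Q A)) → Prop} (hc : IsClosed {M | p M})
    (h00 : ∀ z : q A, p ((Mat.sys 2 (Q (Q A))).p 0 0 (η A z)))
    (h01 : ∀ z w : q A, p ((Mat.sys 2 (Q (Q A))).p 0 1 (η A z * ηbar A w)))
    (h10 : ∀ z w : q A, p ((Mat.sys 2 (Q (Q A))).p 1 0 (ηbar A z * η A w)))
    (h11 : ∀ z : q A, p ((Mat.sys 2 (Q (Q A))).p 1 1 (ηbar A z)))
    (ha : ∀ x y, p x → p y → p (x + y)) (hm : ∀ x y, p x → p y → p (x * y))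
    (hs : ∀ (c : ℂ) x, p x → p (c • x)) (hst : ∀ x, p x → p (star x))
    {M : Mat 2 (Q (Q A))} (hM : M ∈ RSub A) : p M := by
  refine hc.closure_subset_iff.2 ?_ (show M ∈ closure _ from hM)
  intro M hM
  induction hM using NonUnitalStarAlgebra.adjoin_induction with
  | mem x hx =>
    obtain ⟨z, w, rfl | rfl | rfl | rfl⟩ := hx
    exacts [h00 z, h01 z w, h10 z w, h11 z]
  | add x y _ _ ihx ihy => exact ha _ _ ihx ihy
  | zero => simpa using h00 0
  | mul x y _ _ ihx ihy => exact hm _ _ ihx ihy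
  | smul c x _ ihx => exact hs _ _ ihx
  | star x _ ihx => exact hst _ ihx

/-- `qA` is an ideal of `QA`. -/
theorem mul_mem_q (a : Q A) (z : q A) : ∃ z' : q A, (z' : Q A) = a * z :=
  ⟨⟨a * z, show Q.fold A (a * z) = 0 by rw [map_mul, show Q.fold A z = 0 from z.2, mul_zero]⟩, rfl⟩

theorem mem_q_mul (a : Q A) (z : q A) : ∃ z' : q A, (z' : Q A) = z * a :=
  ⟨⟨z * a, show Q.fold A (z * a) = 0 by rw [map_mul, show Q.fold A z = 0 from z.2, zero_mul]⟩, rfl⟩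

theorem diag_mem_idealizer (a b : Q A) :
    Mat.diag₂ (η A a) (ηbar A b) ∈ idealizer (RSub A) := by
  refine mem_idealizer_of_adjoin _
    (Set.range fun x : Q A × Q A => Mat.diag₂ (η A x.1) (ηbar A x.2)) ?_ ?_ ⟨(a, b), rfl⟩
  · rintro _ ⟨⟨a, b⟩, rfl⟩
    refine ⟨(star a, star b), ?_⟩
    beta_reduce
    rw [Mat.diag₂_eq, Mat.diag₂_eq, star_add, MatSys.star_p, MatSys.star_p, map_star (η A),
      map_star (ηbar A)]
  · rintro _ ⟨⟨a, b⟩, rfl⟩ _ ⟨z, w, rfl | rfl | rfl | rfl⟩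
    all_goals
      change _ ∈ RSub A ∧ _ ∈ RSub A
      beta_reduce
      rw [Mat.unit_eq, Mat.diag₂_eq, add_mul, mul_add]
    · obtain ⟨z', hz'⟩ := mul_mem_q a z
      obtain ⟨z'', hz''⟩ := mem_q_mul a z
      rw [MatSys.mul_same, MatSys.mul_same,
        MatSys.mul_ne _ _ _ _ _ _ _ (by decide), MatSys.mul_ne _ _ _ _ _ _ _ (by decide),
        add_zero, add_zero, ← map_mul, ← map_mul, ← hz', ← hz'']
      exact ⟨sys00_mem_R _, sys00_mem_R _⟩
    · obtain ⟨z', hz'⟩ := mul_mem_q a z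
      obtain ⟨w', hw'⟩ := mem_q_mul b w
      rw [MatSys.mul_same, MatSys.mul_same,
        MatSys.mul_ne _ _ _ _ _ _ _ (by decide), MatSys.mul_ne _ _ _ _ _ _ _ (by decide),
        add_zero, zero_add, ← mul_assoc, mul_assoc (η A z), ← map_mul, ← map_mul, ← hz', ← hw']
      exact ⟨sys01_mem_R _ _, sys01_mem_R _ _⟩
    · obtain ⟨z', hz'⟩ := mul_mem_q b z
      obtain ⟨w', hw'⟩ := mem_q_mul a w
      rw [MatSys.mul_same, MatSys.mul_same,
        MatSys.mul_ne _ _ _ _ _ _ _ (by decide), MatSys.mul_ne _ _ _ _ _ _ _ (by decide),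
        add_zero, zero_add, ← mul_assoc, mul_assoc (ηbar A z), ← map_mul, ← map_mul, ← hz', ← hw']
      exact ⟨sys10_mem_R _ _, sys10_mem_R _ _⟩
    · obtain ⟨z', hz'⟩ := mul_mem_q b z
      obtain ⟨z'', hz''⟩ := mem_q_mul b z
      rw [MatSys.mul_same, MatSys.mul_same,
        MatSys.mul_ne _ _ _ _ _ _ _ (by decide), MatSys.mul_ne _ _ _ _ _ _ _ (by decide),
        zero_add, zero_add, ← map_mul, ← map_mul, ← hz', ← hz'']
      exact ⟨sys11_mem_R _, sys11_mem_R _⟩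

/-- The multiplication of `R` by `η(f x) ⊕ η̄(g x)`. -/
def diagMult {B : Type u} [NonUnitalCStarAlgebra B] (f g : B →⋆ₙₐ[ℂ] Q A) :
    B →⋆ₙₐ[ℂ] 𝓜(ℂ, RSub A) :=
  (toMult (RSub A)).comp (NonUnitalStarAlgHom.codRestrict
    (Mat.oplus ((η A).comp f) ((ηbar A).comp g)) (idealizer (RSub A))
    fun x => diag_mem_idealizer (f x) (g x))

theorem isMulBy_diagMult {B : Type u} [NonUnitalCStarAlgebra B] (f g : B →⋆ₙₐ[ℂ] Q A) (x : B) :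
    IsMulBy (diagMult f g x) (Mat.diag₂ (η A (f x)) (ηbar A (g x))) := fun _ => ⟨rfl, rfl⟩

theorem IsMulBy.unique {m m' : 𝓜(ℂ, RSub A)} {w : Mat 2 (Q (Q A))} (h : IsMulBy m w)
    (h' : IsMulBy m' w) : m = m' :=
  Mult.ext_fst fun r => Subtype.ext ((h r).1.trans (h' r).1.symm)

/-- The element `ιx - ῑx` of `qA`. -/
def qDiff (x : A) : q A := ⟨ι x - ιbar x, show Q.fold A _ = 0 by
  rw [map_sub, Q.fold, Q.lift_ι, Q.lift_ιbar, sub_self]⟩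

theorem rotPath_one (S : 𝓜(ℂ, RSub A)) : rotPath S 1 = rotExp S := by
  rw [rotPath, rotExp]; simp

/-- The homomorphism `h₁ ⋆ (Ad F_t ∘ h₂)`. -/
def rotHom {S : 𝓜(ℂ, RSub A)} (hS : IsSelfAdjoint S) (t : ℝ) : Q A →⋆ₙₐ[ℂ] 𝓜(ℂ, RSub A) :=
  Q.lift (diagMult ι ιbar) ((conjHom (rotPath S t) (star_rotPath_mul hS t)).comp
    (diagMult ιbar ι))

theorem continuous_rotHom {S : 𝓜(ℂ, RSub A)} (hS : IsSelfAdjoint S) (z : Q A) :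
    Continuous fun t => rotHom hS t z := by
  refine Q.continuous_family (fun x => ?_) (fun x => ?_) z
  · simp only [rotHom, Q.lift_ι]; exact continuous_const
  · simp only [rotHom, Q.lift_ιbar]
    have := continuous_rotPath S
    change Continuous fun t => rotPath S t * diagMult ιbar ι x * star (rotPath S t)
    fun_prop

theorem rotHom_sub_mem {S : 𝓜(ℂ, RSub A)} (hS : IsRotation S) (t : ℝ) (x : A) :
    rotHom hS.selfAdjoint t (ιbar x) - rotHom hS.selfAdjoint t (ι x) ∈
      Mult.coeIdeal (RSub A) := by
  set J := Mult.coeIdeal (RSub A) with hJ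
  have h1 : diagMult ι ι x - diagMult ι ιbar x ∈ J := by
    refine Mult.mem_coeIdeal.2 ⟨⟨_, sys11_mem_R (qDiff x)⟩, Mult.ext_fst fun r => Subtype.ext ?_⟩
    change (Mat.sys 2 (Q (Q A))).p 1 1 (ηbar A (ι x - ιbar x)) * (r : Mat 2 (Q (Q A))) =
      Mat.diag₂ (η A (ι x)) (ηbar A (ι x)) * (r : Mat 2 (Q (Q A))) -
      Mat.diag₂ (η A (ι x)) (ηbar A (ιbar x)) * (r : Mat 2 (Q (Q A)))
    rw [← sub_mul, Mat.diag₂_eq, Mat.diag₂_eq, map_sub, map_sub, add_sub_add_left_eq_sub]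
  have h2 : diagMult ι ι x - diagMult ιbar ι x ∈ J := by
    refine Mult.mem_coeIdeal.2 ⟨⟨_, sys00_mem_R (qDiff x)⟩, Mult.ext_fst fun r => Subtype.ext ?_⟩
    change (Mat.sys 2 (Q (Q A))).p 0 0 (η A (ι x - ιbar x)) * (r : Mat 2 (Q (Q A))) =
      Mat.diag₂ (η A (ι x)) (ηbar A (ι x)) * (r : Mat 2 (Q (Q A))) -
      Mat.diag₂ (η A (ιbar x)) (ηbar A (ι x)) * (r : Mat 2 (Q (Q A)))
    rw [← sub_mul, Mat.diag₂_eq, Mat.diag₂_eq, map_sub, map_sub, add_sub_add_right_eq_sub]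
  obtain ⟨d, hd, r, -, hr⟩ := hS.commutes x
  obtain rfl : diagMult ι ι x = d := (isMulBy_diagMult ι ι x).unique hd
  rw [rotHom, Q.lift_ι, Q.lift_ιbar]
  exact rotPath_conj_sub_mem Mult.isClosed_coeIdeal hS.selfAdjoint t
    (Mult.mem_coeIdeal.2 ⟨r, hr.symm⟩) h1 h2

end RAlg

end XKK
end

open CategoryTheory
noncomputable section
namespace XKK
open scoped ENNReal MultiplierAlgebra
open TopologicalSpace

/-! ### Homomorphisms to multiplier algebras -/

section MultHom
variable {R : Type u} [NonUnitalCStarAlgebra R]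

/-- The factorization of a homomorphism through an injective one. -/
def factorHom {B : Type u} {C : Type v} {E : Type w} [NonUnitalCStarAlgebra B]
    [NonUnitalCStarAlgebra C] [NonUnitalCStarAlgebra E] (i : C →⋆ₙₐ[ℂ] E)
    (hi : Function.Injective i) (f : B →⋆ₙₐ[ℂ] E) (hf : ∀ b, ∃ c, i c = f b) : B →⋆ₙₐ[ℂ] C where
  toFun b := (hf b).choose
  map_smul' c x := hi ((hf _).choose_spec.trans ((map_smul f c x).trans
    ((congrArg (c • ·) (hf x).choose_spec.symm).trans (map_smul i c _).symm)))
  map_zero' := hi (by rw [(hf _).choose_spec, map_zero, map_zero])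
  map_add' x y := hi (by
    rw [(hf _).choose_spec, map_add, map_add, (hf x).choose_spec, (hf y).choose_spec])
  map_mul' x y := hi (by
    rw [(hf _).choose_spec, map_mul, map_mul, (hf x).choose_spec, (hf y).choose_spec])
  map_star' x := hi (by rw [(hf _).choose_spec, map_star, map_star, (hf x).choose_spec])

theorem factorHom_apply {B : Type u} {C : Type v} {E : Type w} [NonUnitalCStarAlgebra B]
    [NonUnitalCStarAlgebra C] [NonUnitalCStarAlgebra E] (i : C →⋆ₙₐ[ℂ] E)
    (hi : Function.Injective i) (f : B →⋆ₙₐ[ℂ] E) (hf : ∀ b, ∃ c, i c = f b) (b : B) :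
    i (factorHom i hi f hf b) = f b := (hf b).choose_spec

theorem Q.hom_sub_mem {A : Type u} [NonUnitalCStarAlgebra A] [SeparableSpace A] {M : Type v}
    [NonUnitalCStarAlgebra M] (H : Q A →⋆ₙₐ[ℂ] M) {J : TwoSidedIdeal M}
    (hJ : IsClosed (J : Set M)) (h : ∀ x, H (ιbar x) - H (ι x) ∈ J) (z : Q A) :
    H z - H (ι (Q.fold A z)) ∈ J := by
  have hc : Continuous fun z => H z - H (ι (Q.fold A z)) :=
    (hom_continuous H).sub ((hom_continuous H).comp ((hom_continuous ι).comp
      (hom_continuous (Q.fold A))))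
  refine Q.induction (p := fun z => H z - H (ι (Q.fold A z)) ∈ J) (hJ.preimage hc)
    (fun x => ?_) (fun x => ?_) (fun x y hx hy => ?_) (fun x y hx hy => ?_) (fun c x hx => ?_) z
  · simp [Q.fold, zero_mem]
  · simpa [Q.fold] using h x
  · simp only [map_add]
    rw [add_sub_add_comm]
    exact add_mem hx hy
  · simp only [map_mul]
    rw [show H x * H y - H (ι (Q.fold A x)) * H (ι (Q.fold A y)) =
      H x * (H y - H (ι (Q.fold A y))) + (H x - H (ι (Q.fold A x))) * H (ι (Q.fold A y)) by
        rw [mul_sub, sub_mul]; abel]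
    exact add_mem (J.mul_mem_left _ _ hy) (J.mul_mem_right _ _ hx)
  · simp only [map_smul]
    rw [← smul_sub]
    exact smul_mem_closedIdeal hJ c hx

theorem Mult.fst_mem {K : TwoSidedIdeal R} (hK : IsClosed (K : Set R)) (T : 𝓜(ℂ, R)) {k : R}
    (hk : k ∈ K) : T.fst k ∈ K := by
  refine hK.closure_subset (Metric.mem_closure_iff.2 fun ε hε => ?_)
  obtain ⟨e, -, -, -, he, -⟩ := exists_approx_unit_mem hK hk
    (show 0 < ε / (‖T.fst‖ + 1) by positivity)
  refine ⟨T.fst (e * k), ?_, ?_⟩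
  · rw [Mult.fst_mul]
    exact K.mul_mem_left _ _ hk
  · rw [dist_comm, dist_eq_norm, ← map_sub]
    refine (T.fst.le_opNorm _).trans_lt ?_
    rw [lt_div_iff₀ (by positivity)] at he
    nlinarith [norm_nonneg (e * k - k)]

/-- The evaluation `T ↦ Tr`. -/
def Mult.eval (r : R) : 𝓜(ℂ, R) →L[ℂ] R :=
  LinearMap.mkContinuous
    { toFun := fun T => T.fst r
      map_add' := fun _ _ => rfl
      map_smul' := fun _ _ => rfl } ‖r‖ fun T => by
    rw [mul_comm, ← DoubleCentralizer.norm_fst]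
    exact T.fst.le_opNorm r

@[simp] theorem Mult.eval_apply (r : R) (T : 𝓜(ℂ, R)) : Mult.eval r T = T.fst r := rfl

/-- The multipliers that map `R` to the ideal `K`. -/
def Mult.idealOf {K : TwoSidedIdeal R} (hK : IsClosed (K : Set R)) : TwoSidedIdeal 𝓜(ℂ, R) :=
  TwoSidedIdeal.mk' {T | ∀ r, T.fst r ∈ K} (fun _ => zero_mem K)
    (fun hx hy r => add_mem (hx r) (hy r)) (fun hx r => neg_mem (hx r))
    (fun {T _} hT' r => Mult.fst_mem hK T (hT' r)) (fun hT r => hT _)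

theorem Mult.mem_idealOf {K : TwoSidedIdeal R} (hK : IsClosed (K : Set R)) {T : 𝓜(ℂ, R)} :
    T ∈ Mult.idealOf hK ↔ ∀ r, T.fst r ∈ K := TwoSidedIdeal.mem_mk' _ _ _ _ _ _ _

theorem Mult.isClosed_idealOf {K : TwoSidedIdeal R} (hK : IsClosed (K : Set R)) :
    IsClosed (Mult.idealOf hK : Set 𝓜(ℂ, R)) := by
  have : (Mult.idealOf hK : Set 𝓜(ℂ, R)) = ⋂ r, Mult.eval r ⁻¹' (K : Set R) := by
    ext T; simp [Mult.mem_idealOf]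
  rw [this]
  exact isClosed_iInter fun r => hK.preimage (Mult.eval r).continuous

theorem Mult.mem_of_coe_mem_idealOf {K : TwoSidedIdeal R} (hK : IsClosed (K : Set R)) {r : R}
    (h : DoubleCentralizer.coe ℂ r ∈ Mult.idealOf hK) : r ∈ K := by
  refine hK.closure_subset (Metric.mem_closure_iff.2 fun ε hε => ?_)
  obtain ⟨e, -, -, he⟩ := exists_approx_unit R {r} hε
  refine ⟨r * e, (Mult.mem_idealOf hK).1 h e, ?_⟩
  rw [dist_comm, dist_eq_norm]
  exact (he r (Finset.mem_singleton_self _)).2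

theorem Q.map_fst_eq {A : Type u} [NonUnitalCStarAlgebra A] {E : Type v} [NonUnitalCStarAlgebra E]
    (θ : R →⋆ₙₐ[ℂ] E) (H : Q A →⋆ₙₐ[ℂ] 𝓜(ℂ, R)) (G : Q A →⋆ₙₐ[ℂ] E)
    (h₁ : ∀ x r, θ ((H (ι x)).fst r) = G (ι x) * θ r)
    (h₂ : ∀ x r, θ ((H (ιbar x)).fst r) = G (ιbar x) * θ r) (z : Q A) (r : R) :
    θ ((H z).fst r) = G z * θ r := by
  refine Q.induction (p := fun z => ∀ r, θ ((H z).fst r) = G z * θ r) ?_ h₁ h₂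
    (fun x y hx hy r => ?_) (fun x y hx hy r => ?_) (fun c x hx r => ?_) z r
  · rw [Set.ofPred_forall]
    refine isClosed_iInter fun r => isClosed_eq ?_ ?_
    · exact (hom_continuous θ).comp ((Mult.eval r).continuous.comp (hom_continuous H))
    · exact (hom_continuous G).mul continuous_const
  · rw [map_add H, map_add G, add_mul, ← hx, ← hy, ← map_add θ]; rfl
  · rw [map_mul, map_mul, mul_assoc, ← hy, ← hx]; rfl
  · rw [map_smul H, map_smul G, smul_mul_assoc, ← hx, ← map_smul θ]; rfl

theorem map_rotPath_fst {E : Type v} [NonUnitalCStarAlgebra E] (θ : R →⋆ₙₐ[ℂ] E) (σ : E → E)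
    (hσ : ∀ v, σ (σ v) = v) {S : 𝓜(ℂ, R)} (hS : ∀ r, θ (S.fst r) = σ (θ r)) (t : ℝ) (r : R) :
    θ ((rotPath S t).fst r) = (Real.cos (Real.pi / 2 * t) : ℂ) • θ r +
      (Complex.I * (Real.sin (Real.pi / 2 * t) : ℂ)) • σ (θ r) := by
  let Θ : R →L[ℂ] E := ⟨(θ : R →ₗ[ℂ] E), hom_continuous θ⟩
  have h := map_exp_of_involution (Θ.comp (Mult.eval r)) σ S (fun T => hS (T.fst r)) hσ
    (Real.pi / 2 * t * Complex.I)
  rw [Complex.cosh_mul_I, Complex.sinh_mul_I, mul_comm (Complex.sin _)] at h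
  rw [Complex.ofReal_cos, Complex.ofReal_sin]
  push_cast
  exact h

end MultHom

end XKK
end

open CategoryTheory
noncomputable section
namespace XKK
open scoped ENNReal MultiplierAlgebra
open TopologicalSpace

/-! ### The path from `η ⊕ η̄δ` to `φ` -/

section PhiPath
variable {A : Type u} [NonUnitalCStarAlgebra A] [SeparableSpace A]

theorem qIncl_mul_left (a : Q A) (z : q A) : ∃ z' : q A, qIncl z' = a * qIncl z := mul_mem_q a z

theorem Qmap_qIncl_injective : Function.Injective (Q.map (qIncl (A := A))) :=
  Qmap_injective qIncl qIncl_injective qIncl_mul_left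

theorem Mat.map_injective {E : Type u} {D : Type v} [NonUnitalCStarAlgebra E]
    [NonUnitalCStarAlgebra D] (n : ℕ) {f : E →⋆ₙₐ[ℂ] D} (hf : Function.Injective f) :
    Function.Injective (Mat.map n f) := fun M N h => CStarMatrix.ext fun k l =>
  hf (congrFun (congrFun h k) l)

/-- `R` is contained in `M₂(Q(qA))`. -/
theorem R_subset_range {M : Mat 2 (Q (Q A))} (hM : M ∈ RSub A) :
    ∃ N, Mat.map 2 (Q.map (qIncl (A := A))) N = M := by
  have hι : ∀ z : q A, η A z = Q.map qIncl (ι z) := fun z => by rw [Q.map, Q.lift_ι]; rfl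
  have hιb : ∀ z : q A, ηbar A z = Q.map qIncl (ιbar z) := fun z => by rw [Q.map, Q.lift_ιbar]; rfl
  refine R_induction (p := fun M => ∃ N, Mat.map 2 (Q.map (qIncl (A := A))) N = M)
    (isClosed_range_hom _ (Mat.map_injective 2 Qmap_qIncl_injective)) (fun z => ?_) (fun z w => ?_)
    (fun z w => ?_) (fun z => ?_) ?_ ?_ ?_ ?_ hM
  · exact ⟨_, (Mat.map_sys _ 0 0 (ι z)).trans (by rw [hι])⟩
  · exact ⟨_, (Mat.map_sys _ 0 1 (ι z * ιbar w)).trans (by rw [map_mul, hι, hιb])⟩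
  · exact ⟨_, (Mat.map_sys _ 1 0 (ιbar z * ι w)).trans (by rw [map_mul, hι, hιb])⟩
  · exact ⟨_, (Mat.map_sys _ 1 1 (ιbar z)).trans (by rw [hιb])⟩
  · rintro _ _ ⟨x, rfl⟩ ⟨y, rfl⟩; exact ⟨x + y, map_add _ _ _⟩
  · rintro _ _ ⟨x, rfl⟩ ⟨y, rfl⟩; exact ⟨x * y, map_mul _ _ _⟩
  · rintro c _ ⟨x, rfl⟩; exact ⟨c • x, map_smul _ _ _⟩
  · rintro _ ⟨x, rfl⟩; exact ⟨star x, map_star _ _⟩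

theorem rotHom_mem_coeIdeal {S : 𝓜(ℂ, RSub A)} (hS : IsRotation S) (t : ℝ) (z : q A) :
    rotHom hS.selfAdjoint t (qIncl z) ∈ Mult.coeIdeal (RSub A) := by
  have h := Q.hom_sub_mem (rotHom hS.selfAdjoint t) Mult.isClosed_coeIdeal
    (rotHom_sub_mem hS t) (qIncl z)
  rwa [show Q.fold A (qIncl z) = 0 from z.2, map_zero ι, map_zero, sub_zero] at h

/-- The restriction of `h₁ ⋆ (Ad F_t ∘ h₂)` to a homomorphism `qA → R`. -/
def rotR {S : 𝓜(ℂ, RSub A)} (hS : IsRotation S) (t : ℝ) : q A →⋆ₙₐ[ℂ] RSub A :=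
  factorHom (DoubleCentralizer.coeHom (𝕜 := ℂ) (A := RSub A)) Mult.coe_injective
    ((rotHom hS.selfAdjoint t).comp qIncl) fun z => Mult.mem_coeIdeal.1 (rotHom_mem_coeIdeal hS t z)

theorem coe_rotR {S : 𝓜(ℂ, RSub A)} (hS : IsRotation S) (t : ℝ) (z : q A) :
    DoubleCentralizer.coe ℂ (rotR hS t z) = rotHom hS.selfAdjoint t (qIncl z) :=
  factorHom_apply (DoubleCentralizer.coeHom (𝕜 := ℂ) (A := RSub A)) _ _ _ z

theorem continuous_rotR {S : 𝓜(ℂ, RSub A)} (hS : IsRotation S) (z : q A) :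
    Continuous fun t => rotR hS t z :=
  continuous_of_injective_hom _ (Mult.coe_injective (R := RSub A)) (by
    refine (continuous_rotHom hS.selfAdjoint (qIncl z)).congr fun t => ?_
    exact (coe_rotR hS t z).symm)

/-- The homomorphism `φ_t : qA → M₂(Q(qA))`. -/
def phiPath {S : 𝓜(ℂ, RSub A)} (hS : IsRotation S) (t : ℝ) : q A →⋆ₙₐ[ℂ] Mat 2 (Q (q A)) :=
  factorHom (Mat.map 2 (Q.map (qIncl (A := A)))) (Mat.map_injective 2 Qmap_qIncl_injective)
    ((NonUnitalStarSubalgebraClass.subtype (RSub A)).comp (rotR hS t))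
    fun z => R_subset_range (rotR hS t z).2

theorem map_phiPath {S : 𝓜(ℂ, RSub A)} (hS : IsRotation S) (t : ℝ) (z : q A) :
    Mat.map 2 (Q.map (qIncl (A := A))) (phiPath hS t z) = (rotR hS t z : Mat 2 (Q (Q A))) :=
  factorHom_apply _ _ _ _ z

theorem continuous_phiPath {S : 𝓜(ℂ, RSub A)} (hS : IsRotation S) (z : q A) :
    Continuous fun t => phiPath hS t z :=
  continuous_of_injective_hom _ (Mat.map_injective 2 (Qmap_qIncl_injective (A := A))) (by
    refine (continuous_subtype_val.comp (continuous_rotR hS z)).congr fun t => ?_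
    exact (map_phiPath hS t z).symm)

theorem rotHom_zero {S : 𝓜(ℂ, RSub A)} (hS : IsSelfAdjoint S) :
    rotHom hS 0 = diagMult (NonUnitalStarAlgHom.id ℂ (Q A)) (Q.lift ιbar ι) :=
  Q.hom_ext (fun x => by
    rw [rotHom, Q.lift_ι]
    refine (isMulBy_diagMult ι ιbar x).unique ?_
    have := isMulBy_diagMult (NonUnitalStarAlgHom.id ℂ (Q A)) (Q.lift ιbar ι) (ι x)
    rwa [Q.lift_ι] at this) (fun x => by
    rw [rotHom, Q.lift_ιbar]
    change rotPath S 0 * diagMult ιbar ι x * star (rotPath S 0) = _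
    rw [rotPath_zero, one_mul, star_one, mul_one]
    refine (isMulBy_diagMult ιbar ι x).unique ?_
    have := isMulBy_diagMult (NonUnitalStarAlgHom.id ℂ (Q A)) (Q.lift ιbar ι) (ιbar x)
    rwa [Q.lift_ιbar] at this)

/-- The exchange of the rows of a `2 × 2`-matrix. -/
def rowFlip {E : Type u} (M : Mat 2 E) : Mat 2 E := CStarMatrix.ofMatrix fun i j => M i.rev j

theorem rowFlip_apply {E : Type u} (M : Mat 2 E) (i j : Fin 2) : rowFlip M i j = M i.rev j := rfl

theorem rowFlip_rowFlip {E : Type u} (M : Mat 2 E) : rowFlip (rowFlip M) = M :=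
  CStarMatrix.ext fun i j => by rw [rowFlip_apply, rowFlip_apply, Fin.rev_rev]

/-- The quotient map `R → M₂(QA)`. -/
def foldSub (A : Type u) [NonUnitalCStarAlgebra A] [SeparableSpace A] :
    RSub A →⋆ₙₐ[ℂ] Mat 2 (Q A) := (foldR A).comp (NonUnitalStarSubalgebraClass.subtype (RSub A))

theorem foldSub_rotPath {S : 𝓜(ℂ, RSub A)} (hS : IsRotation S) (t : ℝ) (r : RSub A) :
    foldSub A ((rotPath S t).fst r) = (Real.cos (Real.pi / 2 * t) : ℂ) • foldSub A r +
      (Complex.I * (Real.sin (Real.pi / 2 * t) : ℂ)) • rowFlip (foldSub A r) :=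
  map_rotPath_fst (foldSub A) rowFlip rowFlip_rowFlip
    (fun r => CStarMatrix.ext fun i j => hS.lifts r i j) t r

theorem foldR_diag (a b : Q A) : foldR A (Mat.diag₂ (η A a) (ηbar A b)) = Mat.diag₂ a b := by
  rw [Mat.diag₂_eq, Mat.diag₂_eq, map_add, foldR, Mat.map_sys, Mat.map_sys, Q.fold, Q.lift_ι,
    Q.lift_ιbar]; rfl

theorem foldSub_diagMult (f g : A →⋆ₙₐ[ℂ] Q A) (x : A) (r : RSub A) :
    foldSub A ((diagMult f g x).fst r) = Mat.diag₂ (f x) (g x) * foldSub A r := by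
  rw [← foldR_diag]
  exact (congrArg (foldR A) ((isMulBy_diagMult f g x) r).1).trans (map_mul _ _ _)

theorem Mat.mul_diag₂_self {E : Type u} [NonUnitalCStarAlgebra E] (M : Mat 2 E) (a : E)
    (i j : Fin 2) : (M * Mat.diag₂ a a) i j = M i j * a := by
  rw [CStarMatrix.mul_apply, Fin.sum_univ_two]
  fin_cases j <;> simp [Mat.diag₂]

theorem rowFlip_diag₂_mul {E : Type u} [NonUnitalCStarAlgebra E] (a b : E) (M : Mat 2 E) :
    rowFlip (Mat.diag₂ a b * M) = Mat.diag₂ b a * rowFlip M := by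
  refine CStarMatrix.ext fun i j => ?_
  rw [rowFlip_apply, CStarMatrix.mul_apply, CStarMatrix.mul_apply, Fin.sum_univ_two,
    Fin.sum_univ_two, rowFlip_apply, rowFlip_apply]
  fin_cases i <;> simp [Mat.diag₂]

/-- `φ` takes its values in `M₂(q(qA))`. -/
theorem foldR_rotR_one {S : 𝓜(ℂ, RSub A)} (hS : IsRotation S) (z : q A) :
    foldR A (rotR hS 1 z) = 0 := by
  let f : A →⋆ₙₐ[ℂ] Mat 2 (Q A) := Mat.oplus ι ιbar
  have hfold : ∀ r : RSub A, foldSub A ((rotPath S 1).fst r) = Complex.I • rowFlip (foldSub A r) := by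
    intro r
    rw [foldSub_rotPath hS, mul_one, Real.cos_pi_div_two, Real.sin_pi_div_two, Complex.ofReal_zero,
      zero_smul, zero_add, Complex.ofReal_one, mul_one]
  have key : ∀ z r, foldSub A ((rotHom hS.selfAdjoint 1 z).fst r) = Q.lift f f z * foldSub A r := by
    refine Q.map_fst_eq _ _ _ (fun x r => ?_) (fun x r => ?_)
    · rw [rotHom, Q.lift_ι, Q.lift_ι, foldSub_diagMult]; rfl
    · have hr : (rotPath S 1).fst ((star (rotPath S 1)).fst r) = r :=
        congrArg (fun T : 𝓜(ℂ, RSub A) => T.fst r) (rotPath_mul_star hS.selfAdjoint 1)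
      have e : (rotHom hS.selfAdjoint 1 (ιbar x)).fst r =
          (rotPath S 1).fst ((diagMult ιbar ι x).fst ((star (rotPath S 1)).fst r)) := by
        rw [rotHom, Q.lift_ιbar]; rfl
      rw [e]
      generalize (star (rotPath S 1)).fst r = r' at hr ⊢
      rw [← hr, hfold, hfold, foldSub_diagMult, rowFlip_diag₂_mul, Q.lift_ιbar, mul_smul_comm]
      rfl
  have h0 : Q.lift f f (qIncl z) = 0 := by
    have : Q.lift f f = f.comp (Q.fold A) :=
      Q.hom_ext (fun x => by simp [Q.fold]) (fun x => by simp [Q.fold])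
    rw [this]
    exact (congrArg f z.2).trans (map_zero f)
  have h3 : ∀ i j, foldR A (rotR hS 1 z) i j ∈ qSub A := by
    intro i j
    rw [← map_phiPath]
    change Q.fold (Q A) (Q.map qIncl (phiPath hS 1 z i j)) ∈ qSub A
    rw [Q.fold_map]
    exact SetLike.coe_mem _
  have h4 : ∀ e : q A, foldR A (rotR hS 1 z) * Mat.diag₂ (e : Q A) e = 0 := by
    intro e
    have hr : Mat.diag₂ (η A e) (ηbar A e) ∈ RSub A := by
      rw [Mat.diag₂_eq]
      exact add_mem (sys00_mem_R e) (sys11_mem_R e)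
    have h := key (qIncl z) ⟨_, hr⟩
    rw [← coe_rotR hS, h0, zero_mul] at h
    have h5 : foldSub A (rotR hS 1 z * ⟨_, hr⟩) = 0 := h
    rw [map_mul] at h5
    rw [← foldR_diag]
    exact h5
  refine CStarMatrix.ext fun i j => ?_
  let y : q A := ⟨foldR A (rotR hS 1 z) i j, h3 i j⟩
  have hy : (y : Q A) * star (y : Q A) = 0 := by
    have h := congrFun (congrFun (h4 (star y)) i) j
    rwa [Mat.mul_diag₂_self] at h
  exact (CStarRing.mul_star_self_eq_zero_iff _).1 hy

end PhiPath

end XKK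
end

open CategoryTheory
noncomputable section
namespace XKK
open scoped ENNReal MultiplierAlgebra
open TopologicalSpace

open XCAlg
variable {X : Type v} [TopologicalSpace X]

section PhiX
variable {A : XCAlg.{u} X} {S : 𝓜(ℂ, RSub A)}

theorem diag_mem_matIdeal {E : Type u} [NonUnitalCStarAlgebra E] {I : TwoSidedIdeal E} {a b : E}
    (ha : a ∈ I) (hb : b ∈ I) : Mat.diag₂ a b ∈ matIdeal 2 I :=
  mem_matIdeal.2 fun i j => by
    fin_cases i <;> fin_cases j
    exacts [ha, zero_mem I, zero_mem I, hb]

theorem rotR_mem (hS : IsRotation S) (t : ℝ) (U : Opens X) {z : q A}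
    (hz : z ∈ A.qObj.act.ideal U) :
    (rotR hS t z : Mat 2 (Q (Q A))) ∈ matIdeal 2 (A.QObj.QObj.act.ideal U) := by
  let K : TwoSidedIdeal (RSub A) := (matIdeal 2 (A.QObj.QObj.act.ideal U)).comap
    (NonUnitalStarSubalgebraClass.subtype (RSub A))
  have hK : IsClosed (K : Set (RSub A)) :=
    isClosed_comap _ (isClosed_matIdeal 2 (A.QObj.QObj.act.isClosed_ideal U))
  have hmem : ∀ r : RSub A, r ∈ K ↔ (r : Mat 2 (Q (Q A))) ∈ matIdeal 2 (A.QObj.QObj.act.ideal U) :=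
    fun r => TwoSidedIdeal.mem_comap _
  have hdiag : ∀ (f g : A →⋆ₙₐ[ℂ] Q A), (∀ x ∈ A.act.ideal U, f x ∈ A.QObj.act.ideal U) →
      (∀ x ∈ A.act.ideal U, g x ∈ A.QObj.act.ideal U) → ∀ x ∈ A.act.ideal U,
      diagMult f g x ∈ Mult.idealOf hK := by
    intro f g hf hg x hx
    refine (Mult.mem_idealOf hK).2 fun r => (hmem _).2 ?_
    rw [((isMulBy_diagMult f g x) r).1]
    exact TwoSidedIdeal.mul_mem_right _ _ _ (diag_mem_matIdeal
      ((Qι A.QObj).equivariant U _ (hf x hx)) ((Qιbar A.QObj).equivariant U _ (hg x hx)))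
  have h1 : rotHom hS.selfAdjoint t (qIncl z) ∈ Mult.idealOf hK := by
    refine map_mem_of_mem_closedIdealSpan (rotHom hS.selfAdjoint t) (Mult.isClosed_idealOf hK) ?_
      (mem_qObj_ideal.1 hz)
    rintro _ (⟨x, hx, rfl⟩ | ⟨x, hx, rfl⟩)
    · rw [rotHom, Q.lift_ι]
      exact hdiag _ _ ((Qι A).equivariant U) ((Qιbar A).equivariant U) x hx
    · rw [rotHom, Q.lift_ιbar]
      exact TwoSidedIdeal.mul_mem_right _ _ _ (TwoSidedIdeal.mul_mem_left _ _ _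
        (hdiag _ _ ((Qιbar A).equivariant U) ((Qι A).equivariant U) x hx))
  rw [← coe_rotR hS] at h1
  exact (hmem _).1 (Mult.mem_of_coe_mem_idealOf hK h1)

/-- The path `φ_t` of morphisms `qA → M₂(Q(qA))`. -/
def phiX (hS : IsRotation S) (t : ℝ) : A.qObj ⟶ matObj 2 A.qObj.QObj where
  hom := phiPath hS t
  equivariant U z hz := mem_matIdeal.2 fun i j => by
    have h := mem_matIdeal.1 (rotR_mem hS t U hz) i j
    rw [← map_phiPath (A := A) hS t z] at h
    refine closedIdealSpan_mono ?_ (mem_closedIdealSpan_of_Qmap_mem qIncl qIncl_injective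
      qIncl_mul_left (A.QObj.act.ideal U) (z := phiPath hS t z i j) h)
    exact Set.union_subset_union (Set.image_mono fun x hx => mem_qObj_ideal.2 hx)
      (Set.image_mono fun x hx => mem_qObj_ideal.2 hx)

theorem phiPath_eq {A : Type u} [NonUnitalCStarAlgebra A] [SeparableSpace A] {S : 𝓜(ℂ, RSub A)}
    (hS : IsRotation S) (t : ℝ) {z : q A} {M : Mat 2 (Q (q A))} {r : RSub A}
    (hr : rotHom hS.selfAdjoint t (qIncl z) = DoubleCentralizer.coe ℂ r)
    (hM : Mat.map 2 (Q.map (qIncl (A := A))) M = r) : phiPath hS t z = M :=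
  Mat.map_injective 2 Qmap_qIncl_injective (by
    rw [map_phiPath, hM]
    exact congrArg Subtype.val (Mult.coe_injective ((coe_rotR hS t z).trans hr)))

theorem phiPath_zero {A : Type u} [NonUnitalCStarAlgebra A] [SeparableSpace A] {S : 𝓜(ℂ, RSub A)}
    (hS : IsRotation S) {z w : q A} (hw : qIncl w = Q.lift ιbar ι (qIncl z)) :
    phiPath hS 0 z = Mat.diag₂ (ι z) (ιbar w) := by
  have hr : Mat.diag₂ (η A (qIncl z)) (ηbar A (qIncl w)) ∈ RSub A := by
    rw [Mat.diag₂_eq]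
    exact add_mem (sys00_mem_R z) (sys11_mem_R w)
  refine phiPath_eq hS 0 (r := ⟨_, hr⟩) ?_ ?_
  · rw [rotHom_zero]
    refine Mult.ext_fst fun r => Subtype.ext ?_
    refine ((isMulBy_diagMult _ _ _) r).1.trans ?_
    rw [← hw]; rfl
  · rw [Mat.diag₂_eq, map_add, Mat.map_sys, Mat.map_sys, Q.map, Q.lift_ι, Q.lift_ιbar]
    exact (Mat.diag₂_eq _ _).symm

theorem map_fold_phiPath_one {A : Type u} [NonUnitalCStarAlgebra A] [SeparableSpace A]
    {S : 𝓜(ℂ, RSub A)} (hS : IsRotation S) (z : q A) :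
    Mat.map 2 (Q.fold (q A)) (phiPath hS 1 z) = 0 := by
  refine CStarMatrix.ext fun i j => qIncl_injective (A := A) ?_
  have h := congrFun (congrFun (foldR_rotR_one hS z) i) j
  rw [← map_phiPath] at h
  change Q.fold (Q A) (Q.map qIncl (phiPath hS 1 z i j)) = 0 at h
  rw [Q.fold_map] at h
  exact h.trans (map_zero qIncl).symm

theorem phiX_zero (hS : IsRotation S) :
    phiX hS 0 = oplus (Qι A.qObj) (qSwap A ≫ Qιbar A.qObj) :=
  XHom.ext_apply fun z => phiPath_zero (A := A) hS (DFunLike.congr_fun (congrArg XHom.hom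
    ((kerSeq_q A).qPair_j (Qιbar A) (Qι A) (by rw [Qfold, Qι_QLift, Qιbar_QLift]))) z)

theorem phiX_one_of_isPhi {φ : A.qObj ⟶ matObj 2 A.qObj.qObj} (hφ : IsPhi (A := A) φ.hom) :
    ∃ (S : 𝓜(ℂ, RSub A)) (hS : IsRotation S), φ ≫ matMap 2 (qι A.qObj) = phiX hS 1 := by
  obtain ⟨S, hS, H, h₁, h₂, h₃⟩ := hφ
  refine ⟨S, hS, XHom.ext_apply fun z => ?_⟩
  have hH : H = rotHom hS.selfAdjoint 1 := Q.hom_ext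
    (fun x => by rw [rotHom, Q.lift_ι]; exact (h₁ x).unique (isMulBy_diagMult ι ιbar x))
    (fun x => by
      obtain ⟨m, hm, hx⟩ := h₂ x
      rw [hx, rotHom, Q.lift_ιbar, hm.unique (isMulBy_diagMult ιbar ι x), ← rotPath_one]; rfl)
  obtain ⟨r, hr, hz⟩ := h₃ z
  rw [hH] at hz
  exact (phiPath_eq (A := A) hS 1 hz (by rw [hr]; rfl)).symm

theorem isPhi_of_phiX (hS : IsRotation S) :
    ∃ φ : A.qObj ⟶ matObj 2 A.qObj.qObj, IsPhi (A := A) φ.hom := by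
  have h0 : ∀ z : A.qObj, (matMap 2 (Qfold A.qObj)).hom ((phiX hS 1).hom z) = 0 :=
    map_fold_phiPath_one (A := A) hS
  let φ := ((kerSeq_q A.qObj).mat 2).lift (phiX hS 1) h0
  have hφ : ∀ z : q A, Mat.map 2 (qIncl (A := q A)) (φ.hom z) = phiPath hS 1 z :=
    ((kerSeq_q A.qObj).mat 2).lift_apply (phiX hS 1) h0
  refine ⟨φ, S, hS, rotHom hS.selfAdjoint 1, fun x => ?_, fun x => ?_, fun z => ?_⟩
  · rw [rotHom, Q.lift_ι]; exact isMulBy_diagMult ι ιbar x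
  · refine ⟨_, isMulBy_diagMult ιbar ι x, ?_⟩
    rw [rotHom, Q.lift_ιbar, ← rotPath_one]; rfl
  · refine ⟨rotR hS 1 z, ?_, (coe_rotR hS 1 z).symm⟩
    exact (map_phiPath hS 1 z).symm.trans (congrArg _ (hφ z).symm)

theorem homotopic_phi_π {φ : A.qObj ⟶ matObj 2 A.qObj.qObj} (hφ : IsPhi (A := A) φ.hom) :
    Homotopic (φ ≫ matMap 2 (π A.qObj)) (corner₂ A.qObj) := by
  obtain ⟨S, hS, h⟩ := phiX_one_of_isPhi hφ
  refine Homotopic.symm ⟨fun t => phiX hS t ≫ matMap 2 (QLift (𝟙 _) (zeroHom _ _)), fun z => ?_,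
    ?_, ?_⟩
  · exact (hom_continuous (matMap 2 (QLift (𝟙 A.qObj) (zeroHom _ _))).hom).comp
      ((continuous_phiPath (A := A) hS z).comp continuous_subtype_val)
  · change phiX hS 0 ≫ _ = _
    rw [phiX_zero, oplus_matMap, Category.assoc, Qι_QLift, Qιbar_QLift, comp_zeroHom]; rfl
  · change phiX hS 1 ≫ _ = _
    rw [← h, Category.assoc, ← matMap_comp]; rfl

theorem homotopic_π_phi {φ : A.qObj ⟶ matObj 2 A.qObj.qObj} (hφ : IsPhi (A := A) φ.hom) :
    Homotopic (π A.qObj ≫ φ) (corner₂ A.qObj.qObj) := by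
  obtain ⟨S, hS, h⟩ := phiX_one_of_isPhi hφ
  have hk := (kerSeq_q A.qObj).mat 2
  let g : ℝ → (A.qObj ⟶ matObj 2 A.qObj.QObj) := fun t =>
    phiX hS t ≫ matMap 2 (Qfold A.qObj ≫ Qιbar A.qObj)
  have hg : ∀ t, phiX hS t ≫ matMap 2 (Qfold A.qObj) = g t ≫ matMap 2 (Qfold A.qObj) := fun t => by
    rw [Category.assoc, ← matMap_comp, Category.assoc, Qfold, Qιbar_QLift, Category.comp_id]
  have hf0 : phiX hS 0 ≫ matMap 2 (Qfold A.qObj) = oplus (𝟙 _) (qSwap A) := by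
    rw [phiX_zero, oplus_matMap, Category.assoc, Qfold, Qι_QLift, Qιbar_QLift, Category.comp_id]
  have hc : ∀ z : A.qObj, Continuous fun t : unitInterval => (phiX hS t).hom z := fun z =>
    (continuous_phiPath (A := A) hS z).comp continuous_subtype_val
  refine Homotopic.trans (.of_eq (hk.eq_qPair _ _ (hg 1) ?_)) (.trans (Homotopic.symm
    (hk.homotopic_qPair (hg 0) (hg 1) (fun t => phiX hS t) (fun t => g t) hc
      (fun z => (hom_continuous (matMap 2 (Qfold A.qObj ≫ Qιbar A.qObj)).hom).comp (hc z))
      (fun t => hg t) rfl rfl rfl rfl)) (.of_eq (hk.eq_qPair _ _ (hg 0) ?_).symm))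
  · have : g 1 = zeroHom _ _ := by
      change phiX hS 1 ≫ _ = _
      rw [← h, Category.assoc, matMap_comp, ← Category.assoc (matMap 2 (qι _)), hk.comp_eq_zero,
        zeroHom_comp, comp_zeroHom]
    rw [this, ← h]
    have e : QLift (φ ≫ matMap 2 (qι A.qObj)) (zeroHom _ _) =
        QLift (𝟙 _) (zeroHom _ _) ≫ φ ≫ matMap 2 (qι A.qObj) := by
      rw [QLift_comp, Category.id_comp, zeroHom_comp]
    rw [e]; rfl
  · have : g 0 = oplus (Qιbar A.qObj) (qSwap A ≫ Qιbar A.qObj) := by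
      change phiX hS 0 ≫ _ = _
      rw [matMap_comp, ← Category.assoc, hf0, oplus_matMap, Category.id_comp]
    rw [this, phiX_zero, QLift_oplus, comp_oplus, qι_QLift_self, QLift_Qι_Qιbar, corner₂,
      oplus_matMap, Category.comp_id, Category.id_comp]; rfl

end PhiX

end XKK
end

open CategoryTheory
noncomputable section
namespace XKK
open scoped ENNReal MultiplierAlgebra
open TopologicalSpace

/-! ### Quasicentral approximate units -/

section Quasicentral

theorem norm_pow_intertwine_le {M : Type u} [CStarAlgebra M] {y y' k : M} {C δ : ℝ} (hy : ‖y‖ ≤ C)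
    (hy' : ‖y'‖ ≤ C) (h : ‖y * k - k * y'‖ ≤ δ) (n : ℕ) :
    ‖y ^ n * k - k * y' ^ n‖ ≤ (1 + C) ^ n * δ := by
  have hC : 0 ≤ C := (norm_nonneg _).trans hy
  have hδ : 0 ≤ δ := (norm_nonneg _).trans h
  have hpow : ∀ n : ℕ, ‖(y * k - k * y') * y' ^ n‖ ≤ δ * C ^ n := by
    intro n
    induction n with
    | zero => simpa using h
    | succ n ih =>
      rw [pow_succ, ← mul_assoc, pow_succ, ← mul_assoc]
      exact (norm_mul_le _ _).trans (mul_le_mul ih hy' (norm_nonneg _) (by positivity))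
  induction n with
  | zero => simpa using hδ
  | succ n ih =>
    have e : y ^ (n + 1) * k - k * y' ^ (n + 1) =
        y * (y ^ n * k - k * y' ^ n) + (y * k - k * y') * y' ^ n := by
      rw [pow_succ', pow_succ']; noncomm_ring
    rw [e]
    have h1 : ‖y * (y ^ n * k - k * y' ^ n)‖ ≤ C * ((1 + C) ^ n * δ) :=
      (norm_mul_le _ _).trans (mul_le_mul hy ih (norm_nonneg _) hC)
    have h2 : δ * C ^ n ≤ δ * (1 + C) ^ n := by gcongr; linarith
    calc _ ≤ C * ((1 + C) ^ n * δ) + δ * (1 + C) ^ n :=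
          (norm_add_le _ _).trans (add_le_add h1 ((hpow n).trans h2))
      _ = (1 + C) ^ (n + 1) * δ := by ring

theorem norm_exp_intertwine_le {M : Type u} [CStarAlgebra M] {y y' k : M} {C δ : ℝ} (hy : ‖y‖ ≤ C)
    (hy' : ‖y'‖ ≤ C) (h : ‖y * k - k * y'‖ ≤ δ) :
    ‖NormedSpace.exp y * k - k * NormedSpace.exp y'‖ ≤ Real.exp (1 + C) * δ := by
  have h1 := ((NormedSpace.exp_series_hasSum_exp' (𝕂 := ℂ) y).mul_right k).sub
    ((NormedSpace.exp_series_hasSum_exp' (𝕂 := ℂ) y').mul_left k)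
  have h2 := (NormedSpace.exp_series_hasSum_exp' (𝕂 := ℝ) (1 + C)).mul_right δ
  rw [← Real.exp_eq_exp_ℝ] at h2
  rw [← h1.tsum_eq]
  refine tsum_of_norm_bounded h2 fun n => ?_
  rw [smul_mul_assoc, mul_smul_comm, ← smul_sub, norm_smul, smul_eq_mul, mul_assoc]
  have : ‖((n.factorial : ℂ))⁻¹‖ = ((n.factorial : ℝ))⁻¹ := by simp
  rw [this]
  exact mul_le_mul_of_nonneg_left (norm_pow_intertwine_le hy hy' h n) (by positivity)

theorem exists_approx_unit_sub {M : Type u} [NonUnitalCStarAlgebra M]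
    (J : NonUnitalStarSubalgebra ℂ M) [IsClosed (J : Set M)] (s : Finset M) (hs : ∀ a ∈ s, a ∈ J)
    {ε : ℝ} (hε : 0 < ε) : ∃ b ∈ J, star b = b ∧ ‖b‖ ≤ 1 ∧ ∀ a ∈ s, ‖b * a - a‖ < ε := by
  classical
  obtain ⟨b, hb1, hb2, hb3⟩ := exists_approx_unit J
    (s.attach.image fun a : {a // a ∈ s} => (⟨a.1, hs a.1 a.2⟩ : J)) hε
  exact ⟨b, b.2, congrArg Subtype.val hb1, hb2, fun a ha =>
    (hb3 ⟨a, hs a ha⟩ (Finset.mem_image.2 ⟨⟨a, ha⟩, Finset.mem_attach _ _, rfl⟩)).1⟩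

/-- Quasicentral approximate units exist: `u` is an average of elements of an approximate unit whose
commutators with `y` are almost orthogonal. -/
theorem exists_quasicentral {M : Type u} [NonUnitalCStarAlgebra M] (J : NonUnitalStarSubalgebra ℂ M)
    [IsClosed (J : Set M)] (Y K : Finset M) (hY : ∀ y ∈ Y, y ∈ idealizer J) (hK : ∀ k ∈ K, k ∈ J)
    {ε : ℝ} (hε : 0 < ε) : ∃ u ∈ J, star u = u ∧ ‖u‖ ≤ 1 ∧ (∀ y ∈ Y, ‖u * y - y * u‖ ≤ ε) ∧
      ∀ k ∈ K, ‖u * k - k‖ ≤ ε := by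
  classical
  have key : ∀ N : ℕ, ∃ T ∈ J, star T = T ∧ ‖T‖ ≤ N ∧
      (∀ y ∈ Y, ‖T * y - y * T‖ ^ 2 ≤ N * (4 * ‖y‖ ^ 2 + 1)) ∧
      ∀ k ∈ K, ‖T * k - (N : ℂ) • k‖ ≤ N * ε := by
    intro N
    induction N with
    | zero => exact ⟨0, zero_mem J, by simp, by simp, by simp, by simp⟩
    | succ N ih =>
      obtain ⟨T, hT, hst, hn, hc, hk⟩ := ih
      have hcJ : ∀ y ∈ Y, T * y - y * T ∈ J := fun y hy =>
        sub_mem ((hY y hy) T hT).2 ((hY y hy) T hT).1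
      have hcJ' : ∀ y ∈ Y, star y * (T * y - y * T) ∈ J := fun y hy =>
        ((star_mem (hY y hy)) _ (hcJ y hy)).1
      let B : ℝ := 2 * ∑ y ∈ Y, ‖y‖ + 2
      have hB : ∀ y ∈ Y, ‖y‖ + 1 ≤ B / 2 := fun y hy => by
        have := Finset.single_le_sum (f := fun y => ‖y‖) (fun _ _ => norm_nonneg _) hy
        simp only [B]; linarith
      have hB0 : 0 < B := by
        have := Finset.sum_nonneg (s := Y) (f := fun y => ‖y‖) (fun _ _ => norm_nonneg _)
        simp only [B]; linarith
      let δ : ℝ := min ε (1 / B)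
      have hδ : 0 < δ := lt_min hε (by positivity)
      obtain ⟨b, hbJ, hbs, hbn, hb3⟩ := exists_approx_unit_sub J
        (K ∪ (Y.image (fun y => T * y - y * T) ∪ Y.image (fun y => star y * (T * y - y * T))))
        (fun a ha => by
          rcases Finset.mem_union.1 ha with ha | ha
          · exact hK a ha
          rcases Finset.mem_union.1 ha with ha | ha
          all_goals obtain ⟨y, hy, rfl⟩ := Finset.mem_image.1 ha
          · exact hcJ y hy
          · exact hcJ' y hy) hδ
      refine ⟨T + b, add_mem hT hbJ, ?_, ?_, fun y hy => ?_, fun k hk' => ?_⟩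
      · rw [star_add, hst, hbs]
      · push_cast
        exact (norm_add_le _ _).trans (add_le_add hn hbn)
      · set c := T * y - y * T with hcdef
        set c' := b * y - y * b with hc'def
        have e : (T + b) * y - y * (T + b) = c + c' := by
          rw [add_mul, mul_add, hcdef, hc'def]; abel
        have hc' : ‖c'‖ ≤ 2 * ‖y‖ := by
          refine (norm_sub_le _ _).trans ?_
          have h1 := norm_mul_le b y
          have h2 := norm_mul_le y b
          nlinarith [norm_nonneg y]
        have hbc : ‖b * c - c‖ < δ := hb3 c (Finset.mem_union_right _
          (Finset.mem_union_left _ (Finset.mem_image.2 ⟨y, hy, rfl⟩)))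
        have hbc' : ‖b * (star y * c) - star y * c‖ < δ := hb3 _ (Finset.mem_union_right _
          (Finset.mem_union_right _ (Finset.mem_image.2 ⟨y, hy, rfl⟩)))
        have hcc : ‖star c' * c‖ ≤ 1 / 2 := by
          have e2 : star c' * c = star y * (b * c - c) - (b * (star y * c) - star y * c) := by
            rw [hc'def, star_sub, star_mul, star_mul, hbs, sub_mul, mul_sub (star y) (b * c) c,
              mul_assoc, mul_assoc b]
            abel
          rw [e2]
          have h3 := norm_mul_le (star y) (b * c - c)
          rw [norm_star] at h3
          have h4 : ‖y‖ * ‖b * c - c‖ ≤ ‖y‖ * δ := by gcongr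
          have h5 : (‖y‖ + 1) * δ ≤ 1 / 2 := by
            calc (‖y‖ + 1) * δ ≤ (B / 2) * (1 / B) :=
                  mul_le_mul (hB y hy) (min_le_right _ _) hδ.le (by positivity)
              _ = 1 / 2 := by field_simp
          have := norm_sub_le (star y * (b * c - c)) (b * (star y * c) - star y * c)
          nlinarith
        have hcc' : ‖star c * c'‖ ≤ 1 / 2 := by
          rwa [← norm_star, star_mul, star_star]
        rw [e]
        have e3 : star (c + c') * (c + c') = star c * c + star c' * c' + star c * c' + star c' * c := by
          rw [star_add, add_mul, mul_add, mul_add]; abel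
        have h6 : ‖c + c'‖ ^ 2 ≤ ‖c‖ ^ 2 + ‖c'‖ ^ 2 + 1 / 2 + 1 / 2 := by
          rw [sq, ← CStarRing.norm_star_mul_self, e3, sq, sq, ← CStarRing.norm_star_mul_self (x := c),
            ← CStarRing.norm_star_mul_self (x := c')]
          refine (norm_add_le _ _).trans (add_le_add ((norm_add_le _ _).trans
            (add_le_add (norm_add_le _ _) hcc')) hcc)
        have h7 := hc y hy
        have h8 : ‖c'‖ ^ 2 ≤ 4 * ‖y‖ ^ 2 := by nlinarith [norm_nonneg c', norm_nonneg y]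
        push_cast
        linarith
      · have h1 : ‖b * k - k‖ < δ := hb3 k (Finset.mem_union_left _ hk')
        have e : (T + b) * k - ((N + 1 : ℕ) : ℂ) • k = (T * k - (N : ℂ) • k) + (b * k - k) := by
          push_cast
          rw [add_mul, add_smul, one_smul]; abel
        rw [e]
        push_cast
        have := (norm_add_le (T * k - (N : ℂ) • k) (b * k - k)).trans
          (add_le_add (hk k hk') (h1.le.trans (min_le_left _ _)))
        linarith
  obtain ⟨N, hN0, hN⟩ : ∃ N : ℕ, 0 < N ∧ ∀ y ∈ Y, (4 * ‖y‖ ^ 2 + 1) / N ≤ ε ^ 2 := by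
    obtain ⟨N, hN⟩ := exists_nat_ge (∑ y ∈ Y, (4 * ‖y‖ ^ 2 + 1) / ε ^ 2)
    refine ⟨N + 1, Nat.succ_pos N, fun y hy => ?_⟩
    have h1 := Finset.single_le_sum (f := fun y : M => (4 * ‖y‖ ^ 2 + 1) / ε ^ 2)
      (fun _ _ => by positivity) hy
    rw [div_le_iff₀ (by positivity)]
    have h2 := h1.trans hN
    rw [div_le_iff₀ (by positivity)] at h2
    push_cast
    nlinarith [sq_nonneg ε]
  obtain ⟨T, hT, hst, hn, hc, hk⟩ := key N
  have hNr : (0 : ℝ) < N := by exact_mod_cast hN0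
  have hnorm : ‖((N : ℂ))⁻¹‖ = (N : ℝ)⁻¹ := by simp
  refine ⟨(N : ℂ)⁻¹ • T, SMulMemClass.smul_mem _ hT, ?_, ?_, fun y hy => ?_, fun k hk' => ?_⟩
  · rw [star_smul, hst]; simp
  · rw [norm_smul, hnorm, inv_mul_le_iff₀ hNr, mul_one]; exact hn
  · rw [smul_mul_assoc, mul_smul_comm, ← smul_sub, norm_smul, hnorm, inv_mul_le_iff₀ hNr]
    refine abs_le_of_sq_le_sq' ?_ (by positivity) |>.2
    have h1 := hN y hy
    rw [div_le_iff₀ hNr] at h1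
    nlinarith [hc y hy]
  · have : (N : ℂ)⁻¹ • T * k - k = (N : ℂ)⁻¹ • (T * k - (N : ℂ) • k) := by
      rw [smul_sub, smul_smul, inv_mul_cancel₀ (by exact_mod_cast hN0.ne'), one_smul,
        smul_mul_assoc]
    rw [this, norm_smul, hnorm, inv_mul_le_iff₀ hNr]
    exact hk k hk'

end Quasicentral

end XKK
end

open CategoryTheory
noncomputable section
namespace XKK
open scoped ENNReal MultiplierAlgebra
open TopologicalSpace

section Partition
variable {M : Type u} [CStarAlgebra M]

theorem norm_one_le_one : ‖(1 : M)‖ ≤ 1 := by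
  have h := CStarRing.norm_star_mul_self (x := (1 : M))
  rw [star_one, one_mul] at h
  nlinarith [norm_nonneg (1 : M)]

theorem norm_le_one_of_star_mul_add {c s : M} (h : star c * c + star s * s = 1) : ‖c‖ ≤ 1 := by
  let := CStarAlgebra.spectralOrder M
  have := CStarAlgebra.spectralOrderedRing M
  have h1 : star c * c ≤ 1 := by rw [← h]; exact le_add_of_nonneg_right (star_mul_self_nonneg s)
  have h2 := CStarAlgebra.norm_le_norm_of_nonneg_of_le (star_mul_self_nonneg c) h1
  rw [CStarRing.norm_star_mul_self] at h2
  have := norm_one_le_one (M := M)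
  nlinarith [norm_nonneg c]

variable {I : TwoSidedIdeal M}

theorem exp_sub_one_mem (hI : IsClosed (I : Set M)) {y : M} (hy : y ∈ I) : NormedSpace.exp y - 1 ∈ I := by
  have h := (NormedSpace.exp_series_hasSum_exp' (𝕂 := ℂ) y).tendsto_sum_nat.sub_const 1
  refine hI.mem_of_tendsto h (Filter.eventually_atTop.2 ⟨1, fun n hn => ?_⟩)
  obtain ⟨n, rfl⟩ := Nat.exists_eq_add_of_le' hn
  rw [Finset.sum_range_succ']
  simp only [Nat.factorial_zero, Nat.cast_one, inv_one, pow_zero, one_smul, add_sub_cancel_right]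
  exact sum_mem fun k _ => smul_mem_closedIdeal hI _ (by
    rw [pow_succ]; exact I.mul_mem_left _ _ hy)

theorem exists_quasicentral_pair (hI : IsClosed (I : Set M)) (Y W : Finset M) (hW : ∀ w ∈ W, w ∈ I) {ε : ℝ} (hε : 0 < ε) :
    ∃ c s : M, s ∈ I ∧ c - 1 ∈ I ∧ star c * c + star s * s = 1 ∧
      (∀ y ∈ Y, ‖c * y - y * c‖ ≤ ε ∧ ‖s * y - y * s‖ ≤ ε) ∧ ∀ w ∈ W, ‖c * w‖ ≤ ε := by
  have := isClosed_idealCore hI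
  let B : ℝ := Real.exp (1 + Real.pi) * Real.pi
  have hB : 0 < B := by have := Real.pi_pos; positivity
  obtain ⟨u, hu, hst, hn, hc, hk⟩ := exists_quasicentral (idealCore hI) Y W
    (fun y _ r hr => ⟨⟨I.mul_mem_left _ _ hr.1, by
      rw [star_mul]; exact I.mul_mem_right _ _ hr.2⟩, ⟨I.mul_mem_right _ _ hr.1, by
      rw [star_mul]; exact I.mul_mem_left _ _ hr.2⟩⟩)
    (fun w hw => ⟨hW w hw, star_mem_closedIdeal hI (hW w hw)⟩) (div_pos hε hB)
  let z : ℂ := Real.pi * Complex.I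
  have hz : ‖z‖ = Real.pi := by simp [z, abs_of_pos Real.pi_pos]
  let E : M := NormedSpace.exp (z • u)
  have hEu : star E * E = 1 := star_exp_mul_exp (by
    rw [star_smul, hst, ← neg_smul]; congr 1; simp [z])
  have hmem : E - 1 ∈ I := exp_sub_one_mem hI (smul_mem_closedIdeal hI _ hu.1)
  have hzu : ‖z • u‖ ≤ Real.pi := by
    rw [norm_smul, hz]; nlinarith [Real.pi_pos]
  have hz1 : ‖z • (1 : M)‖ ≤ Real.pi := by
    rw [norm_smul, hz]; nlinarith [Real.pi_pos, norm_one_le_one (M := M)]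
  have hexp : NormedSpace.exp (z • (1 : M)) = -1 := by
    rw [← Algebra.algebraMap_eq_smul_one, ← NormedSpace.algebraMap_exp_comm,
      ← Complex.exp_eq_exp_ℂ, Complex.exp_pi_mul_I, map_neg, map_one]
  have hcomm : ∀ y ∈ Y, ‖E * y - y * E‖ ≤ ε := by
    intro y hy
    have h1 : ‖(z • u) * y - y * (z • u)‖ ≤ Real.pi * (ε / B) := by
      rw [smul_mul_assoc, mul_smul_comm, ← smul_sub, norm_smul, hz]
      exact mul_le_mul_of_nonneg_left (hc y hy) Real.pi_pos.le
    refine (norm_exp_intertwine_le hzu hzu h1).trans_eq ?_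
    simp only [B]; field_simp
  have hunit : ∀ w ∈ W, ‖E * w + w‖ ≤ ε := by
    intro w hw
    have h1 : ‖(z • u) * w - w * (z • (1 : M))‖ ≤ Real.pi * (ε / B) := by
      rw [smul_mul_assoc, mul_smul_comm, mul_one, ← smul_sub, norm_smul, hz]
      exact mul_le_mul_of_nonneg_left (hk w hw) Real.pi_pos.le
    have h2 := norm_exp_intertwine_le hzu hz1 h1
    rw [hexp, mul_neg, mul_one, sub_neg_eq_add] at h2
    refine h2.trans_eq ?_
    simp only [B]; field_simp
  have h2n : ‖(2⁻¹ : ℂ)‖ ≤ 1 := by norm_num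
  have half : ∀ T : M, ‖T‖ ≤ ε → ‖(2⁻¹ : ℂ) • T‖ ≤ ε := fun T hT => by
    rw [norm_smul]; nlinarith [norm_nonneg T]
  refine ⟨(2⁻¹ : ℂ) • (1 + E), (2⁻¹ : ℂ) • (1 - E), ?_, ?_, ?_, fun y hy => ⟨?_, ?_⟩, fun w hw => ?_⟩
  · refine smul_mem_closedIdeal hI _ ?_
    rw [← neg_sub]; exact neg_mem hmem
  · have : (2⁻¹ : ℂ) • (1 + E) - 1 = (2⁻¹ : ℂ) • (E - 1) := by
      module
    rw [this]
    exact smul_mem_closedIdeal hI _ hmem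
  · have e : star (1 + E) * (1 + E) + star (1 - E) * (1 - E) = (4 : ℂ) • (1 : M) := by
      rw [star_add, star_sub, star_one]
      have : (1 + star E) * (1 + E) + (1 - star E) * (1 - E) = 1 + 1 + star E * E + star E * E := by
        noncomm_ring
      rw [this, hEu]; module
    rw [star_smul, star_smul, smul_mul_smul_comm, smul_mul_smul_comm, ← smul_add, e, smul_smul]
    norm_num
  · have : (2⁻¹ : ℂ) • (1 + E) * y - y * (2⁻¹ : ℂ) • (1 + E) = (2⁻¹ : ℂ) • (E * y - y * E) := by
      rw [smul_mul_assoc, mul_smul_comm, ← smul_sub]; congr 1; noncomm_ring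
    rw [this]; exact half _ (hcomm y hy)
  · have : (2⁻¹ : ℂ) • (1 - E) * y - y * (2⁻¹ : ℂ) • (1 - E) = (2⁻¹ : ℂ) • -(E * y - y * E) := by
      rw [smul_mul_assoc, mul_smul_comm, ← smul_sub]; congr 1; noncomm_ring
    rw [this]; exact half _ (by rw [norm_neg]; exact hcomm y hy)
  · have : (2⁻¹ : ℂ) • (1 + E) * w = (2⁻¹ : ℂ) • (E * w + w) := by
      rw [smul_mul_assoc, add_mul, one_mul, add_comm]
    rw [this]; exact half _ (hunit w hw)

/-- A quasicentral partition of unity in the ideal `I`, with respect to the sequence `x` of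
elements of `M` and the sequence `w` of elements of `I`. -/
theorem exists_quasicentral_partition (hI : IsClosed (I : Set M)) (x w : ℕ → M) (hw : ∀ j, w j ∈ I) :
    ∃ a : ℕ → M, (∀ n, a n ∈ I) ∧ (∀ n, ‖a n‖ ≤ 1) ∧
      (∀ n, ‖∑ k ∈ Finset.range n, star (a k) * a k‖ ≤ 1) ∧
      (∀ j n, j < n → ‖a n * w j‖ ≤ 8 * (1 / 2) ^ n) ∧
      (∀ j n, j < n → ‖a n * x j - x j * a n‖ ≤ 8 * (1 / 2) ^ n) ∧
      ∀ j n, j < n → ‖(∑ k ∈ Finset.range n, star (a k) * a k) * w j - w j‖ ≤ 8 * (1 / 2) ^ n := by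
  classical
  have hcI : ∀ (b : {b : M // b - 1 ∈ I ∧ ‖b‖ ≤ 1}) (y : M), (b : M) * y - y * b ∈ I := fun b y => by
    have : (b : M) * y - y * b = ((b : M) - 1) * y - y * ((b : M) - 1) := by noncomm_ring
    rw [this]
    exact sub_mem (I.mul_mem_right _ _ b.2.1) (I.mul_mem_left _ _ b.2.1)
  have step : ∀ (b : {b : M // b - 1 ∈ I ∧ ‖b‖ ≤ 1}) (n : ℕ), ∃ c s : M,
      s ∈ I ∧ c - 1 ∈ I ∧ star c * c + star s * s = 1 ∧
      (∀ j ≤ n, ‖c * x j - x j * c‖ ≤ (1 / 2) ^ n ∧ ‖s * x j - x j * s‖ ≤ (1 / 2) ^ n) ∧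
      (∀ j ≤ n, ‖c * (b * w j)‖ ≤ (1 / 2) ^ n) ∧
      ∀ j ≤ n, ‖c * (b * x j - x j * b)‖ ≤ (1 / 2) ^ n := by
    intro b n
    obtain ⟨c, s, hs, hc, hcs, h1, h2⟩ := exists_quasicentral_pair hI
      ((Finset.range (n + 1)).image x) ((Finset.range (n + 1)).image (fun j => (b : M) * w j) ∪
        (Finset.range (n + 1)).image fun j => (b : M) * x j - x j * b) (fun y hy => by
        rcases Finset.mem_union.1 hy with hy | hy <;> obtain ⟨j, -, rfl⟩ := Finset.mem_image.1 hy
        · exact I.mul_mem_left _ _ (hw j)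
        · exact hcI b (x j)) (show (0 : ℝ) < (1 / 2) ^ n by positivity)
    refine ⟨c, s, hs, hc, hcs, fun j hj => h1 _ (Finset.mem_image_of_mem _ ?_), fun j hj =>
      h2 _ (Finset.mem_union_left _ (Finset.mem_image.2 ⟨j, ?_, rfl⟩)), fun j hj =>
      h2 _ (Finset.mem_union_right _ (Finset.mem_image.2 ⟨j, ?_, rfl⟩))⟩
    all_goals exact Finset.mem_range.2 (Nat.lt_succ_of_le hj)
  choose c s hs hc hcs hx hw' hx' using step
  have hcn : ∀ b n, ‖c b n‖ ≤ 1 := fun b n => norm_le_one_of_star_mul_add (hcs b n)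
  have hsn : ∀ b n, ‖s b n‖ ≤ 1 := fun b n =>
    norm_le_one_of_star_mul_add ((add_comm _ _).trans (hcs b n))
  let next : {b : M // b - 1 ∈ I ∧ ‖b‖ ≤ 1} → ℕ →
      {b : M // b - 1 ∈ I ∧ ‖b‖ ≤ 1} := fun b n => ⟨c b n * b, by
    have : c b n * b - 1 = c b n * (b - 1) + (c b n - 1) := by noncomm_ring
    rw [this]
    exact add_mem (I.mul_mem_left _ _ b.2.1) (hc b n), (norm_mul_le _ _).trans
      (mul_le_one₀ (hcn b n) (norm_nonneg _) b.2.2)⟩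
  obtain ⟨b, hb0, hb⟩ : ∃ b : ℕ → {b : M // b - 1 ∈ I ∧ ‖b‖ ≤ 1}, (b 0).1 = 1 ∧
      ∀ n : ℕ, (b (n + 1)).1 = c (b n) n * (b n).1 :=
    ⟨fun n => Nat.rec (motive := fun _ => {b : M // b - 1 ∈ I ∧ ‖b‖ ≤ 1})
      ⟨1, by rw [sub_self]; exact zero_mem I, norm_one_le_one⟩ (fun n b => next b n) n, rfl,
      fun n => rfl⟩
  have hbn : ∀ n, ‖(b n : M)‖ ≤ 1 := fun n => (b n).2.2
  let a : ℕ → M := fun n => s (b n) n * b n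
  have hsum : ∀ n, ∑ k ∈ Finset.range n, star (a k) * a k = 1 - star (b n : M) * b n := by
    intro n
    induction n with
    | zero =>
      rw [Finset.sum_range_zero]
      rw [hb0]
      simp
    | succ n ih =>
      rw [Finset.sum_range_succ, ih, hb]
      have h := hcs (b n) n
      simp only [a, star_mul]
      have h2 : star (b n : M) * (star (c (b n) n) * c (b n) n + star (s (b n) n) * s (b n) n) * b n =
          star (b n : M) * b n := by rw [h, mul_one]
      rw [← h2]; noncomm_ring
  have hbw : ∀ j n, j < n → ‖(b n : M) * w j‖ ≤ 2 * (1 / 2) ^ n := by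
    intro j n hj
    obtain ⟨n, rfl⟩ := Nat.exists_eq_add_of_le' (Nat.one_le_of_lt hj)
    rw [hb, mul_assoc, pow_succ]
    have := hw' (b n) n j (Nat.le_of_lt_succ hj)
    linarith
  have hbx : ∀ j n, j < n → ‖(b n : M) * x j - x j * b n‖ ≤ 4 * (1 / 2) ^ n := by
    intro j n hj
    obtain ⟨n, rfl⟩ := Nat.exists_eq_add_of_le' (Nat.one_le_of_lt hj)
    have h1 := hx' (b n) n j (Nat.le_of_lt_succ hj)
    have h2 := (hx (b n) n j (Nat.le_of_lt_succ hj)).1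
    rw [hb, pow_succ]
    have e : c (b n) n * b n * x j - x j * (c (b n) n * b n) =
        c (b n) n * (b n * x j - x j * b n) + (c (b n) n * x j - x j * c (b n) n) * b n := by
      noncomm_ring
    rw [e]
    have h3 : ‖(c (b n) n * x j - x j * c (b n) n) * (b n : M)‖ ≤ (1 / 2) ^ n * 1 :=
      (norm_mul_le _ _).trans (mul_le_mul h2 (hbn n) (norm_nonneg _) (by positivity))
    have := norm_add_le (c (b n) n * (b n * x j - x j * b n))
      ((c (b n) n * x j - x j * c (b n) n) * (b n : M))
    linarith
  refine ⟨a, fun n => I.mul_mem_right _ _ (hs _ _), fun n => (norm_mul_le _ _).trans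
    (mul_le_one₀ (hsn _ _) (norm_nonneg _) (hbn n)), fun n => ?_, fun j n hj => ?_, fun j n hj => ?_,
    fun j n hj => ?_⟩
  · let := CStarAlgebra.spectralOrder M
    have := CStarAlgebra.spectralOrderedRing M
    refine (CStarAlgebra.norm_le_norm_of_nonneg_of_le (b := (1 : M))
      (Finset.sum_nonneg fun k _ => star_mul_self_nonneg (a k)) ?_).trans norm_one_le_one
    rw [hsum]
    exact sub_le_self _ (star_mul_self_nonneg _)
  · simp only [a]
    rw [mul_assoc]
    have h1 := norm_mul_le (s (b n) n) (b n * w j)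
    have h2 := hbw j n hj
    nlinarith [hsn (b n) n, norm_nonneg (b n * w j), show (0 : ℝ) ≤ (1 / 2) ^ n by positivity]
  · have e : a n * x j - x j * a n =
        s (b n) n * (b n * x j - x j * b n) + (s (b n) n * x j - x j * s (b n) n) * b n := by
      simp only [a]; noncomm_ring
    rw [e]
    have h1 : ‖s (b n) n * (b n * x j - x j * b n)‖ ≤ 1 * (4 * (1 / 2) ^ n) :=
      (norm_mul_le _ _).trans (mul_le_mul (hsn _ _) (hbx j n hj) (norm_nonneg _) zero_le_one)
    have h2 : ‖(s (b n) n * x j - x j * s (b n) n) * (b n : M)‖ ≤ (1 / 2) ^ n * 1 :=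
      (norm_mul_le _ _).trans (mul_le_mul (hx (b n) n j hj.le).2 (hbn n) (norm_nonneg _)
        (by positivity))
    have := norm_add_le (s (b n) n * (b n * x j - x j * b n))
      ((s (b n) n * x j - x j * s (b n) n) * (b n : M))
    have : (0 : ℝ) ≤ (1 / 2) ^ n := by positivity
    linarith
  · rw [hsum, sub_mul, one_mul, sub_sub_cancel_left, norm_neg, mul_assoc]
    have h1 : ‖star (b n : M) * (b n * w j)‖ ≤ 1 * (2 * (1 / 2) ^ n) :=
      (norm_mul_le _ _).trans (mul_le_mul (by rw [norm_star]; exact hbn n) (hbw j n hj)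
        (norm_nonneg _) zero_le_one)
    have : (0 : ℝ) ≤ (1 / 2) ^ n := by positivity
    linarith

end Partition

end XKK
end

open CategoryTheory
noncomputable section
namespace XKK
open scoped ENNReal MultiplierAlgebra
open TopologicalSpace

section Bounds
variable {N : Type u} [CStarAlgebra N]

/-- The partial sums of the compressions `(1 - U)s(1 - U)` are bounded if `-D⋆D ≤ s ≤ D⋆D`, the
partial sums of `D⋆D` are bounded and `U` commutes approximately with `D`. -/
theorem norm_sum_compression_le {U D s G G' : ℕ → N} (hU : ∀ n, star (U n) = U n)
    (hU1 : ∀ n, ‖U n‖ ≤ 1) (hD : ∀ n, ‖U n * D n - D n * U n‖ ≤ (1 / 2) ^ n)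
    (hG : ∀ n, star (D n) * D n - s n = G n * star (G n))
    (hG' : ∀ n, star (D n) * D n + s n = G' n * star (G' n))
    (hsum : ∀ n, ‖∑ k ∈ Finset.range n, star (D k) * D k‖ ≤ 1) (n : ℕ) :
    ‖∑ k ∈ Finset.range n, (1 - U k) * s k * (1 - U k)‖ ≤ 36 := by
  let := CStarAlgebra.spectralOrder N
  have := CStarAlgebra.spectralOrderedRing N
  have hUs : ∀ k, star (1 - U k) = 1 - U k := fun k => by rw [star_sub, star_one, hU]
  have hU2 : ∀ k, ‖1 - U k‖ ≤ 2 := fun k => (norm_sub_le _ _).trans (by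
    have := norm_one_le_one (M := N); linarith [hU1 k])
  have e1 : ∀ k, s k ≤ star (D k) * D k := fun k => by
    rw [← sub_nonneg, hG]; exact mul_star_self_nonneg _
  have e2 : ∀ k, -s k ≤ star (D k) * D k := fun k => by
    rw [← sub_nonneg, sub_neg_eq_add, hG']; exact mul_star_self_nonneg _
  have e3 : ∀ k, (1 - U k) * (star (D k) * D k) * (1 - U k) ≤
      (8 : ℝ) • (star (D k) * D k) + algebraMap ℝ N (2 * (1 / 2) ^ k) := by
    intro k
    obtain ⟨V, hV⟩ : ∃ V, V = 1 - U k := ⟨_, rfl⟩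
    obtain ⟨Z, hZ⟩ : ∃ Z, Z = U k * D k - D k * U k := ⟨_, rfl⟩
    have hVs : star V = V := by rw [hV, hUs]
    have hVn : ‖V‖ ≤ 2 := by rw [hV]; exact hU2 k
    have hZn : ‖Z‖ ≤ (1 / 2) ^ k := by rw [hZ]; exact hD k
    rw [← hV]
    have h1 : star (D k) * (star V * V) * D k ≤ star (D k) * algebraMap ℝ N 4 * D k := by
      refine star_left_conjugate_le_conjugate ?_ (D k)
      refine CStarAlgebra.star_mul_le_algebraMap_norm_sq.trans (algebraMap_mono N ?_)
      nlinarith [norm_nonneg V]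
    have h2 : star Z * Z ≤ algebraMap ℝ N ((1 / 2) ^ k) := by
      refine CStarAlgebra.star_mul_le_algebraMap_norm_sq.trans (algebraMap_mono N ?_)
      have h4 : (1 / 2 : ℝ) ^ k ≤ 1 := pow_le_one₀ (by norm_num) (by norm_num)
      nlinarith [norm_nonneg Z]
    have h3 : V * (star (D k) * D k) * V = star (V * D k + Z) * (V * D k + Z) := by
      have : V * D k + Z = D k * V := by rw [hV, hZ]; noncomm_ring
      rw [this, star_mul, hVs]; noncomm_ring
    have h4 : star (V * D k + Z) * (V * D k + Z) ≤
        (2 : ℝ) • (star (D k) * (star V * V) * D k) + (2 : ℝ) • (star Z * Z) := by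
      rw [← sub_nonneg]
      have : (2 : ℝ) • (star (D k) * (star V * V) * D k) + (2 : ℝ) • (star Z * Z) -
          star (V * D k + Z) * (V * D k + Z) = star (V * D k - Z) * (V * D k - Z) := by
        rw [two_smul, two_smul, star_add, star_sub (V * D k), star_mul]; noncomm_ring
      rw [this]
      exact star_mul_self_nonneg _
    rw [h3]
    refine h4.trans (add_le_add ?_ ?_)
    · refine (smul_le_smul_of_nonneg_left h1 (by norm_num)).trans_eq ?_
      rw [Algebra.algebraMap_eq_smul_one, mul_smul_comm, mul_one, smul_mul_assoc, smul_smul]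
      norm_num
    · refine (smul_le_smul_of_nonneg_left h2 (by norm_num)).trans_eq ?_
      rw [Algebra.smul_def, ← map_mul]
  have hbound : ∀ t : ℕ → N, (∀ k, t k ≤ star (D k) * D k) →
      ∑ k ∈ Finset.range n, (1 - U k) * t k * (1 - U k) ≤ algebraMap ℝ N 12 := by
    intro t ht
    have h1 : ∀ k, (1 - U k) * t k * (1 - U k) ≤
        (8 : ℝ) • (star (D k) * D k) + algebraMap ℝ N (2 * (1 / 2) ^ k) := fun k => by
      refine le_trans ?_ (e3 k)
      have := star_left_conjugate_le_conjugate (ht k) (1 - U k)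
      rwa [hUs] at this
    refine (Finset.sum_le_sum fun k _ => h1 k).trans ?_
    rw [Finset.sum_add_distrib, ← Finset.smul_sum, ← map_sum]
    have h2 : ∑ k ∈ Finset.range n, star (D k) * D k ≤ algebraMap ℝ N 1 :=
      (CStarAlgebra.norm_le_iff_le_algebraMap _ zero_le_one
        (Finset.sum_nonneg fun k _ => star_mul_self_nonneg (D k))).1 (hsum n)
    have h3 : ∑ k ∈ Finset.range n, (2 * (1 / 2) ^ k : ℝ) ≤ 4 := by
      rw [← Finset.mul_sum]
      have := sum_geometric_two_le n
      linarith
    calc _ ≤ (8 : ℝ) • algebraMap ℝ N 1 + algebraMap ℝ N 4 :=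
          add_le_add (smul_le_smul_of_nonneg_left h2 (by norm_num)) (algebraMap_mono N h3)
      _ = algebraMap ℝ N 12 := by
          rw [Algebra.smul_def, ← map_mul, ← map_add]; norm_num
  set T := ∑ k ∈ Finset.range n, (1 - U k) * s k * (1 - U k) with hT
  have hT1 : T ≤ algebraMap ℝ N 12 := hbound s e1
  have hT2 : -T ≤ algebraMap ℝ N 12 := by
    refine le_of_eq_of_le ?_ (hbound (fun k => -s k) e2)
    rw [hT, ← Finset.sum_neg_distrib]
    exact Finset.sum_congr rfl fun k _ => by noncomm_ring
  have h3 : 0 ≤ T + algebraMap ℝ N 12 := by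
    have := add_le_add_right hT2 T
    simpa using this
  have h4 : ‖T + algebraMap ℝ N 12‖ ≤ 24 := by
    refine (CStarAlgebra.norm_le_iff_le_algebraMap _ (by norm_num) h3).2 ?_
    calc T + algebraMap ℝ N 12 ≤ algebraMap ℝ N 12 + algebraMap ℝ N 12 := by gcongr
      _ = algebraMap ℝ N 24 := by rw [← map_add]; norm_num
  have h5 : ‖algebraMap ℝ N 12‖ ≤ 12 := by
    rw [Algebra.algebraMap_eq_smul_one, norm_smul, Real.norm_eq_abs, abs_of_pos (by norm_num)]
    nlinarith [norm_one_le_one (M := N)]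
  calc ‖T‖ = ‖(T + algebraMap ℝ N 12) - algebraMap ℝ N 12‖ := by rw [add_sub_cancel_right]
    _ ≤ 24 + 12 := (norm_sub_le _ _).trans (add_le_add h4 h5)
    _ = 36 := by norm_num

theorem norm_compression_mul_le {U s W : N} {δ δ' : ℝ} (hU : ‖U‖ ≤ 1) (hs : ‖s‖ ≤ 2)
    (hUW : ‖U * W - W * U‖ ≤ δ) (hsW : ‖s * W‖ ≤ δ') :
    ‖(1 - U) * s * (1 - U) * W‖ ≤ 4 * δ' + 4 * δ := by
  have hV : ‖1 - U‖ ≤ 2 := (norm_sub_le _ _).trans (by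
    have := norm_one_le_one (M := N); linarith)
  have e : (1 - U) * s * (1 - U) * W =
      (1 - U) * (s * W) * (1 - U) - (1 - U) * s * (U * W - W * U) := by noncomm_ring
  have h1 : ‖(1 - U) * (s * W) * (1 - U)‖ ≤ 2 * δ' * 2 :=
    norm_mul_le_of_le (norm_mul_le_of_le hV hsW) hV
  have h2 : ‖(1 - U) * s * (U * W - W * U)‖ ≤ 2 * 2 * δ :=
    norm_mul_le_of_le (norm_mul_le_of_le hV hs) hUW
  rw [e]
  refine (norm_sub_le _ _).trans ?_
  linarith

theorem norm_compression_commutator_le {U s d k : N} {δ δ' : ℝ} (hU : ‖U‖ ≤ 1) (hs : ‖s‖ ≤ 2)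
    (hUd : ‖U * d - d * U‖ ≤ δ) (hk : ‖U * k - k‖ ≤ δ) (hkd : ‖s * d - d * s - k‖ ≤ δ') :
    ‖(1 - U) * s * (1 - U) * d - d * ((1 - U) * s * (1 - U))‖ ≤ 10 * δ + 4 * δ' := by
  have hV : ‖1 - U‖ ≤ 2 := (norm_sub_le _ _).trans (by
    have := norm_one_le_one (M := N); linarith)
  have e : (1 - U) * s * (1 - U) * d - d * ((1 - U) * s * (1 - U)) =
      (1 - U) * (s * d - d * s - k) * (1 - U) - (U * k - k) * (1 - U) -
        (1 - U) * s * (U * d - d * U) - (U * d - d * U) * s * (1 - U) := by noncomm_ring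
  have h1 : ‖(1 - U) * (s * d - d * s - k) * (1 - U)‖ ≤ 2 * δ' * 2 :=
    norm_mul_le_of_le (norm_mul_le_of_le hV hkd) hV
  have h2 : ‖(U * k - k) * (1 - U)‖ ≤ δ * 2 := norm_mul_le_of_le hk hV
  have h3 : ‖(1 - U) * s * (U * d - d * U)‖ ≤ 2 * 2 * δ :=
    norm_mul_le_of_le (norm_mul_le_of_le hV hs) hUd
  have h4 : ‖(U * d - d * U) * s * (1 - U)‖ ≤ δ * 2 * 2 :=
    norm_mul_le_of_le (norm_mul_le_of_le hUd hs) hV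
  rw [e]
  refine (norm_sub_le _ _).trans ?_
  have h5 := norm_sub_le ((1 - U) * (s * d - d * s - k) * (1 - U) - (U * k - k) * (1 - U))
    ((1 - U) * s * (U * d - d * U))
  have h6 := norm_sub_le ((1 - U) * (s * d - d * s - k) * (1 - U)) ((U * k - k) * (1 - U))
  linarith

end Bounds

section StrictLimit

theorem isClosed_cauchySeq {V W : Type*} [NormedAddCommGroup V] [NormedAddCommGroup W]
    (F : ℕ → V → W) (C : ℝ) (hF : ∀ n x y, ‖F n x - F n y‖ ≤ C * ‖x - y‖) :
    IsClosed {x | CauchySeq fun n => F n x} := by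
  refine isClosed_of_closure_subset fun x hx => Metric.cauchySeq_iff.2 fun ε hε => ?_
  obtain ⟨y, hy, hxy⟩ := Metric.mem_closure_iff.1 hx (ε / (3 * (|C| + 1))) (by positivity)
  obtain ⟨n₀, hn₀⟩ := Metric.cauchySeq_iff.1 hy (ε / 3) (by positivity)
  have hb : ∀ n, dist (F n x) (F n y) < ε / 3 := fun n => by
    rw [dist_eq_norm] at hxy ⊢
    rw [lt_div_iff₀ (by positivity)] at hxy
    have := hF n x y
    nlinarith [le_abs_self C, norm_nonneg (x - y)]
  refine ⟨n₀, fun m hm n hn => ?_⟩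
  have h1 := dist_triangle (F m x) (F m y) (F n x)
  have h2 := dist_triangle (F m y) (F n y) (F n x)
  have h3 := hn₀ m hm n hn
  have h4 := hb n
  rw [dist_comm] at h4
  linarith [hb m]

theorem isClosed_tendsto_zero {V W : Type*} [NormedAddCommGroup V] [NormedAddCommGroup W]
    (F : ℕ → V → W) (C : ℝ) (hF : ∀ n x y, ‖F n x - F n y‖ ≤ C * ‖x - y‖) :
    IsClosed {x | Filter.Tendsto (fun n => F n x) Filter.atTop (nhds 0)} := by
  refine isClosed_of_closure_subset fun x hx => Metric.tendsto_atTop.2 fun ε hε => ?_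
  obtain ⟨y, hy, hxy⟩ := Metric.mem_closure_iff.1 hx (ε / (2 * (|C| + 1))) (by positivity)
  obtain ⟨n₀, hn₀⟩ := Metric.tendsto_atTop.1 hy (ε / 2) (by positivity)
  have hb : ∀ n, dist (F n x) (F n y) < ε / 2 := fun n => by
    rw [dist_eq_norm] at hxy ⊢
    rw [lt_div_iff₀ (by positivity)] at hxy
    have := hF n x y
    nlinarith [le_abs_self C, norm_nonneg (x - y)]
  refine ⟨n₀, fun n hn => ?_⟩
  have h1 := dist_triangle (F n x) (F n y) 0
  linarith [hb n, hn₀ n hn]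

/-- The strict limit of a bounded sequence of self-adjoint elements. -/
theorem exists_strict_limit {R : Type u} [NonUnitalCStarAlgebra R] (T : ℕ → R)
    (hT : ∀ n, star (T n) = T n) (C : ℝ) (hC : ∀ n, ‖T n‖ ≤ C)
    (h : ∀ r, CauchySeq fun n => T n * r) :
    ∃ S : 𝓜(ℂ, R), IsSelfAdjoint S ∧
      ∀ r, Filter.Tendsto (fun n => T n * r) Filter.atTop (nhds (S.fst r)) := by
  choose f hf using fun r => cauchySeq_tendsto_of_complete (h r)
  have hfn : ∀ r, ‖f r‖ ≤ C * ‖r‖ := fun r =>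
    le_of_tendsto (hf r).norm (Filter.Eventually.of_forall fun n =>
      (norm_mul_le _ _).trans (mul_le_mul_of_nonneg_right (hC n) (norm_nonneg r)))
  let L : R →ₗ[ℂ] R :=
    { toFun := f
      map_add' := fun x y => tendsto_nhds_unique (hf _) (by
        simpa only [mul_add] using (hf x).add (hf y))
      map_smul' := fun c x => tendsto_nhds_unique (hf _) (by
        simpa only [mul_smul_comm, RingHom.id_apply] using (hf x).const_smul c) }
  have hstar : ∀ r, Filter.Tendsto (fun n => r * T n) Filter.atTop (nhds (star (f (star r)))) := by
    intro r
    have := (hf (star r)).star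
    simpa only [star_mul, star_star, hT] using this
  let L' : R →ₗ[ℂ] R :=
    { toFun := fun r => star (f (star r))
      map_add' := fun x y => by
        rw [star_add, show f (star x + star y) = f (star x) + f (star y) from L.map_add _ _, star_add]
      map_smul' := fun c x => by
        rw [star_smul, show f (star c • star x) = star c • f (star x) from L.map_smul _ _, star_smul,
          star_star]; rfl }
  refine ⟨⟨(L.mkContinuous C hfn, L'.mkContinuous C fun r => ?_), fun x y => ?_⟩, ?_, hf⟩
  · change ‖star (f (star r))‖ ≤ _
    rw [norm_star]
    exact (hfn _).trans_eq (by rw [norm_star])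
  · refine tendsto_nhds_unique ((hstar x).mul_const y) ?_
    refine ((hf y).const_mul x).congr fun n => (mul_assoc _ _ _).symm
  · refine Mult.ext_fst fun r => ?_
    rw [DoubleCentralizer.star_fst]
    change star (star (f (star (star r)))) = f r
    rw [star_star, star_star]

end StrictLimit

end XKK
end

open CategoryTheory
noncomputable section
namespace XKK
open scoped ENNReal MultiplierAlgebra
open TopologicalSpace

/-! ### Existence of rotations -/

section ExistsRotation
variable {A : Type u} [NonUnitalCStarAlgebra A]

theorem MatSys.norm_p_le {T : Type} {B E : Type u} [NonUnitalCStarAlgebra B]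
    [NonUnitalCStarAlgebra E] (P : MatSys T B E) (i j : T) (x : B) : ‖P.p i j x‖ ≤ ‖x‖ := by
  have h : ‖P.p i j x‖ * ‖P.p i j x‖ ≤ ‖x‖ * ‖x‖ := by
    rw [← CStarRing.norm_star_mul_self, P.star_p, P.mul_same, ← CStarRing.norm_star_mul_self]
    exact norm_hom_le (P.diag j) _
  exact le_of_sq_le_sq (by rwa [sq, sq]) (norm_nonneg _)

theorem Mult.norm_coe {R : Type u} [NonUnitalCStarAlgebra R] (r : R) :
    ‖DoubleCentralizer.coe ℂ r‖ = ‖r‖ :=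
  NonUnitalStarAlgHom.norm_map (DoubleCentralizer.coeHom (𝕜 := ℂ) (A := R)) Mult.coe_injective r

variable (A) in
/-- The homomorphism `a ↦ η(a) ⊕ η̄(a)`. -/
def dg : Q A →⋆ₙₐ[ℂ] Mat 2 (Q (Q A)) := Mat.oplus (η A) (ηbar A)

theorem dg_eq (a : Q A) : dg A a =
    (Mat.sys 2 (Q (Q A))).p 0 0 (η A a) + (Mat.sys 2 (Q (Q A))).p 1 1 (ηbar A a) :=
  Mat.diag₂_eq _ _

/-- The matrix with the entries `η(a)η̄(b)` and `η̄(a)η(b)` off the diagonal. -/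
def offd (a b : Q A) : Mat 2 (Q (Q A)) :=
  (Mat.sys 2 (Q (Q A))).p 0 1 (η A a * ηbar A b) + (Mat.sys 2 (Q (Q A))).p 1 0 (ηbar A a * η A b)

theorem offd_mul_dg (a b x : Q A) : offd a b * dg A x = offd a (b * x) := by
  rw [offd, offd, dg_eq, add_mul, mul_add, mul_add, MatSys.mul_same, MatSys.mul_same,
    MatSys.mul_ne _ _ _ _ _ _ _ (by decide), MatSys.mul_ne _ _ _ _ _ _ _ (by decide), map_mul (η A),
    map_mul (ηbar A), zero_add, add_zero, mul_assoc, mul_assoc]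

theorem dg_mul_offd (a b x : Q A) : dg A x * offd a b = offd (x * a) b := by
  rw [offd, offd, dg_eq, mul_add, add_mul, add_mul, MatSys.mul_same, MatSys.mul_same,
    MatSys.mul_ne _ _ _ _ _ _ _ (by decide), MatSys.mul_ne _ _ _ _ _ _ _ (by decide), map_mul (η A),
    map_mul (ηbar A), zero_add, add_zero, mul_assoc, mul_assoc]

theorem star_offd (a b : Q A) : star (offd a b) = offd (star b) (star a) := by
  rw [offd, offd, star_add, MatSys.star_p, MatSys.star_p, star_mul, star_mul, map_star (η A),
    map_star (η A), map_star (ηbar A), map_star (ηbar A), add_comm]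

theorem offd_sub_right (a b c : Q A) : offd a (b - c) = offd a b - offd a c := by
  simp only [offd, map_sub, mul_sub]; abel

theorem offd_sub_left (a b c : Q A) : offd (a - b) c = offd a c - offd b c := by
  simp only [offd, map_sub, sub_mul]; abel

theorem norm_offd_le (a b : Q A) : ‖offd a b‖ ≤ 2 * (‖a‖ * ‖b‖) := by
  have h1 : ‖η A a * ηbar A b‖ ≤ ‖a‖ * ‖b‖ :=
    norm_mul_le_of_le (norm_hom_le _ _) (norm_hom_le _ _)
  have h2 : ‖ηbar A a * η A b‖ ≤ ‖a‖ * ‖b‖ :=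
    norm_mul_le_of_le (norm_hom_le _ _) (norm_hom_le _ _)
  refine (norm_add_le _ _).trans ?_
  have h3 := (Mat.sys 2 (Q (Q A))).norm_p_le 0 1 (η A a * ηbar A b)
  have h4 := (Mat.sys 2 (Q (Q A))).norm_p_le 1 0 (ηbar A a * η A b)
  linarith

theorem dg_sub_offd (a : Q A) : star (dg A a) * dg A a - offd (star a) a =
    ((Mat.sys 2 (Q (Q A))).p 0 0 (η A (star a)) - (Mat.sys 2 (Q (Q A))).p 1 0 (ηbar A (star a))) *
    star ((Mat.sys 2 (Q (Q A))).p 0 0 (η A (star a)) -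
      (Mat.sys 2 (Q (Q A))).p 1 0 (ηbar A (star a))) := by
  rw [← map_star, ← map_mul, dg_eq, offd, star_sub, MatSys.star_p, MatSys.star_p, sub_mul, mul_sub,
    mul_sub, MatSys.mul_same, MatSys.mul_same, MatSys.mul_same, MatSys.mul_same, ← map_star (η A),
    ← map_star (ηbar A), star_star, map_mul (η A), map_mul (ηbar A)]
  abel

theorem dg_add_offd (a : Q A) : star (dg A a) * dg A a + offd (star a) a =
    ((Mat.sys 2 (Q (Q A))).p 0 0 (η A (star a)) + (Mat.sys 2 (Q (Q A))).p 1 0 (ηbar A (star a))) *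
    star ((Mat.sys 2 (Q (Q A))).p 0 0 (η A (star a)) +
      (Mat.sys 2 (Q (Q A))).p 1 0 (ηbar A (star a))) := by
  rw [← map_star, ← map_mul, dg_eq, offd, star_add, MatSys.star_p, MatSys.star_p, add_mul, mul_add,
    mul_add, MatSys.mul_same, MatSys.mul_same, MatSys.mul_same, MatSys.mul_same, ← map_star (η A),
    ← map_star (ηbar A), star_star, map_mul (η A), map_mul (ηbar A)]
  abel

variable [SeparableSpace A]

theorem mem_idealizer_qSub (x : Q A) : x ∈ idealizer (qSub A) := fun z hz => by
  obtain ⟨z', h'⟩ := mul_mem_q x ⟨z, hz⟩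
  obtain ⟨z'', h''⟩ := mem_q_mul x ⟨z, hz⟩
  exact ⟨h' ▸ z'.2, h'' ▸ z''.2⟩

theorem exists_partition_q (x : ℕ → Q A) (w : ℕ → q A) : ∃ a : ℕ → q A, (∀ n, ‖a n‖ ≤ 1) ∧
    (∀ n, ‖∑ k ∈ Finset.range n, star (a k) * a k‖ ≤ 1) ∧
    (∀ j n, j < n → ‖a n * w j‖ ≤ 8 * (1 / 2) ^ n) ∧
    (∀ j n, j < n → ‖(a n : Q A) * x j - x j * a n‖ ≤ 8 * (1 / 2) ^ n) ∧
    ∀ j n, j < n → ‖(∑ k ∈ Finset.range n, star (a k) * a k) * w j - w j‖ ≤ 8 * (1 / 2) ^ n := by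
  let c : q A →⋆ₙₐ[ℂ] 𝓜(ℂ, q A) := DoubleCentralizer.coeHom
  have hc : ∀ z, ‖c z‖ = ‖z‖ := Mult.norm_coe
  obtain ⟨a, ha, h1, h2, h3, h4, h5⟩ := exists_quasicentral_partition
    (Mult.isClosed_coeIdeal (R := q A)) (fun j => toMult (qSub A) ⟨x j, mem_idealizer_qSub _⟩)
    (fun j => c (w j)) (fun j => Mult.mem_coeIdeal.2 ⟨w j, rfl⟩)
  choose b hb using fun n => Mult.mem_coeIdeal.1 (ha n)
  obtain rfl : (fun n => c (b n)) = a := funext hb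
  have hsum : ∀ n, ∑ k ∈ Finset.range n, star (c (b k)) * c (b k) =
      c (∑ k ∈ Finset.range n, star (b k) * b k) := fun n => by
    rw [map_sum]
    exact Finset.sum_congr rfl fun k _ => by rw [map_mul, map_star]
  refine ⟨b, fun n => by rw [← hc]; exact h1 n, fun n => ?_, fun j n hj => ?_, fun j n hj => ?_,
    fun j n hj => ?_⟩
  · rw [← hc, ← hsum]; exact h2 n
  · rw [← hc, map_mul]; exact h3 j n hj
  · have h := h4 j n hj
    have e : c (b n) * toMult (qSub A) ⟨x j, mem_idealizer_qSub _⟩ -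
        toMult (qSub A) ⟨x j, mem_idealizer_qSub _⟩ * c (b n) =
        c ((toMult (qSub A) ⟨x j, mem_idealizer_qSub _⟩).snd (b n) -
          (toMult (qSub A) ⟨x j, mem_idealizer_qSub _⟩).fst (b n)) := by
      rw [map_sub]
      exact congrArg₂ _ (Mult.coe_mul _ _) (Mult.mul_coe _ _)
    rw [e, hc] at h
    exact h
  · rw [← hc, map_sub, map_mul, ← hsum]; exact h5 j n hj

theorem offd_mem_R (a b : q A) : offd (a : Q A) b ∈ RSub A :=
  add_mem (sys01_mem_R a b) (sys10_mem_R a b)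

theorem foldR_offd_mul (a b : Q A) (M : Mat 2 (Q A)) :
    foldR A (offd a b) * M = rowFlip (Mat.diag₂ (a * b) (a * b) * M) := by
  rw [offd, map_add, foldR, Mat.map_sys, Mat.map_sys, map_mul (Q.fold (Q A)),
    map_mul (Q.fold (Q A)), Q.fold, Q.lift_ι, Q.lift_ι, Q.lift_ιbar, Q.lift_ιbar]
  refine CStarMatrix.ext fun i j => ?_
  rw [rowFlip_apply, CStarMatrix.mul_apply, CStarMatrix.mul_apply, Fin.sum_univ_two,
    Fin.sum_univ_two]
  simp only [CStarMatrix.add_apply, Mat.sys_apply]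
  fin_cases i <;> simp [Mat.diag₂]

theorem foldR_offd (a b : Q A) : foldR A (offd a b) =
    (Mat.sys 2 (Q A)).p 0 1 (a * b) + (Mat.sys 2 (Q A)).p 1 0 (a * b) := by
  rw [offd, map_add, foldR, Mat.map_sys, Mat.map_sys, map_mul (Q.fold (Q A)),
    map_mul (Q.fold (Q A)), Q.fold, Q.lift_ι, Q.lift_ι, Q.lift_ιbar, Q.lift_ιbar]
  rfl

variable (A) in
/-- The ideal `J = R ∩ M₂(q²A)`. -/
def JSub : NonUnitalStarSubalgebra ℂ (Mat 2 (Q (Q A))) where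
  carrier := {M | M ∈ RSub A ∧ foldR A M = 0}
  add_mem' hx hy := ⟨add_mem hx.1 hy.1, by rw [map_add, hx.2, hy.2, add_zero]⟩
  zero_mem' := ⟨zero_mem _, map_zero _⟩
  mul_mem' hx hy := ⟨mul_mem hx.1 hy.1, by rw [map_mul, hx.2, zero_mul]⟩
  smul_mem' c x hx := ⟨SMulMemClass.smul_mem c hx.1, by rw [map_smul, hx.2, smul_zero]⟩
  star_mem' hx := ⟨star_mem hx.1, by rw [map_star, hx.2, star_zero]⟩

instance : IsClosed (JSub A : Set (Mat 2 (Q (Q A)))) :=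
  (show IsClosed (RSub A : Set (Mat 2 (Q (Q A)))) from inferInstance).inter
    (isClosed_eq (hom_continuous (foldR A)) continuous_const)

theorem dg_mem_idealizer_R (a : Q A) : dg A a ∈ idealizer (RSub A) := diag_mem_idealizer a a

theorem dg_mem_idealizer_J (a : Q A) : dg A a ∈ idealizer (JSub A) := fun r hr =>
  ⟨⟨((dg_mem_idealizer_R a) r hr.1).1, by rw [map_mul, hr.2, mul_zero]⟩,
    ⟨((dg_mem_idealizer_R a) r hr.1).2, by rw [map_mul, hr.2, zero_mul]⟩⟩

theorem tendsto_dg_mul {g : ℕ → q A} (hg : ∀ n, ‖g n‖ ≤ 1)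
    (h : ∀ z : q A, Filter.Tendsto (fun n => g n * z) Filter.atTop (nhds z))
    {r : Mat 2 (Q (Q A))} (hr : r ∈ RSub A) :
    Filter.Tendsto (fun n => dg A (g n) * r) Filter.atTop (nhds r) := by
  have hη : ∀ z : q A, Filter.Tendsto (fun n => η A (g n) * η A z) Filter.atTop (nhds (η A z)) :=
    fun z => by
      have := ((hom_continuous (η A)).comp continuous_subtype_val).tendsto z |>.comp (h z)
      refine this.congr fun n => ?_
      exact map_mul (η A) _ _
  have hηb : ∀ z : q A, Filter.Tendsto (fun n => ηbar A (g n) * ηbar A z) Filter.atTop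
      (nhds (ηbar A z)) := fun z => by
      have := ((hom_continuous (ηbar A)).comp continuous_subtype_val).tendsto z |>.comp (h z)
      refine this.congr fun n => ?_
      exact map_mul (ηbar A) _ _
  have hp : ∀ i j, Continuous ((Mat.sys 2 (Q (Q A))).p i j) := fun i j =>
    AddMonoidHomClass.continuous_of_bound _ 1 fun x => by
      rw [one_mul]; exact MatSys.norm_p_le _ i j x
  have e0 : ∀ (a : Q A) j x, dg A a * (Mat.sys 2 (Q (Q A))).p 0 j x =
      (Mat.sys 2 (Q (Q A))).p 0 j (η A a * x) := fun a j x => by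
    rw [dg_eq, add_mul, MatSys.mul_same, MatSys.mul_ne _ _ _ _ _ _ _ (by decide), add_zero]
  have e1 : ∀ (a : Q A) j x, dg A a * (Mat.sys 2 (Q (Q A))).p 1 j x =
      (Mat.sys 2 (Q (Q A))).p 1 j (ηbar A a * x) := fun a j x => by
    rw [dg_eq, add_mul, MatSys.mul_same, MatSys.mul_ne _ _ _ _ _ _ _ (by decide), zero_add]
  have hn : ∀ n, ‖dg A (g n)‖ ≤ 1 := fun n => (norm_hom_le (dg A) _).trans (hg n)
  have hcl : IsClosed {r | Filter.Tendsto (fun n => dg A (g n) * r - r) Filter.atTop (nhds 0)} := by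
    refine isClosed_tendsto_zero _ 2 fun n x y => ?_
    have e : dg A (g n) * x - x - (dg A (g n) * y - y) = dg A (g n) * (x - y) - (x - y) := by
      rw [mul_sub]; abel
    rw [e]
    refine (norm_sub_le _ _).trans ?_
    have := norm_mul_le_of_le (hn n) (le_refl ‖x - y‖)
    linarith
  have main : ∀ r : Mat 2 (Q (Q A)), Filter.Tendsto (fun n => dg A (g n) * r) Filter.atTop (nhds r) ↔
      Filter.Tendsto (fun n => dg A (g n) * r - r) Filter.atTop (nhds 0) := fun r => by
    rw [tendsto_sub_nhds_zero_iff]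
  have key := R_induction (p := fun r =>
      Filter.Tendsto (fun n => dg A (g n) * r) Filter.atTop (nhds r) ∧
      Filter.Tendsto (fun n => dg A (g n) * star r) Filter.atTop (nhds (star r))) (by
    simp only [main]
    exact hcl.inter (hcl.preimage continuous_star)) (fun z => ?_) (fun z w => ?_) (fun z w => ?_)
    (fun z => ?_) (fun x y hx hy => ?_) (fun x y hx hy => ?_) (fun c x hx => ?_) (fun x hx => ?_) hr
  · exact key.1
  · simp only [MatSys.star_p, ← map_star (η A), e0]
    exact ⟨((hp 0 0).tendsto _).comp (hη z), ((hp 0 0).tendsto _).comp (hη (star z))⟩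
  · simp only [MatSys.star_p, star_mul, ← map_star (η A), ← map_star (ηbar A), e0, e1, ← mul_assoc]
    exact ⟨((hp 0 1).tendsto _).comp ((hη z).mul_const _),
      ((hp 1 0).tendsto _).comp ((hηb (star w)).mul_const _)⟩
  · simp only [MatSys.star_p, star_mul, ← map_star (η A), ← map_star (ηbar A), e0, e1, ← mul_assoc]
    exact ⟨((hp 1 0).tendsto _).comp ((hηb z).mul_const _),
      ((hp 0 1).tendsto _).comp ((hη (star w)).mul_const _)⟩
  · simp only [MatSys.star_p, ← map_star (ηbar A), e1]
    exact ⟨((hp 1 1).tendsto _).comp (hηb z), ((hp 1 1).tendsto _).comp (hηb (star z))⟩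
  · simp only [star_add, mul_add]
    exact ⟨hx.1.add hy.1, hx.2.add hy.2⟩
  · simp only [star_mul, ← mul_assoc]
    exact ⟨hx.1.mul_const _, hy.2.mul_const _⟩
  · simp only [star_smul, mul_smul_comm]
    exact ⟨hx.1.const_smul c, hx.2.const_smul _⟩
  · rw [star_star]
    exact ⟨hx.2, hx.1⟩

end ExistsRotation

end XKK
end

open CategoryTheory
noncomputable section
namespace XKK
open scoped ENNReal MultiplierAlgebra
open TopologicalSpace

section ExistsRotation

section Compression
variable {E : Type u} [NonUnitalCStarAlgebra E]

/-- The compression `(1 - U)s(1 - U)`. -/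
def compression (U s : E) : E := s - U * s - s * U + U * s * U

theorem inr_compression (U s : E) : ((compression U s : E) : Unitization ℂ E) =
    (1 - (U : Unitization ℂ E)) * (s : Unitization ℂ E) * (1 - (U : Unitization ℂ E)) := by
  rw [compression, Unitization.inr_add, Unitization.inr_sub, Unitization.inr_sub,
    Unitization.inr_mul, Unitization.inr_mul, Unitization.inr_mul, Unitization.inr_mul]
  noncomm_ring

theorem inr_commutator (x y : E) : ((x * y - y * x : E) : Unitization ℂ E) =
    (x : Unitization ℂ E) * y - (y : Unitization ℂ E) * x := by
  rw [Unitization.inr_sub, Unitization.inr_mul, Unitization.inr_mul]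

theorem star_compression {U s : E} (hU : star U = U) (hs : star s = s) :
    star (compression U s) = compression U s := by
  rw [compression, star_add, star_sub, star_sub, star_mul, star_mul, star_mul, star_mul, hU, hs]
  noncomm_ring

theorem map_compression {D : Type v} [NonUnitalCStarAlgebra D] (f : E →⋆ₙₐ[ℂ] D) {U : E}
    (hU : f U = 0) (s : E) : f (compression U s) = f s := by
  simp [compression, hU]

theorem compression_mem {B : NonUnitalStarSubalgebra ℂ E} {U s : E} (hU : U ∈ B) (hs : s ∈ B) :
    compression U s ∈ B :=
  add_mem (sub_mem (sub_mem hs (mul_mem hU hs)) (mul_mem hs hU)) (mul_mem (mul_mem hU hs) hU)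

theorem norm_sum_compression_le' {U D s G G' : ℕ → E} (hU : ∀ n, star (U n) = U n)
    (hU1 : ∀ n, ‖U n‖ ≤ 1) (hD : ∀ n, ‖U n * D n - D n * U n‖ ≤ (1 / 2) ^ n)
    (hG : ∀ n, star (D n) * D n - s n = G n * star (G n))
    (hG' : ∀ n, star (D n) * D n + s n = G' n * star (G' n))
    (hsum : ∀ n, ‖∑ k ∈ Finset.range n, star (D k) * D k‖ ≤ 1) (n : ℕ) :
    ‖∑ k ∈ Finset.range n, compression (U k) (s k)‖ ≤ 36 := by
  let i : E →⋆ₙₐ[ℂ] Unitization ℂ E := Unitization.inrNonUnitalStarAlgHom ℂ E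
  have hi : ∀ x, ‖i x‖ = ‖x‖ := fun x => Unitization.norm_inr x
  have h := norm_sum_compression_le (U := fun n => i (U n)) (D := fun n => i (D n))
    (s := fun n => i (s n)) (G := fun n => i (G n)) (G' := fun n => i (G' n))
    (fun n => by rw [← map_star, hU]) (fun n => by rw [hi]; exact hU1 n)
    (fun n => by rw [← map_mul, ← map_mul, ← map_sub, hi]; exact hD n)
    (fun n => by rw [← map_star, ← map_star, ← map_mul, ← map_mul, ← map_sub, hG])
    (fun n => by rw [← map_star, ← map_star, ← map_mul, ← map_mul, ← map_add, hG'])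
    (fun n => by
      simp only [← map_star, ← map_mul]
      rw [← map_sum, hi]; exact hsum n) n
  rw [← hi, map_sum]
  convert h using 3
  exact inr_compression _ _

theorem norm_compression_mul_le' {U s W : E} {δ δ' : ℝ} (hU : ‖U‖ ≤ 1) (hs : ‖s‖ ≤ 2)
    (hUW : ‖U * W - W * U‖ ≤ δ) (hsW : ‖s * W‖ ≤ δ') :
    ‖compression U s * W‖ ≤ 4 * δ' + 4 * δ := by
  have h := norm_compression_mul_le (N := Unitization ℂ E) (U := U) (s := s) (W := W)
    (δ := δ) (δ' := δ') (by rwa [Unitization.norm_inr]) (by rwa [Unitization.norm_inr])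
    (by rwa [← inr_commutator, Unitization.norm_inr])
    (by rwa [← Unitization.inr_mul, Unitization.norm_inr])
  rwa [← inr_compression, ← Unitization.inr_mul, Unitization.norm_inr] at h

theorem norm_compression_commutator_le' {U s d k : E} {δ δ' : ℝ} (hU : ‖U‖ ≤ 1) (hs : ‖s‖ ≤ 2)
    (hUd : ‖U * d - d * U‖ ≤ δ) (hk : ‖U * k - k‖ ≤ δ) (hkd : ‖s * d - d * s - k‖ ≤ δ') :
    ‖compression U s * d - d * compression U s‖ ≤ 10 * δ + 4 * δ' := by
  have h := norm_compression_commutator_le (N := Unitization ℂ E) (U := U) (s := s) (d := d) (k := k)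
    (δ := δ) (δ' := δ') (by rwa [Unitization.norm_inr]) (by rwa [Unitization.norm_inr])
    (by rwa [← inr_commutator, Unitization.norm_inr])
    (by rwa [← Unitization.inr_mul, ← Unitization.inr_sub, Unitization.norm_inr])
    (by rwa [← inr_commutator, ← Unitization.inr_sub, Unitization.norm_inr])
  rwa [← inr_compression, ← inr_commutator, Unitization.norm_inr] at h

theorem cauchySeq_sum_of_norm_le {V : Type*} [NormedAddCommGroup V] [CompleteSpace V] {t : ℕ → V}
    {C : ℝ} {j : ℕ} (h : ∀ n, j < n → ‖t n‖ ≤ C * (1 / 2) ^ n) :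
    CauchySeq fun n => ∑ k ∈ Finset.range n, t k := by
  have hs : Summable t := Summable.of_norm_bounded_eventually_nat
    (summable_geometric_two.mul_left C) (Filter.eventually_atTop.2 ⟨j + 1, fun n hn => h n hn⟩)
  exact hs.hasSum.tendsto_sum_nat.cauchySeq

end Compression

variable {A : Type u} [NonUnitalCStarAlgebra A]

theorem sum_dg_star_mul (a : ℕ → Q A) (n : ℕ) : ∑ k ∈ Finset.range n, star (dg A (a k)) * dg A (a k) =
    dg A (∑ k ∈ Finset.range n, star (a k) * a k) := by
  rw [map_sum]
  exact Finset.sum_congr rfl fun k _ => by rw [map_mul, map_star]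

theorem norm_commutator_offd_le {a y : Q A} {ε : ℝ} (ha : ‖a‖ ≤ 1) (h1 : ‖a * y - y * a‖ ≤ ε)
    (h2 : ‖a * star y - star y * a‖ ≤ ε) :
    ‖offd (star a) a * dg A y - dg A y * offd (star a) a -
      (offd (star a) (y * a) - offd (star a * y) a)‖ ≤ 4 * ε := by
  have e : offd (star a) a * dg A y - dg A y * offd (star a) a -
      (offd (star a) (y * a) - offd (star a * y) a) =
      offd (star a) (a * y - y * a) - offd (y * star a - star a * y) a := by
    rw [offd_mul_dg, dg_mul_offd, offd_sub_right, offd_sub_left]; abel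
  have h3 : ‖y * star a - star a * y‖ ≤ ε := by
    rw [← norm_star, star_sub, star_mul, star_mul, star_star]; exact h2
  have ha' : ‖star a‖ ≤ 1 := by rwa [norm_star]
  have h4 : ‖star a‖ * ‖a * y - y * a‖ ≤ 1 * ε :=
    mul_le_mul ha' h1 (norm_nonneg _) zero_le_one
  have h5 : ‖y * star a - star a * y‖ * ‖a‖ ≤ ε * 1 :=
    mul_le_mul h3 ha (norm_nonneg _) ((norm_nonneg _).trans h3)
  rw [e]
  refine (norm_sub_le _ _).trans ?_
  have h6 := norm_offd_le (star a) (a * y - y * a)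
  have h7 := norm_offd_le (y * star a - star a * y) a
  linarith

variable [SeparableSpace A]

theorem commutator_offd_mem_J (a : q A) (y : Q A) :
    offd (star (a : Q A)) (y * a) - offd (star (a : Q A) * y) a ∈ JSub A := by
  obtain ⟨b, hb⟩ := mul_mem_q y a
  obtain ⟨c, hc⟩ := mem_q_mul y (star a)
  have hc' : (c : Q A) = star (a : Q A) * y := hc
  refine ⟨?_, ?_⟩
  · rw [← hb, ← hc']
    exact sub_mem (offd_mem_R (star a) b) (offd_mem_R c a)
  · rw [map_sub, foldR_offd, foldR_offd, mul_assoc, sub_self]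

theorem foldR_dg (a : Q A) : foldR A (dg A a) = Mat.diag₂ a a := foldR_diag a a

/-- The approximations of a rotation. -/
theorem exists_rotation_approx (A : Type u) [NonUnitalCStarAlgebra A] [SeparableSpace A] :
    ∃ (T : ℕ → Mat 2 (Q (Q A))) (g : ℕ → q A), (∀ n, T n ∈ RSub A) ∧ (∀ n, star (T n) = T n) ∧
      (∀ n, ‖T n‖ ≤ 36) ∧ (∀ n, ‖g n‖ ≤ 1) ∧
      (∀ z : q A, Filter.Tendsto (fun n => g n * z) Filter.atTop (nhds z)) ∧
      (∀ z : q A, CauchySeq fun n => T n * dg A z) ∧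
      (∀ x : A, CauchySeq fun n => T n * dg A (ι x) - dg A (ι x) * T n) ∧
      ∀ n M, foldR A (T n) * M = rowFlip (foldR A (dg A (g n)) * M) := by
  classical
  obtain ⟨y, hy⟩ : ∃ y : ℕ → Q A, ∀ j, y (2 * j) = ι (denseSeq A j) ∧
      y (2 * j + 1) = star (ι (denseSeq A j)) :=
    ⟨fun n => if n % 2 = 0 then ι (denseSeq A (n / 2)) else star (ι (denseSeq A (n / 2))),
      fun j => ⟨by simp, by
        change (if (2 * j + 1) % 2 = 0 then _ else _) = _
        rw [if_neg (by omega)]; congr 3; omega⟩⟩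
  obtain ⟨w, hw⟩ : ∃ w : ℕ → q A, DenseRange w := ⟨denseSeq (q A), denseRange_denseSeq _⟩
  obtain ⟨a, ha, hsum, haw, hax, hgw⟩ := exists_partition_q y w
  choose U hUJ hUs hU1 hUY hUK using fun n : ℕ => exists_quasicentral (JSub A)
    ((Finset.range n).image (fun j => dg A (y j)) ∪ (Finset.range n).image (fun j => dg A (w j)) ∪
      {dg A (a n)})
    ((Finset.range n).image fun j =>
      offd (star (a n : Q A)) (y j * a n) - offd (star (a n : Q A) * y j) (a n))
    (fun _ h => by
      simp only [Finset.mem_union, Finset.mem_image, Finset.mem_singleton] at h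
      rcases h with (⟨j, -, rfl⟩ | ⟨j, -, rfl⟩) | rfl <;> exact dg_mem_idealizer_J _)
    (fun _ h => by
      obtain ⟨j, -, rfl⟩ := Finset.mem_image.1 h
      exact commutator_offd_mem_J (a n) (y j))
    (show (0 : ℝ) < (1 / 2) ^ n by positivity)
  have hUy : ∀ j n, j < n → ‖U n * dg A (y j) - dg A (y j) * U n‖ ≤ (1 / 2) ^ n := fun j n hj =>
    hUY n _ (Finset.mem_union_left _ (Finset.mem_union_left _
      (Finset.mem_image_of_mem _ (Finset.mem_range.2 hj))))
  have hUw : ∀ j n, j < n → ‖U n * dg A (w j) - dg A (w j) * U n‖ ≤ (1 / 2) ^ n := fun j n hj =>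
    hUY n _ (Finset.mem_union_left _ (Finset.mem_union_right _
      (Finset.mem_image_of_mem _ (Finset.mem_range.2 hj))))
  have hUa : ∀ n, ‖U n * dg A (a n) - dg A (a n) * U n‖ ≤ (1 / 2) ^ n := fun n =>
    hUY n _ (Finset.mem_union_right _ (Finset.mem_singleton_self _))
  have hUk : ∀ j n, j < n → ‖U n * (offd (star (a n : Q A)) (y j * a n) -
      offd (star (a n : Q A) * y j) (a n)) - (offd (star (a n : Q A)) (y j * a n) -
      offd (star (a n : Q A) * y j) (a n))‖ ≤ (1 / 2) ^ n := fun j n hj =>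
    hUK n _ (Finset.mem_image_of_mem _ (Finset.mem_range.2 hj))
  have ha' : ∀ n, ‖(a n : Q A)‖ ≤ 1 := ha
  have hs2 : ∀ n, ‖offd (star (a n : Q A)) (a n)‖ ≤ 2 := fun n => by
    have h1 := norm_offd_le (star (a n : Q A)) (a n)
    rw [norm_star] at h1
    have h2 : ‖(a n : Q A)‖ * ‖(a n : Q A)‖ ≤ 1 * 1 :=
      mul_le_mul (ha' n) (ha' n) (norm_nonneg _) zero_le_one
    linarith
  obtain ⟨g, hg⟩ : ∃ g : ℕ → q A, ∀ n, g n = ∑ k ∈ Finset.range n, star (a k) * a k :=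
    ⟨_, fun _ => rfl⟩
  obtain ⟨T, hT⟩ : ∃ T : ℕ → Mat 2 (Q (Q A)), ∀ n, T n =
    ∑ k ∈ Finset.range n, compression (U k) (offd (star (a k : Q A)) (a k)) := ⟨_, fun _ => rfl⟩
  have hg1 : ∀ n, ‖g n‖ ≤ 1 := fun n => by rw [hg]; exact hsum n
  have hgco : ∀ n, ((g n : q A) : Q A) = ∑ k ∈ Finset.range n, star (a k : Q A) * a k := fun n => by
    rw [hg]; exact map_sum (qIncl (A := A)) _ _
  have hT36 : ∀ n, ‖T n‖ ≤ 36 := fun n => by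
    rw [hT]
    refine norm_sum_compression_le' (D := fun n => dg A (a n)) hUs hU1 hUa
      (fun n => dg_sub_offd (a n : Q A)) (fun n => dg_add_offd (a n : Q A)) (fun n => ?_) n
    rw [sum_dg_star_mul (fun k => (a k : Q A)), ← hgco]
    exact (norm_hom_le (dg A) _).trans (hg1 n)
  refine ⟨T, g, fun n => ?_, fun n => ?_, hT36, hg1, fun z => ?_, fun z => ?_, fun x => ?_,
    fun n M => ?_⟩
  · rw [hT]
    exact sum_mem fun k _ => compression_mem (hUJ k).1 (offd_mem_R (star (a k)) (a k))
  · rw [hT, star_sum]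
    exact Finset.sum_congr rfl fun k _ => star_compression (hUs k) (by rw [star_offd, star_star])
  · have hcl := isClosed_tendsto_zero (fun (n : ℕ) (z : q A) => g n * z - z) 2 fun n x y => by
      have e : g n * x - x - (g n * y - y) = g n * (x - y) - (x - y) := by rw [mul_sub]; abel
      rw [e]
      refine (norm_sub_le _ _).trans ?_
      have := norm_mul_le_of_le (hg1 n) (le_refl ‖x - y‖)
      linarith
    have hd : ∀ z : q A, z ∈ {z : q A | Filter.Tendsto (fun n => g n * z - z) Filter.atTop (nhds 0)} := by
      refine fun z => hw.induction_on z hcl fun j => ?_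
      refine squeeze_zero_norm' (a := fun n => 8 * (1 / 2 : ℝ) ^ n)
        (Filter.eventually_atTop.2 ⟨j + 1, fun n hn => ?_⟩) ?_
      · rw [hg]; exact hgw j n hn
      · simpa using (tendsto_pow_atTop_nhds_zero_of_lt_one (r := (1 / 2 : ℝ)) (by norm_num)
          (by norm_num)).const_mul 8
    exact tendsto_sub_nhds_zero_iff.1 (hd z)
  · have hcl := isClosed_cauchySeq (fun n (z : q A) => T n * dg A z) 36 fun n x y => by
      rw [← mul_sub, ← map_sub]
      refine (norm_mul_le _ _).trans (mul_le_mul (hT36 n) ?_ (norm_nonneg _) (by norm_num))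
      exact norm_hom_le (dg A) _
    refine hw.induction_on z hcl fun j => ?_
    have h := cauchySeq_sum_of_norm_le (C := 68) (j := j)
      (t := fun k => compression (U k) (offd (star (a k : Q A)) (a k)) * dg A (w j)) fun n hj => by
        have h1 : ‖offd (star (a n : Q A)) (a n) * dg A (w j)‖ ≤ 16 * (1 / 2) ^ n := by
          rw [offd_mul_dg]
          refine (norm_offd_le _ _).trans ?_
          have h2 : ‖(a n : Q A) * w j‖ ≤ 8 * (1 / 2) ^ n := haw j n hj
          have h3 : ‖star (a n : Q A)‖ ≤ 1 := by rw [norm_star]; exact ha' n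
          have := mul_le_mul h3 h2 (norm_nonneg _) zero_le_one
          linarith
        have := norm_compression_mul_le' (hU1 n) (hs2 n) (hUw j n hj) h1
        linarith
    simpa only [hT, Finset.sum_mul] using h
  · have hcl := isClosed_cauchySeq
      (fun n (x : A) => T n * dg A (ι x) - dg A (ι x) * T n) 72 fun n x y => by
        have e : T n * dg A (ι x) - dg A (ι x) * T n - (T n * dg A (ι y) - dg A (ι y) * T n) =
            T n * dg A (ι (x - y)) - dg A (ι (x - y)) * T n := by
          rw [map_sub, map_sub]; noncomm_ring
        rw [e]
        have h0 : ‖dg A (ι (x - y))‖ ≤ ‖x - y‖ :=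
          (norm_hom_le (dg A) _).trans (norm_hom_le ι _)
        have h1 := norm_mul_le_of_le (hT36 n) h0
        have h2 := norm_mul_le_of_le h0 (hT36 n)
        refine (norm_sub_le _ _).trans ?_
        linarith
    refine (denseRange_denseSeq A).induction_on x hcl fun j => ?_
    have h := cauchySeq_sum_of_norm_le (C := 138) (j := 2 * j + 1)
      (t := fun k => compression (U k) (offd (star (a k : Q A)) (a k)) * dg A (ι (denseSeq A j)) -
        dg A (ι (denseSeq A j)) * compression (U k) (offd (star (a k : Q A)) (a k))) fun n hj => by
        have h1 := hax (2 * j) n (by omega)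
        have h2 := hax (2 * j + 1) n hj
        have h3 := hUy (2 * j) n (by omega)
        have h4 := hUk (2 * j) n (by omega)
        rw [(hy j).2] at h2
        rw [(hy j).1] at h1 h3 h4
        have h5 := norm_commutator_offd_le (ha' n) h1 h2
        have := norm_compression_commutator_le' (hU1 n) (hs2 n) h3 h4 h5
        linarith
    simpa only [hT, Finset.sum_mul, Finset.mul_sum, ← Finset.sum_sub_distrib] using h
  · rw [hT, hgco]
    induction n with
    | zero =>
      rw [Finset.sum_range_zero, Finset.sum_range_zero, map_zero, map_zero, map_zero, zero_mul]; rfl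
    | succ n ih =>
      rw [Finset.sum_range_succ, Finset.sum_range_succ, map_add, map_add, map_add, add_mul, add_mul,
        ih, map_compression (foldR A) (hUJ n).2, foldR_offd_mul, foldR_dg (star (a n : Q A) * (a n : Q A))]
      rfl

theorem exists_rotation (A : Type u) [NonUnitalCStarAlgebra A] [SeparableSpace A] :
    ∃ S : 𝓜(ℂ, RSub A), IsRotation S := by
  obtain ⟨T, g, hTR, hTs, hT36, hg1, hg, hTz, hTx, hfold⟩ := exists_rotation_approx A
  have hdg : ∀ r ∈ RSub A, Filter.Tendsto (fun n => dg A (g n) * r) Filter.atTop (nhds r) :=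
    fun r hr => tendsto_dg_mul hg1 hg hr
  have hcau : ∀ r ∈ RSub A, CauchySeq fun n => T n * r := by
    intro r hr
    have hcl := isClosed_cauchySeq (fun n (r : Mat 2 (Q (Q A))) => T n * r) 36 fun n x y => by
      rw [← mul_sub]
      exact norm_mul_le_of_le (hT36 n) le_rfl
    refine hcl.mem_of_tendsto (hdg r hr) (Filter.Eventually.of_forall fun m => ?_)
    have h := (ContinuousLinearMap.mul ℂ (Mat 2 (Q (Q A)))).flip r |>.uniformContinuous.comp_cauchySeq
      (hTz (g m))
    change CauchySeq fun n => T n * (dg A (g m) * r)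
    simp only [← mul_assoc]
    exact h
  have hcoe : ∀ {t : ℕ → RSub A}, (CauchySeq fun n => (t n : Mat 2 (Q (Q A)))) → CauchySeq t :=
    fun h => Metric.cauchySeq_iff.2 fun ε hε => Metric.cauchySeq_iff.1 h ε hε
  obtain ⟨S, hS, hSr⟩ := exists_strict_limit (R := RSub A) (fun n => ⟨T n, hTR n⟩)
    (fun n => Subtype.ext (hTs n)) 36 hT36 (fun r => hcoe (hcau r r.2))
  have hSr' : ∀ r : RSub A, Filter.Tendsto (fun n => T n * (r : Mat 2 (Q (Q A)))) Filter.atTop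
      (nhds ((S.fst r : RSub A) : Mat 2 (Q (Q A)))) := fun r =>
    (continuous_subtype_val.tendsto _).comp (hSr r)
  have hlift : ∀ r : RSub A, foldR A (S.fst r : RSub A) = rowFlip (foldR A r) := by
    intro r
    refine CStarMatrix.ext fun i j => ?_
    have hent : ∀ i j, Continuous fun M : Mat 2 (Q A) => M i j := fun i j =>
      (continuous_apply j).comp (continuous_apply (A := fun _ => Fin 2 → Q A) i)
    have h1 := (((hent i j).comp (hom_continuous (foldR A))).tendsto _).comp (hSr' r)
    have h2 := (((hent i.rev j).comp (hom_continuous (foldR A))).tendsto _).comp (hdg r r.2)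
    refine tendsto_nhds_unique h1 (h2.congr fun n => ?_)
    change foldR A (dg A (g n) * r) i.rev j = foldR A (T n * r) i j
    rw [map_mul, map_mul, hfold, rowFlip_apply]
  refine ⟨S, hS, fun r i j => by rw [hlift, rowFlip_apply], fun x =>
    ⟨diagMult ι ι x, isMulBy_diagMult ι ι x, ?_⟩⟩
  have hcR : ∀ n, T n * dg A (ι x) - dg A (ι x) * T n ∈ RSub A := fun n =>
    sub_mem (dg_mem_idealizer_R (ι x) _ (hTR n)).2 (dg_mem_idealizer_R (ι x) _ (hTR n)).1
  obtain ⟨c, hc⟩ := cauchySeq_tendsto_of_complete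
    (hcoe (t := fun n => ⟨_, hcR n⟩) (hTx x))
  have hc' : Filter.Tendsto (fun n => T n * dg A (ι x) - dg A (ι x) * T n) Filter.atTop
      (nhds (c : Mat 2 (Q (Q A)))) := (continuous_subtype_val.tendsto _).comp hc
  have hcomm : ∀ r : RSub A, ((S.fst ((diagMult ι ι x).fst r) : RSub A) : Mat 2 (Q (Q A))) -
      dg A (ι x) * (S.fst r : RSub A) = c * r := fun r => by
    have h1 := hSr' ((diagMult ι ι x).fst r)
    have h2 := (hSr' r).const_mul (dg A (ι x))
    have h3 := hc'.mul_const (r : Mat 2 (Q (Q A)))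
    refine tendsto_nhds_unique (h1.sub h2) (h3.congr fun n => ?_)
    rw [((isMulBy_diagMult ι ι x) r).1, sub_mul, mul_assoc, mul_assoc]
    rfl
  refine ⟨c, ?_, Mult.ext_fst fun r => Subtype.ext (hcomm r)⟩
  have hz : ∀ r : RSub A, foldR A c * foldR A r = 0 := fun r => by
    rw [← map_mul, ← hcomm, map_sub, hlift, ((isMulBy_diagMult ι ι x) r).1, map_mul, map_mul,
      foldR_diag, hlift, rowFlip_diag₂_mul, foldR_dg, sub_self]
  have := hz (star c)
  rw [show ((star c : RSub A) : Mat 2 (Q (Q A))) = star (c : Mat 2 (Q (Q A))) from rfl, map_star,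
    CStarRing.mul_star_self_eq_zero_iff] at this
  exact this

end ExistsRotation

end XKK
end

open CategoryTheory
noncomputable section
namespace XKK
open scoped ENNReal MultiplierAlgebra
open TopologicalSpace

open XCAlg
variable {X : Type v} [TopologicalSpace X]

/-! ### The category `KK(X)` -/

section Product
variable {A B C D : XCAlg.{u} X}

theorem exists_phi (A : XCAlg.{u} X) :
    ∃ φ : A.qObj ⟶ matObj 2 A.qObj.qObj, IsPhi (A := A) φ.hom := by
  obtain ⟨S, hS⟩ := exists_rotation A
  exact isPhi_of_phiX hS

theorem el_phi_π {φ : A.qObj ⟶ matObj 2 A.qObj.qObj} (hφ : IsPhi (A := A) φ.hom) :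
    el.map φ ≫ inv (el.map (corner₂ A.qObj.qObj)) ≫ el.map (π A.qObj) = 𝟙 _ := by
  have h : inv (el.map (corner₂ A.qObj.qObj)) ≫ el.map (π A.qObj) =
      el.map (matMap 2 (π A.qObj)) ≫ inv (el.map (corner₂ A.qObj)) := by
    rw [IsIso.inv_comp_eq, ← Category.assoc, IsIso.eq_comp_inv, ← Functor.map_comp,
      ← Functor.map_comp, corner₂_matMap]
  rw [h, ← Category.assoc, ← Functor.map_comp, el_homotopic _ _ (homotopic_phi_π hφ),
    IsIso.hom_inv_id]

instance (A : XCAlg.{u} X) : IsIso (el.map (π A.qObj)) := by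
  obtain ⟨φ, hφ⟩ := exists_phi A
  refine ⟨el.map φ ≫ inv (el.map (corner₂ A.qObj.qObj)), ?_, ?_⟩
  · rw [← Category.assoc, ← Functor.map_comp, el_homotopic _ _ (homotopic_π_phi hφ),
      IsIso.hom_inv_id]
  · rw [Category.assoc, el_phi_π hφ]

theorem el_phi {φ : A.qObj ⟶ matObj 2 A.qObj.qObj} (hφ : IsPhi (A := A) φ.hom) :
    el.map φ = inv (el.map (π A.qObj)) ≫ el.map (corner₂ A.qObj.qObj) := by
  rw [← IsIso.comp_inv_eq]
  refine IsIso.eq_inv_of_hom_inv_id ?_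
  rw [← Category.assoc, ← Functor.map_comp, el_homotopic _ _ (homotopic_π_phi hφ),
    IsIso.hom_inv_id]

/-- The map `q(QA) → qA` given by the identity of `QA` and `QA → A → QA`. -/
def qRetract (A : XCAlg.{u} X) : A.QObj.qObj ⟶ A.qObj :=
  (kerSeq_q A).qPair (𝟙 A.QObj) (Qfold A ≫ Qι A) (by
    rw [Category.assoc, Qfold, Qι_QLift, Category.comp_id, Category.id_comp])

theorem qMap_qι_qRetract (A : XCAlg.{u} X) : qMap (qι A) ≫ qRetract A = π A.qObj := by
  rw [qRetract, KerSeq.qMap_qPair]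
  refine (KerSeq.eq_qPair _ _ _ _ ?_).symm
  have h : qι A ≫ Qfold A ≫ Qι A = zeroHom _ _ := by
    rw [← Category.assoc, (kerSeq_q A).comp_eq_zero, zeroHom_comp]
  have e : π A.qObj = qι A.qObj ≫ QLift (𝟙 A.qObj) (zeroHom A.qObj A.qObj) := rfl
  rw [h, e, Category.assoc, QLift_comp, zeroHom_comp, Category.id_comp, Category.comp_id]

theorem comp_el_qι (x : el.obj D.qObj ⟶ el.obj A.qObj) : x ≫ el.map (qι A) =
    x ≫ el.map (π A) ≫ el.map (Qι A) + (-(x ≫ el.map (π A))) ≫ el.map (Qιbar A) := by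
  have h1 : el.map (qι A ≫ QLift (zeroHom A A) (𝟙 A)) + el.map (π A) = 0 := by
    have := el_qι_QLift_add (zeroHom A A) (𝟙 A)
    rwa [Category.comp_id, comp_zeroHom, el_zeroHom] at this
  have h2 : -(x ≫ el.map (π A)) = x ≫ el.map (qι A ≫ QLift (zeroHom A A) (𝟙 A)) := by
    have h3 : x ≫ el.map (qι A ≫ QLift (zeroHom A A) (𝟙 A)) + x ≫ el.map (π A) = 0 :=
      (el_comp_add _ _ _).symm.trans ((congrArg _ h1).trans (el_comp_zero x))
    exact (eq_neg_of_add_eq_zero_left h3).symm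
  have h4 : el.map (qι A) ≫ 𝟙 _ = el.map (π A) ≫ el.map (Qι A) +
      el.map (qι A ≫ QLift (zeroHom A A) (𝟙 A)) ≫ el.map (Qιbar A) := by
    rw [← el_Q_decomp, el_comp_add, ← Functor.map_comp, ← Functor.map_comp, ← Functor.map_comp,
      ← Functor.map_comp, Category.assoc]
    rfl
  rw [h2, ← Category.comp_id (el.map (qι A)), h4, Category.assoc]
  exact el_comp_add _ _ _

theorem el_q_ext {x y : el.obj D.qObj ⟶ el.obj A.qObj}
    (h : x ≫ el.map (π A) = y ≫ el.map (π A)) : x = y := by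
  have h1 : x ≫ el.map (qι A) = y ≫ el.map (qι A) := by
    rw [comp_el_qι, comp_el_qι, ← Category.assoc, ← Category.assoc, h]
  have h2 : ∀ x : el.obj D.qObj ⟶ el.obj A.qObj, el.map (π D.qObj) ≫ x =
      elq (x ≫ el.map (qι A)) ≫ el.map (qRetract A) := fun x => by
    rw [elq_comp, elq_map, Category.assoc, ← Functor.map_comp, qMap_qι_qRetract, elq_π]
  rw [← cancel_epi (el.map (π D.qObj)), h2, h2, h1]

theorem el_qMap_π (A : XCAlg.{u} X) : el.map (qMap (π A)) = el.map (π A.qObj) :=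
  el_q_ext (by rw [← Functor.map_comp, ← Functor.map_comp, qMap_π])

/-- The composition product. -/
def kComp (a : el.obj A.qObj ⟶ el.obj B) (b : el.obj B.qObj ⟶ el.obj C) :
    el.obj A.qObj ⟶ el.obj C := inv (el.map (π A.qObj)) ≫ elq a ≫ b

theorem kComp_map (a : el.obj A.qObj ⟶ el.obj B) (f : B ⟶ C) :
    kComp a (el.map (π B ≫ f)) = a ≫ el.map f := by
  rw [kComp, Functor.map_comp, ← Category.assoc (elq a), elq_π, Category.assoc,
    IsIso.inv_hom_id_assoc]

theorem map_kComp (f : A ⟶ B) (b : el.obj B.qObj ⟶ el.obj C) :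
    kComp (el.map (π A ≫ f)) b = el.map (qMap f) ≫ b := by
  rw [kComp, elq_map, qMap_comp, Functor.map_comp, el_qMap_π, Category.assoc,
    IsIso.inv_hom_id_assoc]

theorem elq_inv_π_elq (a : el.obj A.qObj ⟶ el.obj B) :
    elq (inv (el.map (π A.qObj)) ≫ elq a) = elq a ≫ inv (el.map (π B.qObj)) := by
  have h : elq (inv (el.map (π A.qObj))) = inv (el.map (π A.qObj.qObj)) := by
    refine IsIso.eq_inv_of_hom_inv_id ?_
    rw [← el_qMap_π, ← elq_map, ← elq_comp, IsIso.hom_inv_id, ← CategoryTheory.Functor.map_id,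
      elq_map, qMap_id, CategoryTheory.Functor.map_id]
  rw [elq_comp, h, IsIso.inv_comp_eq, ← Category.assoc, IsIso.eq_comp_inv, elq_π]

theorem kComp_assoc (a : el.obj A.qObj ⟶ el.obj B) (b : el.obj B.qObj ⟶ el.obj C)
    (c : el.obj C.qObj ⟶ el.obj D) : kComp (kComp a b) c = kComp a (kComp b c) := by
  rw [kComp, kComp, kComp, kComp, ← Category.assoc (inv _) (elq a) b, elq_comp, elq_inv_π_elq]
  simp only [Category.assoc]

theorem kComp_add (a : el.obj A.qObj ⟶ el.obj B) (b b' : el.obj B.qObj ⟶ el.obj C) :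
    kComp a (b + b') = kComp a b + kComp a b' := by
  rw [kComp, ← Category.assoc, kComp, kComp, ← Category.assoc, ← Category.assoc]
  exact el_comp_add _ _ _

theorem add_kComp (a a' : el.obj A.qObj ⟶ el.obj B) (b : el.obj B.qObj ⟶ el.obj C) :
    kComp (a + a') b = kComp a b + kComp a' b := by
  have h : elq (a + a') ≫ b = elq a ≫ b + elq a' ≫ b :=
    (congrArg (· ≫ b) (elq_add a a')).trans (el_add_comp _ _ _)
  rw [kComp, h]
  exact el_comp_add _ _ _

instance (A : XCAlg.{u} X) : IsIso (ho.map (corner (matObj 2 A.stabObj))) := by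
  have h := ho_corner_hoStab (ho.map (corner₂ A.stabObj))
  have h2 : IsIso (hoStab (ho.map (corner₂ A.stabObj))) :=
    ⟨hoStab (ho.map (matStab A)), by
      rw [← hoStab_comp, ho_corner₂_matStab, ← CategoryTheory.Functor.map_id, hoStab_map, stabMap_id,
        CategoryTheory.Functor.map_id], by
      rw [← hoStab_comp, ho_matStab_corner₂, ← CategoryTheory.Functor.map_id, hoStab_map, stabMap_id,
        CategoryTheory.Functor.map_id]⟩
  rw [← IsIso.inv_comp_eq] at h
  rw [← h]
  infer_instance

theorem homotopic_iff_el {f g : A ⟶ matObj 2 B.stabObj} : Homotopic f g ↔ el.map f = el.map g := by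
  rw [← ho_eq_iff, ← cancel_mono (ho.map (corner (matObj 2 B.stabObj)))]
  exact Eq.congr (toHo_map f).symm (toHo_map g).symm

theorem homotopic_product_iff {φ : A.qObj ⟶ matObj 2 A.qObj.qObj} (hφ : IsPhi (A := A) φ.hom)
    (α : A.qObj ⟶ B.stabObj) (β : B.qObj ⟶ C.stabObj) (γ : A.qObj ⟶ C.stabObj) :
    Homotopic (γ ≫ corner C.stabObj ≫ corner₂ C.stabObj.stabObj)
      (φ ≫ matMap 2 (qMap α ≫ mu B ≫ stabMap β)) ↔ kComp (elMk α) (elMk β) = elMk γ := by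
  have h : el.map (φ ≫ matMap 2 (qMap α ≫ mu B ≫ stabMap β)) = kComp (elMk α) (elMk β) ≫
      el.map (corner C) ≫ el.map (corner C.stabObj) ≫ el.map (corner₂ C.stabObj.stabObj) := by
    have h1 : el.map (corner B.qObj) ≫ el.map (stabMap β) =
        elMk β ≫ el.map (corner C) ≫ el.map (corner C.stabObj) := by
      rw [← Functor.map_comp, corner_stabMap, Functor.map_comp, elMk_corner_assoc]
    rw [Functor.map_comp, el_phi hφ, Category.assoc, ← Functor.map_comp, corner₂_matMap,
      Functor.map_comp, ← Category.assoc (qMap α), Functor.map_comp, ← elMk_corner (qMap α ≫ mu B),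
      ← elq_elMk, kComp]
    simp only [Category.assoc]
    rw [← Category.assoc (el.map (corner B.qObj)), h1]
    simp only [Category.assoc]
  rw [homotopic_iff_el, h, Functor.map_comp, Functor.map_comp, ← elMk_corner γ]
  simp only [Category.assoc]
  rw [cancel_mono (el.map (corner C) ≫ el.map (corner C.stabObj) ≫
    el.map (corner₂ C.stabObj.stabObj)), eq_comm]

end Product

theorem isSum_iff {A B : XCAlg.{u} X} (a b c : el.obj A.qObj ⟶ el.obj B) :
    a + b = c ↔ IsSum (A := A) (B := B) a b c := by
  constructor
  · intro h
    obtain ⟨α, rfl⟩ := Quot.exists_rep a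
    obtain ⟨β, rfl⟩ := Quot.exists_rep b
    obtain ⟨γ, rfl⟩ := Quot.exists_rep c
    exact ⟨α, β, γ, rfl, rfl, rfl, ho_eq_iff.1 ((ho_add_eq_iff (ho.map α) (ho.map β) (ho.map γ)).1 h)⟩
  · rintro ⟨α, β, γ, rfl, rfl, rfl, h⟩
    exact (ho_add_eq_iff (ho.map α) (ho.map β) (ho.map γ)).2 (ho_eq_iff.2 h)

theorem isProduct_iff {A B C : XCAlg.{u} X} (a : KK A B) (b : KK B C) (c : KK A C) :
    kComp a b = c ↔ IsProduct a b c := by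
  constructor
  · intro h
    obtain ⟨α, rfl⟩ := Quot.exists_rep a
    obtain ⟨β, rfl⟩ := Quot.exists_rep b
    obtain ⟨γ, rfl⟩ := Quot.exists_rep c
    obtain ⟨φ, hφ⟩ := exists_phi A
    exact ⟨α, β, γ, φ, mu B, rfl, rfl, rfl, hφ, isMu_iff.2 rfl,
      (homotopic_product_iff hφ α β γ).2 h⟩
  · rintro ⟨α, β, γ, φ, μ, rfl, rfl, rfl, hφ, hμ, h⟩
    obtain rfl := isMu_iff.1 hμ
    exact (homotopic_product_iff hφ α β γ).1 h

variable (X) in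
/-- The category `KK(X)`. -/
def kkCat : KKCat.{u} X where
  addGroup A B := instAddCommGroupEl (A := A) (B := B)
  add_eq_iff := isSum_iff
  comp a b := kComp a b
  comp_eq_iff := isProduct_iff
  id_comp {A B} a := by
    refine (map_kComp (𝟙 A) _).trans ?_
    rw [qMap_id, CategoryTheory.Functor.map_id]
    exact Category.id_comp (obj := LCat.{u} X) (X := el.obj A.qObj) (Y := el.obj B) a
  comp_id {A B} a := by
    refine (kComp_map _ (𝟙 B)).trans ?_
    rw [CategoryTheory.Functor.map_id]
    exact Category.comp_id (obj := LCat.{u} X) (X := el.obj A.qObj) (Y := el.obj B) a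
  assoc := kComp_assoc
  add_comp := add_kComp
  comp_add := kComp_add
  ofHom_comp {A B C} f g := by
    change el.map (π A ≫ f ≫ g) = kComp (el.map (π A ≫ f)) (el.map (π B ≫ g))
    rw [kComp_map, ← Functor.map_comp, Category.assoc]

end XKK
end

open CategoryTheory
noncomputable section
namespace XKK
open scoped ENNReal MultiplierAlgebra
open TopologicalSpace

open XCAlg
variable {X : Type v} [TopologicalSpace X]

/-! ### Products and the zero object -/

section Prod
variable {A B C D : XCAlg.{u} X}

/-- The product `A × B` with the action `A(U) × B(U)`. -/
def prodObj (A B : XCAlg.{u} X) : XCAlg.{u} X where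
  carrier := A × B
  act :=
    { ideal := fun U => (A.act.ideal U).comap (NonUnitalStarAlgHom.fst ℂ A B) ⊓
        (B.act.ideal U).comap (NonUnitalStarAlgHom.snd ℂ A B)
      isClosed_ideal := fun U => (isClosed_comap (NonUnitalStarAlgHom.fst ℂ A B)
        (A.act.isClosed_ideal U)).inter
        (isClosed_comap (NonUnitalStarAlgHom.snd ℂ A B) (B.act.isClosed_ideal U))
      mono := fun U V h x hx => by
        obtain ⟨h1, h2⟩ := (TwoSidedIdeal.mem_inf _).1 hx
        exact (TwoSidedIdeal.mem_inf _).2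
          ⟨(TwoSidedIdeal.mem_comap _).2 (A.act.mono h ((TwoSidedIdeal.mem_comap _).1 h1)),
            (TwoSidedIdeal.mem_comap _).2 (B.act.mono h ((TwoSidedIdeal.mem_comap _).1 h2))⟩ }

theorem mem_prodObj_ideal {U : Opens X} {x : prodObj A B} : x ∈ (prodObj A B).act.ideal U ↔
    x.1 ∈ A.act.ideal U ∧ x.2 ∈ B.act.ideal U :=
  (TwoSidedIdeal.mem_inf _).trans (and_congr (TwoSidedIdeal.mem_comap _) (TwoSidedIdeal.mem_comap _))

/-- The first projection. -/
def pfst (A B : XCAlg.{u} X) : prodObj A B ⟶ A where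
  hom := NonUnitalStarAlgHom.fst ℂ A B
  equivariant _ _ h := (mem_prodObj_ideal.1 h).1

/-- The second projection. -/
def psnd (A B : XCAlg.{u} X) : prodObj A B ⟶ B where
  hom := NonUnitalStarAlgHom.snd ℂ A B
  equivariant _ _ h := (mem_prodObj_ideal.1 h).2

/-- The morphism to the product with given components. -/
def plift (f : C ⟶ A) (g : C ⟶ B) : C ⟶ prodObj A B where
  hom := NonUnitalStarAlgHom.prod f.hom g.hom
  equivariant U x h := mem_prodObj_ideal.2 ⟨f.equivariant U x h, g.equivariant U x h⟩

@[simp] theorem plift_fst (f : C ⟶ A) (g : C ⟶ B) : plift f g ≫ pfst A B = f := rfl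

@[simp] theorem plift_snd (f : C ⟶ A) (g : C ⟶ B) : plift f g ≫ psnd A B = g := rfl

theorem isSplitExtension_prod (A B : XCAlg.{u} X) : IsSplitExtension
    (plift (𝟙 A) (zeroHom A B)) (psnd A B) (plift (zeroHom B A) (𝟙 B)) where
  injective _ _ h := congrArg Prod.fst h
  range_eq_ker x := ⟨by rintro ⟨y, rfl⟩; rfl, fun h => ⟨x.1, Prod.ext rfl h.symm⟩⟩
  splits := rfl
  ideal_eq U x := ⟨fun h => (plift (𝟙 A) (zeroHom A B)).equivariant U x h,
    fun h => (mem_prodObj_ideal.1 h).1⟩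

/-- The underlying type of the zero algebra. -/
def ZeroAlg : Type u := PUnit.{u + 1}

instance : Unique ZeroAlg.{u} := inferInstanceAs (Unique PUnit.{u + 1})

instance : NonUnitalCStarAlgebra ZeroAlg.{u} :=
  transferCStar (Equiv.ofUnique ZeroAlg.{u} (Fin 0 → ℂ))

variable (X) in
/-- The zero algebra. -/
def zeroObj : XCAlg.{u} X where
  carrier := ZeroAlg.{u}
  act :=
    { ideal := fun _ => ⊥
      isClosed_ideal := fun _ => (Set.toFinite _).isClosed
      mono := fun _ _ _ => le_rfl }

theorem id_zeroObj : 𝟙 (zeroObj.{u} X) = zeroHom _ _ :=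
  XHom.ext_apply fun _ => Subsingleton.elim (α := ZeroAlg.{u}) _ _

theorem isSplitExtension_zero : IsSplitExtension (𝟙 (zeroObj.{u} X)) (𝟙 _) (𝟙 _) where
  injective _ _ h := h
  range_eq_ker x := ⟨fun _ => Subsingleton.elim (α := ZeroAlg.{u}) _ _, fun _ => ⟨x, rfl⟩⟩
  splits := rfl
  ideal_eq _ _ := Iff.rfl

theorem isSplitExtension_q (A : XCAlg.{u} X) : IsSplitExtension (qι A) (Qfold A) (Qι A) where
  injective := (kerSeq_q A).injective
  range_eq_ker := (kerSeq_q A).range_eq_ker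
  splits := Qι_QLift _ _
  ideal_eq := (kerSeq_q A).ideal_eq

end Prod

attribute [local instance] Limits.hasBinaryBiproducts_of_finite_biproducts

/-! ### Stable, homotopy invariant and split exact functors -/

section Functors
variable {𝒞 : Type w} [Category.{v₁} 𝒞] [Preadditive 𝒞]

theorem isIso_biprod_desc [Limits.HasBinaryBiproducts 𝒞] {I E A : 𝒞} {j : I ⟶ E} {s : A ⟶ E}
    {r : E ⟶ I} {p : E ⟶ A} (hjr : j ≫ r = 𝟙 I) (hjp : j ≫ p = 0) (hsr : s ≫ r = 0)
    (hsp : s ≫ p = 𝟙 A) (h : r ≫ j + p ≫ s = 𝟙 E) : IsIso (Limits.biprod.desc j s) := by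
  refine ⟨Limits.biprod.lift r p, ?_, ?_⟩
  · ext <;> simp [hjr, hjp, hsr, hsp]
  · rw [Limits.biprod.lift_desc, h]

variable [Limits.HasFiniteBiproducts 𝒞] {F : XCAlg.{u} X ⥤ 𝒞} {A B C : XCAlg.{u} X}

namespace IsStableHtpySplitExact

theorem map_zeroHom (hF : IsStableHtpySplitExact F) (A B : XCAlg.{u} X) :
    F.map (zeroHom A B) = 0 := by
  have := hF.split_exact _ _ _ (isSplitExtension_zero (X := X))
  have h : (Limits.biprod.inl : F.obj (zeroObj X) ⟶ F.obj (zeroObj X) ⊞ F.obj (zeroObj X)) =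
      Limits.biprod.inr := by
    rw [← cancel_mono (Limits.biprod.desc (F.map (𝟙 (zeroObj X))) (F.map (𝟙 (zeroObj X)))),
      Limits.biprod.inl_desc, Limits.biprod.inr_desc]
  have h0 : 𝟙 (F.obj (zeroObj.{u} X)) = 0 := by
    rw [← Limits.biprod.inl_fst (X := F.obj (zeroObj X)) (Y := F.obj (zeroObj X)), h,
      Limits.biprod.inr_fst]
  have e : zeroHom A B = zeroHom A (zeroObj.{u} X) ≫ 𝟙 _ ≫ zeroHom _ B := rfl
  rw [e, F.map_comp, F.map_comp, CategoryTheory.Functor.map_id, h0, Limits.zero_comp,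
    Limits.comp_zero]

theorem exists_retraction (hF : IsStableHtpySplitExact F) {j : A ⟶ B} {p : B ⟶ C} {s : C ⟶ B}
    (h : IsSplitExtension j p s) : ∃ r : F.obj B ⟶ F.obj A, F.map j ≫ r = 𝟙 _ ∧ F.map s ≫ r = 0 ∧
      r ≫ F.map j + F.map p ≫ F.map s = 𝟙 _ := by
  have := hF.split_exact _ _ _ h
  have h1 : F.map j ≫ inv (Limits.biprod.desc (F.map j) (F.map s)) = Limits.biprod.inl := by
    rw [IsIso.comp_inv_eq, Limits.biprod.inl_desc]
  have h2 : F.map s ≫ inv (Limits.biprod.desc (F.map j) (F.map s)) = Limits.biprod.inr := by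
    rw [IsIso.comp_inv_eq, Limits.biprod.inr_desc]
  have h3 : F.map p = inv (Limits.biprod.desc (F.map j) (F.map s)) ≫ Limits.biprod.snd := by
    rw [IsIso.eq_inv_comp]
    ext
    · rw [Limits.biprod.inl_desc_assoc, Limits.biprod.inl_snd, ← F.map_comp, h.kerSeq.comp_eq_zero,
        hF.map_zeroHom]
    · rw [Limits.biprod.inr_desc_assoc, Limits.biprod.inr_snd, ← F.map_comp, h.splits,
        CategoryTheory.Functor.map_id]
  refine ⟨inv (Limits.biprod.desc (F.map j) (F.map s)) ≫ Limits.biprod.fst, ?_, ?_, ?_⟩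
  · rw [← Category.assoc, h1, Limits.biprod.inl_fst]
  · rw [← Category.assoc, h2, Limits.biprod.inr_fst]
  · rw [h3, Category.assoc, Category.assoc, ← Preadditive.comp_add, IsIso.inv_comp_eq,
      Category.comp_id]
    ext <;> simp

theorem map_prod (hF : IsStableHtpySplitExact F) (A B : XCAlg.{u} X) :
    F.map (pfst A B) ≫ F.map (plift (𝟙 A) (zeroHom A B)) +
      F.map (psnd A B) ≫ F.map (plift (zeroHom B A) (𝟙 B)) = 𝟙 _ := by
  obtain ⟨r, -, -, h⟩ := hF.exists_retraction (isSplitExtension_prod A B)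
  have h1 : r = F.map (pfst A B) := by
    rw [← Category.id_comp (F.map (pfst A B)), ← h, Preadditive.add_comp, Category.assoc,
      Category.assoc, ← F.map_comp, ← F.map_comp, plift_fst, plift_fst, hF.map_zeroHom,
      Limits.comp_zero, add_zero, CategoryTheory.Functor.map_id, Category.comp_id]
  rwa [h1] at h

theorem isIso_corner₂ (hF : IsStableHtpySplitExact F) (A : XCAlg.{u} X) :
    IsIso (F.map (corner₂ A)) :=
  isIso_map_corner₂ F hF.stable hF.homotopy_invariant A

theorem map_oplus (hF : IsStableHtpySplitExact F) (f g : A ⟶ B) :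
    F.map (oplus f g) = (F.map f + F.map g) ≫ F.map (corner₂ B) := by
  have h1 : oplus f g = plift f g ≫ oplus (pfst B B) (psnd B B) := by
    rw [comp_oplus, plift_fst, plift_snd]
  have h2 : plift (𝟙 B) (zeroHom B B) ≫ oplus (pfst B B) (psnd B B) = corner₂ B := by
    rw [comp_oplus, plift_fst, plift_snd]; rfl
  have h3 : F.map (plift (zeroHom B B) (𝟙 B) ≫ oplus (pfst B B) (psnd B B)) = F.map (corner₂ B) := by
    rw [comp_oplus, plift_fst, plift_snd, ← oplus_matSwap, F.map_comp,
      ← hF.homotopy_invariant _ _ (homotopic_matSwap B), CategoryTheory.Functor.map_id,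
      Category.comp_id]
    rfl
  rw [h1, F.map_comp, ← Category.id_comp (F.map (oplus (pfst B B) (psnd B B))), ← hF.map_prod,
    Preadditive.add_comp, Category.assoc, Category.assoc, ← F.map_comp _ (oplus _ _),
    ← F.map_comp _ (oplus _ _), h2, h3, ← Preadditive.add_comp, ← Category.assoc,
    Preadditive.comp_add, ← F.map_comp, ← F.map_comp, plift_fst, plift_snd]

theorem map_Q (hF : IsStableHtpySplitExact F) (A : XCAlg.{u} X) :
    F.map (QLift (𝟙 A) (zeroHom A A)) ≫ F.map (Qι A) +
      F.map (QLift (zeroHom A A) (𝟙 A)) ≫ F.map (Qιbar A) = 𝟙 (F.obj A.QObj) := by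
  have := hF.isIso_corner₂ A.QObj
  rw [← cancel_mono (F.map (corner₂ A.QObj)), ← F.map_comp, ← F.map_comp, ← hF.map_oplus,
    Category.id_comp]
  exact hF.homotopy_invariant _ _ (homotopic_corner₂_Q A).symm

theorem isIso_π (hF : IsStableHtpySplitExact F) (A : XCAlg.{u} X) : IsIso (F.map (π A)) := by
  obtain ⟨r, hjr, hsr, hr⟩ := hF.exists_retraction (isSplitExtension_q A)
  have hπ : F.map (π A) = F.map (qι A) ≫ F.map (QLift (𝟙 A) (zeroHom A A)) :=
    F.map_comp (qι A) (QLift (𝟙 A) (zeroHom A A))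
  have hr' : r ≫ F.map (qι A) = 𝟙 _ - F.map (Qfold A) ≫ F.map (Qι A) := eq_sub_of_add_eq hr
  have hQ := hF.map_Q A
  have hfold : F.map (Qfold A) =
      F.map (QLift (𝟙 A) (zeroHom A A)) + F.map (QLift (zeroHom A A) (𝟙 A)) := by
    rw [← Category.id_comp (F.map (Qfold A)), ← hQ, Preadditive.add_comp, Category.assoc,
      Category.assoc, ← F.map_comp (Qι A), ← F.map_comp (Qιbar A), Qfold, Qι_QLift, Qιbar_QLift,
      CategoryTheory.Functor.map_id, Category.comp_id, Category.comp_id]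
  have hq0 : F.map (qι A) ≫ F.map (Qfold A) = 0 := by
    rw [← F.map_comp, (kerSeq_q A).comp_eq_zero, hF.map_zeroHom]
  have h1 : F.map (Qι A) ≫ F.map (QLift (𝟙 A) (zeroHom A A)) = 𝟙 _ := by
    rw [← F.map_comp, Qι_QLift, CategoryTheory.Functor.map_id]
  have h2 : F.map (Qιbar A) ≫ F.map (QLift (𝟙 A) (zeroHom A A)) = 0 := by
    rw [← F.map_comp, Qιbar_QLift, hF.map_zeroHom]
  have h3 : F.map (Qιbar A) ≫ F.map (Qfold A) = 𝟙 _ := by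
    rw [← F.map_comp, Qfold, Qιbar_QLift, CategoryTheory.Functor.map_id]
  refine ⟨-(F.map (Qιbar A) ≫ r), ?_, ?_⟩
  · have h4 : F.map (π A) ≫ F.map (Qιbar A) =
        F.map (π A) ≫ F.map (Qι A) - F.map (qι A) := by
      have h5 : F.map (qι A) ≫ F.map (QLift (zeroHom A A) (𝟙 A)) = -F.map (π A) := by
        rw [hfold, Preadditive.comp_add, ← hπ] at hq0
        exact eq_neg_of_add_eq_zero_right hq0
      have h6 : F.map (qι A) = F.map (π A) ≫ F.map (Qι A) - F.map (π A) ≫ F.map (Qιbar A) := by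
        conv_lhs => rw [← Category.comp_id (F.map (qι A)), ← hQ]
        rw [Preadditive.comp_add, ← Category.assoc, ← Category.assoc, h5, ← hπ,
          Preadditive.neg_comp, sub_eq_add_neg]
      rw [h6]; abel
    rw [Preadditive.comp_neg, ← Category.assoc, h4, Preadditive.sub_comp, Category.assoc, hsr, hjr,
      Limits.comp_zero, zero_sub, neg_neg]
  · rw [Preadditive.neg_comp, hπ, Category.assoc, ← Category.assoc r, hr', Preadditive.sub_comp,
      Preadditive.comp_sub, Category.id_comp, h2, Category.assoc, h1, Category.comp_id, h3, zero_sub,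
      neg_neg]

end IsStableHtpySplitExact

end Functors

end XKK
end

open CategoryTheory
noncomputable section
namespace XKK
open scoped ENNReal MultiplierAlgebra
open TopologicalSpace

open XCAlg
variable {X : Type v} [TopologicalSpace X]

attribute [local instance] Limits.hasBinaryBiproducts_of_finite_biproducts

/-! ### The functor to `KK(X)` -/

section KKFunctor
variable {A B C : XCAlg.{u} X}

/-- A morphism of the stable homotopy category from `qA` to `B` as a morphism of `KK(X)`. -/
def ofEl (x : el.obj A.qObj ⟶ el.obj B) : (kkCat X).functor.obj A ⟶ (kkCat X).functor.obj B := x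

theorem kk_map (f : A ⟶ B) : (kkCat X).functor.map f = ofEl (el.map (π A ≫ f)) := rfl

theorem ofEl_comp (x : el.obj A.qObj ⟶ el.obj B) (y : el.obj B.qObj ⟶ el.obj C) :
    ofEl x ≫ ofEl y = ofEl (kComp x y) := rfl

theorem ofEl_add (x y : el.obj A.qObj ⟶ el.obj B) : ofEl x + ofEl y = ofEl (x + y) := rfl

theorem ofEl_zero : ofEl (0 : el.obj A.qObj ⟶ el.obj B) = 0 := rfl

theorem ofEl_comp_map (x : el.obj A.qObj ⟶ el.obj B) (f : B ⟶ C) :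
    ofEl x ≫ (kkCat X).functor.map f = ofEl (x ≫ el.map f) := by
  rw [kk_map, ofEl_comp, kComp_map]

theorem map_comp_ofEl (f : A ⟶ B) (x : el.obj B.qObj ⟶ el.obj C) :
    (kkCat X).functor.map f ≫ ofEl x = ofEl (el.map (qMap f) ≫ x) := by
  rw [kk_map, ofEl_comp, map_kComp]

theorem kk_id (A : XCAlg.{u} X) : 𝟙 ((kkCat X).functor.obj A) = ofEl (el.map (π A)) := by
  rw [← CategoryTheory.Functor.map_id, kk_map, Category.comp_id]

theorem kk_zeroHom : (kkCat X).functor.map (zeroHom A B) = 0 := by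
  rw [kk_map, comp_zeroHom, el_zeroHom, ← ofEl_zero]

theorem kk_homotopic {f g : A ⟶ B} (h : Homotopic f g) :
    (kkCat X).functor.map f = (kkCat X).functor.map g := by
  rw [kk_map, kk_map, el_homotopic _ _ (h.comp_left (π A))]

theorem isIso_kk_corner (A : XCAlg.{u} X) : IsIso ((kkCat X).functor.map (corner A)) := by
  refine ⟨ofEl (el.map (π A.stabObj) ≫ inv (el.map (corner A))), ?_, ?_⟩
  · rw [map_comp_ofEl, kk_id, ← Category.assoc, ← Functor.map_comp, qMap_π, Functor.map_comp,
      Category.assoc, IsIso.hom_inv_id, Category.comp_id]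
  · rw [ofEl_comp_map, Category.assoc, IsIso.inv_hom_id, Category.comp_id, kk_id]

theorem exists_kk_retraction {j : A ⟶ B} {p : B ⟶ C} {s : C ⟶ B} (h : IsSplitExtension j p s) :
    ∃ r : (kkCat X).functor.obj B ⟶ (kkCat X).functor.obj A,
      (kkCat X).functor.map j ≫ r = 𝟙 _ ∧ (kkCat X).functor.map s ≫ r = 0 ∧
      r ≫ (kkCat X).functor.map j + (kkCat X).functor.map p ≫ (kkCat X).functor.map s = 𝟙 _ := by
  have hps : 𝟙 B ≫ p = (p ≫ s) ≫ p := by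
    rw [Category.assoc, h.splits, Category.comp_id, Category.id_comp]
  refine ⟨ofEl (el.map (h.kerSeq.qPair (𝟙 B) (p ≫ s) hps)), ?_, ?_, ?_⟩
  · have e : qMap j ≫ h.kerSeq.qPair (𝟙 B) (p ≫ s) hps = π A := by
      rw [KerSeq.qMap_qPair]
      refine (KerSeq.eq_qPair _ _ _ _ ?_).symm
      have e1 : j ≫ p ≫ s = zeroHom _ _ := by
        rw [← Category.assoc, h.kerSeq.comp_eq_zero, zeroHom_comp]
      have e2 : π A = qι A ≫ QLift (𝟙 A) (zeroHom A A) := rfl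
      rw [e1, e2, Category.assoc, QLift_comp, zeroHom_comp, Category.id_comp, Category.comp_id]
    rw [map_comp_ofEl, ← Functor.map_comp, e, kk_id]
  · have e : qMap s ≫ h.kerSeq.qPair (𝟙 B) (p ≫ s) hps = zeroHom _ _ := by
      rw [KerSeq.qMap_qPair, ← h.kerSeq.qPair_self s]
      congr 1
      rw [← Category.assoc, h.splits, Category.id_comp]
    rw [map_comp_ofEl, ← Functor.map_comp, e, el_zeroHom, ← ofEl_zero]
  · rw [ofEl_comp_map, ← Functor.map_comp, KerSeq.qPair_j, ← Functor.map_comp, kk_map, ofEl_add,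
      kk_id]
    refine congrArg ofEl ((el_qι_QLift_add (𝟙 B) (p ≫ s)).trans ?_)
    rw [Category.comp_id]

instance : Limits.HasZeroObject (kkCat.{u} X).Obj :=
  ⟨(kkCat X).functor.obj (zeroObj X), (Limits.IsZero.iff_id_eq_zero _).2 (by
    rw [← CategoryTheory.Functor.map_id, id_zeroObj, kk_zeroHom])⟩

theorem hasBinaryBiproduct_kk (A B : XCAlg.{u} X) :
    Limits.HasBinaryBiproduct ((kkCat X).functor.obj A) ((kkCat X).functor.obj B) := by
  obtain ⟨r, -, -, h⟩ := exists_kk_retraction (isSplitExtension_prod A B)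
  have hr : r = (kkCat X).functor.map (pfst A B) := by
    rw [← Category.id_comp ((kkCat X).functor.map (pfst A B)), ← h, Preadditive.add_comp,
      Category.assoc, Category.assoc, ← Functor.map_comp, ← Functor.map_comp, plift_fst, plift_fst,
      kk_zeroHom, Limits.comp_zero, add_zero, CategoryTheory.Functor.map_id, Category.comp_id]
  rw [hr] at h
  exact Limits.hasBinaryBiproduct_of_total
    { pt := (kkCat X).functor.obj (prodObj A B)
      fst := (kkCat X).functor.map (pfst A B)
      snd := (kkCat X).functor.map (psnd A B)
      inl := (kkCat X).functor.map (plift (𝟙 A) (zeroHom A B))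
      inr := (kkCat X).functor.map (plift (zeroHom B A) (𝟙 B))
      inl_fst := by rw [← Functor.map_comp, plift_fst, CategoryTheory.Functor.map_id]
      inl_snd := by rw [← Functor.map_comp, plift_snd, kk_zeroHom]
      inr_fst := by rw [← Functor.map_comp, plift_fst, kk_zeroHom]
      inr_snd := by rw [← Functor.map_comp, plift_snd, CategoryTheory.Functor.map_id] } h

theorem hasFiniteBiproducts_kk (X : Type v) [TopologicalSpace X] :
    Limits.HasFiniteBiproducts (kkCat.{u} X).Obj := by
  have : Limits.HasBinaryBiproducts (kkCat.{u} X).Obj := ⟨fun A B => hasBinaryBiproduct_kk A B⟩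
  have : Limits.HasFiniteProducts (kkCat.{u} X).Obj := hasFiniteProducts_of_has_binary_and_terminal
  exact Limits.HasFiniteBiproducts.of_hasFiniteProducts

theorem isStableHtpySplitExact_kk [Limits.HasFiniteBiproducts (kkCat.{u} X).Obj] :
    IsStableHtpySplitExact (kkCat.{u} X).functor where
  stable := isIso_kk_corner
  homotopy_invariant _ _ := kk_homotopic
  split_exact j p s h := by
    obtain ⟨r, h1, h2, h3⟩ := exists_kk_retraction h
    refine isIso_biprod_desc h1 ?_ h2 ?_ h3
    · rw [← Functor.map_comp, h.kerSeq.comp_eq_zero, kk_zeroHom]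
    · rw [← Functor.map_comp, h.splits, CategoryTheory.Functor.map_id]

end KKFunctor

/-! ### The universal property -/

section Universal
variable {𝒞 : Type w} [Category.{v₁} 𝒞] [Preadditive 𝒞] [Limits.HasFiniteBiproducts 𝒞]
  {F : XCAlg.{u} X ⥤ 𝒞} {A B C : XCAlg.{u} X}

namespace IsStableHtpySplitExact

/-- The extension of `F` to the stable homotopy category. -/
def elExt (hF : IsStableHtpySplitExact F) (x : el.obj A ⟶ el.obj B) : F.obj A ⟶ F.obj B :=
  have := hF.stable B
  Quot.lift (fun f : A ⟶ B.stabObj => F.map f)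
    (fun f g h => hF.homotopy_invariant f g h) (toHo x) ≫ inv (F.map (corner B))

theorem elExt_corner (hF : IsStableHtpySplitExact F) (f : A ⟶ B.stabObj) :
    hF.elExt (elMk f) ≫ F.map (corner B) = F.map f := by
  have := hF.stable B
  exact (Category.assoc _ _ _).trans ((congrArg _ (IsIso.inv_hom_id _)).trans (Category.comp_id _))

theorem elExt_map (hF : IsStableHtpySplitExact F) (f : A ⟶ B) : hF.elExt (el.map f) = F.map f := by
  have := hF.stable B
  rw [← cancel_mono (F.map (corner B)), ← F.map_comp]
  exact hF.elExt_corner (f ≫ corner B)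

theorem elExt_comp (hF : IsStableHtpySplitExact F) (x : el.obj A ⟶ el.obj B)
    (y : el.obj B ⟶ el.obj C) : hF.elExt (x ≫ y) = hF.elExt x ≫ hF.elExt y := by
  obtain ⟨f, rfl⟩ := elMk_surj x
  obtain ⟨g, rfl⟩ := elMk_surj y
  have := hF.stable B
  have := hF.stable C
  have h1 : elMk f ≫ elMk g = elMk (f ≫ stabMap g ≫ stabStab C) := rfl
  have h2 : F.map (corner B) ≫ F.map (stabMap g ≫ stabStab C) = F.map g := by
    rw [F.map_comp, ← Category.assoc, ← F.map_comp, corner_stabMap, F.map_comp, Category.assoc,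
      ← F.map_comp, hF.homotopy_invariant _ _ (corner_stabStab C), CategoryTheory.Functor.map_id,
      Category.comp_id]
  rw [h1, ← cancel_mono (F.map (corner C)), elExt_corner, Category.assoc, elExt_corner, F.map_comp,
    ← elExt_corner hF f, Category.assoc, h2]

theorem elExt_add (hF : IsStableHtpySplitExact F) (x y : el.obj A ⟶ el.obj B) :
    hF.elExt (x + y) = hF.elExt x + hF.elExt y := by
  obtain ⟨f, rfl⟩ := elMk_surj x
  obtain ⟨g, rfl⟩ := elMk_surj y
  have := hF.stable B
  have h1 : elMk f + elMk g = elMk (oplus f g ≫ matStab B) := rfl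
  rw [h1, ← cancel_mono (F.map (corner B)), elExt_corner, F.map_comp, hF.map_oplus, Category.assoc,
    ← F.map_comp, hF.homotopy_invariant _ _ (corner₂_matStab B), CategoryTheory.Functor.map_id,
    Category.comp_id, Preadditive.add_comp, elExt_corner, elExt_corner]

/-- The extension of `F` to `KK(X)` on morphisms. -/
def kkExt (hF : IsStableHtpySplitExact F) (x : el.obj A.qObj ⟶ el.obj B) : F.obj A ⟶ F.obj B :=
  have := hF.isIso_π A
  inv (F.map (π A)) ≫ hF.elExt x

theorem π_kkExt (hF : IsStableHtpySplitExact F) (x : el.obj A.qObj ⟶ el.obj B) :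
    F.map (π A) ≫ hF.kkExt x = hF.elExt x := by
  have := hF.isIso_π A
  exact IsIso.hom_inv_id_assoc _ _

theorem kkExt_map (hF : IsStableHtpySplitExact F) (f : A ⟶ B) :
    hF.kkExt (el.map (π A ≫ f)) = F.map f := by
  have := hF.isIso_π A
  rw [← cancel_epi (F.map (π A)), π_kkExt, elExt_map, F.map_comp]

theorem kkExt_kComp (hF : IsStableHtpySplitExact F) (x : el.obj A.qObj ⟶ el.obj B)
    (y : el.obj B.qObj ⟶ el.obj C) : hF.kkExt (kComp x y) = hF.kkExt x ≫ hF.kkExt y := by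
  have := hF.isIso_π A
  have := hF.isIso_π A.qObj
  have h : F.map (π A.qObj) ≫ hF.elExt (kComp x y) = hF.elExt (elq x) ≫ hF.elExt y := by
    rw [kComp, ← elExt_map hF (π A.qObj), ← elExt_comp, ← elExt_comp, IsIso.hom_inv_id_assoc]
  have h' : F.map (π A.qObj) ≫ hF.elExt x = hF.elExt (elq x) ≫ F.map (π B) := by
    rw [← elExt_map hF (π A.qObj), ← elExt_comp, ← elq_π, elExt_comp, elExt_map]
  rw [← cancel_epi (F.map (π A)), π_kkExt, ← cancel_epi (F.map (π A.qObj)), h,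
    ← Category.assoc (F.map (π A)), π_kkExt, ← Category.assoc, h', Category.assoc, π_kkExt]

theorem kkExt_add (hF : IsStableHtpySplitExact F) (x y : el.obj A.qObj ⟶ el.obj B) :
    hF.kkExt (x + y) = hF.kkExt x + hF.kkExt y := by
  have := hF.isIso_π A
  rw [← cancel_epi (F.map (π A)), Preadditive.comp_add, π_kkExt, π_kkExt, π_kkExt]
  exact hF.elExt_add x y

/-- The extension of `F` to `KK(X)`. -/
def kkFunctor (hF : IsStableHtpySplitExact F) : (kkCat.{u} X).Obj ⥤ 𝒞 where
  obj A := F.obj A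
  map {A B} a := hF.kkExt (A := A) (B := B) a
  map_id A := (hF.kkExt_map (A := A) (𝟙 _)).trans (F.map_id _)
  map_comp {A B C} a b := hF.kkExt_kComp (A := A) (B := B) (C := C) a b

theorem kkFunctor_additive (hF : IsStableHtpySplitExact F) : hF.kkFunctor.Additive where
  map_add {A B} {a b} := hF.kkExt_add (A := A) (B := B) a b

theorem comp_kkFunctor (hF : IsStableHtpySplitExact F) : (kkCat.{u} X).functor ⋙ hF.kkFunctor = F :=
  CategoryTheory.Functor.ext (fun _ => rfl) fun _ _ f =>
    (hF.kkExt_map f).trans ((Category.id_comp _).trans (Category.comp_id _)).symm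

end IsStableHtpySplitExact

theorem π_comp_ofEl_comp_corner (α : A.qObj ⟶ B.stabObj) :
    (kkCat X).functor.map (π A) ≫ ofEl (elMk α) ≫ (kkCat X).functor.map (corner B) =
      (kkCat X).functor.map α := by
  rw [ofEl_comp_map, map_comp_ofEl, elMk_corner, el_qMap_π, ← Functor.map_comp, kk_map]

theorem kk_functor_ext {𝒟 : Type w} [Category.{v₁} 𝒟] {G G' : (kkCat.{u} X).Obj ⥤ 𝒟}
    (h : (kkCat X).functor ⋙ G = (kkCat X).functor ⋙ G') : G = G' := by
  have hobj : ∀ A, G.obj A = G'.obj A := fun A => Functor.congr_obj h A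
  have hmap : ∀ {A B : XCAlg.{u} X} (f : A ⟶ B), G.map ((kkCat X).functor.map f) =
      eqToHom (hobj _) ≫ G'.map ((kkCat X).functor.map f) ≫ eqToHom (hobj _).symm :=
    fun f => Functor.congr_hom h f
  suffices key : ∀ (A B : XCAlg.{u} X) (x : el.obj A.qObj ⟶ el.obj B), G.map (ofEl x) =
      eqToHom (hobj _) ≫ G'.map (ofEl x) ≫ eqToHom (hobj _).symm from
    CategoryTheory.Functor.ext hobj fun A B a => key A B a
  intro A B x
  obtain ⟨α, rfl⟩ := elMk_surj x
  have := hasFiniteBiproducts_kk.{u} X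
  have := isStableHtpySplitExact_kk.isIso_π (F := (kkCat.{u} X).functor) A
  have := isIso_kk_corner.{u} (X := X) B
  have e := hmap α
  rw [← π_comp_ofEl_comp_corner, G.map_comp, G.map_comp, G'.map_comp, G'.map_comp, hmap (π A),
    hmap (corner B)] at e
  have e' : (G'.map ((kkCat X).functor.map (π A)) ≫ eqToHom (hobj _).symm ≫ G.map (ofEl (elMk α)) ≫
      eqToHom (hobj _) ≫ G'.map ((kkCat X).functor.map (corner B))) =
      G'.map ((kkCat X).functor.map (π A)) ≫ G'.map (ofEl (elMk α)) ≫
        G'.map ((kkCat X).functor.map (corner B)) := by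
    rw [← cancel_epi (eqToHom (hobj ((kkCat X).functor.obj A.qObj))),
      ← cancel_mono (eqToHom (hobj ((kkCat X).functor.obj B.stabObj)).symm)]
    simpa only [Category.assoc] using e
  rw [cancel_epi, ← Category.assoc, ← Category.assoc, cancel_mono, Category.assoc] at e'
  rw [← e']
  simp

end Universal

end XKK
end

theorem statement18 (X : Type v) [TopologicalSpace X] :
    ∃ (𝒦 : XKK.KKCat.{u} X) (_ : Limits.HasFiniteBiproducts 𝒦.Obj),
      XKK.IsStableHtpySplitExact 𝒦.functor ∧
      ∀ (𝒞 : Type w) [Category.{v₁} 𝒞] [Preadditive 𝒞] [Limits.HasFiniteBiproducts 𝒞]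
        (F : XKK.XCAlg.{u} X ⥤ 𝒞), XKK.IsStableHtpySplitExact F →
        ∃ G : 𝒦.Obj ⥤ 𝒞, G.Additive ∧ 𝒦.functor ⋙ G = F ∧
          ∀ G' : 𝒦.Obj ⥤ 𝒞, 𝒦.functor ⋙ G' = F → G' = G := by
  refine ⟨XKK.kkCat X, XKK.hasFiniteBiproducts_kk X, ?_, ?_⟩
  · have := XKK.hasFiniteBiproducts_kk.{u} X
    exact XKK.isStableHtpySplitExact_kk
  · intro 𝒞 _ _ _ F hF
    exact ⟨hF.kkFunctor, hF.kkFunctor_additive, hF.comp_kkFunctor,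
      fun G' h => XKK.kk_functor_ext (h.trans hF.comp_kkFunctor.symm)⟩
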